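/- Let d ≥ 1, δ ∈ (0,1], p, q ∈ (1,∞) and β ∈ (1,∞). Then there exist constants â = â(d,δ,p,q,β) > 0 and N = N(d,δ,p,q,β) such that for every measurable a : ℝ^{1+d} → 𝕊_δ with a^♯ ≤ â and every u ∈ C₀^∞(ℝ^{1+d}), ‖∂_t u‖_{Ė_{q,p,β}} + ‖D²u‖_{Ė_{q,p,β}} ≤ N ‖∂_t u + Σ_{i,j} a^{ij}(t,x) D_{ij}u‖_{Ė_{q,p,β}}. -/

import Mathlib

open MeasureTheory Metric Set
open scoped ENNReal NNReal

noncomputable section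

abbrev Spc (d : ℕ) : Type := EuclideanSpace ℝ (Fin d)

abbrev Pt (d : ℕ) : Type := ℝ × Spc d

instance matrixMeasurableSpace (d : ℕ) : MeasurableSpace (Matrix (Fin d) (Fin d) ℝ) :=
  (inferInstance : MeasurableSpace (Fin d → Fin d → ℝ))

/-- Membership in `𝕊_δ`: symmetric `d×d` matrices with
`δ|ξ|² ≤ (aξ,ξ) ≤ δ⁻¹|ξ|²`. -/
def inS (d : ℕ) (δ : ℝ) (a : Matrix (Fin d) (Fin d) ℝ) : Prop :=
  a.IsSymm ∧ ∀ ξ : Fin d → ℝ,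
    δ * (∑ i, ξ i ^ 2) ≤ (∑ i, ∑ j, a i j * ξ i * ξ j) ∧
    (∑ i, ∑ j, a i j * ξ i * ξ j) ≤ δ⁻¹ * (∑ i, ξ i ^ 2)

/-- `{a,u} = a^{ij} a^{kr} u_{ik} u_{jr}`. -/
def bra (d : ℕ) (a u : Matrix (Fin d) (Fin d) ℝ) : ℝ :=
  ∑ i, ∑ j, ∑ k, ∑ r, a i j * a k r * u i k * u j r

/-- Frobenius norm of a `d×d` array. -/
def mnorm {d : ℕ} (m : Fin d → Fin d → ℝ) : ℝ :=
  Real.sqrt (∑ i, ∑ j, m i j ^ 2)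

/-- Euclidean norm of a vector given as `Fin d → ℝ`. -/
def vnorm {d : ℕ} (v : Fin d → ℝ) : ℝ :=
  Real.sqrt (∑ i, v i ^ 2)

/-- Parabolic cylinder `C_R(t,x) = (t, t+R²) × B_R(x)`. -/
def cyl (d : ℕ) (R t : ℝ) (x : Spc d) : Set (Pt d) :=
  Ioo t (t + R ^ 2) ×ˢ ball x R

/-- Time derivative `∂_t u`. -/
def Dt {d : ℕ} (u : Pt d → ℝ) (z : Pt d) : ℝ :=
  deriv (fun s => u (s, z.2)) z.1

/-- Spatial derivative `D_i u`. -/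
def Dx {d : ℕ} (i : Fin d) (u : Pt d → ℝ) (z : Pt d) : ℝ :=
  fderiv ℝ (fun y => u (z.1, y)) z.2 (EuclideanSpace.single i 1)

/-- Second spatial derivative `D_{ij} u = D_i D_j u`. -/
def Dxx {d : ℕ} (i j : Fin d) (u : Pt d → ℝ) : Pt d → ℝ :=
  Dx i (Dx j u)

/-- `u ∈ C₀^∞(ℝ^{1+d})`. -/
def CinfC {d : ℕ} (u : Pt d → ℝ) : Prop :=
  ContDiff ℝ (⊤ : ℕ∞) u ∧ HasCompactSupport u

/-- The kernel `p_{α,k}(s,r)`. -/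
def pak (d : ℕ) (α k s r : ℝ) : ℝ :=
  if 0 < s then s ^ (-((d : ℝ) + 2 - α) / 2) * Real.exp (-(r ^ 2) / (k * s)) else 0

/-- Parabolic distance to the origin `ρ(t,x) = |x| + √|t|`. -/
def prho {d : ℕ} (z : Pt d) : ℝ := ‖z.2‖ + Real.sqrt |z.1|

/-- Average of (the positive part of) `g` over `C`, valued in `ℝ≥0∞`. -/
def aveLin {d : ℕ} (C : Set (Pt d)) (g : Pt d → ℝ) : ℝ≥0∞ :=
  (volume C)⁻¹ * ∫⁻ z in C, ENNReal.ofReal (g z)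

/-- Parabolic maximal function `𝕄_β g` (for `g ≥ 0`). -/
def maxF {d : ℕ} (β : ℝ) (g : Pt d → ℝ) (z : Pt d) : ℝ≥0∞ :=
  ⨆ (ρ : ℝ) (_ : 0 < ρ) (t : ℝ) (x : Spc d) (_ : z ∈ cyl d ρ t x),
    ENNReal.ofReal (ρ ^ β) * aveLin (cyl d ρ t x) g

/-- Oscillation of a matrix-valued function over `C`. -/
def oscC {d : ℕ} (C : Set (Pt d)) (g : Pt d → Fin d → Fin d → ℝ) : ℝ :=
  ⨍ z₁ in C, ⨍ z₂ in C, mnorm (fun i j => g z₁ i j - g z₂ i j)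

/-- Mixed norm `‖f‖_{𝕃_{q,p}}` (inner integration in `t`, outer in `x`). -/
def mixedNorm {d : ℕ} (q p : ℝ) (f : Pt d → ℝ) : ℝ :=
  (∫ x : Spc d, (∫ t : ℝ, |f (t, x)| ^ q) ^ (p / q)) ^ (1 / p)

/-- Mixed norm on a set `Γ`. -/
def mixedNormOn {d : ℕ} (q p : ℝ) (Γ : Set (Pt d)) (f : Pt d → ℝ) : ℝ :=
  mixedNorm q p (Γ.indicator f)

/-- Normalized (averaged) mixed norm over the cylinder `C_R(t,x)`, in `ℝ≥0∞`. -/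
def cylNormL {d : ℕ} (q p R t : ℝ) (x : Spc d) (f : Pt d → ℝ) : ℝ≥0∞ :=
  ((volume (ball x R))⁻¹ * ∫⁻ y in ball x R,
      ((volume (Ioo t (t + R ^ 2)))⁻¹ * ∫⁻ s in Ioo t (t + R ^ 2),
        ENNReal.ofReal |f (s, y)| ^ q) ^ (p / q)) ^ (1 / p)

/-- Mixed norm on a set, valued in `ℝ≥0∞`. -/
def mixedNormLe {d : ℕ} (q p : ℝ) (Γ : Set (Pt d)) (f : Pt d → ℝ) : ℝ≥0∞ :=
  (∫⁻ x : Spc d, (∫⁻ t : ℝ, ENNReal.ofReal |Γ.indicator f (t, x)| ^ q) ^ (p / q)) ^ (1 / p)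

/-- `ã_C(t)`: average of `a(t,·)` over the ball of the cylinder. -/
def aTilde {d : ℕ} (a : Pt d → Matrix (Fin d) (Fin d) ℝ) (R : ℝ) (x₀ : Spc d) (t : ℝ)
    (i j : Fin d) : ℝ :=
  ⨍ y in ball x₀ R, a (t, y) i j

/-- The mean oscillation of `a` w.r.t. `x` over one cylinder. -/
def aSharpCyl {d : ℕ} (a : Pt d → Matrix (Fin d) (Fin d) ℝ) (R t₀ : ℝ) (x₀ : Spc d) : ℝ≥0∞ :=
  (volume (cyl d R t₀ x₀))⁻¹ * ∫⁻ z in cyl d R t₀ x₀,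
    ENNReal.ofReal (mnorm (fun i j => a z i j - aTilde a R x₀ z.1 i j))

/-- `a^♯`. -/
def aSharp {d : ℕ} (a : Pt d → Matrix (Fin d) (Fin d) ℝ) : ℝ≥0∞ :=
  ⨆ (R : ℝ) (_ : 0 < R) (t₀ : ℝ) (x₀ : Spc d), aSharpCyl a R t₀ x₀

/-- `a^♯_ρ` (only cylinders of radius `≤ ρa`). -/
def aSharpRho {d : ℕ} (a : Pt d → Matrix (Fin d) (Fin d) ℝ) (ρa : ℝ) : ℝ≥0∞ :=
  ⨆ (R : ℝ) (_ : 0 < R) (_ : R ≤ ρa) (t₀ : ℝ) (x₀ : Spc d), aSharpCyl a R t₀ x₀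

/-- Homogeneous Morrey norm `‖g‖_{Ė_{p,β}}`. -/
def morreyP {d : ℕ} (p β : ℝ) (g : Pt d → ℝ) : ℝ≥0∞ :=
  ⨆ (ρ : ℝ) (_ : 0 < ρ) (t : ℝ) (x : Spc d),
    ENNReal.ofReal (ρ ^ β) *
      ((volume (cyl d ρ t x))⁻¹ * ∫⁻ z in cyl d ρ t x, ENNReal.ofReal |g z| ^ p) ^ (1 / p)

/-- Homogeneous mixed-norm Morrey norm `‖g‖_{Ė_{q,p,β}}`. -/
def morreyQP {d : ℕ} (q p β : ℝ) (g : Pt d → ℝ) : ℝ≥0∞ :=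
  ⨆ (ρ : ℝ) (_ : 0 < ρ) (t : ℝ) (x : Spc d),
    ENNReal.ofReal (ρ ^ β) * cylNormL q p ρ t x g

/-- Inhomogeneous mixed-norm Morrey norm `‖g‖_{E_{q,p,β}}` (radii `ρ ∈ (0,1]`). -/
def morreyI {d : ℕ} (q p β : ℝ) (g : Pt d → ℝ) : ℝ≥0∞ :=
  ⨆ (ρ : ℝ) (_ : 0 < ρ) (_ : ρ ≤ 1) (t : ℝ) (x : Spc d),
    ENNReal.ofReal (ρ ^ β) * cylNormL q p ρ t x g

/-- `b̄_{q',p',ρb}` for a vector field `b`. -/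
def bBar {d : ℕ} (q' p' : ℝ) (b : Pt d → Fin d → ℝ) (ρb : ℝ) : ℝ≥0∞ :=
  ⨆ (R : ℝ) (_ : 0 < R) (_ : R ≤ ρb) (t : ℝ) (x : Spc d),
    ENNReal.ofReal R * cylNormL q' p' R t x (fun z => vnorm (b z))

/-- Test function supported in the open set `Q`. -/
def IsTest {d : ℕ} (Q : Set (Pt d)) (φ : Pt d → ℝ) : Prop :=
  ContDiff ℝ (⊤ : ℕ∞) φ ∧ HasCompactSupport φ ∧ tsupport φ ⊆ Q

/-- `ut` is the weak time derivative of `u` on `Q`. -/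
def WeakDtOn {d : ℕ} (Q : Set (Pt d)) (u ut : Pt d → ℝ) : Prop :=
  ∀ φ, IsTest Q φ → ∫ z in Q, u z * Dt φ z = - ∫ z in Q, ut z * φ z

/-- `ui` is the weak `i`-th spatial derivative of `u` on `Q`. -/
def WeakDxOn {d : ℕ} (Q : Set (Pt d)) (i : Fin d) (u ui : Pt d → ℝ) : Prop :=
  ∀ φ, IsTest Q φ → ∫ z in Q, u z * Dx i φ z = - ∫ z in Q, ui z * φ z

instance haarPt (d : ℕ) : Measure.IsAddHaarMeasure (volume : Measure (Pt d)) :=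
  Measure.prod.instIsAddHaarMeasure volume volume

/-- directional derivative -/
def dv {d : ℕ} (v : Pt d) (u : Pt d → ℝ) (z : Pt d) : ℝ := fderiv ℝ u z v

section
variable {d : ℕ} {u w : Pt d → ℝ}

lemma CinfC.diff (h : CinfC u) : Differentiable ℝ u := h.1.differentiable (by simp)
lemma CinfC.cont (h : CinfC u) : Continuous u := h.1.continuous
lemma CinfC.integrable (h : CinfC u) : Integrable u :=
  h.cont.integrable_of_hasCompactSupport h.2
lemma CinfC.dv (h : CinfC u) (v : Pt d) : CinfC (dv v u) :=
  ⟨(h.1.fderiv_right (m := (⊤ : ℕ∞)) le_rfl).clm_apply contDiff_const, h.2.fderiv_apply ℝ v⟩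

lemma Dx_eq (h : CinfC u) (i : Fin d) : Dx i u = dv (0, EuclideanSpace.single i 1) u := by
  funext z
  have h1 : HasFDerivAt (fun y => u (z.1, y)) ((fderiv ℝ u z).comp
      (ContinuousLinearMap.inr ℝ ℝ (Spc d))) z.2 :=
    ((h.diff z).hasFDerivAt).comp (f := fun y => (z.1, y)) z.2 (hasFDerivAt_prodMk_right z.1 z.2)
  simp [Dx, h1.fderiv, _root_.dv]

lemma Dt_eq (h : CinfC u) : Dt u = dv (1, 0) u := by
  funext z
  have h1 : HasDerivAt (fun s => u (s, z.2)) (fderiv ℝ u z (1, 0)) z.1 :=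
    HasFDerivAt.comp_hasDerivAt (f := fun s => (s, z.2)) z.1 ((h.diff z).hasFDerivAt)
      ((hasDerivAt_id z.1).prodMk (hasDerivAt_const z.1 z.2))
  simp [Dt, h1.deriv, _root_.dv]

lemma CinfC.Dx (h : CinfC u) (i : Fin d) : CinfC (Dx i u) := by rw [Dx_eq h]; exact h.dv _
lemma CinfC.Dt (h : CinfC u) : CinfC (Dt u) := by rw [Dt_eq h]; exact h.dv _
lemma CinfC.Dxx (h : CinfC u) (i j : Fin d) : CinfC (Dxx i j u) := (h.Dx j).Dx i
lemma CinfC.add (h : CinfC u) (k : CinfC w) : CinfC (fun z => u z + w z) :=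
  ⟨h.1.add k.1, h.2.add k.2⟩
lemma CinfC.smul (c : ℝ) (h : CinfC u) : CinfC (fun z => c * u z) :=
  ⟨contDiff_const.mul h.1, h.2.mul_left⟩
lemma CinfC.sub (h : CinfC u) (k : CinfC w) : CinfC (fun z => u z - w z) := by
  simpa [sub_eq_add_neg] using h.add (k.smul (-1))
lemma CinfC.mul' (h : ContDiff ℝ (⊤ : ℕ∞) w) (k : CinfC u) : CinfC (fun z => w z * u z) :=
  ⟨h.mul k.1, k.2.mul_left⟩
lemma CinfC.mul (h : CinfC w) (k : CinfC u) : CinfC (fun z => w z * u z) := .mul' h.1 k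
lemma CinfC.zero : CinfC (fun _ : Pt d => (0 : ℝ)) := ⟨contDiff_const, .zero⟩
lemma CinfC.sum {ι : Type*} (s : Finset ι) {f : ι → Pt d → ℝ} (h : ∀ i, CinfC (f i)) :
    CinfC (fun z => ∑ i ∈ s, f i z) := by
  classical
  induction s using Finset.induction_on with
  | empty => simpa using CinfC.zero
  | insert a s ha ih => simpa [Finset.sum_insert ha] using (h a).add ih

lemma dv_comm (h : CinfC u) (v v' : Pt d) : dv v (dv v' u) = dv v' (dv v u) := by
  funext z
  have h1 : ContDiffAt ℝ (⊤ : ℕ∞) u z := h.1.contDiffAt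
  have h2 := h1.isSymmSndFDerivAt (by
    rw [minSmoothness_of_isRCLikeNormedField]; exact WithTop.coe_le_coe.2 (le_top : (2 : ℕ∞) ≤ ⊤))
  have h3 : DifferentiableAt ℝ (fderiv ℝ u) z :=
    ((h.1.fderiv_right (m := (⊤ : ℕ∞)) le_rfl).differentiable (by simp)) z
  have h4 : ∀ x y : Pt d, dv x (dv y u) z = fderiv ℝ (fderiv ℝ u) z x y := by
    intro x y
    have : HasFDerivAt (fun z => fderiv ℝ u z y) _ z :=
      h3.hasFDerivAt.clm_apply (hasFDerivAt_const y z)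
    simp only [_root_.dv]
    rw [show (_root_.dv y u) = (fun z => fderiv ℝ u z y) from rfl, this.fderiv]; simp
  rw [h4, h4]; exact h2 v v'

lemma dv_add (h : CinfC u) (k : CinfC w) (v : Pt d) (z) :
    dv v (fun z => u z + w z) z = dv v u z + dv v w z := by
  simp only [dv]; rw [fderiv_fun_add (h.diff z) (k.diff z)]; rfl
lemma dv_smul (h : CinfC u) (c : ℝ) (v : Pt d) (z) :
    dv v (fun z => c * u z) z = c * dv v u z := by
  simp only [dv]; rw [fderiv_const_mul (h.diff z)]; rfl
lemma dv_mul (h : Differentiable ℝ w) (k : Differentiable ℝ u) (v : Pt d) (z) :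
    dv v (fun z => w z * u z) z = w z * dv v u z + dv v w z * u z := by
  simp only [dv]; rw [fderiv_fun_mul (h z) (k z)]; simp; ring

lemma dv_sub (h : CinfC u) (k : CinfC w) (v : Pt d) (z) :
    dv v (fun z => u z - w z) z = dv v u z - dv v w z := by
  simp only [dv]; rw [fderiv_fun_sub (h.diff z) (k.diff z)]; rfl

lemma Dxx_eq (h : CinfC u) (i j : Fin d) :
    Dxx i j u = dv (0, EuclideanSpace.single i 1) (dv (0, EuclideanSpace.single j 1) u) := by
  rw [Dxx, Dx_eq (h.Dx j), Dx_eq h]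

lemma Dx_comm (h : CinfC u) (i j : Fin d) : Dx i (Dx j u) = Dx j (Dx i u) := by
  rw [Dx_eq h, Dx_eq h, Dx_eq (h.dv _), Dx_eq (h.dv _), dv_comm h]
lemma Dt_Dx (h : CinfC u) (i : Fin d) : Dt (Dx i u) = Dx i (Dt u) := by
  rw [Dx_eq h, Dt_eq h, Dx_eq (h.dv _), Dt_eq (h.dv _), dv_comm h]

lemma integral_dv (h : CinfC u) (v : Pt d) : ∫ z, dv v u z = 0 := by
  have := integral_mul_fderiv_eq_neg_fderiv_mul_of_integrable (μ := (volume : Measure (Pt d)))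
    (f := fun _ => (1 : ℝ)) (g := u) (v := v) (by simp)
    (by simpa using! (h.dv v).integrable) (by simpa using h.integrable)
    (by simp) (fun x _ => h.diff x)
  simpa [dv] using this

/-- bounded measurable functions of time times test functions are integrable -/
lemma CinfC.int_bdd (h : CinfC u) {b : ℝ → ℝ} (hb : Measurable b) {B : ℝ} (hB : ∀ t, |b t| ≤ B) :
    Integrable (fun z : Pt d => b z.1 * u z) :=
  h.integrable.bdd_mul (c := B) (hb.comp measurable_fst).aestronglyMeasurable (.of_forall fun z => hB z.1)

lemma integral_b_Dx (h : CinfC u) (k : Fin d) {b : ℝ → ℝ} (hb : Measurable b) {B : ℝ}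
    (hB : ∀ t, |b t| ≤ B) : ∫ z : Pt d, b z.1 * Dx k u z = 0 := by
  have hi := (h.Dx k).int_bdd hb hB
  rw [Measure.volume_eq_prod] at hi ⊢
  rw [integral_prod _ hi]
  apply integral_eq_zero_of_ae
  refine .of_forall fun t => ?_
  simp only [integral_const_mul, Pi.zero_apply, mul_eq_zero]
  right
  have hu : ContDiff ℝ (⊤ : ℕ∞) (fun y => u (t, y)) := h.1.comp (contDiff_const.prodMk contDiff_id)
  have hc : HasCompactSupport (fun y => u (t, y)) := by
    obtain ⟨r, hr⟩ := h.2.isCompact.isBounded.subset_closedBall 0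
    refine HasCompactSupport.intro (isCompact_closedBall (0 : Spc d) r) fun x hx => ?_
    by_contra hne
    have := hr (subset_tsupport u hne)
    simp only [mem_closedBall, dist_zero_right, Prod.norm_def] at this hx
    exact hx ((le_max_right _ _).trans this)
  have h1 : Continuous fun y => fderiv ℝ (fun y => u (t, y)) y (EuclideanSpace.single k 1) :=
    (hu.continuous_fderiv (by simp)).clm_apply continuous_const
  have := integral_mul_fderiv_eq_neg_fderiv_mul_of_integrable (μ := (volume : Measure (Spc d)))
    (f := fun _ => (1 : ℝ)) (g := fun y => u (t, y)) (v := EuclideanSpace.single k 1) (by simp)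
    (by simpa using h1.integrable_of_hasCompactSupport (hc.fderiv_apply ℝ _))
    (by simpa using hu.continuous.integrable_of_hasCompactSupport hc)
    (by simp) (fun x _ => hu.differentiable (by simp) x)
  simpa [_root_.Dx] using this

end

/-- The operator `σ∂_t + a^{ij}D_{ij}`. -/
def Lop {d : ℕ} (σ : ℝ) (a : Pt d → Matrix (Fin d) (Fin d) ℝ) (u : Pt d → ℝ) (z : Pt d) : ℝ :=
  σ * Dt u z + ∑ i, ∑ j, a z i j * Dxx i j u z

/-- The a priori estimate in `L_s` for coefficients depending only on time. -/
def HS (d : ℕ) (δ : ℝ) (s : ℝ≥0∞) : Prop :=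
  ∃ N : ℝ≥0, ∀ σ : ℝ, σ ^ 2 = 1 → ∀ A : ℝ → Matrix (Fin d) (Fin d) ℝ, Measurable A →
    (∀ t, inS d δ (A t)) → ∀ u : Pt d → ℝ, CinfC u → ∀ i j,
      eLpNorm (Dxx i j u) s volume ≤ N * eLpNorm (Lop σ (fun z => A z.1) u) s volume

lemma inS.bdd {d : ℕ} {δ : ℝ} (hδ : 0 < δ) {a : Matrix (Fin d) (Fin d) ℝ} (h : inS d δ a) (i j) :
    |a i j| ≤ δ⁻¹ := by
  have hs : a j i = a i j := h.1.apply i j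
  have key : ∀ c : ℝ, (∑ k, ∑ l, a k l * (Pi.single i 1 + Pi.single j c : Fin d → ℝ) k *
      (Pi.single i 1 + Pi.single j c : Fin d → ℝ) l)
      = a i i + 2 * c * a i j + c ^ 2 * a j j := by
    intro c
    simp [mul_add, add_mul, Finset.sum_add_distrib, Pi.single_apply, hs]; ring
  have key2 : ∀ c : ℝ, (∑ k, (Pi.single i 1 + Pi.single j c : Fin d → ℝ) k ^ 2)
      = 1 + 2 * c * (if i = j then 1 else 0) + c ^ 2 := by
    intro c
    rcases eq_or_ne i j with hij | hij
    · simp [pow_two, mul_add, add_mul, Finset.sum_add_distrib, Pi.single_apply, hij]; ring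
    · simp [pow_two, mul_add, add_mul, Finset.sum_add_distrib, Pi.single_apply, hij, hij.symm]
  have h1 := h.2 (Pi.single i 1 + Pi.single j 1)
  have h2 := h.2 (Pi.single i 1 + Pi.single j (-1))
  rw [key, key2] at h1 h2
  have hd : 0 < δ⁻¹ := by positivity
  rw [abs_le]
  split_ifs at h1 h2 with hij <;> constructor <;> nlinarith

lemma meas_entry {d : ℕ} {X : Type*} [MeasurableSpace X] {A : X → Matrix (Fin d) (Fin d) ℝ}
    (hA : Measurable A) (i j) : Measurable fun t => A t i j :=
  (measurable_pi_apply j).comp ((measurable_pi_apply (X := fun _ : Fin d => Fin d → ℝ) i).comp hA)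


section
variable {d : ℕ} {u w : Pt d → ℝ}
lemma Dx_mul (h : CinfC w) (k : CinfC u) (i : Fin d) (z) :
    Dx i (fun z => w z * u z) z = w z * Dx i u z + Dx i w z * u z := by
  rw [Dx_eq (h.mul k), Dx_eq h, Dx_eq k, dv_mul h.diff k.diff]
lemma Dt_mul (h : CinfC w) (k : CinfC u) (z) :
    Dt (fun z => w z * u z) z = w z * Dt u z + Dt w z * u z := by
  rw [Dt_eq (h.mul k), Dt_eq h, Dt_eq k, dv_mul h.diff k.diff]

lemma CinfC.memLp (h : CinfC u) (p : ℝ≥0∞) : MemLp u p volume :=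
  h.cont.memLp_of_hasCompactSupport h.2

lemma Lop_memLp {δ : ℝ} (hδ : 0 < δ) (h : CinfC u) {a : Pt d → Matrix (Fin d) (Fin d) ℝ}
    (ha : Measurable a) (hS : ∀ z, inS d δ (a z)) (σ : ℝ) (p : ℝ≥0∞) :
    MemLp (Lop σ a u) p volume := by
  have h1 : MemLp (fun z => ∑ i, ∑ j, a z i j * Dxx i j u z) p volume := by
    refine memLp_finsetSum _ fun i _ => memLp_finsetSum _ fun j _ => ?_
    refine ((h.Dxx i j).memLp p).of_le_mul (c := δ⁻¹)
      ((meas_entry ha i j).aestronglyMeasurable.mul (h.Dxx i j).cont.aestronglyMeasurable) ?_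
    refine .of_forall fun z => ?_
    rw [norm_mul]
    gcongr
    exact (hS z).bdd hδ i j
  exact (((h.Dt.memLp p).const_mul σ)).add h1

/-- integrable with zero integral -/
def Zint (g : Pt d → ℝ) : Prop := Integrable g ∧ ∫ z, g z = 0
lemma Zint.add {f g : Pt d → ℝ} (hf : Zint f) (hg : Zint g) : Zint (fun z => f z + g z) :=
  ⟨hf.1.add hg.1, by rw [integral_add hf.1 hg.1, hf.2, hg.2, add_zero]⟩
lemma Zint.smul {f : Pt d → ℝ} (c : ℝ) (hf : Zint f) : Zint (fun z => c * f z) :=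
  ⟨hf.1.const_mul c, by rw [integral_const_mul, hf.2, mul_zero]⟩
lemma Zint.sum {ι : Type*} (s : Finset ι) {f : ι → Pt d → ℝ} (h : ∀ i, Zint (f i)) :
    Zint (fun z => ∑ i ∈ s, f i z) :=
  ⟨integrable_finsetSum _ fun i _ => (h i).1, by
    rw [integral_finsetSum _ fun i _ => (h i).1]; simp [fun i => (h i).2]⟩
lemma Zint_Dx (h : CinfC u) (k : Fin d) {b : ℝ → ℝ} (hb : Measurable b) {B : ℝ}
    (hB : ∀ t, |b t| ≤ B) : Zint (fun z : Pt d => b z.1 * Dx k u z) :=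
  ⟨(h.Dx k).int_bdd hb hB, integral_b_Dx h k hb hB⟩
lemma Zint_Dt (h : CinfC u) : Zint (Dt u) :=
  ⟨h.Dt.integrable, by rw [Dt_eq h]; exact integral_dv h _⟩

lemma zint1 (h : CinfC u) {b : ℝ → ℝ} (hb : Measurable b) {B : ℝ} (hB : ∀ t, |b t| ≤ B) (i j k) :
    Zint (fun z : Pt d => b z.1 * (Dxx i j u z * Dxx k k u z - Dxx i k u z * Dxx j k u z)) := by
  have h1 := (Zint_Dx ((h.Dxx i j).mul (h.Dx k)) k hb hB).add
    ((Zint_Dx ((h.Dxx i k).mul (h.Dx k)) j hb hB).smul (-1))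
  have e : Dx k (Dxx i j u) = Dx j (Dxx i k u) := by
    simp only [Dxx]
    rw [Dx_comm (h.Dx j) k i, Dx_comm h k j, ← Dx_comm (h.Dx k) i j]
  convert h1 using 2 with z
  rw [Dx_mul (h.Dxx i j) (h.Dx k), Dx_mul (h.Dxx i k) (h.Dx k), e]
  simp only [Dxx]; ring

lemma zint2 (h : CinfC u) (k) : Zint (fun z : Pt d => Dt u z * Dxx k k u z) := by
  have h1 := (Zint_Dx (h.Dt.mul (h.Dx k)) k (b := fun _ => 1) measurable_const (B := 1) (by simp)).add
    ((Zint_Dt ((h.Dx k).mul (h.Dx k))).smul (-(1/2)))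
  convert h1 using 2 with z
  rw [Dx_mul h.Dt (h.Dx k), Dt_mul (h.Dx k) (h.Dx k), Dt_Dx h]
  simp only [Dxx]; ring

lemma hs_two_aux {δ : ℝ} (hδ : 0 < δ) {σ : ℝ} {A : ℝ → Matrix (Fin d) (Fin d) ℝ}
    (hA : Measurable A) (hS : ∀ t, inS d δ (A t)) (h : CinfC u) (i j) :
    ∫ z, Dxx i j u z ^ 2 ≤ d / δ ^ 2 * ∫ z, Lop σ (fun z => A z.1) u z ^ 2 := by
  set f := Lop σ (fun z => A z.1) u with hf
  have hd : (0 : ℝ) < d := by exact_mod_cast i.pos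
  have hz := ((Zint.sum Finset.univ fun k => (zint2 h k)).smul σ).add
    (Zint.sum Finset.univ fun k => Zint.sum Finset.univ fun i => Zint.sum Finset.univ fun j =>
      zint1 h (meas_entry hA i j) (fun t => (hS t).bdd hδ i j) i j k)
  have hfm : MemLp f 2 volume := Lop_memLp hδ h (hA.comp measurable_fst) (fun z => hS z.1) σ 2
  have hsq : ∀ i j, Integrable fun z => Dxx i j u z ^ 2 := fun i j =>
    ((h.Dxx i j).memLp 2).integrable_sq
  have hSS : Integrable (fun z => ∑ k, ∑ i, Dxx i k u z ^ 2) :=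
    integrable_finsetSum _ fun k _ => integrable_finsetSum _ fun i _ => hsq i k
  have hpt : ∀ z, δ / 2 * (∑ k, ∑ i, Dxx i k u z ^ 2) ≤ d / (2 * δ) * f z ^ 2 -
     (σ * (∑ k, Dt u z * Dxx k k u z) + ∑ k, ∑ i, ∑ j, A z.1 i j *
       (Dxx i j u z * Dxx k k u z - Dxx i k u z * Dxx j k u z)) := by
    intro z
    have q : δ * (∑ k, ∑ i, Dxx i k u z ^ 2) ≤
        ∑ k, ∑ i, ∑ j, A z.1 i j * Dxx i k u z * Dxx j k u z := by
      rw [Finset.mul_sum]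
      exact Finset.sum_le_sum fun k _ => ((hS z.1).2 (fun i => Dxx i k u z)).1
    have e : σ * (∑ k, Dt u z * Dxx k k u z) + ∑ k, ∑ i, ∑ j, A z.1 i j *
       (Dxx i j u z * Dxx k k u z - Dxx i k u z * Dxx j k u z) = f z * (∑ k, Dxx k k u z) -
       ∑ k, ∑ i, ∑ j, A z.1 i j * Dxx i k u z * Dxx j k u z := by
      simp only [hf, Lop, add_mul, Finset.mul_sum, mul_sub, Finset.sum_sub_distrib, Finset.sum_add_distrib,
        mul_assoc]
      rw [← add_sub_assoc]; congr 2
      refine Finset.sum_congr rfl fun k _ => ?_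
      rw [Finset.sum_mul]
      refine Finset.sum_congr rfl fun i _ => ?_
      rw [Finset.sum_mul]
      exact Finset.sum_congr rfl fun j _ => by ring
    have cs : (∑ k, Dxx k k u z) ^ 2 ≤ d * ∑ k, ∑ i, Dxx i k u z ^ 2 := by
      refine (sq_sum_le_card_mul_sum_sq).trans ?_
      simp only [Finset.card_univ, Fintype.card_fin]
      gcongr with k
      exact Finset.single_le_sum (f := fun i => Dxx i k u z ^ 2) (fun i _ => sq_nonneg _)
        (Finset.mem_univ k)
    rw [e]
    have y : f z * (∑ k, Dxx k k u z) ≤ d / (2 * δ) * f z ^ 2 +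
        δ / (2 * d) * (∑ k, Dxx k k u z) ^ 2 := by
      have : 0 ≤ (d / (2 * δ)) * (f z - δ / d * (∑ k, Dxx k k u z)) ^ 2 := by positivity
      have e2 : (d / (2 * δ)) * (f z - δ / d * (∑ k, Dxx k k u z)) ^ 2 = d / (2 * δ) * f z ^ 2 +
        δ / (2 * d) * (∑ k, Dxx k k u z) ^ 2 - f z * (∑ k, Dxx k k u z) := by
        field_simp; ring
      linarith
    have y2 : δ / (2 * d) * (∑ k, Dxx k k u z) ^ 2 ≤ δ / 2 * (∑ k, ∑ i, Dxx i k u z ^ 2) := by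
      calc _ ≤ δ / (2 * d) * (d * ∑ k, ∑ i, Dxx i k u z ^ 2) := by gcongr
        _ = _ := by field_simp
    linarith
  have h1 := integral_mono (hSS.const_mul (δ / 2)) ((hfm.integrable_sq.const_mul _).sub hz.1) hpt
  simp only [Pi.sub_apply] at h1
  rw [integral_const_mul, integral_sub (hfm.integrable_sq.const_mul _) hz.1, hz.2, sub_zero,
    integral_const_mul] at h1
  have h2 : ∫ z, Dxx i j u z ^ 2 ≤ ∫ z, ∑ k, ∑ i, Dxx i k u z ^ 2 := by
    refine integral_mono (hsq i j) hSS fun z => ?_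
    refine (Finset.single_le_sum (f := fun i => Dxx i j u z ^ 2) (fun i _ => sq_nonneg _)
        (Finset.mem_univ i)).trans ?_
    exact Finset.single_le_sum (f := fun k => ∑ i, Dxx i k u z ^ 2)
        (fun i _ => Finset.sum_nonneg fun _ _ => sq_nonneg _) (Finset.mem_univ j)
  have h3 : ∫ z, ∑ k, ∑ i, Dxx i k u z ^ 2 ≤ (2 / δ) * (d / (2 * δ) * ∫ z, f z ^ 2) := by
    rw [← div_le_iff₀' (by positivity)]; convert h1 using 1; field_simp
  refine h2.trans (h3.trans (le_of_eq ?_)); field_simp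
end

lemma hs_two (d : ℕ) (δ : ℝ) (hδ : 0 < δ) : HS d δ 2 := by
  refine ⟨(Real.sqrt (d / δ ^ 2)).toNNReal, fun σ _ A hA hS u h i j => ?_⟩
  have h1 := hs_two_aux (σ := σ) hδ hA hS h i j
  have hfm : MemLp (Lop σ (fun z => A z.1) u) 2 volume :=
    Lop_memLp hδ h (hA.comp measurable_fst) (fun z => hS z.1) σ 2
  have e : ∀ g : Pt d → ℝ, MemLp g 2 volume →
      eLpNorm g 2 volume = ENNReal.ofReal (Real.sqrt (∫ z, g z ^ 2)) := by
    intro g hg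
    rw [MemLp.eLpNorm_eq_integral_rpow_norm two_ne_zero (by simp) hg, Real.sqrt_eq_rpow]
    simp
  rw [e _ ((h.Dxx i j).memLp 2), e _ hfm, ← ENNReal.ofReal_coe_nnreal,
    Real.coe_toNNReal _ (Real.sqrt_nonneg _), ← ENNReal.ofReal_mul (Real.sqrt_nonneg _),
    ← Real.sqrt_mul (by positivity)]
  exact ENNReal.ofReal_le_ofReal (Real.sqrt_le_sqrt h1)

/-- maximal function over a family of sets -/
def MF {X ι : Type*} [MeasurableSpace X] (μ : Measure X) (S : ι → Set X) (g : X → ℝ≥0∞) (x : X) :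
    ℝ≥0∞ := ⨆ (i : ι) (_ : x ∈ S i), (μ (S i))⁻¹ * ∫⁻ y in S i, g y ∂μ

structure HLfam {X ι : Type*} [TopologicalSpace X] [MeasurableSpace X] (μ : Measure X)
    (S : ι → Set X) (r : ι → ℝ) (e : ι → ι) (K : ℝ≥0∞) : Prop where
  op : ∀ i, IsOpen (S i)
  rpos : ∀ i, 0 < r i
  eng : ∀ i j, (S i ∩ S j).Nonempty → r j ≤ 2 * r i → S j ⊆ S (e i)
  dbl : ∀ i, μ (S (e i)) ≤ K * μ (S i)
  pos : ∀ i, μ (S i) ≠ 0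
  fin : ∀ i, μ (S i) ≠ ⊤

set_option linter.unusedSectionVars false
section
variable {X ι : Type*} [TopologicalSpace X] [SecondCountableTopology X] [MeasurableSpace X]
  [BorelSpace X] {μ : Measure X}
  {S : ι → Set X} {r : ι → ℝ} {e : ι → ι} {K : ℝ≥0∞}

lemma MF_ge {g : X → ℝ≥0∞} {x : X} (i : ι) (h : x ∈ S i) :
    (μ (S i))⁻¹ * ∫⁻ y in S i, g y ∂μ ≤ MF μ S g x :=
  le_iSup₂_of_le (f := fun i (_ : x ∈ S i) => (μ (S i))⁻¹ * ∫⁻ y in S i, g y ∂μ) i h le_rfl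

lemma MF_meas (hS : ∀ i, IsOpen (S i)) (g : X → ℝ≥0∞) : Measurable (MF μ S g) := by
  refine measurable_of_Ioi fun a => IsOpen.measurableSet ?_
  have : MF μ S g ⁻¹' Ioi a = ⋃ (i : ι) (_ : a < (μ (S i))⁻¹ * ∫⁻ y in S i, g y ∂μ), S i := by
    ext x; simp only [MF, mem_preimage, mem_Ioi, lt_iSup_iff, mem_iUnion]
    constructor <;> rintro ⟨i, h1, h2⟩ <;> exact ⟨i, h2, h1⟩
  rw [this]
  exact isOpen_iUnion fun i => isOpen_iUnion fun _ => hS i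

lemma MF_weak (h : HLfam μ S r e K) {g φ : X → ℝ≥0∞} (l : ℝ≥0∞) :
    l * ∫⁻ x in {x | l < MF μ S g x}, φ x ∂μ ≤ K * ∫⁻ x, g x * MF μ S φ x ∂μ := by
  set E : ℕ → Set X := fun n => ⋃ (i : ι) (_ : r i ≤ n ∧ l < (μ (S i))⁻¹ * ∫⁻ y in S i, g y ∂μ), S i
  have hE : {x | l < MF μ S g x} = ⋃ n, E n := by
    ext x; simp only [MF, mem_ofPred_eq, lt_iSup_iff, mem_iUnion, E]
    constructor
    · rintro ⟨i, h1, h2⟩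
      obtain ⟨n, hn⟩ := exists_nat_ge (r i)
      exact ⟨n, i, ⟨hn, h2⟩, h1⟩
    · rintro ⟨n, i, h1, h2⟩; exact ⟨i, h2, h1.2⟩
  have hmono : Monotone E := fun m n hmn => by
    refine iUnion_mono fun i => iUnion_mono' fun hi => ⟨⟨hi.1.trans (by exact_mod_cast hmn), hi.2⟩, le_rfl⟩
  rw [hE, setLIntegral_iUnion_of_directed _ hmono.directed_le, ENNReal.mul_iSup]
  refine iSup_le fun n => ?_
  have hne : ∀ i, (S i).Nonempty := fun i => nonempty_of_measure_ne_zero (h.pos i)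
  obtain ⟨u, hu, hdis, hcov⟩ := Vitali.exists_disjoint_subfamily_covering_enlargement S
    {i | r i ≤ n ∧ l < (μ (S i))⁻¹ * ∫⁻ y in S i, g y ∂μ} r 2 one_lt_two
    (fun i _ => (h.rpos i).le) n (fun i hi => hi.1) (fun i _ => hne i)
  have hcount : u.Countable := hdis.countable_of_isOpen (fun i _ => h.op i) (fun i _ => hne i)
  have := hcount.to_subtype
  have hsub : E n ⊆ ⋃ b : u, S (e b) := by
    refine iUnion₂_subset fun i hi => ?_
    obtain ⟨b, hb, h1, h2⟩ := hcov i hi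
    exact (h.eng b i (by rwa [inter_comm]) h2).trans (subset_iUnion (fun b : u => S (e b)) ⟨b, hb⟩)
  have hone : ∀ b : u, l * ∫⁻ x in S (e b), φ x ∂μ ≤ K * ∫⁻ x in S b, g x * MF μ S φ x ∂μ := by
    intro b
    have hb := hu b.2
    have h1 : l * μ (S b) ≤ ∫⁻ y in S b, g y ∂μ := by
      have := hb.2.le
      rwa [mul_comm, ← div_eq_mul_inv, ENNReal.le_div_iff_mul_le (.inl (h.pos b)) (.inl (h.fin b))] at this
    set av := (μ (S (e b)))⁻¹ * ∫⁻ y in S (e b), φ y ∂μ with hav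
    have h2 : ∫⁻ x in S (e b), φ x ∂μ = μ (S (e b)) * av := by
      rw [hav, ← mul_assoc, ENNReal.mul_inv_cancel (h.pos _) (h.fin _), one_mul]
    have hbb : S b ⊆ S (e b) := h.eng b b (by simpa using hne b) (by linarith [h.rpos b])
    calc l * ∫⁻ x in S (e b), φ x ∂μ ≤ l * (K * μ (S b) * av) := by
          rw [h2]; gcongr; exact h.dbl b
      _ = K * ((l * μ (S b)) * av) := by ring
      _ ≤ K * ((∫⁻ y in S b, g y ∂μ) * av) := by gcongr
      _ ≤ K * ∫⁻ x in S b, g x * av ∂μ := by gcongr; exact lintegral_mul_const_le _ _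
      _ ≤ _ := by
          gcongr 1
          refine setLIntegral_mono' (h.op b).measurableSet fun x hx => ?_
          gcongr
          exact MF_ge (e b) (hbb hx)
  calc l * ∫⁻ x in E n, φ x ∂μ ≤ l * ∑' b : u, ∫⁻ x in S (e b), φ x ∂μ := by
        gcongr; exact (lintegral_mono_set hsub).trans (lintegral_iUnion_le _ _)
    _ = ∑' b : u, l * ∫⁻ x in S (e b), φ x ∂μ := ENNReal.tsum_mul_left.symm
    _ ≤ ∑' b : u, K * ∫⁻ x in S b, g x * MF μ S φ x ∂μ := ENNReal.tsum_le_tsum hone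
    _ = K * ∫⁻ x in ⋃ b : u, S b, g x * MF μ S φ x ∂μ := by
        rw [ENNReal.tsum_mul_left, lintegral_iUnion (fun b : u => (h.op b).measurableSet)]
        exact fun a b hab => hdis a.2 b.2 (by simpa [Subtype.ext_iff] using hab)
    _ ≤ _ := by gcongr; exact Measure.restrict_le_self

end
lemma layer (y : ℝ≥0∞) {c : ℝ} (hc : 0 < c) :
    ∫⁻ l in Ioi (0 : ℝ), ({l : ℝ | ENNReal.ofReal l < y}.indicator
      (fun l => ENNReal.ofReal (l ^ (c - 1)))) l = y ^ c / ENNReal.ofReal c := by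
  have key : ∀ b : ℝ, 0 ≤ b → ∫⁻ l in Ioc 0 b, ENNReal.ofReal (l ^ (c - 1)) =
      ENNReal.ofReal b ^ c / ENNReal.ofReal c := by
    intro b hb
    have hi : IntegrableOn (fun l : ℝ => l ^ (c - 1)) (Ioc 0 b) :=
      (intervalIntegrable_iff_integrableOn_Ioc_of_le hb).1
        (intervalIntegral.intervalIntegrable_rpow' (by linarith))
    rw [← ofReal_integral_eq_lintegral_ofReal hi, ← intervalIntegral.integral_of_le hb,
      integral_rpow (.inl (by linarith)), ENNReal.ofReal_rpow_of_nonneg hb hc.le,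
      ← ENNReal.ofReal_div_of_pos hc]
    · simp [Real.zero_rpow hc.ne']
    · refine (ae_restrict_iff' measurableSet_Ioc).2 (.of_forall fun x hx => Real.rpow_nonneg hx.1.le _)
  have hms : MeasurableSet {l : ℝ | ENNReal.ofReal l < y} :=
    measurableSet_lt ENNReal.measurable_ofReal measurable_const
  rw [lintegral_indicator hms, Measure.restrict_restrict hms]
  rcases eq_or_ne y ⊤ with rfl | hy
  · have h1 : ∀ n : ℝ≥0, (n : ℝ≥0∞) ^ c / ENNReal.ofReal c ≤ ∫⁻ l in
      ({l : ℝ | ENNReal.ofReal l < ⊤} ∩ Ioi 0), ENNReal.ofReal (l ^ (c - 1)) := by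
      intro n
      rw [← ENNReal.ofReal_coe_nnreal, ← key n n.2]
      exact lintegral_mono_set fun x hx => ⟨by simp, hx.1⟩
    rw [ENNReal.top_rpow_of_pos hc, ENNReal.top_div_of_ne_top ENNReal.ofReal_ne_top]
    refine ENNReal.eq_top_of_forall_nnreal_le fun n => ?_
    have := h1 ((n * c.toNNReal) ^ (1 / c))
    rw [← ENNReal.coe_rpow_of_nonneg _ hc.le, ← NNReal.rpow_mul, one_div_mul_cancel hc.ne'] at this
    simp only [NNReal.rpow_one, ENNReal.coe_mul] at this
    rwa [ENNReal.ofReal, ENNReal.mul_div_cancel_right (by simpa using hc) (by simp)] at this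
  · rw [show y = ENNReal.ofReal y.toReal by simp [hy], ← key _ ENNReal.toReal_nonneg]
    rw [show {l : ℝ | ENNReal.ofReal l < ENNReal.ofReal y.toReal} ∩ Ioi 0 = Ioo 0 y.toReal by
      ext l; simp only [mem_inter_iff, mem_ofPred_eq, mem_Ioi, mem_Ioo]
      constructor
      · rintro ⟨h1, h2⟩; exact ⟨h2, (ENNReal.ofReal_lt_ofReal_iff_of_nonneg h2.le).1 h1⟩
      · rintro ⟨h1, h2⟩; exact ⟨(ENNReal.ofReal_lt_ofReal_iff_of_nonneg h1.le).2 h2, h1⟩]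
    exact setLIntegral_congr Ioo_ae_eq_Ioc

def hlC (K : ℝ≥0∞) (q : ℝ) : ℝ≥0∞ := ENNReal.ofReal q * (2 * K) * (2 ^ (q - 1) / ENNReal.ofReal (q - 1))

lemma hlC_ne_top {K : ℝ≥0∞} (hK : K ≠ ⊤) {q : ℝ} (hq : 1 < q) : hlC K q ≠ ⊤ := by
  have : ENNReal.ofReal (q - 1) ≠ 0 := by simpa using hq
  exact ENNReal.mul_ne_top (ENNReal.mul_ne_top (by simp) (ENNReal.mul_ne_top (by simp) hK))
    (ENNReal.div_ne_top (ENNReal.rpow_ne_top_of_nonneg (by linarith) (by simp)) this)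

lemma MF_strong {X ι : Type*} [TopologicalSpace X] [SecondCountableTopology X] [MeasurableSpace X]
    [BorelSpace X] {μ : Measure X} [SFinite μ] {S : ι → Set X} {r : ι → ℝ} {e : ι → ι} {K : ℝ≥0∞}
    (h : HLfam μ S r e K) {q : ℝ} (hq : 1 < q) {g φ : X → ℝ≥0∞} (hg : Measurable g)
    (hφ : Measurable φ) :
    ∫⁻ x, MF μ S g x ^ q * φ x ∂μ ≤ hlC K q * ∫⁻ x, g x ^ q * MF μ S φ x ∂μ := by
  have mM := MF_meas (μ := μ) h.op g
  have mP := MF_meas (μ := μ) h.op φ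
  have hq0 : ENNReal.ofReal q ≠ 0 := by simp; linarith
  have hweak : ∀ l : ℝ, 0 < l → ENNReal.ofReal l * ∫⁻ x in {x | ENNReal.ofReal l < MF μ S g x}, φ x ∂μ ≤
      2 * K * ∫⁻ x, ({x | ENNReal.ofReal l < 2 * g x}.indicator g x) * MF μ S φ x ∂μ := by
    intro l hl
    set gl := {x | ENNReal.ofReal l < 2 * g x}.indicator g with hgl
    have hle : ∀ x, g x ≤ gl x + ENNReal.ofReal l / 2 := by
      intro x
      by_cases hx : ENNReal.ofReal l < 2 * g x
      · rw [hgl, indicator_of_mem (by exact hx)]; exact le_self_add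
      · rw [not_lt, mul_comm, ← ENNReal.le_div_iff_mul_le (by simp) (by simp)] at hx
        exact hx.trans le_add_self
    have hM : ∀ x, MF μ S g x ≤ MF μ S gl x + ENNReal.ofReal l / 2 := by
      intro x
      refine iSup₂_le fun i hi => ?_
      calc _ ≤ (μ (S i))⁻¹ * ∫⁻ y in S i, (gl y + ENNReal.ofReal l / 2) ∂μ := by gcongr; exact hle _
        _ = (μ (S i))⁻¹ * ∫⁻ y in S i, gl y ∂μ + (μ (S i))⁻¹ * μ (S i) * (ENNReal.ofReal l / 2) := by
          rw [lintegral_add_right _ measurable_const, lintegral_const]; simp; ring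
        _ ≤ _ := by
          rw [ENNReal.inv_mul_cancel (h.pos i) (h.fin i), one_mul]
          gcongr; exact MF_ge i hi
    have hsub : {x | ENNReal.ofReal l < MF μ S g x} ⊆ {x | ENNReal.ofReal l / 2 < MF μ S gl x} := by
      intro x hx
      by_contra hcon
      simp only [mem_ofPred_eq, not_lt] at hcon hx
      have := (hM x).trans (add_le_add_left hcon _)
      rw [ENNReal.add_halves] at this
      exact absurd hx (not_lt.2 this)
    calc _ ≤ 2 * ((ENNReal.ofReal l / 2) * ∫⁻ x in {x | ENNReal.ofReal l / 2 < MF μ S gl x}, φ x ∂μ) := by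
          rw [← mul_assoc, ENNReal.mul_div_cancel (by simp) (by simp)]
          gcongr
      _ ≤ 2 * (K * ∫⁻ x, gl x * MF μ S φ x ∂μ) := by gcongr 2 * ?_; exact MF_weak h _
      _ = _ := by ring
  have e1 : ∀ x, MF μ S g x ^ q * φ x = ENNReal.ofReal q * ∫⁻ l in Ioi (0 : ℝ),
      ({l : ℝ | ENNReal.ofReal l < MF μ S g x}.indicator
        (fun l => ENNReal.ofReal (l ^ (q - 1)))) l * φ x := by
    intro x
    rw [lintegral_mul_const, layer _ (by linarith), ← mul_assoc,
      ENNReal.mul_div_cancel hq0 (by simp)]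
    exact Measurable.indicator (by fun_prop) (measurableSet_lt ENNReal.measurable_ofReal measurable_const)
  have m1 : Measurable (fun z : X × ℝ => ({l : ℝ | ENNReal.ofReal l < MF μ S g z.1}.indicator
        (fun l => ENNReal.ofReal (l ^ (q - 1)))) z.2 * φ z.1) := by
    refine Measurable.mul ?_ (hφ.comp measurable_fst)
    exact Measurable.indicator (s := {z : X × ℝ | ENNReal.ofReal z.2 < MF μ S g z.1})
      (f := fun z : X × ℝ => ENNReal.ofReal (z.2 ^ (q - 1))) (by fun_prop)
      (measurableSet_lt (by fun_prop) (mM.comp measurable_fst))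
  have m2 : Measurable (fun z : ℝ × X => ENNReal.ofReal (z.1 ^ (q - 1 - 1)) *
      (({x | ENNReal.ofReal z.1 < 2 * g x}.indicator g z.2) * MF μ S φ z.2)) := by
    refine Measurable.mul (by fun_prop) (Measurable.mul ?_ (mP.comp measurable_snd))
    exact Measurable.indicator (s := {z : ℝ × X | ENNReal.ofReal z.1 < 2 * g z.2})
      (f := fun z : ℝ × X => g z.2) (by fun_prop)
      (measurableSet_lt (by fun_prop) (by fun_prop))
  simp_rw [e1]
  rw [lintegral_const_mul _ m1.lintegral_prod_right',
    lintegral_lintegral_swap m1.aemeasurable]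
  have e2 : ∀ l ∈ Ioi (0 : ℝ), ∫⁻ x, ({l : ℝ | ENNReal.ofReal l < MF μ S g x}.indicator
        (fun l => ENNReal.ofReal (l ^ (q - 1)))) l * φ x ∂μ ≤ 2 * K *
        ∫⁻ x, ENNReal.ofReal (l ^ (q - 1 - 1)) *
        (({x | ENNReal.ofReal l < 2 * g x}.indicator g x) * MF μ S φ x) ∂μ := by
    intro l hl
    have hl' : 0 < l := hl
    have : ∀ x, ({l : ℝ | ENNReal.ofReal l < MF μ S g x}.indicator
        (fun l => ENNReal.ofReal (l ^ (q - 1)))) l * φ x = ENNReal.ofReal (l ^ (q - 1)) *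
        ({x | ENNReal.ofReal l < MF μ S g x}.indicator φ x) := by
      intro x
      by_cases hx : ENNReal.ofReal l < MF μ S g x <;> simp [indicator, hx]
    simp_rw [this]
    have mm : Measurable fun x => {x | ENNReal.ofReal l < 2 * g x}.indicator g x * MF μ S φ x :=
      (hg.indicator (measurableSet_lt measurable_const (by fun_prop))).mul mP
    rw [lintegral_const_mul _ (hφ.indicator (measurableSet_lt measurable_const mM)),
      lintegral_const_mul _ mm, lintegral_indicator (measurableSet_lt measurable_const mM)]
    calc _ = ENNReal.ofReal (l ^ (q - 1 - 1)) * (ENNReal.ofReal l *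
          ∫⁻ x in {x | ENNReal.ofReal l < MF μ S g x}, φ x ∂μ) := by
          rw [← mul_assoc, ← ENNReal.ofReal_mul (by positivity), ← Real.rpow_add_one hl'.ne']
          congr 3; ring
      _ ≤ ENNReal.ofReal (l ^ (q - 1 - 1)) * (2 * K * ∫⁻ x,
          ({x | ENNReal.ofReal l < 2 * g x}.indicator g x) * MF μ S φ x ∂μ) := by
          exact mul_le_mul' le_rfl (hweak l hl)
      _ = _ := by ring
  calc _ ≤ ENNReal.ofReal q * ∫⁻ l in Ioi (0 : ℝ), 2 * K * ∫⁻ x, ENNReal.ofReal (l ^ (q - 1 - 1)) *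
        (({x | ENNReal.ofReal l < 2 * g x}.indicator g x) * MF μ S φ x) ∂μ := by
        exact mul_le_mul' le_rfl <| setLIntegral_mono' measurableSet_Ioi e2
    _ = ENNReal.ofReal q * (2 * K * ∫⁻ x, ((2 * g x) ^ (q - 1) / ENNReal.ofReal (q - 1)) *
        (g x * MF μ S φ x) ∂μ) := by
        rw [lintegral_const_mul _ m2.lintegral_prod_right', lintegral_lintegral_swap m2.aemeasurable]
        congr 3; ext x
        rw [← layer (2 * g x) (by linarith : 0 < q - 1), ← lintegral_mul_const]
        · refine lintegral_congr fun l => ?_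
          by_cases hx : ENNReal.ofReal l < 2 * g x <;> simp [indicator, hx]
        · exact Measurable.indicator (by fun_prop) (measurableSet_lt ENNReal.measurable_ofReal measurable_const)
    _ = _ := by
        have : ∀ x, ((2 * g x) ^ (q - 1) / ENNReal.ofReal (q - 1)) * (g x * MF μ S φ x) =
          (2 ^ (q - 1) / ENNReal.ofReal (q - 1)) * (g x ^ q * MF μ S φ x) := by
          intro x
          have e3 : g x ^ q = g x ^ (q - 1) * g x := by
            conv_rhs => rw [← ENNReal.rpow_one (g x), ← ENNReal.rpow_mul, one_mul,
              ← ENNReal.rpow_add_of_nonneg _ _ (by linarith) zero_le_one]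
            simp
          rw [ENNReal.mul_rpow_of_nonneg _ _ (by linarith), e3]; simp only [div_eq_mul_inv]; ring
        simp_rw [this]
        have m3 : Measurable fun x => g x ^ q * MF μ S φ x := (hg.pow_const q).mul mP
        rw [lintegral_const_mul _ m3, hlC]; ring

section
variable {d : ℕ}

/-- index of cylinders -/
abbrev CI (d : ℕ) := {r : ℝ // 0 < r} × ℝ × Spc d
abbrev BI (d : ℕ) := {r : ℝ // 0 < r} × Spc d
def cS (i : CI d) : Set (Pt d) := cyl d i.1 i.2.1 i.2.2
def bS (i : BI d) : Set (Spc d) := ball i.2 i.1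
def hK (d : ℕ) : ℝ≥0∞ := 5 ^ (d + 2)
lemma hK_ne_top : hK d ≠ ⊤ := ENNReal.pow_ne_top (by simp)

lemma vol_ball_mul (x y : Spc d) {c : ℝ} (hc : 0 < c) (r : ℝ) :
    volume (ball x (c * r)) = ENNReal.ofReal c ^ d * volume (ball y r) := by
  rw [Measure.addHaar_ball_mul_of_pos _ _ hc, finrank_euclideanSpace_fin, ENNReal.ofReal_pow hc.le,
    Measure.addHaar_ball_center _ y]

lemma vol_cyl (r t : ℝ) (x : Spc d) :
    volume (cyl d r t x) = ENNReal.ofReal (r ^ 2) * volume (ball x r) := by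
  rw [cyl, Measure.volume_eq_prod, Measure.prod_prod, Real.volume_Ioo]; simp

lemma vol_cyl_mul (x y : Spc d) (t t' : ℝ) {c : ℝ} (hc : 0 < c) (r : ℝ) :
    volume (cyl d (c * r) t x) = ENNReal.ofReal c ^ (d + 2) * volume (cyl d r t' y) := by
  rw [vol_cyl, vol_cyl, vol_ball_mul x y hc, mul_pow, ENNReal.ofReal_mul (by positivity),
    ENNReal.ofReal_pow hc.le]; ring

lemma vol_ball_ne (x : Spc d) {r : ℝ} (hr : 0 < r) : volume (ball x r) ≠ 0 :=
  (measure_ball_pos _ _ hr).ne'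
lemma vol_cyl_ne (x : Spc d) (t : ℝ) {r : ℝ} (hr : 0 < r) : volume (cyl d r t x) ≠ 0 := by
  rw [vol_cyl]; exact mul_ne_zero (by simpa using hr.ne') (vol_ball_ne x hr)
lemma vol_cyl_fin (x : Spc d) (t r : ℝ) : volume (cyl d r t x) ≠ ⊤ := by
  rw [vol_cyl]; exact ENNReal.mul_ne_top (by simp) measure_ball_lt_top.ne
lemma cyl_open (x : Spc d) (t r : ℝ) : IsOpen (cyl d r t x) := isOpen_Ioo.prod isOpen_ball
lemma cyl_meas (x : Spc d) (t r : ℝ) : MeasurableSet (cyl d r t x) := (cyl_open x t r).measurableSet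

lemma bfam (d : ℕ) : HLfam (volume : Measure (Spc d)) bS (fun i => i.1.1)
    (fun i => (⟨5 * i.1.1, by linarith [i.1.2]⟩, i.2)) (hK d) where
  op i := isOpen_ball
  rpos i := i.1.2
  eng i j h hr := by
    obtain ⟨z, h1, h2⟩ := h
    intro y hy
    simp only [bS, mem_ball] at *
    have := dist_triangle y j.2 z
    have := dist_triangle y z i.2
    rw [dist_comm j.2 z] at *
    linarith
  dbl i := by
    simp only [bS]
    rw [vol_ball_mul i.2 i.2 (by norm_num), hK]; gcongr
    · norm_num
    · simp
    · simp
  pos i := vol_ball_ne _ i.1.2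
  fin i := measure_ball_lt_top.ne

lemma cfam (d : ℕ) : HLfam (volume : Measure (Pt d)) cS (fun i => i.1.1)
    (fun i => (⟨5 * i.1.1, by linarith [i.1.2]⟩, i.2.1 - 4 * i.1.1 ^ 2, i.2.2)) (hK d) where
  op i := cyl_open _ _ _
  rpos i := i.1.2
  eng i j h hr := by
    obtain ⟨z, h1, h2⟩ := h
    intro y hy
    have := i.1.2
    have := j.1.2
    simp only [cS, cyl, mem_prod, mem_ball, mem_Ioo] at *
    have := dist_triangle y.2 j.2.2 z.2
    have := dist_triangle y.2 z.2 i.2.2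
    rw [dist_comm j.2.2 z.2] at *
    have h3 : j.1.1 ^ 2 ≤ 4 * i.1.1 ^ 2 := by nlinarith
    refine ⟨⟨by linarith, by nlinarith⟩, by linarith⟩
  dbl i := by
    simp only [cS]
    rw [vol_cyl_mul i.2.2 i.2.2 _ i.2.1 (by norm_num), hK]; simp
  pos i := vol_cyl_ne _ _ i.1.2
  fin i := vol_cyl_fin _ _ _

def MC (g : Pt d → ℝ≥0∞) : Pt d → ℝ≥0∞ := MF volume cS g
def MX (g : Spc d → ℝ≥0∞) : Spc d → ℝ≥0∞ := MF volume bS g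
lemma MC_meas (g : Pt d → ℝ≥0∞) : Measurable (MC g) := MF_meas (cfam d).op g
lemma MX_meas (g : Spc d → ℝ≥0∞) : Measurable (MX g) := MF_meas (bfam d).op g

lemma lint_pt {f : Pt d → ℝ≥0∞} (hf : Measurable f) : ∫⁻ z, f z = ∫⁻ x, ∫⁻ t, f (t, x) := by
  rw [Measure.volume_eq_prod, lintegral_prod_symm _ hf.aemeasurable]
lemma lint_cyl {f : Pt d → ℝ≥0∞} (hf : Measurable f) (r t : ℝ) (x : Spc d) :
    ∫⁻ z in cyl d r t x, f z = ∫⁻ y in ball x r, ∫⁻ s in Ioo t (t + r ^ 2), f (s, y) := by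
  rw [Measure.volume_eq_prod, cyl, ← Measure.prod_restrict, lintegral_prod_symm _ hf.aemeasurable]
lemma ae_pt {P : Pt d → Prop} (hP : MeasurableSet {z | P z}) (h : ∀ᵐ x, ∀ᵐ t, P (t, x)) :
    ∀ᵐ z, P z := by
  rw [Measure.volume_eq_prod, Measure.ae_prod_iff_ae_ae hP]
  exact (Measure.ae_ae_comm (p := fun t x => P (t, x)) hP).2 h

lemma MC_snd {φ : Spc d → ℝ≥0∞} (hφ : Measurable φ) (z : Pt d) :
    MC (fun z => φ z.2) z ≤ MX φ z.2 := by
  refine iSup₂_le fun i hi => ?_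
  refine le_trans (le_of_eq ?_) (MF_ge (i.1, i.2.2) hi.2)
  have h0 : ENNReal.ofReal (i.1.1 ^ 2) ≠ 0 := by have := i.1.2; simp; positivity
  simp only [cS, bS]
  rw [lint_cyl (f := fun z => φ z.2) (hφ.comp measurable_snd), vol_cyl]
  simp only [lintegral_const, Measure.restrict_apply_univ, Real.volume_Ioo,
    add_sub_cancel_left]
  rw [lintegral_mul_const _ hφ, ENNReal.mul_inv (.inl h0) (.inl (by simp)), mul_comm (∫⁻ _ in _, _),
    mul_mul_mul_comm, ENNReal.inv_mul_cancel h0 (by simp), one_mul]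

lemma MC_one (z : Pt d) : MC (fun _ => 1) z ≤ 1 := by
  refine iSup₂_le fun i hi => ?_
  simp [ENNReal.inv_mul_cancel ((cfam d).pos i) ((cfam d).fin i)]
lemma MX_one (z : Spc d) : MX (fun _ => 1) z ≤ 1 := by
  refine iSup₂_le fun i hi => ?_
  simp [ENNReal.inv_mul_cancel ((bfam d).pos i) ((bfam d).fin i)]

lemma MC_strong1 {q : ℝ} (hq : 1 < q) {g : Pt d → ℝ≥0∞} (hg : Measurable g) :
    ∫⁻ z, MC g z ^ q ≤ hlC (hK d) q * ∫⁻ z, g z ^ q := by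
  have := MF_strong (cfam d) hq hg (φ := fun _ => 1) measurable_const
  simp only [mul_one] at this
  refine this.trans ?_
  gcongr with z
  exact mul_le_of_le_one_right' (MC_one z)
lemma MX_strong1 {q : ℝ} (hq : 1 < q) {g : Spc d → ℝ≥0∞} (hg : Measurable g) :
    ∫⁻ z, MX g z ^ q ≤ hlC (hK d) q * ∫⁻ z, g z ^ q := by
  have := MF_strong (bfam d) hq hg (φ := fun _ => 1) measurable_const
  simp only [mul_one] at this
  refine this.trans ?_
  gcongr with z
  exact mul_le_of_le_one_right' (MX_one z)

lemma absorb_pow {I A : ℝ≥0∞} {r r' : ℝ} (hr : r.HolderConjugate r') (hI : I ≠ ⊤)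
    (h : I ≤ A * I ^ (1 / r')) : I ≤ A ^ r := by
  rcases eq_or_ne I 0 with rfl | h0
  · simp
  have h1 : I ^ (1 / r) ≤ A := by
    have e : (1 : ℝ) / r = 1 - 1 / r' := by
      have := hr.inv_add_inv_eq_one; simp only [one_div]; linarith
    rw [e, ENNReal.rpow_sub _ _ h0 hI, ENNReal.rpow_one]
    exact ENNReal.div_le_of_le_mul h
  calc I = (I ^ (1 / r)) ^ r := by
        rw [← ENNReal.rpow_mul, one_div_mul_cancel hr.ne_zero, ENNReal.rpow_one]
    _ ≤ _ := ENNReal.rpow_le_rpow h1 hr.nonneg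

lemma dual_lint {H : Spc d → ℝ≥0∞} (hH : Measurable H) {r r' : ℝ} (hr : r.HolderConjugate r')
    {A : ℝ≥0∞} (h : ∀ φ : Spc d → ℝ≥0∞, Measurable φ →
      ∫⁻ x, H x * φ x ≤ A * (∫⁻ x, φ x ^ r') ^ (1 / r')) : ∫⁻ x, H x ^ r ≤ A ^ r := by
  have hr0 := hr.pos
  have hr1 : 0 < r - 1 := by linarith [hr.lt]
  set F : ℕ → Spc d → ℝ≥0∞ := fun n => (ball 0 n).indicator fun x => (min (H x) n) ^ r
  have hF : ∀ x, H x ^ r = ⨆ n, F n x := by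
    intro x
    refine le_antisymm ?_ (iSup_le fun n => ?_)
    · obtain ⟨m, hm⟩ := exists_nat_gt ‖x‖
      have h1 : H x = ⨆ n : ℕ, min (H x) n := by
        rw [← inf_iSup_eq, ENNReal.iSup_natCast, inf_top_eq]
      conv_lhs => rw [h1]
      rw [← ENNReal.orderIsoRpow_apply r hr0, OrderIso.map_iSup]
      refine iSup_le fun n => le_iSup_of_le (max n m) ?_
      have : x ∈ ball (0 : Spc d) ((max n m : ℕ) : ℝ) := by
        simp only [mem_ball, dist_zero_right]; exact hm.trans_le (by exact_mod_cast le_max_right _ _)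
      simp only [F, indicator_of_mem this, ENNReal.orderIsoRpow_apply]
      gcongr; exact le_max_left _ _
    · refine (indicator_le_self _ _ _).trans ?_
      gcongr; exact min_le_left _ _
  have mF : ∀ n, Measurable (F n) := fun n =>
    ((hH.min measurable_const).pow_const r).indicator measurableSet_ball
  have hmono : Monotone F := fun m n hmn x => by
    by_cases hx : x ∈ ball (0 : Spc d) m
    · have hx' : x ∈ ball (0 : Spc d) n := ball_subset_ball (by exact_mod_cast hmn) hx
      simp only [F, indicator_of_mem hx, indicator_of_mem hx']
      gcongr
    · simp [F, indicator_of_notMem hx]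
  simp_rw [hF]
  rw [lintegral_iSup mF hmono]
  refine iSup_le fun n => ?_
  have hfin : ∫⁻ x, F n x ≠ ⊤ := by
    simp only [F]
    rw [lintegral_indicator measurableSet_ball]
    refine ((setLIntegral_mono' (g := fun _ => (n : ℝ≥0∞) ^ r) measurableSet_ball fun x _ => ?_).trans_lt ?_).ne
    · gcongr; exact min_le_right _ _
    · rw [lintegral_const]
      exact ENNReal.mul_lt_top (ENNReal.rpow_lt_top_of_nonneg hr0.le (by simp))
        (by simpa using measure_ball_lt_top)
  refine absorb_pow hr hfin ?_
  have h1 := h ((ball 0 n).indicator fun x => (min (H x) n) ^ (r - 1))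
    (((hH.min measurable_const).pow_const _).indicator measurableSet_ball)
  refine le_trans (lintegral_mono fun x => ?_) (h1.trans (le_of_eq ?_))
  · simp only [F]
    by_cases hx : x ∈ ball (0 : Spc d) n
    · simp only [indicator_of_mem hx]
      calc min (H x) n ^ r = min (H x) n ^ (1 : ℝ) * min (H x) n ^ (r - 1) := by
            rw [← ENNReal.rpow_add_of_nonneg _ _ zero_le_one hr1.le]; simp
        _ ≤ _ := by rw [ENNReal.rpow_one]; gcongr; exact min_le_left _ _
    · simp [indicator_of_notMem hx]
  · congr 3; ext x; simp only [F]
    by_cases hx : x ∈ ball (0 : Spc d) n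
    · simp only [indicator_of_mem hx, ← ENNReal.rpow_mul]
      rw [hr.sub_one_mul_conj]
    · simp [indicator_of_notMem hx, hr.symm.pos]

def mixI (q p : ℝ) (g : Pt d → ℝ≥0∞) : ℝ≥0∞ := ∫⁻ x, (∫⁻ t, g (t, x) ^ q) ^ (p / q)

lemma meas_inner {g : Pt d → ℝ≥0∞} (hg : Measurable g) (q : ℝ) :
    Measurable fun x => ∫⁻ t, g (t, x) ^ q :=
  Measurable.lintegral_prod_left' (f := fun z : Pt d => g z ^ q) (hg.pow_const q)

lemma MC_mixed_gt {q p : ℝ} (hq : 1 < q) (hqp : q < p) {g : Pt d → ℝ≥0∞} (hg : Measurable g) :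
    mixI q p (MC g) ≤ (hlC (hK d) q * hlC (hK d) (Real.conjExponent (p / q)) ^
      (1 / Real.conjExponent (p / q))) ^ (p / q) * mixI q p g := by
  set r := p / q
  have hr1 : 1 < r := (one_lt_div (by linarith)).2 hqp
  have hr : r.HolderConjugate (Real.conjExponent r) := Real.HolderConjugate.conjExponent hr1
  set r' := Real.conjExponent r
  have mH := meas_inner (MC_meas g) q
  have mJ := meas_inner hg q
  have h1 := dual_lint mH hr (A := hlC (hK d) q * hlC (hK d) r' ^ (1 / r') * (mixI q p g) ^ (1 / r)) ?_
  · refine h1.trans (le_of_eq ?_)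
    rw [ENNReal.mul_rpow_of_nonneg _ _ hr.nonneg, ← ENNReal.rpow_mul _ (1 / r) r,
      one_div_mul_cancel hr.ne_zero, ENNReal.rpow_one]
  · intro φ hφ
    have mM := MX_meas φ
    calc ∫⁻ x, (∫⁻ t, MC g (t, x) ^ q) * φ x = ∫⁻ z : Pt d, MC g z ^ q * φ z.2 := by
          rw [lint_pt (f := fun z : Pt d => MC g z ^ q * φ z.2)
            (((MC_meas g).pow_const q).mul (hφ.comp measurable_snd))]
          refine lintegral_congr fun x => ?_
          have hm : Measurable fun t => MC g (t, x) ^ q :=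
            ((MC_meas g).comp (measurable_prodMk_right)).pow_const q
          exact (lintegral_mul_const _ hm).symm
      _ ≤ hlC (hK d) q * ∫⁻ z, g z ^ q * MC (fun z => φ z.2) z :=
          MF_strong (cfam d) hq hg (φ := fun z : Pt d => φ z.2) (hφ.comp measurable_snd)
      _ ≤ hlC (hK d) q * ∫⁻ z : Pt d, g z ^ q * MX φ z.2 := by
          gcongr with z; exact MC_snd hφ z
      _ = hlC (hK d) q * ∫⁻ x, (∫⁻ t, g (t, x) ^ q) * MX φ x := by
          rw [lint_pt (f := fun z : Pt d => g z ^ q * MX φ z.2)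
            ((hg.pow_const q).mul (mM.comp measurable_snd))]
          congr 2; ext x
          have hm : Measurable fun t => g (t, x) ^ q :=
            (hg.comp (measurable_prodMk_right)).pow_const q
          exact lintegral_mul_const (MX φ x) hm
      _ ≤ hlC (hK d) q * ((∫⁻ x, (∫⁻ t, g (t, x) ^ q) ^ r) ^ (1 / r) *
            (∫⁻ x, MX φ x ^ r') ^ (1 / r')) := by
          refine mul_le_mul' le_rfl ?_
          exact ENNReal.lintegral_mul_le_Lp_mul_Lq volume hr mJ.aemeasurable mM.aemeasurable
      _ ≤ hlC (hK d) q * ((∫⁻ x, (∫⁻ t, g (t, x) ^ q) ^ r) ^ (1 / r) *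
            (hlC (hK d) r' * ∫⁻ x, φ x ^ r') ^ (1 / r')) := by
          gcongr
          · exact one_div_nonneg.2 hr.symm.nonneg
          · exact MX_strong1 hr.symm.lt hφ
      _ = _ := by
          rw [ENNReal.mul_rpow_of_nonneg _ _ (one_div_nonneg.2 hr.symm.nonneg), mixI]; ring

lemma MC_mixed_lt {q p : ℝ} (hp : 1 < p) (hqp : p < q) {g : Pt d → ℝ≥0∞} (hg : Measurable g)
    (hfin : mixI q p g ≠ ⊤) : mixI q p (MC g) ≤ hlC (hK d) p * mixI q p g := by
  have hq0 : 0 < q := by linarith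
  have hp0 : 0 < p := by linarith
  set θ := p / q with hθ
  have hθ0 : 0 < θ := by positivity
  have hθ1 : θ < 1 := (div_lt_one hq0).2 hqp
  have h1θ : 0 ≤ 1 - θ := by linarith
  have hqθ : θ * q = p := by rw [hθ]; field_simp
  set J : Spc d → ℝ≥0∞ := fun x => ∫⁻ t, g (t, x) ^ q with hJ
  have mJ : Measurable J := meas_inner hg q
  set G : Spc d → ℝ≥0∞ := fun x => J x ^ (1 / q) with hG
  have mG : Measurable G := mJ.pow_const _
  set k : Pt d → ℝ≥0∞ := fun z => g z ^ (1 / θ) * J z.2 ^ (1 / q - 1 / p) with hk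
  have mk : Measurable k := (hg.pow_const _).mul ((mJ.comp measurable_snd).pow_const _)
  have hJtop : ∀ᵐ x, J x ≠ ⊤ := by
    have : ∀ᵐ x, J x ^ θ < ⊤ := ae_lt_top (mJ.pow_const θ) hfin
    filter_upwards [this] with x hx h
    rw [h, ENNReal.top_rpow_of_pos hθ0] at hx
    exact lt_irrefl _ hx
  have hge : ∀ᵐ z : Pt d, g z ≤ k z ^ θ * G z.2 ^ (1 - θ) := by
    refine ae_pt (measurableSet_le hg ((mk.pow_const _).mul ((mG.comp measurable_snd).pow_const _))) ?_
    filter_upwards [hJtop] with x hx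
    rcases eq_or_ne (J x) 0 with h0 | h0
    · have : ∀ᵐ t, g (t, x) ^ q = 0 :=
        (lintegral_eq_zero_iff ((hg.comp (measurable_prodMk_right)).pow_const q)).1 h0
      filter_upwards [this] with t ht
      rw [ENNReal.rpow_eq_zero_iff_of_pos hq0] at ht
      rw [ht]; exact zero_le
    · refine .of_forall fun t => le_of_eq ?_
      simp only [hk, hG]
      rw [ENNReal.mul_rpow_of_nonneg _ _ hθ0.le, ← ENNReal.rpow_mul, ← ENNReal.rpow_mul,
        ← ENNReal.rpow_mul, one_div_mul_cancel hθ0.ne', ENNReal.rpow_one, mul_assoc,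
        ← ENNReal.rpow_add _ _ h0 hx]
      rw [show (1 / q - 1 / p) * θ + 1 / q * (1 - θ) = 0 by rw [hθ]; field_simp; ring]
      simp
  have hM : ∀ z : Pt d, MC g z ≤ MC k z ^ θ * MX G z.2 ^ (1 - θ) := by
    intro z
    refine iSup₂_le fun i hi => ?_
    set V := (volume (cS i))⁻¹
    calc V * ∫⁻ y in cS i, g y ≤ V * ∫⁻ y in cS i, k y ^ θ * G y.2 ^ (1 - θ) := by
          refine mul_le_mul' le_rfl (lintegral_mono_ae (ae_restrict_of_ae hge))
      _ ≤ V * ((∫⁻ y in cS i, k y) ^ θ * (∫⁻ y in cS i, G y.2) ^ (1 - θ)) := by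
          refine mul_le_mul' le_rfl (ENNReal.lintegral_mul_norm_pow_le mk.aemeasurable
            (mG.comp measurable_snd).aemeasurable hθ0.le (by linarith) (by ring))
      _ = (V * ∫⁻ y in cS i, k y) ^ θ * (V * ∫⁻ y in cS i, G y.2) ^ (1 - θ) := by
          rw [ENNReal.mul_rpow_of_nonneg _ _ hθ0.le, ENNReal.mul_rpow_of_nonneg _ _ (by linarith),
            mul_mul_mul_comm, ← ENNReal.rpow_add_of_nonneg _ _ hθ0.le (by linarith)]
          simp
      _ ≤ _ := by
          gcongr
          · exact MF_ge i hi
          · exact (MF_ge (g := fun z : Pt d => G z.2) i hi).trans (MC_snd mG z)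
  have hkp : ∀ x, ∫⁻ t, k (t, x) ^ p ≤ J x ^ θ := by
    intro x
    have e : ∀ t, k (t, x) ^ p = J x ^ (θ - 1) * g (t, x) ^ q := by
      intro t
      simp only [hk]
      rw [ENNReal.mul_rpow_of_nonneg _ _ hp0.le, ← ENNReal.rpow_mul, ← ENNReal.rpow_mul, mul_comm]
      congr 2
      · rw [hθ]; field_simp
      · rw [hθ]; field_simp
    simp_rw [e]
    have hm : Measurable fun t => g (t, x) ^ q :=
      (hg.comp (measurable_prodMk_right)).pow_const q
    rw [lintegral_const_mul _ hm]
    change J x ^ (θ - 1) * J x ≤ _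
    rcases eq_or_ne (J x) 0 with h0 | h0
    · simp [h0]
    rcases eq_or_ne (J x) ⊤ with h1 | h1
    · rw [h1, ENNReal.top_rpow_of_pos hθ0]; exact le_top
    rw [ENNReal.rpow_sub _ _ h0 h1, ENNReal.rpow_one, ENNReal.div_mul_cancel h0 h1]
  have mMk := MC_meas k
  have mMG := MX_meas G
  have hin : ∀ x, (∫⁻ t, MC g (t, x) ^ q) ^ θ ≤
      (∫⁻ t, MC k (t, x) ^ p) ^ θ * (MX G x ^ p) ^ (1 - θ) := by
    intro x
    calc _ ≤ (∫⁻ t, MC k (t, x) ^ p * MX G x ^ ((1 - θ) * q)) ^ θ := by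
          gcongr with t
          calc _ ≤ (MC k (t, x) ^ θ * MX G x ^ (1 - θ)) ^ q := by gcongr; exact hM (t, x)
            _ = _ := by
              rw [ENNReal.mul_rpow_of_nonneg _ _ hq0.le, ← ENNReal.rpow_mul, ← ENNReal.rpow_mul, hqθ]
      _ = _ := by
          have hm : Measurable fun t => MC k (t, x) ^ p :=
            (mMk.comp (measurable_prodMk_right)).pow_const p
          rw [lintegral_mul_const _ hm,
            ENNReal.mul_rpow_of_nonneg _ _ hθ0.le, ← ENNReal.rpow_mul, ← ENNReal.rpow_mul,
            show (1 - θ) * q * θ = p * (1 - θ) by rw [← hqθ]; ring]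
  have hGp : ∫⁻ x, G x ^ p = mixI q p g := by
    simp only [mixI, hG, hJ]; congr 1; ext x
    rw [← ENNReal.rpow_mul]; congr 1; field_simp
  calc mixI q p (MC g) ≤ ∫⁻ x, (∫⁻ t, MC k (t, x) ^ p) ^ θ * (MX G x ^ p) ^ (1 - θ) :=
        lintegral_mono hin
    _ ≤ (∫⁻ x, ∫⁻ t, MC k (t, x) ^ p) ^ θ * (∫⁻ x, MX G x ^ p) ^ (1 - θ) :=
        ENNReal.lintegral_mul_norm_pow_le (meas_inner mMk p).aemeasurable
          (mMG.pow_const p).aemeasurable hθ0.le (by linarith) (by ring)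
    _ ≤ (hlC (hK d) p * mixI q p g) ^ θ * (hlC (hK d) p * mixI q p g) ^ (1 - θ) := by
        gcongr ?_ ^ θ * ?_ ^ (1 - θ)
        · rw [← lint_pt (f := fun z => MC k z ^ p) (mMk.pow_const p)]
          refine (MC_strong1 hp mk).trans (mul_le_mul' le_rfl ?_)
          rw [lint_pt (f := fun z => k z ^ p) (mk.pow_const p)]
          exact lintegral_mono hkp
        · rw [← hGp]; exact MX_strong1 hp mG
    _ = _ := by
        rw [← ENNReal.rpow_add_of_nonneg _ _ hθ0.le (by linarith)]; simp

lemma MC_mixed (d : ℕ) {q p : ℝ} (hq : 1 < q) (hp : 1 < p) : ∃ N : ℝ≥0∞, N ≠ ⊤ ∧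
    ∀ g : Pt d → ℝ≥0∞, Measurable g → mixI q p (MC g) ≤ N * mixI q p g := by
  rcases lt_trichotomy q p with h | rfl | h
  · have hr : (p / q).HolderConjugate (Real.conjExponent (p / q)) :=
      Real.HolderConjugate.conjExponent ((one_lt_div (by linarith)).2 h)
    refine ⟨_, ?_, fun g hg => MC_mixed_gt hq h hg⟩
    exact ENNReal.rpow_ne_top_of_nonneg hr.nonneg (ENNReal.mul_ne_top (hlC_ne_top hK_ne_top hq)
      (ENNReal.rpow_ne_top_of_nonneg (one_div_nonneg.2 hr.symm.nonneg)
        (hlC_ne_top hK_ne_top hr.symm.lt)))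
  · refine ⟨hlC (hK d) q, hlC_ne_top hK_ne_top hq, fun g hg => ?_⟩
    have e : ∀ g : Pt d → ℝ≥0∞, Measurable g → mixI q q g = ∫⁻ z, g z ^ q := fun g hg => by
      rw [lint_pt (f := fun z => g z ^ q) (hg.pow_const q), mixI]
      simp [div_self (by linarith : q ≠ 0)]
    rw [e _ hg, e _ (MC_meas g)]
    exact MC_strong1 hq hg
  · refine ⟨hlC (hK d) p + 1, by simp [hlC_ne_top hK_ne_top hp], fun g hg => ?_⟩
    rcases eq_or_ne (mixI q p g) ⊤ with h1 | h1
    · rw [h1, ENNReal.mul_top (by simp)]; exact le_top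
    · exact (MC_mixed_lt hp h hg h1).trans (by gcongr; exact le_self_add)
end

section
variable {X : Type*} [MeasurableSpace X] {κ : Type} [Countable κ]

structure DTree (μ : Measure X) (P : ℕ → Set (Set X)) (K : ℕ) (κ : Type) : Prop where
  meas : ∀ n, ∀ Q ∈ P n, MeasurableSet Q
  fin : ∀ n, ∀ Q ∈ P n, μ Q ≠ ⊤
  ne : ∀ n, ∀ Q ∈ P n, μ Q ≠ 0
  ch : ∀ n, ∀ Q ∈ P (n + 1), ∃ f : κ → Set X, (∀ k, f k ∈ P n ∧ K * μ (f k) = μ Q) ∧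
    Pairwise (Function.onFun Disjoint f) ∧ ⋃ k, f k = Q

variable {μ : Measure X} {P : ℕ → Set (Set X)} {K : ℕ}

lemma fs_pairing (hP : DTree μ P K κ) (hK : 1 ≤ K) {g : X → ℝ} (hg : Measurable g)
    {h Θ Ψ : X → ℝ≥0∞} (hh : Measurable h)
    {c : Set X → ℝ} {θ : Set X → ℝ≥0∞} {η : ℝ≥0∞} (hη : η ≠ 0)
    (hc : ∀ n, ∀ Q ∈ P n, ∀ b, ENNReal.ofReal |c Q - b| * μ Q ≤ ∫⁻ z in Q, ENNReal.ofReal |g z - b| ∂μ)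
    (hθ1 : ∀ n, ∀ Q ∈ P n, ∫⁻ z in Q, ENNReal.ofReal |g z - c Q| ∂μ ≤ θ Q * μ Q)
    (hθ2 : ∀ n, ∀ Q ∈ P n, η ≤ θ Q) (hθ3 : ∀ n, ∀ Q ∈ P n, θ Q ≠ ⊤)
    (hθ4 : ∀ n, ∀ Q ∈ P n, ∀ z ∈ Q, θ Q ≤ Θ z)
    (hleaf : ∀ Q ∈ P 0, ∀ z ∈ Q, ENNReal.ofReal |g z - c Q| ≤ η)
    (hΨ : ∀ n, ∀ Q ∈ P n, ∀ z ∈ Q, ∫⁻ w in Q, h w ∂μ ≤ Ψ z * μ Q)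
    (n : ℕ) (Q : Set X) (hQ : Q ∈ P n) :
    ∫⁻ z in Q, ENNReal.ofReal |g z - c Q| * h z ∂μ ≤ 8 * K * ∫⁻ z in Q, Θ z * Ψ z ∂μ := by
  have hK' : (1 : ℝ≥0∞) ≤ K := by exact_mod_cast hK
  have mD : ∀ b, Measurable fun z => ENNReal.ofReal |g z - b| := fun b => by fun_prop
  have tri : ∀ b c' z, ENNReal.ofReal |g z - b| ≤ ENNReal.ofReal |g z - c'| + ENNReal.ofReal |c' - b| := by
    intro b c' z
    rw [← ENNReal.ofReal_add (abs_nonneg _) (abs_nonneg _)]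
    exact ENNReal.ofReal_le_ofReal (abs_sub_le _ _ _)
  -- J' at level n
  let J' : ℕ → Prop := fun n => ∀ Q ∈ P n, ∀ b : ℝ, ∀ T : ℝ≥0∞, η ≤ T → T ≠ ⊤ →
    ∫⁻ z in Q, ENNReal.ofReal |g z - b| ∂μ ≤ T * μ Q → ∃ U ⊆ Q, MeasurableSet U ∧
      T * μ U ≤ ∫⁻ z in Q, ENNReal.ofReal |g z - b| ∂μ ∧
      ∫⁻ z in Q, ENNReal.ofReal |g z - b| * h z ∂μ ≤
        8 * K * ∫⁻ z in U, Θ z * Ψ z ∂μ + 2 * K * T * ∫⁻ z in Q, h z ∂μ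
  let E : ℕ → Prop := fun n => ∀ Q ∈ P n,
    ∫⁻ z in Q, ENNReal.ofReal |g z - c Q| * h z ∂μ ≤ 8 * K * ∫⁻ z in Q, Θ z * Ψ z ∂μ
  have hE : ∀ n, J' n → E n := by
    intro n hJ Q hQ
    have hη1 := hθ2 n Q hQ
    have hfin := hθ3 n Q hQ
    have hne : θ Q ≠ 0 := fun h0 => hη (le_zero_iff.1 (h0 ▸ hη1))
    have h12 : θ Q ≤ 2 * θ Q := by rw [two_mul]; exact le_self_add
    obtain ⟨U, hU, mU, h1, h2⟩ := hJ Q hQ (c Q) (2 * θ Q) (hη1.trans h12)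
      (ENNReal.mul_ne_top (by simp) hfin)
      ((hθ1 n Q hQ).trans (mul_le_mul' h12 le_rfl))
    have hQm := hP.meas n Q hQ
    have hQf := hP.fin n Q hQ
    have hUf : μ U ≠ ⊤ := ne_top_of_le_ne_top hQf (measure_mono hU)
    have hhalf : μ Q ≤ 2 * μ (Q \ U) := by
      have h3 : θ Q * (2 * μ U) ≤ θ Q * μ Q := by
        calc _ = 2 * θ Q * μ U := by ring
          _ ≤ _ := h1.trans (hθ1 n Q hQ)
      have h4 : 2 * μ U ≤ μ Q := (ENNReal.mul_le_mul_iff_right hne hfin).1 h3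
      have h5 : μ Q = μ U + μ (Q \ U) := by
        rw [← measure_union disjoint_sdiff_right (hQm.diff mU), union_sdiff_cancel hU]
      have h6 : μ U ≤ μ (Q \ U) := by
        rw [h5, two_mul] at h4
        exact (ENNReal.add_le_add_iff_left hUf).1 h4
      rw [h5, two_mul]; gcongr
    have hw : θ Q * ∫⁻ z in Q, h z ∂μ ≤ 2 * ∫⁻ z in Q \ U, Θ z * Ψ z ∂μ := by
      have hm : ∀ z ∈ Q, θ Q * ((μ Q)⁻¹ * ∫⁻ z in Q, h z ∂μ) ≤ Θ z * Ψ z := by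
        intro z hz
        refine mul_le_mul' (hθ4 n Q hQ z hz) ?_
        rw [mul_comm, ← div_eq_mul_inv]
        exact ENNReal.div_le_of_le_mul (hΨ n Q hQ z hz)
      calc θ Q * ∫⁻ z in Q, h z ∂μ = θ Q * ((μ Q)⁻¹ * ∫⁻ z in Q, h z ∂μ) * μ Q := by
            rw [mul_assoc, mul_comm _ (μ Q), ← mul_assoc (μ Q), ENNReal.mul_inv_cancel (hP.ne n Q hQ) hQf,
              one_mul]
        _ ≤ θ Q * ((μ Q)⁻¹ * ∫⁻ z in Q, h z ∂μ) * (2 * μ (Q \ U)) := by gcongr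
        _ = 2 * ∫⁻ z in Q \ U, θ Q * ((μ Q)⁻¹ * ∫⁻ z in Q, h z ∂μ) ∂μ := by
            rw [setLIntegral_const]; ring
        _ ≤ _ := by
            refine mul_le_mul' le_rfl (setLIntegral_mono' (hQm.diff mU) fun z hz => hm z hz.1)
    calc _ ≤ _ := h2
      _ = 8 * K * ∫⁻ z in U, Θ z * Ψ z ∂μ + 4 * K * (θ Q * ∫⁻ z in Q, h z ∂μ) := by ring
      _ ≤ 8 * K * ∫⁻ z in U, Θ z * Ψ z ∂μ + 4 * K * (2 * ∫⁻ z in Q \ U, Θ z * Ψ z ∂μ) := by gcongr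
      _ = 8 * K * (∫⁻ z in U, Θ z * Ψ z ∂μ + ∫⁻ z in Q \ U, Θ z * Ψ z ∂μ) := by ring
      _ = _ := by
        rw [← lintegral_union (hQm.diff mU) disjoint_sdiff_right, union_sdiff_cancel hU]
  have hJ0 : J' 0 := by
    intro Q hQ b T hT hTf hb
    refine ⟨∅, empty_subset _, MeasurableSet.empty, by simp, ?_⟩
    have hQm := hP.meas 0 Q hQ
    have hcb : ENNReal.ofReal |c Q - b| ≤ T :=
      (ENNReal.mul_le_mul_iff_left (hP.ne 0 Q hQ) (hP.fin 0 Q hQ)).1 ((hc 0 Q hQ b).trans hb)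
    simp only [setLIntegral_empty, mul_zero, zero_add]
    rw [← lintegral_const_mul _ hh]
    refine setLIntegral_mono' hQm fun z hz => mul_le_mul' ?_ le_rfl
    calc _ ≤ _ := tri b (c Q) z
      _ ≤ T + T := add_le_add ((hleaf Q hQ z hz).trans hT) hcb
      _ = 2 * 1 * T := by ring
      _ ≤ _ := by gcongr
  have hS : ∀ n, J' n → J' (n + 1) := by
    intro n hJ Q hQ b T hT hTf hb
    obtain ⟨f, hf, hd, hu⟩ := hP.ch n Q hQ
    have key : ∀ k, ∃ U ⊆ f k, MeasurableSet U ∧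
      T * μ U ≤ ∫⁻ z in f k, ENNReal.ofReal |g z - b| ∂μ ∧
      ∫⁻ z in f k, ENNReal.ofReal |g z - b| * h z ∂μ ≤
        8 * K * ∫⁻ z in U, Θ z * Ψ z ∂μ + 2 * K * T * ∫⁻ z in f k, h z ∂μ := by
      intro k
      have hk := (hf k).1
      by_cases hs : ∫⁻ z in f k, ENNReal.ofReal |g z - b| ∂μ ≤ T * μ (f k)
      · exact hJ (f k) hk b T hT hTf hs
      · refine ⟨f k, Subset.rfl, hP.meas n _ hk, (not_le.1 hs).le, ?_⟩
        have hcb : ENNReal.ofReal |c (f k) - b| ≤ K * T := by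
          refine (ENNReal.mul_le_mul_iff_left (hP.ne n _ hk) (hP.fin n _ hk)).1 ?_
          calc _ ≤ _ := hc n _ hk b
            _ ≤ ∫⁻ z in Q, ENNReal.ofReal |g z - b| ∂μ :=
              lintegral_mono_set (hu ▸ subset_iUnion f k)
            _ ≤ T * μ Q := hb
            _ = _ := by rw [← (hf k).2]; ring
        calc _ ≤ ∫⁻ z in f k, (ENNReal.ofReal |g z - c (f k)| * h z + ENNReal.ofReal |c (f k) - b| * h z) ∂μ := by
              refine lintegral_mono fun z => ?_
              rw [← add_mul]; exact mul_le_mul' (tri _ _ _) le_rfl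
          _ = ∫⁻ z in f k, ENNReal.ofReal |g z - c (f k)| * h z ∂μ +
              ENNReal.ofReal |c (f k) - b| * ∫⁻ z in f k, h z ∂μ := by
              have hm : Measurable fun z => ENNReal.ofReal |g z - c (f k)| * h z := (mD _).mul hh
              rw [lintegral_add_left hm, lintegral_const_mul _ hh]
          _ ≤ 8 * K * ∫⁻ z in f k, Θ z * Ψ z ∂μ + (2 * K * T) * ∫⁻ z in f k, h z ∂μ := by
              refine add_le_add (hE n hJ _ hk) (mul_le_mul' (hcb.trans ?_) le_rfl)
              rw [mul_assoc, two_mul]; exact le_self_add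
    choose U hU mU h1 h2 using key
    have hdU : Pairwise (Function.onFun Disjoint U) := fun i j hij =>
      (hd hij).mono (hU i) (hU j)
    have mf : ∀ k, MeasurableSet (f k) := fun k => hP.meas n _ (hf k).1
    refine ⟨⋃ k, U k, ?_, MeasurableSet.iUnion mU, ?_, ?_⟩
    · rw [← hu]; exact iUnion_mono hU
    · rw [measure_iUnion hdU mU, ← hu, lintegral_iUnion mf hd, ← ENNReal.tsum_mul_left]
      exact ENNReal.tsum_le_tsum h1
    · rw [← hu, lintegral_iUnion mf hd, lintegral_iUnion mf hd, lintegral_iUnion mU hdU,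
        ← ENNReal.tsum_mul_left, ← ENNReal.tsum_mul_left, ← ENNReal.tsum_add]
      exact ENNReal.tsum_le_tsum h2
  have hJ : ∀ n, J' n := fun n => Nat.rec hJ0 (fun n ih => hS n ih) n
  exact hE n (hJ n) Q hQ
end

section
variable {d : ℕ}
def dbox (τ : ℝ) (y : Fin d → ℝ) (l : ℝ) : Set (Pt d) :=
  Ico τ (τ + l ^ 2) ×ˢ {x : Spc d | ∀ i, x i ∈ Ico (y i) (y i + l)}

lemma qbox_vol (y : Fin d → ℝ) (l : ℝ) :
    volume {x : Spc d | ∀ i, x i ∈ Ico (y i) (y i + l)} = ENNReal.ofReal l ^ d := by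
  have e : {x : Spc d | ∀ i, x i ∈ Ico (y i) (y i + l)} =
      (MeasurableEquiv.toLp 2 (Fin d → ℝ)).symm ⁻¹' (Set.pi univ fun i => Ico (y i) (y i + l)) := by
    ext x; simp [Set.mem_pi]
  rw [e, (EuclideanSpace.volume_preserving_symm_measurableEquiv_toLp (Fin d)).measure_preimage
    (MeasurableSet.univ_pi fun i => measurableSet_Ico).nullMeasurableSet, Real.volume_pi_Ico]
  simp

lemma qbox_meas (y : Fin d → ℝ) (l : ℝ) :
    MeasurableSet {x : Spc d | ∀ i, x i ∈ Ico (y i) (y i + l)} := by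
  have e : {x : Spc d | ∀ i, x i ∈ Ico (y i) (y i + l)} = ⋂ i, (fun x : Spc d => x i) ⁻¹' Ico (y i) (y i + l) := by
    ext; simp
  rw [e]
  exact MeasurableSet.iInter fun i => (by fun_prop : Measurable fun x : Spc d => x i) measurableSet_Ico

lemma dbox_meas (τ : ℝ) (y : Fin d → ℝ) (l : ℝ) : MeasurableSet (dbox τ y l) :=
  measurableSet_Ico.prod (qbox_meas y l)

lemma dbox_vol (τ : ℝ) (y : Fin d → ℝ) {l : ℝ} (hl : 0 < l) :
    volume (dbox τ y l) = ENNReal.ofReal l ^ (d + 2) := by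
  rw [dbox, Measure.volume_eq_prod, Measure.prod_prod, qbox_vol, Real.volume_Ico, add_sub_cancel_left,
    ENNReal.ofReal_pow hl.le]; ring

abbrev DK (d : ℕ) := Fin 4 × (Fin d → Fin 2)

lemma dbox_tree (Q0 : Set (Pt d)) {l : ℝ} (hl : 0 < l) :
    DTree (volume : Measure (Pt d)) (fun n => {Q | Q ⊆ Q0 ∧ ∃ τ y, Q = dbox τ y (2 ^ n * l)})
      (4 * 2 ^ d) (DK d) where
  meas n Q hQ := by obtain ⟨-, τ, y, rfl⟩ := hQ; exact dbox_meas _ _ _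
  fin n Q hQ := by
    obtain ⟨-, τ, y, rfl⟩ := hQ
    rw [dbox_vol _ _ (by positivity)]; exact ENNReal.pow_ne_top ENNReal.ofReal_ne_top
  ne n Q hQ := by
    obtain ⟨-, τ, y, rfl⟩ := hQ
    rw [dbox_vol _ _ (by positivity)]
    refine pow_ne_zero _ ?_
    have : 0 < 2 ^ n * l := by positivity
    simpa using this
  ch n Q hQ := by
    obtain ⟨h0, τ, y, rfl⟩ := hQ
    set r := 2 ^ n * l with hr
    have hr0 : 0 < r := by positivity
    have e2 : (2 : ℝ) ^ (n + 1) * l = 2 * r := by rw [hr]; ring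
    rw [e2] at h0 ⊢
    let f : DK d → Set (Pt d) := fun k =>
      dbox (τ + (k.1 : ℕ) * r ^ 2) (fun i => y i + (k.2 i : ℕ) * r) r
    have hu : ⋃ k, f k = dbox τ y (2 * r) := by
      ext z
      simp only [mem_iUnion, f, dbox, mem_prod, mem_Ico, Set.mem_ofPred_eq]
      constructor
      · rintro ⟨k, ⟨h1, h2⟩, h3⟩
        have hk1 : ((k.1 : ℕ) : ℝ) ≤ 3 := by exact_mod_cast Nat.le_of_lt_succ k.1.2
        have hr2 : 0 < r ^ 2 := by positivity
        refine ⟨⟨by nlinarith [Nat.cast_nonneg (α := ℝ) (k.1 : ℕ)], by nlinarith⟩, fun i => ?_⟩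
        have hk2 : ((k.2 i : ℕ) : ℝ) ≤ 1 := by exact_mod_cast Nat.le_of_lt_succ (k.2 i).2
        have := h3 i
        constructor <;> nlinarith [Nat.cast_nonneg (α := ℝ) (k.2 i : ℕ)]
      · rintro ⟨⟨h1, h2⟩, h3⟩
        have key : ∀ (m : ℕ) (a b s : ℝ), 0 < s → a ≤ b → b < a + (m : ℝ) * s →
            ∃ k : Fin m, a + (k : ℕ) * s ≤ b ∧ b < a + (k : ℕ) * s + s := by
          intro m a b s hs hab hb
          have h5 : 0 ≤ (b - a) / s := div_nonneg (by linarith) hs.le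
          have h6 : (b - a) / s < m := by rw [div_lt_iff₀ hs]; linarith
          refine ⟨⟨⌊(b - a) / s⌋₊, (Nat.floor_lt h5).2 h6⟩, ?_, ?_⟩
          · have := Nat.floor_le h5
            rw [le_div_iff₀ hs] at this
            simp only; linarith
          · have := Nat.lt_floor_add_one ((b - a) / s)
            rw [div_lt_iff₀ hs] at this
            simp only; linarith
        obtain ⟨k1, hk1⟩ := key 4 τ z.1 (r ^ 2) (by positivity) h1 (by push_cast; linarith)
        have : ∀ i, ∃ k : Fin 2, y i + (k : ℕ) * r ≤ z.2 i ∧ z.2 i < y i + (k : ℕ) * r + r :=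
          fun i => key 2 (y i) (z.2 i) r hr0 (h3 i).1 (by push_cast; linarith [(h3 i).2])
        choose k2 hk2 using this
        exact ⟨(k1, k2), hk1, hk2⟩
    refine ⟨f, fun k => ⟨⟨?_, _, _, rfl⟩, ?_⟩, ?_, hu⟩
    · exact (subset_iUnion f k).trans (hu ▸ h0)
    · rw [dbox_vol _ _ hr0, dbox_vol _ _ (by positivity),
        ENNReal.ofReal_mul (p := 2) (q := r) (by norm_num), ENNReal.ofReal_ofNat]
      push_cast; ring
    · have key : ∀ (k k' : ℕ) (a b s : ℝ), 0 < s → a + k * s ≤ b → b < a + k' * s + s → k ≤ k' := by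
        intro k k' a b s hs h1 h2
        have : (k : ℝ) < k' + 1 := by
          by_contra h; push Not at h
          nlinarith
        exact Nat.lt_succ_iff.1 (by exact_mod_cast this)
      intro k k' hkk
      rw [Function.onFun, Set.disjoint_left]
      rintro z ⟨h1, h2⟩ ⟨h3, h4⟩
      refine hkk (Prod.ext (Fin.ext (le_antisymm ?_ ?_)) (funext fun i => Fin.ext (le_antisymm ?_ ?_)))
      · exact key _ _ τ z.1 (r ^ 2) (by positivity) h1.1 h3.2
      · exact key _ _ τ z.1 (r ^ 2) (by positivity) h3.1 h1.2
      · exact key _ _ (y i) (z.2 i) r hr0 (h2 i).1 (h4 i).2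
      · exact key _ _ (y i) (z.2 i) r hr0 (h4 i).1 (h2 i).2
end

section
variable {d : ℕ}

def mixn (q p : ℝ) (g : Pt d → ℝ≥0∞) : ℝ≥0∞ := mixI q p g ^ (1 / p)

lemma mixI_mono {q p : ℝ} (hq : 0 ≤ q) (hp : 0 ≤ p) {f g : Pt d → ℝ≥0∞} (h : ∀ z, f z ≤ g z) :
    mixI q p f ≤ mixI q p g := by
  refine lintegral_mono fun x => ENNReal.rpow_le_rpow (lintegral_mono fun t => ?_) (by positivity)
  exact ENNReal.rpow_le_rpow (h _) hq

lemma mixn_mono {q p : ℝ} (hq : 0 ≤ q) (hp : 0 ≤ p) {f g : Pt d → ℝ≥0∞} (h : ∀ z, f z ≤ g z) :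
    mixn q p f ≤ mixn q p g :=
  ENNReal.rpow_le_rpow (mixI_mono hq hp h) (by positivity)

lemma sl_meas {g : Pt d → ℝ≥0∞} (hg : Measurable g) (x : Spc d) : Measurable fun t => g (t, x) :=
  hg.comp measurable_prodMk_right

lemma mixn_eq {q p : ℝ} (_ : 0 < q) (g : Pt d → ℝ≥0∞) :
    mixn q p g = (∫⁻ x, ((∫⁻ t, g (t, x) ^ q) ^ (1 / q)) ^ p) ^ (1 / p) := by
  simp only [mixn, mixI]; congr 2; ext x
  rw [← ENNReal.rpow_mul]; congr 1; ring

lemma mixn_add {q p : ℝ} (hq : 1 ≤ q) (hp : 1 ≤ p) {f g : Pt d → ℝ≥0∞} (hf : Measurable f)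
    (hg : Measurable g) : mixn q p (fun z => f z + g z) ≤ mixn q p f + mixn q p g := by
  have hq0 : 0 < q := by linarith
  rw [mixn_eq hq0, mixn_eq hq0, mixn_eq hq0]
  refine le_trans ?_ (ENNReal.lintegral_Lp_add_le ((meas_inner hf q).pow_const _).aemeasurable
    ((meas_inner hg q).pow_const _).aemeasurable hp)
  refine ENNReal.rpow_le_rpow (lintegral_mono fun x => ENNReal.rpow_le_rpow ?_ (by linarith))
    (by positivity)
  exact ENNReal.lintegral_Lp_add_le (sl_meas hf x).aemeasurable (sl_meas hg x).aemeasurable hq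

lemma mixn_smul {q p : ℝ} (hq : 0 < q) (hp : 0 < p) (c : ℝ≥0∞) {g : Pt d → ℝ≥0∞}
    (hg : Measurable g) : mixn q p (fun z => c * g z) = c * mixn q p g := by
  rw [mixn_eq hq, mixn_eq hq]
  have : ∀ x, (∫⁻ t, (c * g (t, x)) ^ q) ^ (1 / q) = c * (∫⁻ t, g (t, x) ^ q) ^ (1 / q) := by
    intro x
    simp_rw [ENNReal.mul_rpow_of_nonneg _ _ hq.le]
    rw [lintegral_const_mul _ ((sl_meas hg x).pow_const q), ENNReal.mul_rpow_of_nonneg _ _ (by positivity),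
      ← ENNReal.rpow_mul, mul_one_div_cancel hq.ne', ENNReal.rpow_one]
  simp_rw [this, ENNReal.mul_rpow_of_nonneg _ _ hp.le]
  rw [lintegral_const_mul _ (((meas_inner hg q).pow_const _).pow_const _),
    ENNReal.mul_rpow_of_nonneg _ _ (by positivity),
    ← ENNReal.rpow_mul, mul_one_div_cancel hp.ne', ENNReal.rpow_one]

lemma mixn_holder {q p q' p' : ℝ} (hq : q.HolderConjugate q') (hp : p.HolderConjugate p')
    {f g : Pt d → ℝ≥0∞} (hf : Measurable f) (hg : Measurable g) :
    ∫⁻ z, f z * g z ≤ mixn q p f * mixn q' p' g := by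
  rw [lint_pt (f := fun z => f z * g z) (hf.mul hg), mixn_eq hq.pos, mixn_eq hq.symm.pos]
  refine le_trans (lintegral_mono fun x => ?_) (ENNReal.lintegral_mul_le_Lp_mul_Lq volume hp
    ((meas_inner hf q).pow_const _).aemeasurable ((meas_inner hg q').pow_const _).aemeasurable)
  exact ENNReal.lintegral_mul_le_Lp_mul_Lq volume hq (sl_meas hf x).aemeasurable
    (sl_meas hg x).aemeasurable

def cylE (q p R t : ℝ) (x : Spc d) (f : Pt d → ℝ≥0∞) : ℝ≥0∞ :=
  ((volume (ball x R))⁻¹ * ∫⁻ y in ball x R,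
      ((volume (Ioo t (t + R ^ 2)))⁻¹ * ∫⁻ s in Ioo t (t + R ^ 2), f (s, y) ^ q) ^ (p / q)) ^ (1 / p)

def morE (q p β : ℝ) (g : Pt d → ℝ≥0∞) : ℝ≥0∞ :=
  ⨆ (ρ : ℝ) (_ : 0 < ρ) (t : ℝ) (x : Spc d), ENNReal.ofReal (ρ ^ β) * cylE q p ρ t x g

lemma morE_eq (q p β : ℝ) (g : Pt d → ℝ) :
    morreyQP q p β g = morE q p β fun z => ENNReal.ofReal |g z| := rfl

def gam (d : ℕ) (q p R : ℝ) : ℝ≥0∞ := volume (ball (0 : Spc d) R) * ENNReal.ofReal (R ^ 2) ^ (p / q)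

lemma gam_ne (q p : ℝ) {R : ℝ} (hR : 0 < R) : gam d q p R ≠ 0 := by
  refine mul_ne_zero (vol_ball_ne _ hR) ?_
  exact (ENNReal.rpow_pos (by simp; positivity) (by simp)).ne'

lemma gam_fin {q p R : ℝ} (hpq : 0 ≤ p / q) : gam d q p R ≠ ⊤ :=
  ENNReal.mul_ne_top measure_ball_lt_top.ne (ENNReal.rpow_ne_top_of_nonneg hpq (by simp))

lemma gam_mul {q p m : ℝ} (hpq : 0 ≤ p / q) (hm : 0 < m) (R : ℝ) :
    gam d q p (m * R) = ENNReal.ofReal m ^ d * ENNReal.ofReal (m ^ 2) ^ (p / q) * gam d q p R := by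
  rw [gam, vol_ball_mul 0 0 hm, mul_pow, ENNReal.ofReal_mul (by positivity),
    ENNReal.mul_rpow_of_nonneg _ _ hpq, gam]; ring

lemma ind_pow {q : ℝ} (hq : 0 < q) (S : Set (Pt d)) (f : Pt d → ℝ≥0∞) (z) :
    S.indicator f z ^ q = S.indicator (fun z => f z ^ q) z := by
  by_cases h : z ∈ S <;> simp [h, hq]

lemma cylE_eq {q p : ℝ} (hq : 0 < q) (hp : 0 < p) {R : ℝ} (hR : 0 < R) (t : ℝ) (x : Spc d)
    (f : Pt d → ℝ≥0∞) :
    mixn q p ((cyl d R t x).indicator f) = gam d q p R ^ (1 / p) * cylE q p R t x f := by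
  have hpq : 0 < p / q := by positivity
  have hv : volume (ball x R) = volume (ball (0 : Spc d) R) := Measure.addHaar_ball_center _ _ _
  have e1 : ∀ y, (∫⁻ s, (cyl d R t x).indicator f (s, y) ^ q) ^ (p / q) =
      (ball x R).indicator (fun y => (∫⁻ s in Ioo t (t + R ^ 2), f (s, y) ^ q) ^ (p / q)) y := by
    intro y
    simp_rw [ind_pow hq]
    by_cases hy : y ∈ ball x R
    · rw [indicator_of_mem hy, ← lintegral_indicator measurableSet_Ioo]
      congr 2; ext s
      by_cases hs : s ∈ Ioo t (t + R ^ 2)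
      · rw [indicator_of_mem hs, indicator_of_mem (show (s, y) ∈ cyl d R t x from ⟨hs, hy⟩)]
      · rw [indicator_of_notMem hs, indicator_of_notMem fun h => hs h.1]
    · rw [indicator_of_notMem hy]
      have : ∀ s, (cyl d R t x).indicator (fun z => f z ^ q) (s, y) = 0 := fun s =>
        indicator_of_notMem (fun h => hy h.2) _
      simp [this, hpq]
  have hI : volume (Ioo t (t + R ^ 2)) = ENNReal.ofReal (R ^ 2) := by simp
  have hI0 : ENNReal.ofReal (R ^ 2) ≠ 0 := by simp; positivity
  rw [mixn, mixI, cylE, ← ENNReal.mul_rpow_of_nonneg _ _ (by positivity)]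
  simp_rw [e1, ENNReal.mul_rpow_of_nonneg _ _ hpq.le]
  rw [lintegral_indicator measurableSet_ball, lintegral_const_mul' _ _ (ENNReal.rpow_ne_top_of_nonneg hpq.le
    (by rw [hI]; simpa using hR.ne')), gam, hv, hI]
  congr 1
  rw [ENNReal.inv_rpow]
  set A := volume (ball (0 : Spc d) R)
  set B := ENNReal.ofReal (R ^ 2) ^ (p / q)
  have hA0 : A ≠ 0 := vol_ball_ne _ hR
  have hA1 : A ≠ ⊤ := measure_ball_lt_top.ne
  have hB0 : B ≠ 0 := by
    have := gam_ne (d := d) q p hR; exact right_ne_zero_of_mul this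
  have hB1 : B ≠ ⊤ := ENNReal.rpow_ne_top_of_nonneg hpq.le (by simp)
  calc _ = (A * A⁻¹) * (B * B⁻¹) * (∫⁻ y in ball x R, (∫⁻ s in Ioo t (t + R ^ 2), f (s, y) ^ q) ^ (p / q)) := by
        rw [ENNReal.mul_inv_cancel hA0 hA1, ENNReal.mul_inv_cancel hB0 hB1]; simp
    _ = _ := by ring

lemma cylE_mono {q p : ℝ} (hq : 0 < q) (hp : 0 < p) (R t : ℝ) (x : Spc d)
    {f g : Pt d → ℝ≥0∞} (h : ∀ z ∈ cyl d R t x, f z ≤ g z) : cylE q p R t x f ≤ cylE q p R t x g := by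
  refine ENNReal.rpow_le_rpow (mul_le_mul' le_rfl (setLIntegral_mono' measurableSet_ball fun y hy =>
    ENNReal.rpow_le_rpow (mul_le_mul' le_rfl (setLIntegral_mono' measurableSet_Ioo fun s hs =>
      ENNReal.rpow_le_rpow (h _ ⟨hs, hy⟩) hq.le)) (by positivity))) (by positivity)

lemma cylE_add {q p : ℝ} (hq : 1 ≤ q) (hp : 1 ≤ p) {R : ℝ} (hR : 0 < R) (t : ℝ) (x : Spc d)
    {f g : Pt d → ℝ≥0∞} (hf : Measurable f) (hg : Measurable g) :
    cylE q p R t x (fun z => f z + g z) ≤ cylE q p R t x f + cylE q p R t x g := by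
  have hq0 : 0 < q := by linarith
  have hp0 : 0 < p := by linarith
  have h0 : gam d q p R ^ (1 / p) ≠ 0 := (ENNReal.rpow_pos (pos_iff_ne_zero.2 (gam_ne q p hR))
    (gam_fin (by positivity))).ne'
  have h1 : gam d q p R ^ (1 / p) ≠ ⊤ :=
    ENNReal.rpow_ne_top_of_nonneg (by positivity) (gam_fin (by positivity))
  refine (ENNReal.mul_le_mul_iff_right h0 h1).1 ?_
  rw [mul_add, ← cylE_eq hq0 hp0 hR, ← cylE_eq hq0 hp0 hR, ← cylE_eq hq0 hp0 hR]
  refine le_trans (le_of_eq ?_) (mixn_add hq hp (hf.indicator (cyl_meas x t R)) (hg.indicator (cyl_meas x t R)))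
  congr 1; ext z
  by_cases hz : z ∈ cyl d R t x <;> simp [hz]

lemma cylE_smul {q p : ℝ} (hq : 0 < q) (hp : 0 < p) {R : ℝ} (hR : 0 < R) (t : ℝ) (x : Spc d) (c : ℝ≥0∞)
    {f : Pt d → ℝ≥0∞} (hf : Measurable f) :
    cylE q p R t x (fun z => c * f z) = c * cylE q p R t x f := by
  have h0 : gam d q p R ^ (1 / p) ≠ 0 := (ENNReal.rpow_pos (pos_iff_ne_zero.2 (gam_ne q p hR))
    (gam_fin (by positivity))).ne'
  have h1 : gam d q p R ^ (1 / p) ≠ ⊤ :=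
    ENNReal.rpow_ne_top_of_nonneg (by positivity) (gam_fin (by positivity))
  refine (ENNReal.mul_right_inj h0 h1).1 ?_
  rw [mul_left_comm, ← cylE_eq hq hp hR, ← cylE_eq hq hp hR, ← mixn_smul hq hp _ (hf.indicator (cyl_meas x t R))]
  congr 1; ext z
  by_cases hz : z ∈ cyl d R t x <;> simp [hz]

lemma cylE_const {q p : ℝ} (hq : 0 < q) (hp : 0 < p) {R : ℝ} (hR : 0 < R) (t : ℝ) (x : Spc d) (c : ℝ≥0∞) :
    cylE q p R t x (fun _ => c) = c := by
  have h1 : ∀ c : ℝ≥0∞, (volume (ball x R))⁻¹ * (c * volume (ball x R)) = c := fun c => by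
    rw [mul_left_comm, ENNReal.inv_mul_cancel (vol_ball_ne _ hR) measure_ball_lt_top.ne, mul_one]
  have h2 : ∀ c : ℝ≥0∞, (ENNReal.ofReal (R ^ 2))⁻¹ * (c * ENNReal.ofReal (R ^ 2)) = c := fun c => by
    rw [mul_left_comm, ENNReal.inv_mul_cancel (by simp; positivity) (by simp), mul_one]
  simp only [cylE, setLIntegral_const, Real.volume_Ioo, add_sub_cancel_left]
  rw [h2, h1, ← ENNReal.rpow_mul, ← ENNReal.rpow_mul]
  rw [show q * (p / q * (1 / p)) = 1 by field_simp]; simp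

lemma avg_pow {X : Type*} [MeasurableSpace X] {μ : Measure X} {S : Set X} (h0 : μ S ≠ 0) (h1 : μ S ≠ ⊤)
    {a : ℝ} (ha : 0 ≤ a) (ha1 : a ≤ 1) {f : X → ℝ≥0∞} (hf : Measurable f) :
    (μ S)⁻¹ * ∫⁻ z in S, f z ^ a ∂μ ≤ ((μ S)⁻¹ * ∫⁻ z in S, f z ∂μ) ^ a := by
  have h := ENNReal.lintegral_mul_norm_pow_le (μ := μ.restrict S) hf.aemeasurable
    (g := fun _ => 1) aemeasurable_const ha (sub_nonneg.2 ha1) (by ring)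
  simp only [ENNReal.one_rpow, mul_one, lintegral_const, Measure.restrict_apply_univ, one_mul] at h
  calc _ ≤ (μ S)⁻¹ * ((∫⁻ z in S, f z ∂μ) ^ a * μ S ^ (1 - a)) := mul_le_mul' le_rfl h
    _ = _ := by
      rw [ENNReal.mul_rpow_of_nonneg _ _ ha, ENNReal.rpow_sub _ _ h0 h1, ENNReal.rpow_one, ENNReal.inv_rpow,
        div_eq_mul_inv]
      calc _ = ((μ S)⁻¹ * μ S) * ((μ S ^ a)⁻¹ * (∫⁻ z in S, f z ∂μ) ^ a) := by ring
        _ = _ := by rw [ENNReal.inv_mul_cancel h0 h1, one_mul]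

/-- `L_s` average over a cylinder -/
def avS (s R t : ℝ) (x : Spc d) (f : Pt d → ℝ≥0∞) : ℝ≥0∞ :=
  ((volume (cyl d R t x))⁻¹ * ∫⁻ z in cyl d R t x, f z ^ s) ^ (1 / s)

lemma avS_le_cylE {s q p : ℝ} (hs : 0 < s) (hq : s ≤ q) (hp : s ≤ p) {R : ℝ} (hR : 0 < R) (t : ℝ)
    (x : Spc d) {f : Pt d → ℝ≥0∞} (hf : Measurable f) : avS s R t x f ≤ cylE q p R t x f := by
  have hq0 : 0 < q := by linarith
  have hp0 : 0 < p := by linarith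
  have hI0 : volume (Ioo t (t + R ^ 2)) ≠ 0 := by simp; positivity
  have hI1 : volume (Ioo t (t + R ^ 2)) ≠ ⊤ := by simp
  have hB0 := vol_ball_ne x hR
  have hB1 : volume (ball x R) ≠ ⊤ := measure_ball_lt_top.ne
  have hm : Measurable fun y => (volume (Ioo t (t + R ^ 2)))⁻¹ * ∫⁻ σ in Ioo t (t + R ^ 2), f (σ, y) ^ q :=
    (Measurable.lintegral_prod_left' (f := fun z : Pt d => f z ^ q) (hf.pow_const q)).const_mul _
  have key : (volume (cyl d R t x))⁻¹ * ∫⁻ z in cyl d R t x, f z ^ s ≤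
      ((volume (ball x R))⁻¹ * ∫⁻ y in ball x R,
      ((volume (Ioo t (t + R ^ 2)))⁻¹ * ∫⁻ s in Ioo t (t + R ^ 2), f (s, y) ^ q) ^ (p / q)) ^ (s / p) := by
    refine le_trans ?_ (avg_pow hB0 hB1 (by positivity) ((div_le_one hp0).2 hp) (hm.pow_const _))
    have hv : (volume (cyl d R t x))⁻¹ = (volume (ball x R))⁻¹ * (volume (Ioo t (t + R ^ 2)))⁻¹ := by
      rw [vol_cyl, mul_comm, ENNReal.mul_inv (.inl hB0) (.inl hB1)]; simp
    rw [lint_cyl (hf.pow_const s), hv, mul_assoc,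
      ← lintegral_const_mul' _ _ (ENNReal.inv_ne_top.2 hI0)]
    refine mul_le_mul' le_rfl (lintegral_mono fun y => ?_)
    rw [← ENNReal.rpow_mul, show p / q * (s / p) = s / q by field_simp]
    refine le_trans (le_of_eq ?_) (avg_pow hI0 hI1 (by positivity) ((div_le_one hq0).2 hq)
      ((sl_meas hf y).pow_const q))
    congr 1; refine lintegral_congr fun σ => ?_
    rw [← ENNReal.rpow_mul]; congr 1; field_simp
  calc avS s R t x f ≤ _ := ENNReal.rpow_le_rpow key (by positivity)
    _ = _ := by rw [← ENNReal.rpow_mul, show s / p * (1 / s) = 1 / p by field_simp]; rfl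
end

section
variable {d : ℕ}

lemma euc_norm_le (x : Spc d) {r : ℝ} (h : ∀ i, |x i| ≤ r) : ‖x‖ ≤ d * r := by
  have h1 : x = ∑ i, x i • EuclideanSpace.single i (1 : ℝ) := by
    ext j; simp [Pi.single_apply]
  rw [h1]
  refine (norm_sum_le _ _).trans ?_
  calc _ ≤ ∑ _i : Fin d, r := Finset.sum_le_sum fun i _ => by simpa [norm_smul] using h i
    _ = _ := by simp

def bC (d : ℕ) : ℝ≥0∞ := ENNReal.ofReal (d + 2) ^ (d + 2) * volume (cyl d 1 0 0)
lemma bC_fin : bC d ≠ ⊤ := ENNReal.mul_ne_top (ENNReal.pow_ne_top (by simp)) (vol_cyl_fin _ _ _)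

lemma dbox_sub (τ : ℝ) (y : Fin d → ℝ) {l : ℝ} (hl : 0 < l) :
    dbox τ y l ⊆ cyl d ((d + 2) * l) (τ - l ^ 2) (WithLp.toLp 2 y) := by
  rintro z ⟨h1, h2⟩
  have hd : (0 : ℝ) ≤ d := Nat.cast_nonneg d
  have hl2 : 0 < l ^ 2 := by positivity
  refine ⟨⟨by linarith [h1.1], ?_⟩, ?_⟩
  · have := h1.2
    have : 4 * l ^ 2 ≤ ((d + 2) * l) ^ 2 := by rw [mul_pow]; gcongr; nlinarith
    linarith
  · rw [mem_ball, dist_eq_norm]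
    have := euc_norm_le (z.2 - WithLp.toLp 2 y) (r := l) (fun i => by
      have := h2 i; simp only [mem_Ico] at this
      simp only [PiLp.sub_apply]; rw [abs_le]; constructor <;> linarith)
    nlinarith

lemma dbox_cyl_vol (τ τ' : ℝ) (y : Fin d → ℝ) (x : Spc d) {l : ℝ} (hl : 0 < l) :
    volume (cyl d ((d + 2) * l) τ' x) = bC d * volume (dbox τ y l) := by
  have hd : (0 : ℝ) ≤ d := Nat.cast_nonneg d
  have := vol_cyl_mul x 0 τ' 0 (c := (d + 2) * l) (by positivity) 1
  rw [mul_one] at this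
  rw [this, dbox_vol _ _ hl, bC, ENNReal.ofReal_mul (by positivity)]; ring

lemma mean_dev {X : Type*} [MeasurableSpace X] {μ : Measure X} {Q : Set X} (h0 : μ Q ≠ 0) (h1 : μ Q ≠ ⊤)
    {g : X → ℝ} (hg : IntegrableOn g Q μ) (b : ℝ) :
    ENNReal.ofReal |(⨍ z in Q, g z ∂μ) - b| * μ Q ≤ ∫⁻ z in Q, ENNReal.ofReal |g z - b| ∂μ := by
  have hr : 0 < μ.real Q := ENNReal.toReal_pos h0 h1
  have hc : IntegrableOn (fun _ => b) Q μ := integrableOn_const h1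
  have e : ((⨍ z in Q, g z ∂μ) - b) * μ.real Q = ∫ z in Q, (g z - b) ∂μ := by
    rw [setAverage_eq, smul_eq_mul, integral_sub hg hc, setIntegral_const, smul_eq_mul]
    field_simp
  have h2 : |(⨍ z in Q, g z ∂μ) - b| * μ.real Q ≤ ∫ z in Q, |g z - b| ∂μ := by
    rw [show |(⨍ z in Q, g z ∂μ) - b| * μ.real Q = |((⨍ z in Q, g z ∂μ) - b) * μ.real Q| by
      rw [abs_mul, abs_of_pos hr], e]
    exact abs_integral_le_integral_abs
  calc _ = ENNReal.ofReal (|(⨍ z in Q, g z ∂μ) - b| * μ.real Q) := by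
        rw [ENNReal.ofReal_mul (abs_nonneg _), Measure.real, ENNReal.ofReal_toReal h1]
    _ ≤ ENNReal.ofReal (∫ z in Q, |g z - b| ∂μ) := ENNReal.ofReal_le_ofReal h2
    _ = _ := ofReal_integral_eq_lintegral_ofReal (hg.sub hc).abs (.of_forall fun _ => abs_nonneg _)

lemma tri_int {X : Type*} [MeasurableSpace X] {μ : Measure X} {Q : Set X} 
    (g : X → ℝ) (b c : ℝ) :
    ∫⁻ z in Q, ENNReal.ofReal |g z - c| ∂μ ≤ ∫⁻ z in Q, ENNReal.ofReal |g z - b| ∂μ +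
      ENNReal.ofReal |c - b| * μ Q := by
  calc _ ≤ ∫⁻ z in Q, (ENNReal.ofReal |g z - b| + ENNReal.ofReal |c - b|) ∂μ := by
        refine lintegral_mono fun z => ?_
        rw [← ENNReal.ofReal_add (abs_nonneg _) (abs_nonneg _)]
        refine ENNReal.ofReal_le_ofReal ?_
        rw [abs_sub_comm c b]; exact abs_sub_le _ _ _
    _ = _ := by rw [lintegral_add_right _ measurable_const, setLIntegral_const]

/-- oscillation hypothesis -/
def OSC (κ s : ℝ) (g : Pt d → ℝ) (F : Pt d → ℝ≥0∞) : Prop :=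
  ∀ R, 0 < R → ∀ t x, ∃ c : ℝ, (volume (cyl d R t x))⁻¹ * ∫⁻ z in cyl d R t x, ENNReal.ofReal |g z - c| ≤
    avS s (κ * R) (t - (κ * R) ^ 2 / 2) x F

lemma cylE_le_mor (q p β : ℝ) {R : ℝ} (hR : 0 < R) (t : ℝ) (x : Spc d) (F : Pt d → ℝ≥0∞) :
    cylE q p R t x F ≤ ENNReal.ofReal (R ^ (-β)) * morE q p β F := by
  have h : ENNReal.ofReal (R ^ β) * cylE q p R t x F ≤ morE q p β F :=
    le_iSup_of_le R (le_iSup_of_le hR (le_iSup_of_le t (le_iSup_of_le x le_rfl)))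
  calc _ = ENNReal.ofReal (R ^ (-β)) * (ENNReal.ofReal (R ^ β) * cylE q p R t x F) := by
        rw [← mul_assoc, ← ENNReal.ofReal_mul (by positivity), ← Real.rpow_add hR]; simp
    _ ≤ _ := mul_le_mul' le_rfl h

lemma osc_pair {q p s β κ : ℝ} (hs : 1 ≤ s) (hsq : s < q) (hsp : s < p) (hβ : 0 ≤ β)
    (hκ : 2 ≤ κ) {g : Pt d → ℝ} (hg : Continuous g) (hgc : HasCompactSupport g) {F : Pt d → ℝ≥0∞}
    (hF : Measurable F) (ho : OSC κ s g F) {R : ℝ} (hR : 0 < R) (t0 : ℝ) (x0 : Spc d)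
    {η : ℝ} (hη : 0 < η) {h : Pt d → ℝ≥0∞} (hh : Measurable h) :
    ∫⁻ z in dbox t0 (fun i => x0 i - R) (2 * R),
      ENNReal.ofReal |g z - ⨍ w in dbox t0 (fun i => x0 i - R) (2 * R), g w| * h z ≤
    8 * (4 * 2 ^ d : ℕ) * ∫⁻ z in dbox t0 (fun i => x0 i - R) (2 * R),
      (ENNReal.ofReal η + 2 * bC d * (ENNReal.ofReal (R ^ (-β)) * morE q p β F) +
        2 * bC d * MC ((cyl d ((d + 4) * R) (t0 - 5 * R ^ 2) x0).indicator fun z => F z ^ s) z ^ (1 / s)) *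
      (bC d * MC h z) := by
  have hd : (0 : ℝ) ≤ d := Nat.cast_nonneg d
  set Q0 := dbox t0 (fun i => x0 i - R) (2 * R) with hQ0
  set V := cyl d ((d + 4) * R) (t0 - 5 * R ^ 2) x0 with hV
  have gi : Integrable g := hg.integrable_of_hasCompactSupport hgc
  -- uniform continuity
  obtain ⟨ε, hε, hu⟩ := Metric.uniformContinuous_iff.1 (hgc.uniformContinuous_of_continuous hg) η hη
  obtain ⟨n, hn⟩ : ∃ n : ℕ, (d + 2) * (2 * R / 2 ^ n) + (2 * R / 2 ^ n) ^ 2 < ε := by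
    have h1 : Filter.Tendsto (fun n : ℕ => 2 * R / (2 : ℝ) ^ n) Filter.atTop (nhds 0) := by
      have := (tendsto_pow_atTop_nhds_zero_of_lt_one (r := (1 / 2 : ℝ)) (by norm_num) (by norm_num)).const_mul (2 * R)
      simpa [div_eq_mul_inv] using this
    have h2 := (h1.const_mul ((d : ℝ) + 2)).add (h1.pow 2)
    simp only [mul_zero, ne_eq, OfNat.ofNat_ne_zero, not_false_eq_true, zero_pow, add_zero] at h2
    exact (h2.eventually (gt_mem_nhds hε)).exists
  set l := 2 * R / 2 ^ n with hl
  have hl0 : 0 < l := by positivity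
  have tree := dbox_tree Q0 hl0
  set P : ℕ → Set (Set (Pt d)) := fun n => {Q | Q ⊆ Q0 ∧ ∃ τ y, Q = dbox τ y (2 ^ n * l)} with hP
  have hmean : ∀ n, ∀ Q ∈ P n, ∀ b, ENNReal.ofReal |(⨍ z in Q, g z) - b| * volume Q ≤
      ∫⁻ z in Q, ENNReal.ofReal |g z - b| := fun n Q hQ b =>
    mean_dev (tree.ne n Q hQ) (tree.fin n Q hQ) gi.integrableOn b
  have mI : ∀ b, Measurable fun z => ENNReal.ofReal |g z - b| := fun b =>
    (hg.measurable.sub_const b).abs.ennreal_ofReal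
  refine fs_pairing tree (Nat.one_le_iff_ne_zero.2 (by positivity)) hg.measurable hh
    (c := fun Q => ⨍ z in Q, g z)
    (θ := fun Q => (volume Q)⁻¹ * (∫⁻ z in Q, ENNReal.ofReal |g z - ⨍ z in Q, g z|) + ENNReal.ofReal η)
    (η := ENNReal.ofReal η) (by simpa using hη) hmean ?_ ?_ ?_ ?_ ?_ ?_ n Q0 ?_
  · intro n Q hQ
    rw [add_mul, mul_right_comm, mul_comm _ (volume Q), ENNReal.mul_inv_cancel (tree.ne n Q hQ) (tree.fin n Q hQ), one_mul]
    exact le_self_add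
  · intro n Q hQ; exact le_add_self
  · intro n Q hQ
    refine ENNReal.add_ne_top.2 ⟨ENNReal.mul_ne_top (ENNReal.inv_ne_top.2 (tree.ne n Q hQ)) ?_, by simp⟩
    have : IntegrableOn (fun z => g z - ⨍ z in Q, g z) Q :=
      gi.integrableOn.sub (integrableOn_const (tree.fin n Q hQ))
    have h2 := this.hasFiniteIntegral
    rw [hasFiniteIntegral_iff_norm] at h2
    exact h2.ne
  · rintro n Q hQ z hz
    have hne := tree.ne n Q hQ
    have hfin := tree.fin n Q hQ
    obtain ⟨hsub, τ, y, hQe⟩ := hQ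
    set r := 2 ^ n * l with hr
    have hr0 : 0 < r := by positivity
    have hcor : (τ, (WithLp.toLp 2 y : Spc d)) ∈ Q0 := by
      refine hsub ?_
      rw [hQe]
      exact ⟨⟨le_rfl, by simp only; nlinarith⟩, fun i => ⟨le_rfl, by simpa using hr0⟩⟩
    set ρ := κ * ((d + 2) * r) with hρ
    have hρ0 : 0 < ρ := by positivity
    obtain ⟨b, hb⟩ := ho ((d + 2) * r) (by positivity) (τ - r ^ 2) (WithLp.toLp 2 y)
    rw [← hρ] at hb
    have hvol := dbox_cyl_vol τ (τ - r ^ 2) y (WithLp.toLp 2 y) hr0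
    rw [← hQe] at hvol
    have hzc : z ∈ cyl d ((d + 2) * r) (τ - r ^ 2) (WithLp.toLp 2 y) := dbox_sub τ y hr0 (hQe ▸ hz)
    have h1 : (volume Q)⁻¹ * ∫⁻ z in Q, ENNReal.ofReal |g z - ⨍ z in Q, g z| ≤
        2 * bC d * avS s ρ (τ - r ^ 2 - ρ ^ 2 / 2) (WithLp.toLp 2 y) F := by
      have h2 : ∫⁻ z in Q, ENNReal.ofReal |g z - ⨍ z in Q, g z| ≤ 2 * ∫⁻ z in Q, ENNReal.ofReal |g z - b| := by
        refine (tri_int g b _).trans ?_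
        rw [two_mul]
        exact add_le_add le_rfl (hmean n Q ⟨hsub, τ, y, hQe⟩ b)
      have h3 : ∫⁻ z in Q, ENNReal.ofReal |g z - b| ≤
          bC d * volume Q * avS s ρ (τ - r ^ 2 - ρ ^ 2 / 2) (WithLp.toLp 2 y) F := by
        rw [← hvol]
        calc _ ≤ ∫⁻ z in cyl d ((d + 2) * r) (τ - r ^ 2) (WithLp.toLp 2 y), ENNReal.ofReal |g z - b| :=
              lintegral_mono_set (hQe ▸ dbox_sub τ y hr0)
          _ ≤ _ := by
              rw [mul_comm (volume _), ← ENNReal.div_le_iff_le_mul (.inl (vol_cyl_ne _ _ (by positivity)))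
                (.inl (vol_cyl_fin _ _ _)), div_eq_mul_inv, mul_comm]
              exact hb
      calc _ ≤ (volume Q)⁻¹ * (2 * (bC d * volume Q * avS s ρ (τ - r ^ 2 - ρ ^ 2 / 2) (WithLp.toLp 2 y) F)) :=
            mul_le_mul' le_rfl (h2.trans (mul_le_mul' le_rfl h3))
        _ = ((volume Q)⁻¹ * volume Q) * (2 * bC d * avS s ρ (τ - r ^ 2 - ρ ^ 2 / 2) (WithLp.toLp 2 y) F) := by ring
        _ = _ := by rw [ENNReal.inv_mul_cancel hne hfin, one_mul]
    rw [add_comm, add_assoc]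
    refine add_le_add le_rfl (h1.trans ?_)
    rcases le_or_gt R ρ with hc | hc
    · refine le_trans (mul_le_mul' le_rfl ?_) le_self_add
      refine (avS_le_cylE (by linarith) hsq.le hsp.le hρ0 _ _ hF).trans
        ((cylE_le_mor q p β hρ0 _ _ F).trans (mul_le_mul' (ENNReal.ofReal_le_ofReal ?_) le_rfl))
      exact Real.rpow_le_rpow_of_nonpos hR hc (by linarith)
    · refine le_trans (mul_le_mul' le_rfl ?_) le_add_self
      refine ENNReal.rpow_le_rpow ?_ (by positivity)
      have hzρ : (r * (d + 2)) * 2 ≤ ρ := by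
        have hp1 : 0 ≤ (κ - 2) * ((d + 2) * r) := mul_nonneg (by linarith) (by positivity)
        rw [hρ]; linarith
      have hr2 : r ≤ R := by nlinarith [mul_nonneg hd hr0.le]
      have hs2 : (2 * ((d + 2) * r)) ^ 2 ≤ ρ ^ 2 := by
        apply pow_le_pow_left₀ (by positivity); linarith
      have hzb : z ∈ cyl d ρ (τ - r ^ 2 - ρ ^ 2 / 2) (WithLp.toLp 2 y) := by
        refine ⟨⟨?_, ?_⟩, ?_⟩
        · have := hzc.1.1; nlinarith
        · have := hzc.1.2; nlinarith
        · have := hzc.2; rw [mem_ball] at this ⊢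
          nlinarith
      have hbV : cyl d ρ (τ - r ^ 2 - ρ ^ 2 / 2) (WithLp.toLp 2 y) ⊆ V := by
        have hρR : ρ ^ 2 ≤ R ^ 2 := pow_le_pow_left₀ hρ0.le hc.le 2
        have hrR : r ^ 2 ≤ R ^ 2 := pow_le_pow_left₀ hr0.le hr2 2
        have hc1 := hcor.1
        simp only [mem_Ico] at hc1
        have hR4 : 16 * R ^ 2 ≤ ((d + 4) * R) ^ 2 := by rw [mul_pow]; gcongr; nlinarith
        rintro w ⟨⟨h5, h6⟩, h7⟩
        refine ⟨⟨?_, ?_⟩, ?_⟩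
        · linarith [sq_nonneg R]
        · nlinarith [sq_nonneg r]
        · rw [mem_ball] at h7 ⊢
          have h8 : dist (WithLp.toLp 2 y : Spc d) x0 ≤ d * R := by
            rw [dist_eq_norm]
            refine euc_norm_le _ fun i => ?_
            have := hcor.2 i
            simp only [mem_Ico] at this
            simp only [PiLp.sub_apply]
            rw [abs_le]; constructor <;> linarith
          have := dist_triangle w.2 (WithLp.toLp 2 y) x0
          nlinarith
      refine le_trans (le_of_eq ?_) (MF_ge (μ := volume) (S := cS)
        (g := V.indicator fun z => F z ^ s)
        (⟨ρ, hρ0⟩, τ - r ^ 2 - ρ ^ 2 / 2, WithLp.toLp 2 y) hzb)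
      simp only [cS]
      congr 1
      refine setLIntegral_congr_fun (cyl_meas _ _ _) fun w hw => ?_
      simp only [indicator_of_mem (hbV hw)]
  · rintro Q ⟨hsub, τ, y, hQe⟩ z hz
    have hQ : Q ∈ P 0 := ⟨hsub, τ, y, hQe⟩
    have h1 : ∀ w ∈ Q, |g w - g z| ≤ η := by
      intro w hw
      rw [hQe, pow_zero, one_mul] at hw hz
      refine (le_of_lt ?_)
      rw [← Real.dist_eq]
      refine hu ?_
      rw [Prod.dist_eq, max_lt_iff]
      have h3 := euc_norm_le (w.2 - z.2) (r := l) (fun i => by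
        have h4 := hz.2 i; have h5 := hw.2 i; simp only [mem_Ico] at h4 h5
        simp only [PiLp.sub_apply]; rw [abs_le]; constructor <;> linarith)
      constructor
      · rw [Real.dist_eq, abs_lt]
        have h4 := hz.1; have h5 := hw.1; simp only [mem_Ico] at h4 h5
        constructor <;> nlinarith
      · rw [dist_eq_norm]; nlinarith
    have h2 := hmean 0 Q hQ (g z)
    have h3 : ∫⁻ w in Q, ENNReal.ofReal |g w - g z| ≤ ENNReal.ofReal η * volume Q := by
      rw [← setLIntegral_const]
      exact setLIntegral_mono' (tree.meas 0 Q hQ) fun w hw => ENNReal.ofReal_le_ofReal (h1 w hw)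
    rw [abs_sub_comm]
    exact (ENNReal.mul_le_mul_iff_left (tree.ne 0 Q hQ) (tree.fin 0 Q hQ)).1 (h2.trans h3)
  · rintro n Q ⟨hsub, τ, y, hQe⟩ z hz
    set r := 2 ^ n * l with hr
    have hr0 : 0 < r := by positivity
    have hvol := dbox_cyl_vol τ (τ - r ^ 2) y (WithLp.toLp 2 y) hr0
    rw [← hQe] at hvol
    have hzc : z ∈ cyl d ((d + 2) * r) (τ - r ^ 2) (WithLp.toLp 2 y) := dbox_sub τ y hr0 (hQe ▸ hz)
    have hp2 : 0 < (d + 2) * r := by positivity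
    calc _ ≤ ∫⁻ w in cyl d ((d + 2) * r) (τ - r ^ 2) (WithLp.toLp 2 y), h w :=
          lintegral_mono_set (hQe ▸ dbox_sub τ y hr0)
      _ ≤ MC h z * volume (cyl d ((d + 2) * r) (τ - r ^ 2) (WithLp.toLp 2 y)) := by
          rw [← ENNReal.div_le_iff_le_mul (.inl (vol_cyl_ne _ _ (by positivity)))
                (.inl (vol_cyl_fin _ _ _)), div_eq_mul_inv, mul_comm]
          exact MF_ge (μ := volume) (S := cS) (⟨_, hp2⟩, τ - r ^ 2, WithLp.toLp 2 y) hzc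
      _ = _ := by rw [hvol]; ring
  · refine ⟨Subset.rfl, t0, fun i => x0 i - R, ?_⟩
    rw [hQ0, hl]; congr 1; field_simp
end

section
variable {d : ℕ}

lemma mix_dual {q p q' p' : ℝ} (hq : q.HolderConjugate q') (hp : p.HolderConjugate p')
    {D : Pt d → ℝ≥0∞} (hD : Measurable D) (hfin : mixI q p D ≠ ⊤) :
    ∃ h : Pt d → ℝ≥0∞, Measurable h ∧ ∫⁻ z, D z * h z = mixI q p D ∧ mixI q' p' h ≤ mixI q p D := by
  have hq0 := hq.pos
  have hp0 := hp.pos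
  have hpq : 0 < p / q := by positivity
  set A : Spc d → ℝ≥0∞ := fun x => ∫⁻ t, D (t, x) ^ q with hA
  have mA : Measurable A := meas_inner hD q
  have hAt : ∀ᵐ x, A x ≠ ⊤ := by
    filter_upwards [ae_lt_top (mA.pow_const (p / q)) hfin] with x hx h
    rw [h, ENNReal.top_rpow_of_pos hpq] at hx; exact lt_irrefl _ hx
  set e := (p - q) / q with he
  have mh : Measurable fun z : Pt d => D z ^ (q - 1) * A z.2 ^ e :=
    (hD.pow_const _).mul ((mA.comp measurable_snd).pow_const _)
  refine ⟨fun z => D z ^ (q - 1) * A z.2 ^ e, mh, ?_, ?_⟩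
  · rw [lint_pt (f := fun z => D z * (D z ^ (q - 1) * A z.2 ^ e)) (hD.mul mh)]
    refine lintegral_congr_ae ?_
    filter_upwards [hAt] with x hx
    have h1 : ∀ t, D (t, x) * (D (t, x) ^ (q - 1) * A x ^ e) = D (t, x) ^ q * A x ^ e := by
      intro t
      rw [← mul_assoc]; congr 1
      have := ENNReal.rpow_add_of_nonneg (x := D (t, x)) 1 (q - 1) (by norm_num) (by linarith [hq.lt])
      rw [ENNReal.rpow_one] at this
      rw [← this]; congr 1; ring
    simp only [h1]
    rw [lintegral_mul_const _ ((sl_meas hD x).pow_const q)]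
    change A x * A x ^ e = A x ^ (p / q)
    rcases eq_or_ne (A x) 0 with h0 | h0
    · rw [h0, zero_mul, ENNReal.zero_rpow_of_pos hpq]
    · nth_rewrite 1 [← ENNReal.rpow_one (A x)]
      rw [← ENNReal.rpow_add _ _ h0 hx]; congr 1; rw [he]; field_simp; ring
  · refine lintegral_mono_ae ?_
    filter_upwards [hAt] with x hx
    have h1 : ∀ t, (D (t, x) ^ (q - 1) * A x ^ e) ^ q' = D (t, x) ^ q * A x ^ (e * q') := by
      intro t
      rw [ENNReal.mul_rpow_of_nonneg _ _ hq.symm.nonneg, ← ENNReal.rpow_mul, ← ENNReal.rpow_mul,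
        hq.sub_one_mul_conj]
    simp only [h1]
    rw [lintegral_mul_const _ ((sl_meas hD x).pow_const q)]
    change (A x * A x ^ (e * q')) ^ (p' / q') ≤ A x ^ (p / q)
    have hpq' : 0 < p' / q' := div_pos hp.symm.pos hq.symm.pos
    rcases eq_or_ne (A x) 0 with h0 | h0
    · rw [h0, zero_mul, ENNReal.zero_rpow_of_pos hpq', ENNReal.zero_rpow_of_pos hpq]
    · nth_rewrite 1 [← ENNReal.rpow_one (A x)]
      rw [← ENNReal.rpow_add _ _ h0 hx, ← ENNReal.rpow_mul]
      refine le_of_eq (congrArg _ ?_)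
      have hq1 : q - 1 ≠ 0 := by linarith [hq.lt]
      have hp1 : p - 1 ≠ 0 := by linarith [hp.lt]
      rw [he, hq.conjugate_eq, hp.conjugate_eq]
      field_simp; ring

lemma mixI_pow {q p s : ℝ} (hs : 0 < s) (g : Pt d → ℝ≥0∞) :
    mixI q p (fun z => g z ^ (1 / s)) = mixI (q / s) (p / s) g := by
  simp only [mixI]; congr 1; ext x
  rw [show p / s / (q / s) = p / q by field_simp]
  congr 2; ext t; rw [← ENNReal.rpow_mul]; congr 1; ring

lemma osc_mixed (d : ℕ) {q p s β : ℝ} (hs : 1 ≤ s) (hsq : s < q) (hsp : s < p) (hβ : 0 ≤ β) :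
    ∃ C : ℝ≥0∞, C ≠ ⊤ ∧ ∀ κ, 2 ≤ κ → ∀ g : Pt d → ℝ, Continuous g → HasCompactSupport g →
      ∀ F : Pt d → ℝ≥0∞, Measurable F → OSC κ s g F → ∀ R, 0 < R → ∀ t x, ∃ b : ℝ,
        cylE q p R t x (fun z => ENNReal.ofReal |g z - b|) ≤
          C * (ENNReal.ofReal (R ^ (-β)) * morE q p β F) := by
  have hd : (0 : ℝ) ≤ d := Nat.cast_nonneg d
  have hq := Real.HolderConjugate.conjExponent (p := q) (by linarith)
  have hp := Real.HolderConjugate.conjExponent (p := p) (by linarith)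
  set q' := q.conjExponent
  set p' := p.conjExponent
  have hq0 := hq.pos
  have hp0 := hp.pos
  have hs0 : 0 < s := by linarith
  obtain ⟨N1, hN1, hm1⟩ := MC_mixed d hq.symm.lt hp.symm.lt
  obtain ⟨N2, hN2, hm2⟩ := MC_mixed d (q := q / s) (p := p / s) ((one_lt_div hs0).2 hsq)
    ((one_lt_div hs0).2 hsp)
  set G : ℝ≥0∞ := (ENNReal.ofReal (d + 4) ^ d * ENNReal.ofReal ((d + 4) ^ 2) ^ (p / q)) ^ (1 / p) with hG
  have hGt : G ≠ ⊤ := ENNReal.rpow_ne_top_of_nonneg (by positivity) (ENNReal.mul_ne_top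
    (ENNReal.pow_ne_top (by simp)) (ENNReal.rpow_ne_top_of_nonneg (by positivity) (by simp)))
  set C1 : ℝ≥0∞ := 8 * (4 * 2 ^ d : ℕ) * (bC d * N1 ^ (1 / p')) * G with hC1
  have hC1t : C1 ≠ ⊤ := ENNReal.mul_ne_top (ENNReal.mul_ne_top (ENNReal.mul_ne_top (by simp)
    (ENNReal.natCast_ne_top _)) (ENNReal.mul_ne_top bC_fin (ENNReal.rpow_ne_top_of_nonneg
      (one_div_nonneg.2 hp.symm.nonneg) hN1))) hGt
  set C2 : ℝ≥0∞ := 2 * bC d + 2 * bC d * N2 ^ (1 / p) with hC2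
  have hC2t : C2 ≠ ⊤ := ENNReal.add_ne_top.2 ⟨ENNReal.mul_ne_top (by simp) bC_fin,
    ENNReal.mul_ne_top (ENNReal.mul_ne_top (by simp) bC_fin)
      (ENNReal.rpow_ne_top_of_nonneg (by positivity) hN2)⟩
  refine ⟨C1 * C2, ENNReal.mul_ne_top hC1t hC2t, fun κ hκ g hg hgc F hF ho R hR t0 x0 => ?_⟩
  set Q0 := dbox t0 (fun i => x0 i - R) (2 * R) with hQ0
  have mQ0 : MeasurableSet Q0 := dbox_meas _ _ _
  set b := ⨍ w in Q0, g w with hb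
  set V := cyl d ((d + 4) * R) (t0 - 5 * R ^ 2) x0 with hV
  have hm0 : 0 < (d + 4) * R := by positivity
  have hR2 : 0 < R ^ 2 := by positivity
  have hR4 : 16 * R ^ 2 ≤ ((d + 4) * R) ^ 2 := by rw [mul_pow]; gcongr; nlinarith
  have mV : MeasurableSet V := cyl_meas _ _ _
  have hQV : Q0 ⊆ V := by
    rintro z ⟨h1, h2⟩
    refine ⟨⟨by linarith [h1.1], by linarith [h1.2]⟩, ?_⟩
    rw [mem_ball, dist_eq_norm]
    have := euc_norm_le (z.2 - x0) (r := R) (fun i => by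
      have := h2 i; simp only [mem_Ico] at this
      simp only [PiLp.sub_apply]; rw [abs_le]; constructor <;> linarith)
    nlinarith
  have hCQ : cyl d R t0 x0 ⊆ Q0 := by
    rintro z ⟨h1, h2⟩
    refine ⟨⟨h1.1.le, by nlinarith [h1.2]⟩, fun i => ?_⟩
    have h3 : |(z.2 - x0) i| ≤ ‖z.2 - x0‖ := by
      simpa using PiLp.norm_apply_le (z.2 - x0) i
    rw [mem_ball, dist_eq_norm] at h2
    have h4 := abs_lt.1 (h3.trans_lt h2)
    simp only [PiLp.sub_apply] at h4
    constructor <;> linarith [h4.1, h4.2]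
  set D : Pt d → ℝ≥0∞ := fun z => ENNReal.ofReal |g z - b| with hDdef
  have mD : Measurable D := (hg.measurable.sub_const b).abs.ennreal_ofReal
  have mDi : Measurable (Q0.indicator D) := mD.indicator mQ0
  set Γ := gam d q p R ^ (1 / p) with hΓ
  have hΓ0 : Γ ≠ 0 := (ENNReal.rpow_pos (pos_iff_ne_zero.2 (gam_ne q p hR))
    (gam_fin (by positivity))).ne'
  have hΓ1 : Γ ≠ ⊤ := ENNReal.rpow_ne_top_of_nonneg (by positivity) (gam_fin (by positivity))
  have hΓm : gam d q p ((d + 4) * R) ^ (1 / p) = G * Γ := by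
    rw [gam_mul (by positivity) (by positivity), ENNReal.mul_rpow_of_nonneg _ _ (by positivity)]
  have hVc : ∀ c : ℝ≥0∞, mixn q p (V.indicator fun _ => c) = G * Γ * c := by
    intro c
    rw [hV, cylE_eq hq0 hp0 hm0, cylE_const hq0 hp0 hm0, hΓm]
  -- finiteness
  have hfin : mixI q p (Q0.indicator D) ≠ ⊤ := by
    obtain ⟨B, hB⟩ := hg.bounded_above_of_compact_support hgc
    have h1 : mixn q p (Q0.indicator D) ≤ G * Γ * ENNReal.ofReal (B + |b|) := by
      rw [← hVc]
      refine mixn_mono hq0.le hp0.le fun z => ?_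
      refine (indicator_le_indicator_of_subset hQV (fun _ => zero_le) z).trans
        (indicator_le_indicator ?_)
      refine ENNReal.ofReal_le_ofReal ((abs_sub _ _).trans ?_)
      have := hB z; rw [Real.norm_eq_abs] at this; linarith
    have h2 : mixn q p (Q0.indicator D) ≠ ⊤ := ne_top_of_le_ne_top
      (ENNReal.mul_ne_top (ENNReal.mul_ne_top hGt hΓ1) (by simp)) h1
    intro h3; apply h2; rw [mixn, h3, ENNReal.top_rpow_of_pos (by positivity)]
  obtain ⟨h, mh, hh1, hh2⟩ := mix_dual hq hp mDi hfin
  refine ⟨b, ?_⟩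
  set Y := ENNReal.ofReal (R ^ (-β)) * morE q p β F with hY
  have main : ∀ η : ℝ, 0 < η → cylE q p R t0 x0 D ≤ C1 * (ENNReal.ofReal η + C2 * Y) := by
    intro η hη
    have hop := osc_pair hs hsq hsp hβ hκ hg hgc hF ho hR t0 x0 hη mh
    set M := MC (V.indicator fun z => F z ^ s) with hM
    have mM : Measurable M := MC_meas _
    set Θ : Pt d → ℝ≥0∞ := fun z => ENNReal.ofReal η + 2 * bC d * Y + 2 * bC d * M z ^ (1 / s) with hΘ
    have mΘ : Measurable Θ := ((mM.pow_const _).const_mul _).const_add _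
    have hX : mixI q p (Q0.indicator D) ≤
        (8 * (4 * 2 ^ d : ℕ) * (bC d * N1 ^ (1 / p')) * mixn q p (Q0.indicator Θ)) *
          mixI q p (Q0.indicator D) ^ (1 / p') := by
      calc _ = ∫⁻ z, Q0.indicator D z * h z := hh1.symm
        _ = ∫⁻ z in Q0, D z * h z := by
            rw [← lintegral_indicator mQ0]
            refine lintegral_congr fun z => ?_
            by_cases hz : z ∈ Q0 <;> simp [hz]
        _ ≤ 8 * (4 * 2 ^ d : ℕ) * ∫⁻ z in Q0, Θ z * (bC d * MC h z) := hop
        _ = 8 * (4 * 2 ^ d : ℕ) * (bC d * ∫⁻ z, Q0.indicator Θ z * MC h z) := by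
            have hm : Measurable fun z => Q0.indicator Θ z * MC h z := (mΘ.indicator mQ0).mul (MC_meas h)
            rw [← lintegral_indicator mQ0, ← lintegral_const_mul _ hm]
            congr 1
            refine lintegral_congr fun z => ?_
            by_cases hz : z ∈ Q0
            · simp only [indicator_of_mem hz]; ring
            · simp [hz]
        _ ≤ 8 * (4 * 2 ^ d : ℕ) * (bC d * (mixn q p (Q0.indicator Θ) *
              (N1 * mixI q p (Q0.indicator D)) ^ (1 / p'))) := by
            refine mul_le_mul' le_rfl (mul_le_mul' le_rfl ?_)
            refine (mixn_holder hq hp (mΘ.indicator mQ0) (MC_meas h)).trans (mul_le_mul' le_rfl ?_)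
            refine ENNReal.rpow_le_rpow ?_ (one_div_nonneg.2 hp.symm.nonneg)
            exact (hm1 h mh).trans (mul_le_mul' le_rfl hh2)
        _ = _ := by
            rw [ENNReal.mul_rpow_of_nonneg _ _ (one_div_nonneg.2 hp.symm.nonneg)]; ring
    have hX2 := absorb_pow hp hfin hX
    have hX3 : mixn q p (Q0.indicator D) ≤
        8 * (4 * 2 ^ d : ℕ) * (bC d * N1 ^ (1 / p')) * mixn q p (Q0.indicator Θ) := by
      refine (ENNReal.rpow_le_rpow hX2 (by positivity : 0 ≤ 1 / p)).trans (le_of_eq ?_)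
      rw [← ENNReal.rpow_mul, mul_one_div_cancel hp0.ne', ENNReal.rpow_one]
    have hT : mixn q p (Q0.indicator Θ) ≤ G * Γ * (ENNReal.ofReal η + C2 * Y) := by
      have h1 : mixn q p (fun z => M z ^ (1 / s)) ≤ N2 ^ (1 / p) * (G * Γ * Y) := by
        have h2 : mixI q p (fun z => M z ^ (1 / s)) ≤ N2 * mixI q p (V.indicator F) := by
          rw [mixI_pow hs0]
          refine (hm2 _ ((hF.pow_const s).indicator mV)).trans (le_of_eq ?_)
          rw [← mixI_pow hs0]; congr 2; ext z
          by_cases hz : z ∈ V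
          · simp only [indicator_of_mem hz]
            rw [← ENNReal.rpow_mul, mul_one_div_cancel hs0.ne', ENNReal.rpow_one]
          · simp [hz, hs0]
        refine (ENNReal.rpow_le_rpow h2 (by positivity : 0 ≤ 1 / p)).trans ?_
        rw [ENNReal.mul_rpow_of_nonneg _ _ (by positivity)]
        refine mul_le_mul' le_rfl ?_
        change mixn q p (V.indicator F) ≤ _
        rw [hV, cylE_eq hq0 hp0 hm0, hΓm]
        refine mul_le_mul' le_rfl ((cylE_le_mor q p β hm0 _ _ F).trans
          (mul_le_mul' (ENNReal.ofReal_le_ofReal ?_) le_rfl))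
        exact Real.rpow_le_rpow_of_nonpos hR (by nlinarith) (by linarith)
      calc _ ≤ mixn q p (fun z => V.indicator (fun _ => ENNReal.ofReal η + 2 * bC d * Y) z +
              2 * bC d * M z ^ (1 / s)) := by
            refine mixn_mono hq0.le hp0.le fun z => ?_
            by_cases hz : z ∈ Q0
            · rw [indicator_of_mem hz, indicator_of_mem (hQV hz)]
            · rw [indicator_of_notMem hz]; exact zero_le
        _ ≤ _ := mixn_add hq.lt.le hp.lt.le (measurable_const.indicator mV)
            ((mM.pow_const _).const_mul _)
        _ ≤ G * Γ * (ENNReal.ofReal η + 2 * bC d * Y) + 2 * bC d * (N2 ^ (1 / p) * (G * Γ * Y)) := by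
            rw [hVc, mixn_smul hq0 hp0 _ (mM.pow_const _)]
            exact add_le_add le_rfl (mul_le_mul' le_rfl h1)
        _ = _ := by rw [hC2]; ring
    refine (ENNReal.mul_le_mul_iff_right hΓ0 hΓ1).1 ?_
    rw [← cylE_eq hq0 hp0 hR]
    calc _ ≤ mixn q p (Q0.indicator D) := mixn_mono hq0.le hp0.le fun z =>
          indicator_le_indicator_of_subset hCQ (fun _ => zero_le) z
      _ ≤ _ := hX3.trans (mul_le_mul' le_rfl hT)
      _ = _ := by rw [hC1]; ring
  have lim : Filter.Tendsto (fun η : ℝ => C1 * (ENNReal.ofReal η + C2 * Y)) (nhdsWithin 0 (Ioi 0))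
      (nhds (C1 * (ENNReal.ofReal 0 + C2 * Y))) := by
    refine ENNReal.Tendsto.const_mul (Filter.Tendsto.add ?_ tendsto_const_nhds) (.inr hC1t)
    exact (ENNReal.continuous_ofReal.tendsto 0).mono_left nhdsWithin_le_nhds
  have := ge_of_tendsto lim (Filter.eventually_of_mem self_mem_nhdsWithin main)
  simpa [mul_assoc] using this
end

section
variable {d : ℕ}

lemma avS_one (R t : ℝ) (x : Spc d) (f : Pt d → ℝ≥0∞) :
    avS 1 R t x f = (volume (cyl d R t x))⁻¹ * ∫⁻ z in cyl d R t x, f z := by simp [avS]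

lemma av_tri {R : ℝ} (hR : 0 < R) (t : ℝ) (x : Spc d) {g : Pt d → ℝ} (hg : Measurable g) (b c : ℝ) :
    ENNReal.ofReal |b - c| ≤ avS 1 R t x (fun z => ENNReal.ofReal |g z - b|) +
      avS 1 R t x (fun z => ENNReal.ofReal |g z - c|) := by
  have hv := vol_cyl_ne x t hR
  have hf := vol_cyl_fin x t R
  rw [avS_one, avS_one, ← mul_add]
  calc _ = (volume (cyl d R t x))⁻¹ * ∫⁻ z in cyl d R t x, ENNReal.ofReal |b - c| := by
        rw [setLIntegral_const, mul_left_comm, ENNReal.inv_mul_cancel hv hf, mul_one]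
    _ ≤ (volume (cyl d R t x))⁻¹ * ∫⁻ z in cyl d R t x, (ENNReal.ofReal |g z - b| + ENNReal.ofReal |g z - c|) := by
        refine mul_le_mul' le_rfl (lintegral_mono fun z => ?_)
        rw [← ENNReal.ofReal_add (abs_nonneg _) (abs_nonneg _)]
        refine ENNReal.ofReal_le_ofReal ?_
        rw [abs_sub_comm (g z) b]
        simpa using abs_add_le (b - g z) (g z - c)
    _ = _ := by
        have hm : Measurable fun z => ENNReal.ofReal |g z - b| := (hg.sub_const _).abs.ennreal_ofReal
        rw [lintegral_add_left hm]

lemma mor_abs (d : ℕ) {q p s β : ℝ} (hs : 1 ≤ s) (hsq : s < q) (hsp : s < p) (hβ : 0 < β) :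
    ∃ N : ℝ≥0∞, N ≠ ⊤ ∧ ∀ κ, 2 ≤ κ → ∀ g : Pt d → ℝ, Continuous g → HasCompactSupport g →
      ∀ F : Pt d → ℝ≥0∞, Measurable F → OSC κ s g F →
        morE q p β (fun z => ENNReal.ofReal |g z|) ≤ N * morE q p β F := by
  obtain ⟨C, hC, H⟩ := osc_mixed d hs hsq hsp hβ.le
  set ρ : ℝ≥0∞ := ENNReal.ofReal (2 ^ (-β)) with hρ
  have hρ1 : ρ < 1 := by
    rw [hρ, ENNReal.ofReal_lt_one]; exact Real.rpow_lt_one_of_one_lt_of_neg (by norm_num) (by linarith)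
  set K : ℝ≥0∞ := 1 + 2 ^ (d + 2) with hK
  have hKf : K ≠ ⊤ := by simp [hK]
  have hI : (1 - ρ)⁻¹ ≠ ⊤ := ENNReal.inv_ne_top.2 (tsub_pos_of_lt hρ1).ne'
  refine ⟨(1 + K * (1 - ρ)⁻¹) * C + 1, ?_, fun κ hκ g hg hgc F hF ho => ?_⟩
  · exact ENNReal.add_ne_top.2 ⟨ENNReal.mul_ne_top (ENNReal.add_ne_top.2 ⟨by simp,
      ENNReal.mul_ne_top hKf hI⟩) hC, by simp⟩
  set M := morE q p β F with hM
  by_cases hMt : M = ⊤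
  · rw [hMt, ENNReal.mul_top (by simp)]; exact le_top
  have hq0 : 0 < q := by linarith
  have hp0 : 0 < p := by linarith
  refine iSup_le fun R => iSup_le fun hR => iSup_le fun t => iSup_le fun x => ?_
  choose b hb using fun n : ℕ => H κ hκ g hg hgc F hF ho (2 ^ n * R) (by positivity) t x
  set e := C * (ENNReal.ofReal (R ^ (-β)) * M) with he
  have hef : e ≠ ⊤ := ENNReal.mul_ne_top hC (ENNReal.mul_ne_top (by simp) hMt)
  have hgm := hg.measurable
  have hm : ∀ c : ℝ, Measurable fun z => ENNReal.ofReal |g z - c| := fun c =>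
    (hgm.sub_const _).abs.ennreal_ofReal
  have hb' : ∀ n, cylE q p (2 ^ n * R) t x (fun z => ENNReal.ofReal |g z - b n|) ≤ ρ ^ n * e := by
    intro n
    refine (hb n).trans (le_of_eq ?_)
    rw [Real.mul_rpow (by positivity) hR.le, ENNReal.ofReal_mul (by positivity), he, hρ,
      ← ENNReal.ofReal_pow (by positivity), ← Real.rpow_natCast, ← Real.rpow_natCast,
      ← Real.rpow_mul (by norm_num), ← Real.rpow_mul (by norm_num), mul_comm (n : ℝ)]
    ring
  have ha : ∀ n, avS 1 (2 ^ n * R) t x (fun z => ENNReal.ofReal |g z - b n|) ≤ ρ ^ n * e := fun n =>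
    (avS_le_cylE one_pos (by linarith) (by linarith) (by positivity) t x (hm _)).trans (hb' n)
  have hcyl : ∀ n, cyl d (2 ^ n * R) t x ⊆ cyl d (2 ^ (n + 1) * R) t x := by
    intro n
    have h1 : (2 : ℝ) ^ n * R ≤ 2 ^ (n + 1) * R := by gcongr <;> norm_num
    have h2 : ((2 : ℝ) ^ n * R) ^ 2 ≤ (2 ^ (n + 1) * R) ^ 2 := by gcongr <;> norm_num
    exact prod_mono (Ioo_subset_Ioo le_rfl (by linarith)) (ball_subset_ball h1)
  have step : ∀ n, ENNReal.ofReal |b n| ≤ K * ρ ^ n * e + ENNReal.ofReal |b (n + 1)| := by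
    intro n
    have h1 := av_tri (R := 2 ^ n * R) (by positivity) t x hgm (b n) (b (n + 1))
    have h2 : avS 1 (2 ^ n * R) t x (fun z => ENNReal.ofReal |g z - b (n + 1)|) ≤ 2 ^ (d + 2) * (ρ ^ n * e) := by
      calc _ ≤ 2 ^ (d + 2) * avS 1 (2 ^ (n + 1) * R) t x (fun z => ENNReal.ofReal |g z - b (n + 1)|) := by
            rw [avS_one, avS_one, ← mul_assoc]
            refine mul_le_mul' ?_ (lintegral_mono_set (hcyl n))
            rw [show (2 : ℝ) ^ (n + 1) * R = 2 * (2 ^ n * R) by ring, vol_cyl_mul x x t t two_pos,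
              ENNReal.mul_inv (.inl (by simp)) (.inl (by simp)), ← mul_assoc, ENNReal.ofReal_ofNat,
              ENNReal.mul_inv_cancel (by simp) (by simp), one_mul]
        _ ≤ _ := mul_le_mul' le_rfl ((ha (n + 1)).trans (mul_le_mul' ?_ le_rfl))
      rw [pow_succ]; exact mul_le_of_le_one_right' hρ1.le
    calc _ ≤ ENNReal.ofReal |b n - b (n + 1)| + ENNReal.ofReal |b (n + 1)| := by
          rw [← ENNReal.ofReal_add (abs_nonneg _) (abs_nonneg _)]
          refine ENNReal.ofReal_le_ofReal ?_
          simpa using abs_add_le (b n - b (n + 1)) (b (n + 1))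
      _ ≤ _ := by
          refine add_le_add (h1.trans ((add_le_add (ha n) h2).trans (le_of_eq ?_))) le_rfl
          rw [hK]; ring
  set G := ∫⁻ z, ENNReal.ofReal |g z| with hG
  have hGf : G ≠ ⊤ := by
    have := (hg.integrable_of_hasCompactSupport (μ := volume) hgc).2
    simpa [HasFiniteIntegral, hG, Real.enorm_eq_ofReal_abs] using this.ne
  set V := volume (cyl d R t x) with hV
  have hV0 : V⁻¹ ≠ ⊤ := ENNReal.inv_ne_top.2 (vol_cyl_ne x t hR)
  have last : ∀ n, ENNReal.ofReal |b n| ≤ ρ ^ n * e + (2⁻¹) ^ n * (V⁻¹ * G) := by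
    intro n
    have h1 := av_tri (R := 2 ^ n * R) (by positivity) t x hgm (b n) 0
    simp only [sub_zero] at h1
    refine h1.trans (add_le_add (ha n) ?_)
    rw [avS_one, ← mul_assoc]
    refine mul_le_mul' ?_ (setLIntegral_le_lintegral _ _)
    rw [vol_cyl_mul x x t t (by positivity), ENNReal.mul_inv (.inl (by simp)) (.inl (by simp))]
    refine mul_le_mul' ?_ le_rfl
    rw [← ENNReal.inv_pow, ENNReal.inv_le_inv, ENNReal.ofReal_pow (by norm_num), ENNReal.ofReal_ofNat]
    exact le_self_pow₀ (one_le_pow₀ (by norm_num)) (by simp)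
  have sum : ∀ n, ENNReal.ofReal |b 0| ≤ K * (∑ j ∈ Finset.range n, ρ ^ j) * e + ENNReal.ofReal |b n| := by
    intro n
    induction n with
    | zero => simp
    | succ n ih =>
      refine ih.trans ((add_le_add le_rfl (step n)).trans (le_of_eq ?_))
      rw [Finset.sum_range_succ]; ring
  have b0 : ENNReal.ofReal |b 0| ≤ K * (1 - ρ)⁻¹ * e := by
    have lim : Filter.Tendsto (fun n : ℕ => K * (1 - ρ)⁻¹ * e + (ρ ^ n * e + (2⁻¹) ^ n * (V⁻¹ * G)))
        Filter.atTop (nhds (K * (1 - ρ)⁻¹ * e + (0 * e + 0 * (V⁻¹ * G)))) := by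
      refine tendsto_const_nhds.add (.add ?_ ?_)
      · exact ENNReal.Tendsto.mul_const (ENNReal.tendsto_pow_atTop_nhds_zero_of_lt_one hρ1) (.inr hef)
      · exact ENNReal.Tendsto.mul_const (ENNReal.tendsto_pow_atTop_nhds_zero_of_lt_one (by simp))
          (.inr (ENNReal.mul_ne_top hV0 hGf))
    simp only [zero_mul, add_zero] at lim
    refine ge_of_tendsto' lim fun n => (sum n).trans (add_le_add ?_ (last n))
    refine mul_le_mul' (mul_le_mul' le_rfl ?_) le_rfl
    rw [← ENNReal.tsum_geometric]
    exact ENNReal.sum_le_tsum _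
  have fin : cylE q p R t x (fun z => ENNReal.ofReal |g z|) ≤ e + K * (1 - ρ)⁻¹ * e := by
    have h0 := hb' 0
    simp only [pow_zero, one_mul] at h0
    calc _ ≤ cylE q p R t x (fun z => ENNReal.ofReal |g z - b 0| + ENNReal.ofReal |b 0|) := by
          refine cylE_mono hq0 hp0 R t x fun z _ => ?_
          rw [← ENNReal.ofReal_add (abs_nonneg _) (abs_nonneg _)]
          refine ENNReal.ofReal_le_ofReal ?_
          simpa using abs_add_le (g z - b 0) (b 0)
      _ ≤ _ := by
          refine (cylE_add (by linarith) (by linarith) hR t x (hm _) measurable_const).trans (add_le_add h0 ?_)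
          rw [cylE_const hq0 hp0 hR]; exact b0
  refine (mul_le_mul' le_rfl fin).trans ?_
  have h1 : ENNReal.ofReal (R ^ β) * ENNReal.ofReal (R ^ (-β)) = 1 := by
    rw [← ENNReal.ofReal_mul (by positivity), ← Real.rpow_add hR]; simp
  calc _ = (1 + K * (1 - ρ)⁻¹) * C * M * (ENNReal.ofReal (R ^ β) * ENNReal.ofReal (R ^ (-β))) := by
        rw [he]; ring
    _ ≤ _ := by rw [h1, mul_one]; exact mul_le_mul' le_self_add le_rfl

lemma morE_add {q p β : ℝ} (hq : 1 ≤ q) (hp : 1 ≤ p) {f g : Pt d → ℝ≥0∞} (hf : Measurable f)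
    (hg : Measurable g) : morE q p β (fun z => f z + g z) ≤ morE q p β f + morE q p β g := by
  refine iSup_le fun R => iSup_le fun hR => iSup_le fun t => iSup_le fun x => ?_
  refine (mul_le_mul' le_rfl (cylE_add hq hp hR t x hf hg)).trans ?_
  rw [mul_add]
  exact add_le_add (le_iSup_of_le R (le_iSup_of_le hR (le_iSup_of_le t (le_iSup_of_le x le_rfl))))
    (le_iSup_of_le R (le_iSup_of_le hR (le_iSup_of_le t (le_iSup_of_le x le_rfl))))

lemma morE_smul {q p β : ℝ} (hq : 0 < q) (hp : 0 < p) (c : ℝ≥0∞) {f : Pt d → ℝ≥0∞} (hf : Measurable f) :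
    morE q p β (fun z => c * f z) ≤ c * morE q p β f := by
  refine iSup_le fun R => iSup_le fun hR => iSup_le fun t => iSup_le fun x => ?_
  rw [cylE_smul hq hp hR t x c hf, mul_left_comm]
  exact mul_le_mul' le_rfl (le_iSup_of_le R (le_iSup_of_le hR (le_iSup_of_le t (le_iSup_of_le x le_rfl))))

lemma morE_mono {q p β : ℝ} (hq : 0 < q) (hp : 0 < p) {f g : Pt d → ℝ≥0∞} (h : ∀ z, f z ≤ g z) :
    morE q p β f ≤ morE q p β g :=
  iSup_mono fun R => iSup_mono fun hR => iSup_mono fun t => iSup_mono fun x =>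
    mul_le_mul' le_rfl (cylE_mono hq hp R t x fun z _ => h z)

lemma morE_sum {q p β : ℝ} (hq : 1 ≤ q) (hp : 1 ≤ p) {ι : Type*} (S : Finset ι) {f : ι → Pt d → ℝ≥0∞}
    (hf : ∀ i, Measurable (f i)) : morE q p β (fun z => ∑ i ∈ S, f i z) ≤ ∑ i ∈ S, morE q p β (f i) := by
  classical
  induction S using Finset.induction_on with
  | empty =>
    have := morE_smul (β := β) (by linarith : 0 < q) (by linarith : 0 < p) 0 (f := fun _ : Pt d => 0) measurable_const
    simpa using this
  | insert a s ha ih =>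
    simp only [Finset.sum_insert ha]
    exact (morE_add hq hp (hf a) (Finset.measurable_sum _ fun i _ => hf i)).trans (add_le_add le_rfl ih)
end

section
variable {d : ℕ} {u : Pt d → ℝ}

/-- convolution in `x` -/
def T (k : Spc d → ℝ) (u : Pt d → ℝ) (z : Pt d) : ℝ := ∫ y, k y * u (z.1, z.2 - y)

/-- smooth compactly supported kernels in `B_1` -/
structure Ker (k : Spc d → ℝ) : Prop where
  sm : ContDiff ℝ (⊤ : ℕ∞) k
  sp : ∀ y, 1 ≤ ‖y‖ → k y = 0

lemma Ker.cpt {k : Spc d → ℝ} (hk : Ker k) : HasCompactSupport k :=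
  HasCompactSupport.intro (isCompact_closedBall (0 : Spc d) 1) fun y hy => hk.sp y (by simp at hy; exact hy.le)

def pd (i : Fin d) (k : Spc d → ℝ) (y : Spc d) : ℝ := fderiv ℝ k y (EuclideanSpace.single i 1)

lemma Ker.pd {k : Spc d → ℝ} (hk : Ker k) (i : Fin d) : Ker (pd i k) := by
  refine ⟨(hk.sm.fderiv_right (m := (⊤ : ℕ∞)) le_rfl).clm_apply contDiff_const, fun y hy => ?_⟩
  have hcl : IsClosed {y | _root_.pd i k y = 0} := isClosed_eq
    ((hk.sm.continuous_fderiv (by simp)).clm_apply continuous_const) continuous_const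
  have h1 : {y : Spc d | 1 < ‖y‖} ⊆ {y | _root_.pd i k y = 0} := by
    intro y hy
    have : k =ᶠ[nhds y] fun _ => 0 := by
      filter_upwards [(isOpen_lt continuous_const continuous_norm).mem_nhds hy] with w hw
      exact hk.sp w (le_of_lt hw)
    simp [_root_.pd, this.fderiv_eq]
  have h2 := closure_minimal h1 hcl
  refine h2 ?_
  have hy0 : y ≠ 0 := by rintro rfl; simp at hy; linarith
  refine mem_closure_of_tendsto (f := fun n : ℕ => (1 + 1 / ((n : ℝ) + 1)) • y) (b := Filter.atTop) ?_ (.of_forall fun n => ?_)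
  · have := (tendsto_one_div_add_atTop_nhds_zero_nat (𝕜 := ℝ)).const_add 1
    simpa using this.smul_const y
  · have h3 : (0 : ℝ) < 1 / ((n : ℝ) + 1) := by positivity
    rw [mem_setOf_eq, norm_smul, Real.norm_of_nonneg (by positivity)]
    nlinarith

lemma supp_slice (h : HasCompactSupport u) : IsCompact (Prod.snd '' tsupport u) ∧
    ∀ (p : ℝ) (x : Spc d), p ∈ univ → x ∉ Prod.snd '' tsupport u → u (p, x) = 0 :=
  ⟨h.image continuous_snd, fun p x _ hx => by
    by_contra hn
    exact hx ⟨(p, x), subset_tsupport _ hn, rfl⟩⟩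

lemma CinfC.T {k : Spc d → ℝ} (hk : Ker k) (h : CinfC u) : CinfC (T k u) := by
  obtain ⟨h1, h2⟩ := supp_slice h.2
  constructor
  · have := contDiffOn_convolution_right_with_param (n := ⊤) (ContinuousLinearMap.lsmul ℝ ℝ) (μ := volume) (g := fun p x => u (p, x))
      isOpen_univ h1 h2 (hk.sm.continuous.integrable_of_hasCompactSupport hk.cpt).locallyIntegrable
      (h.1.contDiffOn)
    rw [univ_prod_univ, contDiffOn_univ] at this
    exact this
  · refine HasCompactSupport.intro ((h.2.image continuous_fst).prod (h1.add (isCompact_closedBall (0 : Spc d) 1))) fun z hz => ?_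
    refine integral_eq_zero_of_ae (.of_forall fun y => ?_)
    by_cases hy : 1 ≤ ‖y‖
    · simp [hk.sp y hy]
    · have : u (z.1, z.2 - y) = 0 := by
        by_contra hn
        have hn := subset_tsupport _ (Function.mem_support.2 hn)
        exact hz ⟨⟨_, hn, rfl⟩, mem_add.2 ⟨_, ⟨_, hn, rfl⟩, y, by simpa using (not_le.1 hy).le, by simp⟩⟩
      simp [this]

lemma dv_T {k : Spc d → ℝ} (hk : Ker k) (h : CinfC u) (v : Pt d) : dv v (T k u) = T k (dv v u) := by
  obtain ⟨h1, h2⟩ := supp_slice h.2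
  have hs : ContDiff ℝ 1 u := h.1.of_le (by simp)
  funext z
  have hk1 := (hk.sm.continuous.integrable_of_hasCompactSupport (μ := volume) hk.cpt).locallyIntegrable
  have h4 := hasFDerivAt_convolution_right_with_param (ContinuousLinearMap.lsmul ℝ ℝ) (μ := volume) (g := fun p x => u (p, x))
      isOpen_univ h1 h2 hk1 hs.contDiffOn z trivial
  have hc : HasCompactSupport fun x : Spc d => fderiv ℝ u (z.1, x) :=
    HasCompactSupport.intro h1 fun x hx => by
      by_contra hn
      exact hx ⟨(z.1, x), support_fderiv_subset ℝ hn, rfl⟩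
  have h5 : ConvolutionExistsAt k (fun x : Spc d => fderiv ℝ u (z.1, x)) z.2 ((ContinuousLinearMap.lsmul ℝ ℝ).precompR (Pt d)) volume :=
    hc.convolutionExists_right _ hk1 ((hs.continuous_fderiv (by simp)).comp (by fun_prop)) z.2
  have h6 : fderiv ℝ (T k u) z = _ := h4.fderiv
  rw [dv, h6, convolution_def]
  erw [ContinuousLinearMap.integral_apply h5]
  rfl

lemma Dx_T {k : Spc d → ℝ} (hk : Ker k) (h : CinfC u) (i : Fin d) : Dx i (T k u) = T k (Dx i u) := by
  rw [Dx_eq (h.T hk), Dx_eq h, dv_T hk h]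
lemma Dt_T {k : Spc d → ℝ} (hk : Ker k) (h : CinfC u) : Dt (T k u) = T k (Dt u) := by
  rw [Dt_eq (h.T hk), Dt_eq h, dv_T hk h]
lemma Dxx_T {k : Spc d → ℝ} (hk : Ker k) (h : CinfC u) (i j : Fin d) : Dxx i j (T k u) = T k (Dxx i j u) := by
  rw [Dxx, Dx_T hk h, Dx_T hk (h.Dx j), Dxx]

lemma T_int {k : Spc d → ℝ} (hk : Ker k) (h : Continuous u) (z : Pt d) :
    Integrable fun y => k y * u (z.1, z.2 - y) := by
  have := hk.sm.continuous
  exact Continuous.integrable_of_hasCompactSupport (by fun_prop) hk.cpt.mul_right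

lemma T_ibp {k : Spc d → ℝ} (hk : Ker k) (h : CinfC u) (i : Fin d) : T k (Dx i u) = T (pd i k) u := by
  funext z
  have hd : ∀ y, fderiv ℝ (fun y => u (z.1, z.2 - y)) y (EuclideanSpace.single i 1) = - Dx i u (z.1, z.2 - y) := by
    intro y
    have hw : Differentiable ℝ fun y => u (z.1, y) := h.diff.comp ((differentiable_const _).prodMk differentiable_id)
    have h1 := (hw (z.2 - y)).hasFDerivAt.comp y ((hasFDerivAt_id (𝕜 := ℝ) y).const_sub z.2)
    have h2 : fderiv ℝ (fun y => u (z.1, z.2 - y)) y = _ := h1.fderiv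
    rw [h2]; simp [Dx]
  have hu : Differentiable ℝ fun y => u (z.1, z.2 - y) :=
    h.diff.comp ((differentiable_const _).prodMk ((differentiable_const _).sub differentiable_id))
  have := integral_mul_fderiv_eq_neg_fderiv_mul_of_integrable (μ := (volume : Measure (Spc d)))
    (f := k) (g := fun y => u (z.1, z.2 - y)) (v := EuclideanSpace.single i 1)
    (T_int (hk.pd i) h.cont z) (by simp only [hd, mul_neg]; exact (T_int hk (h.Dx i).cont z).neg)
    (T_int hk h.cont z) (fun x _ => hk.sm.differentiable (by simp) x) (fun x _ => hu x)
  simp only [hd, mul_neg, integral_neg, neg_inj] at this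
  exact this

lemma ball_tr (x : Spc d) (f : Spc d → ℝ≥0∞) :
    ∫⁻ y in ball (0 : Spc d) 1, f (x - y) = ∫⁻ y in ball x 1, f y := by
  rw [← lintegral_indicator measurableSet_ball, ← lintegral_indicator measurableSet_ball,
    ← lintegral_sub_left_eq_self ((ball x 1).indicator _) x]
  congr 1; ext y
  by_cases h : y ∈ ball (0 : Spc d) 1
  · rw [indicator_of_mem h, indicator_of_mem]; simpa using h
  · rw [indicator_of_notMem h, indicator_of_notMem]; simpa using h

lemma T_bd {k : Spc d → ℝ} (hk : Ker k) {K : ℝ} (hK : ∀ y, |k y| ≤ K) (g : Pt d → ℝ) (z : Pt d) :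
    ‖T k g z‖ₑ ≤ ENNReal.ofReal K * ∫⁻ y in ball z.2 1, ‖g (z.1, y)‖ₑ := by
  refine (enorm_integral_le_lintegral_enorm _).trans ?_
  rw [← ball_tr z.2 fun y => ‖g (z.1, y)‖ₑ, ← lintegral_const_mul' _ _ (by simp),
    ← lintegral_indicator measurableSet_ball]
  refine lintegral_mono fun y => ?_
  by_cases h : y ∈ ball (0 : Spc d) 1
  · rw [indicator_of_mem h, enorm_mul]
    exact mul_le_mul' (by rw [Real.enorm_eq_ofReal_abs]; exact ENNReal.ofReal_le_ofReal (hK y)) le_rfl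
  · simp [hk.sp y (by simpa using h)]

/-- mollifying kernels at scale `h` -/
structure Mol (h : ℝ) (k : Spc d → ℝ) : Prop extends Ker k where
  nn : ∀ y, 0 ≤ k y
  one : ∫ y, k y = 1
  sh : ∀ y, h ≤ ‖y‖ → k y = 0

lemma pd_scale {k : Spc d → ℝ} (hk : ContDiff ℝ (⊤ : ℕ∞) k) (c a : ℝ) (i : Fin d) :
    pd i (fun y => c * k (a • y)) = fun y => (c * a) * pd i k (a • y) := by
  funext y
  have h1 : HasFDerivAt (fun y => c * k (a • y)) (c • (fderiv ℝ k (a • y)).comp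
      (a • ContinuousLinearMap.id ℝ (Spc d))) y :=
    ((hk.differentiable (by simp) (a • y)).hasFDerivAt.comp y ((hasFDerivAt_id y).const_smul a)).const_mul c
  rw [pd, h1.fderiv]; simp [pd]; ring

lemma Ker.bd {k : Spc d → ℝ} (hk : Ker k) : ∃ K : ℝ, 0 ≤ K ∧ ∀ y, |k y| ≤ K := by
  obtain ⟨C, hC⟩ := hk.cpt.exists_bound_of_continuous hk.sm.continuous
  exact ⟨C, (norm_nonneg _).trans (hC 0), hC⟩

lemma mol_exists (d : ℕ) : ∃ K : ℝ, 0 ≤ K ∧ ∀ h : ℝ, 0 < h → h ≤ 1 → ∃ k : Spc d → ℝ, Mol h k ∧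
    ∀ i j l m y, |k y| ≤ K * h⁻¹ ^ (d + 4) ∧ |pd i k y| ≤ K * h⁻¹ ^ (d + 4) ∧
      |pd i (pd j k) y| ≤ K * h⁻¹ ^ (d + 4) ∧ |pd i (pd j (pd l k)) y| ≤ K * h⁻¹ ^ (d + 4) ∧
      |pd i (pd j (pd l (pd m k))) y| ≤ K * h⁻¹ ^ (d + 4) := by
  let b : ContDiffBump (0 : Spc d) := ⟨1/2, 1, by norm_num, by norm_num⟩
  set η := b.normed volume with hη
  have kη : Ker η := by
    refine ⟨b.contDiff_normed, fun y hy => ?_⟩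
    by_contra h
    have : y ∈ Function.support η := h
    rw [hη, b.support_normed_eq] at this
    simp [b] at this; linarith
  obtain ⟨K0, hK0, H0⟩ := kη.bd
  choose K1 hK1 H1 using fun i => (kη.pd i).bd
  choose K2 hK2 H2 using fun i j => ((kη.pd j).pd i).bd
  choose K3 hK3 H3 using fun i j l => (((kη.pd l).pd j).pd i).bd
  choose K4 hK4 H4 using fun i j l m => ((((kη.pd m).pd l).pd j).pd i).bd
  refine ⟨K0 + ∑ i, (K1 i + ∑ j, (K2 i j + ∑ l, (K3 i j l + ∑ m, K4 i j l m))), ?_, fun h h0 h1 => ?_⟩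
  · have := hK1; have := hK2; have := hK3; have := hK4
    exact add_nonneg hK0 (Finset.sum_nonneg fun i _ => add_nonneg (hK1 i) (Finset.sum_nonneg fun j _ =>
      add_nonneg (hK2 i j) (Finset.sum_nonneg fun l _ => add_nonneg (hK3 i j l)
        (Finset.sum_nonneg fun m _ => hK4 i j l m))))
  have hi : 0 < h⁻¹ := by positivity
  have hi1 : 1 ≤ h⁻¹ := (one_le_inv₀ h0).2 h1
  have sp : ∀ y : Spc d, h ≤ ‖y‖ → η (h⁻¹ • y) = 0 := fun y hy => kη.sp _ (by
    rw [norm_smul, Real.norm_of_nonneg hi.le, inv_mul_eq_div, le_div_iff₀ h0]; linarith)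
  refine ⟨fun y => h⁻¹ ^ d * η (h⁻¹ • y), ⟨⟨contDiff_const.mul (kη.sm.comp (contDiff_const_smul _)),
    fun y hy => by rw [sp y (h1.trans hy), mul_zero]⟩, fun y => mul_nonneg (by positivity) (b.nonneg_normed _), ?_,
    fun y hy => by rw [sp y hy, mul_zero]⟩, fun i j l m y => ?_⟩
  · rw [integral_const_mul, Measure.integral_comp_smul, finrank_euclideanSpace_fin, b.integral_normed,
      abs_of_nonneg (by positivity)]
    simp [h0.ne']
  have S1 : ∀ i, K1 i + ∑ j, (K2 i j + ∑ l, (K3 i j l + ∑ m, K4 i j l m)) ≤ ∑ i, (K1 i + ∑ j, (K2 i j + ∑ l, (K3 i j l + ∑ m, K4 i j l m))) :=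
    fun i => Finset.single_le_sum (f := fun i => K1 i + ∑ j, (K2 i j + ∑ l, (K3 i j l + ∑ m, K4 i j l m)))
      (fun i _ => add_nonneg (hK1 i) (Finset.sum_nonneg fun j _ =>
      add_nonneg (hK2 i j) (Finset.sum_nonneg fun l _ => add_nonneg (hK3 i j l)
        (Finset.sum_nonneg fun m _ => hK4 i j l m)))) (Finset.mem_univ i)
  have S2 : ∀ i j, K2 i j + ∑ l, (K3 i j l + ∑ m, K4 i j l m) ≤ ∑ j, (K2 i j + ∑ l, (K3 i j l + ∑ m, K4 i j l m)) :=
    fun i j => Finset.single_le_sum (f := fun j => K2 i j + ∑ l, (K3 i j l + ∑ m, K4 i j l m))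
      (fun j _ => add_nonneg (hK2 i j) (Finset.sum_nonneg fun l _ => add_nonneg (hK3 i j l)
        (Finset.sum_nonneg fun m _ => hK4 i j l m))) (Finset.mem_univ j)
  have S3 : ∀ i j l, K3 i j l + ∑ m, K4 i j l m ≤ ∑ l, (K3 i j l + ∑ m, K4 i j l m) :=
    fun i j l => Finset.single_le_sum (f := fun l => K3 i j l + ∑ m, K4 i j l m)
      (fun l _ => add_nonneg (hK3 i j l) (Finset.sum_nonneg fun m _ => hK4 i j l m)) (Finset.mem_univ l)
  have S4 : ∀ i j l m, K4 i j l m ≤ ∑ m, K4 i j l m :=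
    fun i j l m => Finset.single_le_sum (fun m _ => hK4 i j l m) (Finset.mem_univ m)
  have s1 := S1 i; have s2 := S2 i j; have s3 := S3 i j l; have s4 := S4 i j l m
  have a1 := hK1 i; have a2 := hK2 i j; have a3 := hK3 i j l; have a4 := hK4 i j l m
  set KK := K0 + ∑ i, (K1 i + ∑ j, (K2 i j + ∑ l, (K3 i j l + ∑ m, K4 i j l m)))
  have key : ∀ (n : ℕ) (c : ℝ) (w K' : ℝ), n ≤ 4 → c = h⁻¹ ^ (d + n) → |w| ≤ K' → K' ≤ KK → |c * w| ≤ KK * h⁻¹ ^ (d + 4) := by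
    intro n c w K' hn hc hw hK
    rw [abs_mul, hc, abs_of_nonneg (by positivity), mul_comm]
    exact mul_le_mul (hw.trans hK) (pow_le_pow_right₀ hi1 (by omega)) (by positivity) ((abs_nonneg _).trans (hw.trans hK))
  simp only [pd_scale kη.sm, pd_scale (kη.pd _).sm, pd_scale ((kη.pd _).pd _).sm, pd_scale (((kη.pd _).pd _).pd _).sm]
  exact ⟨key 0 _ _ K0 (by norm_num) (by ring) (H0 _) (by linarith),
    key 1 _ _ (K1 i) (by norm_num) (by ring) (H1 _ _) (by linarith),
    key 2 _ _ (K2 i j) (by norm_num) (by ring) (H2 _ _ _) (by linarith),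
    key 3 _ _ (K3 i j l) (by norm_num) (by ring) (H3 _ _ _ _) (by linarith),
    key 4 _ _ (K4 i j l m) (by norm_num) (by ring) (H4 _ _ _ _ _) (by linarith)⟩
end

section
variable {d : ℕ} {u : Pt d → ℝ}

def Qb (d : ℕ) (a : ℝ) : Set (Pt d) := Ioo (-a) a ×ˢ ball 0 a

lemma Qb_meas (a : ℝ) : MeasurableSet (Qb d a) := (isOpen_Ioo.prod isOpen_ball).measurableSet
lemma Qb_mono {a b : ℝ} (h : a ≤ b) : Qb d a ⊆ Qb d b :=
  prod_mono (Ioo_subset_Ioo (by linarith) h) (ball_subset_ball h)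

/-- local `L_s` norm -/
def nQ (s a : ℝ) (g : Pt d → ℝ) : ℝ≥0∞ := eLpNorm g (ENNReal.ofReal s) (volume.restrict (Qb d a))

lemma nQ_eq {s : ℝ} (hs : 0 < s) (a : ℝ) (g : Pt d → ℝ) : nQ s a g = (∫⁻ z in Qb d a, ‖g z‖ₑ ^ s) ^ (1 / s) := by
  rw [nQ, eLpNorm_eq_lintegral_rpow_enorm_toReal (by simpa using hs) (by simp), ENNReal.toReal_ofReal hs.le]

lemma nQ_mono {s a b : ℝ} (h : a ≤ b) (g : Pt d → ℝ) : nQ s a g ≤ nQ s b g :=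
  eLpNorm_mono_measure _ (Measure.restrict_mono (Qb_mono h) le_rfl)

lemma avg_int {Ω : Type*} [MeasurableSpace Ω] {m : Measure Ω} [IsProbabilityMeasure m] {Y : Ω → Spc d}
    (hY : Measurable Y) (hY1 : ∀ᵐ ω ∂m, ‖Y ω‖ ≤ 1) {s : ℝ} (hs : 1 ≤ s) (a : ℝ) {f : Pt d → ℝ≥0∞}
    (hf : Measurable f) :
    ∫⁻ z in Qb d a, (∫⁻ ω, f (z.1, z.2 - Y ω) ∂m) ^ s ≤ ∫⁻ z in Qb d (a + 1), f z ^ s := by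
  have hs0 : 0 < s := by linarith
  have hm : Measurable fun p : Pt d × Ω => f (p.1.1, p.1.2 - Y p.2) := by fun_prop
  calc _ ≤ ∫⁻ z in Qb d a, ∫⁻ ω, f (z.1, z.2 - Y ω) ^ s ∂m := by
        refine lintegral_mono fun z => ?_
        have hmz : Measurable fun ω => f (z.1, z.2 - Y ω) := by fun_prop
        have := avg_pow (μ := m) (S := univ) (by simp) (by simp) (a := 1 / s) (by positivity)
          (by rw [div_le_one hs0]; exact hs) (hmz.pow_const s)
        simp only [Measure.restrict_univ, measure_univ, inv_one, one_mul, ← ENNReal.rpow_mul,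
          mul_one_div_cancel hs0.ne', ENNReal.rpow_one] at this
        calc _ ≤ ((∫⁻ ω, f (z.1, z.2 - Y ω) ^ s ∂m) ^ (1 / s)) ^ s := ENNReal.rpow_le_rpow this hs0.le
          _ = _ := by rw [← ENNReal.rpow_mul, one_div_mul_cancel hs0.ne', ENNReal.rpow_one]
    _ = ∫⁻ ω, (∫⁻ z in Qb d a, f (z.1, z.2 - Y ω) ^ s) ∂m :=
        lintegral_lintegral_swap (hm.pow_const s).aemeasurable
    _ ≤ ∫⁻ ω, (∫⁻ z in Qb d (a + 1), f z ^ s) ∂m := by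
        refine lintegral_mono_ae (hY1.mono fun ω hω => ?_)
        rw [← lintegral_indicator (Qb_meas _), ← lintegral_indicator (Qb_meas _),
          ← lintegral_sub_right_eq_self ((Qb d (a + 1)).indicator _) ((0 : ℝ), Y ω)]
        refine lintegral_mono fun z => ?_
        by_cases hz : z ∈ Qb d a
        · have e : z - (0, Y ω) = (z.1, z.2 - Y ω) := by ext <;> simp
          rw [indicator_of_mem hz, e, indicator_of_mem]
          refine ⟨⟨by linarith [hz.1.1], by linarith [hz.1.2]⟩, ?_⟩
          have h2 := hz.2
          rw [mem_ball_zero_iff] at h2 ⊢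
          linarith [norm_sub_le z.2 (Y ω)]
        · simp [hz]
    _ = _ := by simp

lemma avg_nQ {Ω : Type*} [MeasurableSpace Ω] {m : Measure Ω} [IsProbabilityMeasure m] {Y : Ω → Spc d}
    (hY : Measurable Y) (hY1 : ∀ᵐ ω ∂m, ‖Y ω‖ ≤ 1) {s : ℝ} (hs : 1 ≤ s) (a : ℝ) {g G : Pt d → ℝ}
    (hG : Measurable G) (c : ℝ≥0) (h : ∀ z, ‖g z‖ₑ ≤ c * ∫⁻ ω, ‖G (z.1, z.2 - Y ω)‖ₑ ∂m) :
    nQ s a g ≤ c * nQ s (a + 1) G := by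
  have hs0 : 0 < s := by linarith
  rw [nQ_eq hs0, nQ_eq hs0]
  have h1 : ∫⁻ z in Qb d a, ‖g z‖ₑ ^ s ≤ (c : ℝ≥0∞) ^ s * ∫⁻ z in Qb d (a + 1), ‖G z‖ₑ ^ s := by
    refine le_trans ?_ (mul_le_mul' le_rfl (avg_int hY hY1 hs a hG.enorm))
    rw [← lintegral_const_mul' _ _ (by simp [hs0.le])]
    refine lintegral_mono fun z => ?_
    rw [← ENNReal.mul_rpow_of_nonneg _ _ hs0.le]
    exact ENNReal.rpow_le_rpow (h z) hs0.le
  refine (ENNReal.rpow_le_rpow h1 (by positivity)).trans (le_of_eq ?_)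
  rw [ENNReal.mul_rpow_of_nonneg _ _ (by positivity), ← ENNReal.rpow_mul, mul_one_div_cancel hs0.ne',
    ENNReal.rpow_one]

/-- the probability measure of a mollifier -/
def mkm (k : Spc d → ℝ) : Measure (Spc d) := volume.withDensity fun y => ENNReal.ofReal (k y)

lemma Mol.prob {h : ℝ} {k : Spc d → ℝ} (hk : Mol h k) : IsProbabilityMeasure (mkm k) := by
  constructor
  rw [mkm, withDensity_apply _ .univ, Measure.restrict_univ, ← ofReal_integral_eq_lintegral_ofReal
    (hk.sm.continuous.integrable_of_hasCompactSupport hk.cpt) (.of_forall hk.nn), hk.one, ENNReal.ofReal_one]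

lemma mk_int {h : ℝ} {k : Spc d → ℝ} (hk : Mol h k) {f : Spc d → ℝ≥0∞} (hf : Measurable f) :
    ∫⁻ y, f y ∂(mkm k) = ∫⁻ y, ENNReal.ofReal (k y) * f y := by
  rw [mkm, lintegral_withDensity_eq_lintegral_mul _ hk.sm.continuous.measurable.ennreal_ofReal hf]; rfl

lemma mk_ae {h : ℝ} {k : Spc d → ℝ} (hk : Mol h k) : ∀ᵐ y ∂(mkm k), ‖y‖ ≤ h := by
  rw [mkm, ae_withDensity_iff hk.sm.continuous.measurable.ennreal_ofReal]
  refine .of_forall fun y hy => ?_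
  by_contra h'
  exact hy (by rw [hk.sh y (not_le.1 h').le, ENNReal.ofReal_zero])

lemma T_nQ {h : ℝ} (h1 : h ≤ 1) {k : Spc d → ℝ} (hk : Mol h k) {s : ℝ} (hs : 1 ≤ s) (a : ℝ) {g : Pt d → ℝ}
    (hg : Measurable g) : nQ s a (T k g) ≤ nQ s (a + 1) g := by
  have := hk.prob
  have := avg_nQ (m := mkm k) (Y := id) measurable_id ((mk_ae hk).mono fun y hy => hy.trans h1) hs a hg 1
    (g := T k g) (fun z => by
      have hm : Measurable fun y => ‖g (z.1, z.2 - id y)‖ₑ := by fun_prop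
      rw [mk_int hk hm, ENNReal.coe_one, one_mul]
      refine (enorm_integral_le_lintegral_enorm _).trans (le_of_eq (lintegral_congr fun y => ?_))
      rw [enorm_mul, Real.enorm_of_nonneg (hk.nn y), id])
  simpa using this

/-- `1 - P` -/
def Rk (k : Spc d → ℝ) (u : Pt d → ℝ) (z : Pt d) : ℝ := u z - T k u z

lemma CinfC.Rk {k : Spc d → ℝ} (hk : Ker k) (h : CinfC u) : CinfC (Rk k u) := h.sub (h.T hk)

lemma T_meas {k : Spc d → ℝ} (hk : Ker k) {g : Pt d → ℝ} (hg : Measurable g) : Measurable (T k g) := by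
  have hm : Measurable fun p : Pt d × Spc d => k p.2 * g (p.1.1, p.1.2 - p.2) := by
    have := hk.sm.continuous.measurable
    fun_prop
  exact hm.stronglyMeasurable.integral_prod_right.measurable

lemma Rk_meas {k : Spc d → ℝ} (hk : Ker k) {g : Pt d → ℝ} (hg : Measurable g) : Measurable (Rk k g) :=
  hg.sub (T_meas hk hg)

lemma Rk_nQ {h : ℝ} (h1 : h ≤ 1) {k : Spc d → ℝ} (hk : Mol h k) {s : ℝ} (hs : 1 ≤ s) (a : ℝ) {g : Pt d → ℝ}
    (hg : Measurable g) : nQ s a (Rk k g) ≤ 2 * nQ s (a + 1) g := by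
  have : nQ s a (Rk k g) ≤ nQ s a g + nQ s a (T k g) :=
    eLpNorm_sub_le hg.aestronglyMeasurable (T_meas hk.toKer hg).aestronglyMeasurable (by simpa using hs)
  refine this.trans ?_
  rw [two_mul]
  exact add_le_add (nQ_mono (by linarith) g) (T_nQ h1 hk hs a hg)

lemma Dx_Rk {k : Spc d → ℝ} (hk : Ker k) (h : CinfC u) (i : Fin d) : Dx i (Rk k u) = Rk k (Dx i u) := by
  funext z
  rw [Dx_eq (h.Rk hk), show Rk k u = fun z => u z - T k u z from rfl, dv_sub h (h.T hk), dv_T hk h, ← Dx_eq h]; rfl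
lemma Dt_Rk {k : Spc d → ℝ} (hk : Ker k) (h : CinfC u) : Dt (Rk k u) = Rk k (Dt u) := by
  funext z
  rw [Dt_eq (h.Rk hk), show Rk k u = fun z => u z - T k u z from rfl, dv_sub h (h.T hk), dv_T hk h, ← Dt_eq h]; rfl
lemma Dxx_Rk {k : Spc d → ℝ} (hk : Ker k) (h : CinfC u) (i j : Fin d) : Dxx i j (Rk k u) = Rk k (Dxx i j u) := by
  rw [Dxx, Dx_Rk hk h, Dx_Rk hk (h.Dx j), Dxx]

lemma T_Lop {k : Spc d → ℝ} (hk : Ker k) (h : CinfC u) (σ : ℝ) (A : ℝ → Matrix (Fin d) (Fin d) ℝ) (z : Pt d) :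
    T k (Lop σ (fun z => A z.1) u) z = Lop σ (fun z => A z.1) (T k u) z := by
  have e : Lop σ (fun z => A z.1) (T k u) z = σ * T k (Dt u) z + ∑ i, ∑ j, A z.1 i j * T k (Dxx i j u) z := by
    simp only [Lop, Dt_T hk h, Dxx_T hk h]
  rw [e]
  simp only [T, Lop, mul_add, Finset.mul_sum]
  have i1 : Integrable fun y => k y * (σ * Dt u (z.1, z.2 - y)) :=
    ((T_int hk h.Dt.cont z).const_mul σ).congr (.of_forall fun y => by ring)
  have i2 : ∀ i j, Integrable fun y => k y * (A z.1 i j * Dxx i j u (z.1, z.2 - y)) := fun i j =>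
    ((T_int hk (h.Dxx i j).cont z).const_mul (A z.1 i j)).congr (.of_forall fun y => by ring)
  rw [integral_add i1 (integrable_finsetSum _ fun i _ => integrable_finsetSum _ fun j _ => i2 i j),
    integral_finsetSum _ fun i _ => integrable_finsetSum _ fun j _ => i2 i j]
  congr 1
  · rw [← integral_const_mul]; congr 1; ext y; ring
  · refine Finset.sum_congr rfl fun i _ => ?_
    rw [integral_finsetSum _ fun j _ => i2 i j]
    refine Finset.sum_congr rfl fun j _ => ?_
    rw [← integral_const_mul]; congr 1; ext y; ring

lemma Lop_Rk {k : Spc d → ℝ} (hk : Ker k) (h : CinfC u) (σ : ℝ) (A : ℝ → Matrix (Fin d) (Fin d) ℝ) :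
    Lop σ (fun z => A z.1) (Rk k u) = Rk k (Lop σ (fun z => A z.1) u) := by
  funext z
  rw [Rk, T_Lop hk h]
  simp only [Lop, Dt_Rk hk h, Dxx_Rk hk h, Rk, Dt_T hk h, Dxx_T hk h, mul_sub, Finset.sum_sub_distrib]
  ring

lemma seg_bd (h : CinfC u) (t : ℝ) (x y : Spc d) :
    ‖u (t, x) - u (t, x - y)‖ₑ ≤ ‖y‖ₑ * ∫⁻ θ in Ioc (0 : ℝ) 1, ‖∑ i, |Dx i u (t, x - θ • y)|‖ₑ := by
  have hw : Differentiable ℝ fun y => u (t, y) := h.diff.comp ((differentiable_const _).prodMk differentiable_id)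
  have hf : ∀ x y, fderiv ℝ (fun y => u (t, y)) x y = ∑ i, y i * Dx i u (t, x) := by
    intro x y
    have : y = ∑ i, y i • EuclideanSpace.single i (1 : ℝ) := by ext j; simp [Pi.single_apply]
    conv_lhs => rw [this]
    simp [Dx]
  have hd : ∀ θ : ℝ, HasDerivAt (fun θ : ℝ => u (t, x - θ • y)) (- ∑ i, y i * Dx i u (t, x - θ • y)) θ := by
    intro θ
    have := (hw (x - θ • y)).hasFDerivAt.comp_hasDerivAt θ (((hasDerivAt_id θ).smul_const y).const_sub x)
    rw [one_smul, map_neg, hf] at this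
    exact this
  have hc : Continuous fun θ : ℝ => - ∑ i, y i * Dx i u (t, x - θ • y) := by
    have := fun i => (h.Dx i).cont
    fun_prop
  have e := intervalIntegral.integral_eq_sub_of_hasDerivAt (a := 0) (b := 1) (fun θ _ => hd θ)
    (hc.intervalIntegrable _ _)
  simp only [one_smul, zero_smul, sub_zero] at e
  rw [← enorm_neg, neg_sub, ← e, intervalIntegral.integral_of_le (by norm_num)]
  refine (enorm_integral_le_lintegral_enorm _).trans ?_
  rw [← lintegral_const_mul' _ _ (by simp)]
  refine lintegral_mono fun θ => ?_
  rw [enorm_neg, ← ofReal_norm, ← ofReal_norm y, ← ofReal_norm (∑ i, |Dx i u (t, x - θ • y)|),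
    ← ENNReal.ofReal_mul (norm_nonneg _)]
  refine ENNReal.ofReal_le_ofReal ?_
  rw [Real.norm_of_nonneg (Finset.sum_nonneg fun i _ => abs_nonneg _), Finset.mul_sum]
  refine (norm_sum_le _ _).trans (Finset.sum_le_sum fun i _ => ?_)
  rw [norm_mul]
  exact mul_le_mul (PiLp.norm_apply_le y i) le_rfl (norm_nonneg _) (norm_nonneg _)

lemma nQ_sum_le {s : ℝ} (hs : 1 ≤ s) (a : ℝ) {ι : Type*} (S : Finset ι) {f : ι → Pt d → ℝ} (hf : ∀ i, Measurable (f i)) :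
    nQ s a (fun z => ∑ i ∈ S, f i z) ≤ ∑ i ∈ S, nQ s a (f i) := by
  have := eLpNorm_sum_le (μ := volume.restrict (Qb d a)) (s := S) (f := f) (p := ENNReal.ofReal s)
    (fun i _ => (hf i).aestronglyMeasurable) (by simpa using hs)
  have e : (fun z => ∑ i ∈ S, f i z) = ∑ i ∈ S, f i := by ext z; simp
  rw [e]; exact this

lemma Rk_grad {h : ℝ} (h1 : h ≤ 1) (h0 : 0 < h) {k : Spc d → ℝ} (hk : Mol h k) {s : ℝ} (hs : 1 ≤ s) (a : ℝ)
    (hu : CinfC u) : nQ s a (Rk k u) ≤ ENNReal.ofReal h * ∑ i, nQ s (a + 1) (Dx i u) := by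
  have := hk.prob
  have hmi : ∀ i, Measurable (Dx i u) := fun i => (hu.Dx i).cont.measurable
  have hG : Measurable fun z => ∑ i, |Dx i u z| := by fun_prop
  have hP : IsProbabilityMeasure (volume.restrict (Ioc (0 : ℝ) 1)) := ⟨by simp⟩
  have key := avg_nQ (m := (volume.restrict (Ioc (0 : ℝ) 1)).prod (mkm k)) (Y := fun p => p.1 • p.2) (by fun_prop)
    (by
      have e1 : ∀ᵐ p ∂((volume.restrict (Ioc (0 : ℝ) 1)).prod (mkm k)), p.1 ∈ Ioc (0 : ℝ) 1 :=
        Measure.quasiMeasurePreserving_fst.ae (ae_restrict_mem measurableSet_Ioc)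
      have e2 : ∀ᵐ p ∂((volume.restrict (Ioc (0 : ℝ) 1)).prod (mkm k)), ‖p.2‖ ≤ h :=
        Measure.quasiMeasurePreserving_snd.ae (mk_ae hk)
      filter_upwards [e1, e2] with p hp hp2
      rw [norm_smul, Real.norm_of_nonneg hp.1.le]
      exact mul_le_one₀ hp.2 (norm_nonneg _) (hp2.trans h1)) hs a hG h.toNNReal (g := Rk k u) (fun z => by
      have hm : Measurable fun p : ℝ × Spc d => ‖∑ i, |Dx i u (z.1, z.2 - p.1 • p.2)|‖ₑ := by fun_prop
      rw [lintegral_prod_symm _ hm.aemeasurable, mk_int hk (hm.lintegral_prod_left'),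
        ← lintegral_const_mul' _ _ (by simp)]
      have e : Rk k u z = ∫ y, k y * (u (z.1, z.2) - u (z.1, z.2 - y)) := by
        simp only [mul_sub]
        rw [integral_sub ((hk.sm.continuous.integrable_of_hasCompactSupport hk.cpt).mul_const _) (T_int hk.toKer hu.cont z),
          integral_mul_const, hk.one, one_mul]; rfl
      rw [e]
      refine (enorm_integral_le_lintegral_enorm _).trans (lintegral_mono fun y => ?_)
      rw [enorm_mul, Real.enorm_of_nonneg (hk.nn y), mul_left_comm]
      by_cases hy : h ≤ ‖y‖
      · simp [hk.sh y hy]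
      · refine mul_le_mul' le_rfl ((seg_bd hu _ _ _).trans (mul_le_mul' ?_ le_rfl))
        rw [← ofReal_norm]; exact ENNReal.ofReal_le_ofReal (not_le.1 hy).le)
  refine key.trans ?_
  refine mul_le_mul' le_rfl ((nQ_sum_le hs _ _ fun i => (hmi i).abs).trans (le_of_eq ?_))
  refine Finset.sum_congr rfl fun i _ => ?_
  exact eLpNorm_norm (Dx i u)
end

section
variable {d : ℕ} {u w : Pt d → ℝ}

lemma Qb_eq (a : ℝ) : Qb d a = ball (0 : Pt d) a := by
  rw [Qb, show (0 : Pt d) = ((0 : ℝ), (0 : Spc d)) from rfl, ← ball_prod_same, Real.ball_eq_Ioo]; simp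

lemma cutoff {a : ℝ} (ha : 0 < a) : ∃ ζ : Pt d → ℝ, CinfC ζ ∧ (∀ z ∈ Qb d a, ζ z = 1) ∧
    ∀ z, z ∉ closedBall (0 : Pt d) (a + 1) → ζ z = 0 := by
  let f : ContDiffBump (0 : Pt d) := ⟨a, a + 1, ha, by linarith⟩
  refine ⟨f, ⟨f.contDiff, f.hasCompactSupport⟩, fun z hz => f.one_of_mem_closedBall ?_, fun z hz => f.zero_of_le_dist ?_⟩
  · rw [Qb_eq] at hz; exact ball_subset_closedBall hz
  · rw [mem_closedBall, not_le] at hz; exact hz.le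

lemma dv_congr {v : Pt d} {z : Pt d} (h : u =ᶠ[nhds z] w) : dv v u =ᶠ[nhds z] dv v w := by
  filter_upwards [h.fderiv (𝕜 := ℝ)] with y hy
  rw [dv, dv, hy]

lemma Dxx_congr (hu : CinfC u) (hw : CinfC w) {z : Pt d} (h : u =ᶠ[nhds z] w) (i j : Fin d) :
    Dxx i j u z = Dxx i j w z := by
  rw [Dxx_eq hu, Dxx_eq hw]; exact (dv_congr (dv_congr h)).eq_of_nhds

lemma Dt_congr (hu : CinfC u) (hw : CinfC w) {z : Pt d} (h : u =ᶠ[nhds z] w) : Dt u z = Dt w z := by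
  rw [Dt_eq hu, Dt_eq hw]; exact (dv_congr h).eq_of_nhds

lemma CinfC.bd (h : CinfC u) : ∃ K : ℝ, 0 ≤ K ∧ ∀ z, |u z| ≤ K := by
  obtain ⟨K, hK⟩ := h.cont.bounded_above_of_compact_support h.2
  exact ⟨max K 0, le_max_right _ _, fun z => (hK z).trans (le_max_left _ _)⟩

lemma Dxx_mul (h : CinfC w) (k : CinfC u) (i j : Fin d) (z) : Dxx i j (fun z => w z * u z) z =
    w z * Dxx i j u z + (Dx i w z * Dx j u z + Dx j w z * Dx i u z) + Dxx i j w z * u z := by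
  have e : Dx j (fun z => w z * u z) = fun z => w z * Dx j u z + Dx j w z * u z := by
    funext z; rw [Dx_mul h k]
  rw [Dxx, e, Dx_eq ((h.mul (k.Dx j)).add ((h.Dx j).mul k)), dv_add (h.mul (k.Dx j)) ((h.Dx j).mul k),
    ← Dx_eq (h.mul (k.Dx j)), ← Dx_eq ((h.Dx j).mul k), Dx_mul h (k.Dx j), Dx_mul (h.Dx j) k, Dxx, Dxx]
  ring

lemma Lop_mul (h : CinfC w) (k : CinfC u) (σ : ℝ) (a : Pt d → Matrix (Fin d) (Fin d) ℝ) (z) :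
    Lop σ a (fun z => w z * u z) z = w z * Lop σ a u z +
      (∑ i, ∑ j, a z i j * (Dx i w z * Dx j u z + Dx j w z * Dx i u z)) + Lop σ a w z * u z := by
  simp only [Lop, Dxx_mul h k, Dt_mul h k, mul_add, Finset.sum_add_distrib, add_mul, Finset.sum_mul, Finset.mul_sum]
  have e : ∀ i j, a z i j * (w z * Dxx i j u z) = w z * (a z i j * Dxx i j u z) := fun i j => by ring
  have e' : ∀ i j, a z i j * (Dxx i j w z * u z) = a z i j * Dxx i j w z * u z := fun i j => by ring
  simp only [e, e']
  ring

lemma Lop_meas (h : CinfC u) (σ : ℝ) {a : Pt d → Matrix (Fin d) (Fin d) ℝ} (ha : Measurable a) :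
    Measurable (Lop σ a u) := by
  have h1 := h.Dt.cont.measurable
  have h2 := fun i j => (h.Dxx i j).cont.measurable
  have h3 := fun i j => meas_entry ha i j
  unfold Lop
  fun_prop

lemma Lop_congr (hu : CinfC u) (hw : CinfC w) {z : Pt d} (h : u =ᶠ[nhds z] w) (σ : ℝ)
    (a : Pt d → Matrix (Fin d) (Fin d) ℝ) : Lop σ a u z = Lop σ a w z := by
  simp only [Lop, Dt_congr hu hw h, Dxx_congr hu hw h]

lemma Lop_zero (σ : ℝ) (a : Pt d → Matrix (Fin d) (Fin d) ℝ) (z) : Lop σ a (fun _ => 0) z = 0 := by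
  simp [Lop, Dt, Dxx, Dx]

lemma nQ_abs (s a : ℝ) (f : Pt d → ℝ) : nQ s a (fun z => |f z|) = nQ s a f := eLpNorm_norm f

set_option maxHeartbeats 800000 in
lemma loc_est {δ : ℝ} (hδ : 0 < δ) {s : ℝ} (hs : 1 ≤ s) (H : HS d δ (ENNReal.ofReal s)) {a : ℝ} (ha : 0 < a) :
    ∃ N : ℝ≥0, ∀ σ : ℝ, σ ^ 2 = 1 → ∀ A : ℝ → Matrix (Fin d) (Fin d) ℝ, Measurable A →
    (∀ t, inS d δ (A t)) → ∀ v : Pt d → ℝ, CinfC v →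
    ∑ i, ∑ j, nQ s a (Dxx i j v) ≤ N * (nQ s (a + 2) (Lop σ (fun z => A z.1) v) +
      (∑ i, nQ s (a + 2) (Dx i v)) + nQ s (a + 2) v) := by
  obtain ⟨N, hN⟩ := H
  obtain ⟨ζ, hζ, h1, h2⟩ := cutoff (d := d) ha
  obtain ⟨Kz, kz0, hKz⟩ := hζ.bd
  obtain ⟨Kt, kt0, hKt⟩ := hζ.Dt.bd
  choose Kx kx0 hKx using fun i => (hζ.Dx i).bd
  choose Kxx kxx0 hKxx using fun i j => (hζ.Dxx i j).bd
  set P := ∑ i, Kx i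
  set S := ∑ i, ∑ j, Kxx i j
  have P0 : 0 ≤ P := Finset.sum_nonneg fun i _ => kx0 i
  have S0 : 0 ≤ S := Finset.sum_nonneg fun i _ => Finset.sum_nonneg fun j _ => kxx0 i j
  have hP : ∀ i z, |Dx i ζ z| ≤ P := fun i z =>
    (hKx i z).trans (Finset.single_le_sum (f := Kx) (fun i _ => kx0 i) (Finset.mem_univ i))
  have hδ' : 0 ≤ δ⁻¹ := by positivity
  set K := Kz + δ⁻¹ * P * (2 * d) + (Kt + δ⁻¹ * S)
  have e1 : 0 ≤ δ⁻¹ * P * (2 * d) := by positivity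
  have e2 : 0 ≤ δ⁻¹ * S := by positivity
  refine ⟨(d * d : ℕ) * (N * K.toNNReal), fun σ hσ A hA hS v hv => ?_⟩
  have hσ1 : |σ| = 1 := by rw [← sq_eq_sq₀ (abs_nonneg _) zero_le_one, sq_abs, hσ, one_pow]
  have hwv := hζ.mul hv
  have pw : ∀ z, ‖Lop σ (fun z => A z.1) (fun z => ζ z * v z) z‖ ≤ K * ‖(Qb d (a + 2)).indicator
      (fun z => |Lop σ (fun z => A z.1) v z| + (∑ i, |Dx i v z|) + |v z|) z‖ := by
    intro z
    by_cases hz : z ∈ Qb d (a + 2)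
    · have s0 : 0 ≤ ∑ i, |Dx i v z| := Finset.sum_nonneg fun i _ => abs_nonneg _
      rw [indicator_of_mem hz, Lop_mul hζ hv, Real.norm_of_nonneg (add_nonneg (add_nonneg (abs_nonneg _) s0) (abs_nonneg _)), Real.norm_eq_abs]
      have b1 : |ζ z * Lop σ (fun z => A z.1) v z| ≤ Kz * |Lop σ (fun z => A z.1) v z| := by
        rw [abs_mul]; gcongr; exact hKz z
      have b2 : |∑ i, ∑ j, A z.1 i j * (Dx i ζ z * Dx j v z + Dx j ζ z * Dx i v z)| ≤
          δ⁻¹ * P * (2 * d) * ∑ i, |Dx i v z| := by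
        calc _ ≤ ∑ i, ∑ j, δ⁻¹ * (P * |Dx j v z| + P * |Dx i v z|) := by
              refine (Finset.abs_sum_le_sum_abs _ _).trans (Finset.sum_le_sum fun i _ =>
                (Finset.abs_sum_le_sum_abs _ _).trans (Finset.sum_le_sum fun j _ => ?_))
              rw [abs_mul]
              refine mul_le_mul ((hS z.1).bdd hδ i j) ((abs_add_le _ _).trans ?_) (abs_nonneg _) hδ'
              rw [abs_mul, abs_mul]
              gcongr <;> exact hP _ z
          _ = _ := by
              simp only [← Finset.mul_sum, Finset.sum_add_distrib, Finset.sum_const, Finset.card_univ, Fintype.card_fin,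
                nsmul_eq_mul]
              ring
      have b3 : |Lop σ (fun z => A z.1) ζ z * v z| ≤ (Kt + δ⁻¹ * S) * |v z| := by
        rw [abs_mul]
        gcongr
        refine (abs_add_le _ _).trans (add_le_add ?_ ?_)
        · rw [abs_mul, hσ1, one_mul]; exact hKt z
        · rw [Finset.mul_sum]
          refine (Finset.abs_sum_le_sum_abs _ _).trans (Finset.sum_le_sum fun i _ => ?_)
          rw [Finset.mul_sum]
          refine (Finset.abs_sum_le_sum_abs _ _).trans (Finset.sum_le_sum fun j _ => ?_)
          rw [abs_mul]
          exact mul_le_mul ((hS z.1).bdd hδ i j) (hKxx i j z) (abs_nonneg _) hδ'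
      refine (abs_add_le _ _).trans ((add_le_add (abs_add_le _ _) le_rfl).trans
        ((add_le_add (add_le_add b1 b2) b3).trans ?_))
      rw [mul_add, mul_add]
      gcongr
      · simp only [K]; linarith
      · simp only [K]; linarith
      · simp only [K]; linarith
    · rw [indicator_of_notMem hz, norm_zero, mul_zero, Lop_congr hwv CinfC.zero (z := z), Lop_zero, norm_zero]
      have hz2 : z ∈ (closedBall (0 : Pt d) (a + 1))ᶜ := by
        intro h; rw [Qb_eq] at hz
        exact hz (closedBall_subset_ball (by linarith) h)
      filter_upwards [isClosed_closedBall.isOpen_compl.mem_nhds hz2] with y hy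
      rw [h2 y hy, zero_mul]
  have hLm := Lop_meas hv σ (hA.comp measurable_fst)
  have hmi : ∀ i, Measurable (Dx i v) := fun i => (hv.Dx i).cont.measurable
  have hvm := hv.cont.measurable
  have hs' : 1 ≤ ENNReal.ofReal s := by simpa using hs
  have key : eLpNorm (Lop σ (fun z => A z.1) (fun z => ζ z * v z)) (ENNReal.ofReal s) volume ≤ K.toNNReal *
      (nQ s (a + 2) (Lop σ (fun z => A z.1) v) + (∑ i, nQ s (a + 2) (Dx i v)) + nQ s (a + 2) v) := by
    refine (eLpNorm_le_nnreal_smul_eLpNorm_of_ae_le_mul (c := K.toNNReal) (g := (Qb d (a + 2)).indicator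
      (fun z => |Lop σ (fun z => A z.1) v z| + (∑ i, |Dx i v z|) + |v z|)) (.of_forall fun z => ?_) _).trans ?_
    · rw [← NNReal.coe_le_coe]
      refine (pw z).trans ?_
      rw [NNReal.coe_mul]
      gcongr
      · exact Real.le_coe_toNNReal K
      · rfl
    · rw [ENNReal.smul_def, smul_eq_mul, eLpNorm_indicator_eq_eLpNorm_restrict (Qb_meas _)]
      refine mul_le_mul' le_rfl ((eLpNorm_add_le ?_ ?_ hs').trans (add_le_add
        ((eLpNorm_add_le ?_ ?_ hs').trans (add_le_add ?_ ?_)) ?_))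
      · exact (hLm.abs.add (Finset.univ.measurable_sum fun i _ => (hmi i).abs)).aestronglyMeasurable
      · exact hvm.abs.aestronglyMeasurable
      · exact hLm.abs.aestronglyMeasurable
      · exact (Finset.univ.measurable_sum fun i _ => (hmi i).abs).aestronglyMeasurable
      · exact (nQ_abs s (a + 2) (Lop σ (fun z => A z.1) v)).le
      · refine (nQ_sum_le hs _ _ fun i => (hmi i).abs).trans (Finset.sum_le_sum fun i _ => ?_)
        exact (nQ_abs s (a + 2) (Dx i v)).le
      · exact (nQ_abs s (a + 2) v).le
  have e : ∀ i j, nQ s a (Dxx i j v) ≤ N * (K.toNNReal *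
      (nQ s (a + 2) (Lop σ (fun z => A z.1) v) + (∑ i, nQ s (a + 2) (Dx i v)) + nQ s (a + 2) v)) := by
    intro i j
    refine le_trans ?_ ((hN σ hσ A hA hS _ hwv i j).trans (mul_le_mul' le_rfl key))
    refine le_trans (le_of_eq ?_) (eLpNorm_mono_measure _ (Measure.restrict_le_self (s := Qb d a)))
    refine eLpNorm_congr_ae ((ae_restrict_iff' (Qb_meas _)).2 (.of_forall fun z hz => ?_))
    refine Dxx_congr hv hwv ?_ i j
    rw [Qb_eq] at hz
    filter_upwards [isOpen_ball.mem_nhds hz] with y hy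
    rw [h1 y (by rw [Qb_eq]; exact hy), one_mul]
  refine (Finset.sum_le_sum fun i _ => Finset.sum_le_sum fun j _ => e i j).trans (le_of_eq ?_)
  simp only [Finset.sum_const, Finset.card_univ, Fintype.card_fin, nsmul_eq_mul]
  push_cast
  ring

lemma one_step {δ : ℝ} (hδ : 0 < δ) {s : ℝ} (hs : 1 ≤ s) (H : HS d δ (ENNReal.ofReal s)) {a : ℝ} (ha : 0 < a) :
    ∃ N : ℝ≥0, ∀ h : ℝ, 0 < h → h ≤ 1 → ∀ k : Spc d → ℝ, Mol h k →
    ∀ σ : ℝ, σ ^ 2 = 1 → ∀ A : ℝ → Matrix (Fin d) (Fin d) ℝ, Measurable A →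
    (∀ t, inS d δ (A t)) → ∀ u : Pt d → ℝ, CinfC u →
    ∑ i, ∑ j, nQ s a (Dxx i j (Rk k (Rk k u))) ≤ N * (nQ s (a + 4) (Lop σ (fun z => A z.1) u) +
      ENNReal.ofReal h * ∑ i, ∑ j, nQ s (a + 4) (Dxx i j u)) := by
  obtain ⟨N, hN⟩ := loc_est hδ hs H ha
  refine ⟨4 * N, fun h h0 h1 k hk σ hσ A hA hS u hu => ?_⟩
  have hK := hk.toKer
  have hv := (hu.Rk hK)
  refine (hN σ hσ A hA hS _ (hv.Rk hK)).trans ?_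
  have hLm := Lop_meas hu σ (hA.comp measurable_fst)
  set X := nQ s (a + 4) (Lop σ (fun z => A z.1) u)
  set Y := ∑ i, ∑ j, nQ s (a + 4) (Dxx i j u)
  have hh1 : ENNReal.ofReal h ≤ 1 := by simpa using h1
  have c1 : nQ s (a + 2) (Lop σ (fun z => A z.1) (Rk k (Rk k u))) ≤ 4 * X := by
    rw [Lop_Rk hK hv, Lop_Rk hK hu]
    refine (Rk_nQ h1 hk hs _ (Rk_meas hK hLm)).trans ?_
    refine (mul_le_mul' le_rfl (Rk_nQ h1 hk hs _ hLm)).trans ?_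
    rw [← mul_assoc, show a + 2 + 1 + 1 = a + 4 by ring]
    norm_num
    exact le_rfl
  have c2 : ∑ j, nQ s (a + 2) (Dx j (Rk k (Rk k u))) ≤ 2 * (ENNReal.ofReal h * Y) := by
    have e : ∀ j, nQ s (a + 2) (Dx j (Rk k (Rk k u))) ≤ ∑ i, 2 * (ENNReal.ofReal h * nQ s (a + 4) (Dxx i j u)) := by
      intro j
      rw [Dx_Rk hK hv, Dx_Rk hK hu]
      refine (Rk_grad h1 h0 hk hs _ ((hu.Dx j).Rk hK)).trans ?_
      rw [Finset.mul_sum]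
      refine Finset.sum_le_sum fun i _ => ?_
      rw [mul_left_comm]
      refine mul_le_mul' le_rfl ?_
      rw [Dx_Rk hK (hu.Dx j), show a + 4 = a + 2 + 1 + 1 by ring]
      exact Rk_nQ h1 hk hs _ (hu.Dxx i j).cont.measurable
    refine (Finset.sum_le_sum fun j _ => e j).trans ?_
    rw [Finset.sum_comm]
    simp only [← Finset.mul_sum]
    exact le_rfl
  have c3 : nQ s (a + 2) (Rk k (Rk k u)) ≤ ENNReal.ofReal h * Y := by
    refine (Rk_grad h1 h0 hk hs _ hv).trans (mul_le_mul' le_rfl ?_)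
    have e : ∀ j, nQ s (a + 2 + 1) (Dx j (Rk k u)) ≤ ∑ i, nQ s (a + 4) (Dxx i j u) := by
      intro j
      rw [Dx_Rk hK hu]
      refine (Rk_grad h1 h0 hk hs _ (hu.Dx j)).trans ?_
      refine (mul_le_mul' hh1 le_rfl).trans ?_
      rw [one_mul, show a + 2 + 1 + 1 = a + 4 by ring]
      exact le_rfl
    refine (Finset.sum_le_sum fun j _ => e j).trans ?_
    rw [Finset.sum_comm]
  refine (mul_le_mul' le_rfl (add_le_add (add_le_add c1 c2) c3)).trans ?_
  set Z := ENNReal.ofReal h * Y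
  calc _ = N * (4 * X + 3 * Z) := by ring
    _ ≤ N * (4 * X + 4 * Z) := by gcongr; norm_num
    _ = _ := by push_cast; ring

lemma CinfC.iter {k : Spc d → ℝ} (hk : Ker k) (n : ℕ) (h : CinfC u) : CinfC ((_root_.Rk k)^[n] u) := by
  induction n generalizing u with
  | zero => exact h
  | succ n ih => exact ih (h.Rk hk)

lemma many_step {δ : ℝ} (hδ : 0 < δ) {s : ℝ} (hs : 1 ≤ s) (H : HS d δ (ENNReal.ofReal s)) {a : ℝ} (ha : 0 < a) (m : ℕ) :
    ∃ N : ℝ≥0, ∃ M : ℝ, a ≤ M ∧ ∀ h : ℝ, 0 < h → h ≤ 1 → ∀ k : Spc d → ℝ, Mol h k →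
    ∀ σ : ℝ, σ ^ 2 = 1 → ∀ A : ℝ → Matrix (Fin d) (Fin d) ℝ, Measurable A →
    (∀ t, inS d δ (A t)) → ∀ u : Pt d → ℝ, CinfC u →
    ∑ i, ∑ j, nQ s a (Dxx i j ((Rk k)^[2 * m] u)) ≤ N * (nQ s M (Lop σ (fun z => A z.1) u) +
      ENNReal.ofReal h ^ m * ∑ i, ∑ j, nQ s M (Dxx i j u)) := by
  induction m with
  | zero =>
    refine ⟨1, a, le_rfl, fun h h0 h1 k hk σ hσ A hA hS u hu => ?_⟩
    simp
  | succ m ih =>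
    obtain ⟨N, M, hM, hN⟩ := ih
    obtain ⟨N', hN'⟩ := one_step hδ hs H (ha.trans_le hM)
    refine ⟨N * (4 + N'), M + 4, by linarith, fun h h0 h1 k hk σ hσ A hA hS u hu => ?_⟩
    have hK := hk.toKer
    have hv := (hu.Rk hK)
    have hLm := Lop_meas hu σ (hA.comp measurable_fst)
    have hh1 : ENNReal.ofReal h ≤ 1 := by simpa using h1
    refine (hN h h0 h1 k hk σ hσ A hA hS _ (hv.Rk hK)).trans ?_
    set X := nQ s (M + 4) (Lop σ (fun z => A z.1) u)
    set Y := ∑ i, ∑ j, nQ s (M + 4) (Dxx i j u)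
    have c1 : nQ s M (Lop σ (fun z => A z.1) (Rk k (Rk k u))) ≤ 4 * X := by
      rw [Lop_Rk hK hv, Lop_Rk hK hu]
      refine (Rk_nQ h1 hk hs _ (Rk_meas hK hLm)).trans ?_
      refine (mul_le_mul' le_rfl (Rk_nQ h1 hk hs _ hLm)).trans ?_
      rw [← mul_assoc]
      refine (mul_le_mul' (by norm_num) (nQ_mono (by linarith) _))
    refine (mul_le_mul' le_rfl (add_le_add c1 (mul_le_mul' le_rfl
      (hN' h h0 h1 k hk σ hσ A hA hS u hu)))).trans ?_
    rw [ENNReal.coe_mul, mul_assoc]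
    refine mul_le_mul' le_rfl ?_
    push_cast
    calc 4 * X + ENNReal.ofReal h ^ m * (N' * (X + ENNReal.ofReal h * Y))
        = 4 * X + N' * (ENNReal.ofReal h ^ m * X) + N' * (ENNReal.ofReal h ^ (m + 1) * Y) := by ring
      _ ≤ 4 * X + N' * (1 * X) + (N' * (ENNReal.ofReal h ^ (m + 1) * Y) + 4 * (ENNReal.ofReal h ^ (m + 1) * Y)) := by
        refine add_le_add (add_le_add le_rfl (mul_le_mul' le_rfl (mul_le_mul' (pow_le_one' hh1 m) le_rfl))) le_self_add
      _ = _ := by ring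

lemma iter_nQ {h : ℝ} (h1 : h ≤ 1) {k : Spc d → ℝ} (hk : Mol h k) {s : ℝ} (hs : 1 ≤ s) (a : ℝ) (n : ℕ) {g : Pt d → ℝ}
    (hg : Measurable g) : nQ s a ((Rk k)^[n] g) ≤ 2 ^ n * nQ s (a + n) g := by
  induction n generalizing g with
  | zero => simp
  | succ n ih =>
    refine (ih (Rk_meas hk.toKer hg)).trans ?_
    rw [pow_succ, mul_assoc, show a + ((n + 1 : ℕ) : ℝ) = a + n + 1 by push_cast; ring]
    exact mul_le_mul' le_rfl (Rk_nQ h1 hk hs _ hg)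

lemma iter_Dxx {k : Spc d → ℝ} (hk : Ker k) (n : ℕ) (h : CinfC u) (i j : Fin d) :
    Dxx i j ((Rk k)^[n] u) = (Rk k)^[n] (Dxx i j u) := by
  induction n generalizing u with
  | zero => rfl
  | succ n ih => rw [Function.iterate_succ_apply, ih (h.Rk hk), Dxx_Rk hk h]; rfl

lemma iter_Lop {k : Spc d → ℝ} (hk : Ker k) (n : ℕ) (h : CinfC u) (σ : ℝ) (A : ℝ → Matrix (Fin d) (Fin d) ℝ) :
    Lop σ (fun z => A z.1) ((Rk k)^[n] u) = (Rk k)^[n] (Lop σ (fun z => A z.1) u) := by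
  induction n generalizing u with
  | zero => rfl
  | succ n ih => rw [Function.iterate_succ_apply, ih (h.Rk hk), Lop_Rk hk h]; rfl
end

section
variable {d : ℕ} {u w : Pt d → ℝ}

lemma ftc_t (h : CinfC u) (x : Spc d) {a b t τ : ℝ} (ht : t ∈ Icc a b) (hτ : τ ∈ Icc a b) :
    ‖u (t, x) - u (τ, x)‖ₑ ≤ ∫⁻ r in Icc a b, ‖Dt u (r, x)‖ₑ := by
  have hd : ∀ r : ℝ, HasDerivAt (fun r : ℝ => u (r, x)) (Dt u (r, x)) r := fun r => by
    have : Differentiable ℝ fun r : ℝ => u (r, x) := h.diff.comp (differentiable_id.prodMk (differentiable_const _))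
    exact (this r).hasDerivAt
  have hc : Continuous fun r : ℝ => Dt u (r, x) := by have := h.Dt.cont; fun_prop
  rw [← intervalIntegral.integral_eq_sub_of_hasDerivAt (fun θ _ => hd θ) (hc.intervalIntegrable _ _),
    ← enorm_norm, intervalIntegral.norm_integral_eq_norm_integral_uIoc, enorm_norm]
  refine (enorm_integral_le_lintegral_enorm _).trans (lintegral_mono_set ?_)
  exact uIoc_subset_uIcc.trans (uIcc_subset_Icc hτ ht)

lemma slice_le {g : Pt d → ℝ} (hg : Measurable g) {x : Spc d} (hx : ‖x‖ ≤ 1) {a b : ℝ} (ha : -1 ≤ a) (hb : b ≤ 1) :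
    ∫⁻ t in Icc a b, ∫⁻ y in ball x 1, ‖g (t, y)‖ₑ ≤ nQ 1 2 g := by
  rw [nQ_eq one_pos]
  simp only [ENNReal.rpow_one, div_one]
  have hm : Measurable fun z => ‖g z‖ₑ := by fun_prop
  have e := setLIntegral_prod (μ := (volume : Measure ℝ)) (ν := (volume : Measure (Spc d))) (s := Icc a b) (t := ball x 1)
    (fun z => ‖g z‖ₑ) hm.aemeasurable
  rw [← e]
  refine lintegral_mono_set (prod_mono (fun t ht => ⟨?_, ?_⟩) (ball_subset_ball' ?_))
  · linarith [ht.1]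
  · linarith [ht.2]
  · rw [dist_zero_right]; linarith

lemma Dt_TD {κ : Spc d → ℝ} (hκ : Ker κ) {σ : ℝ} (hσ : σ ^ 2 = 1) (A : ℝ → Matrix (Fin d) (Fin d) ℝ) {δ : ℝ} (hδ : 0 < δ)
    (hS : ∀ t, inS d δ (A t)) {W : Pt d → ℝ} (hW : CinfC W) {K : ℝ} (i j : Fin d) (hK : ∀ y, |pd j (pd i κ) y| ≤ K) (z : Pt d) :
    ‖Dt (T κ (Dxx i j W)) z‖ₑ ≤ (ENNReal.ofReal K * ∫⁻ y in ball z.2 1, ‖Lop σ (fun z => A z.1) W (z.1, y)‖ₑ) +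
      ENNReal.ofReal δ⁻¹ * ∑ k, ∑ l, ‖T (pd j (pd i κ)) (Dxx k l W) z‖ₑ := by
  have hκ' := (hκ.pd i).pd j
  set κ' := pd j (pd i κ)
  have e1 : Dt (T κ (Dxx i j W)) = Dt (T κ' W) := by
    rw [Dt_T hκ (hW.Dxx i j), Dxx, Dt_Dx (hW.Dx j), Dt_Dx hW, T_ibp hκ (hW.Dt.Dx j), T_ibp (hκ.pd i) hW.Dt, Dt_T hκ' hW]
  have hσ1 : |σ| = 1 := by rw [← sq_eq_sq₀ (abs_nonneg _) zero_le_one, sq_abs, hσ, one_pow]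
  have hσe : ‖σ‖ₑ = 1 := by rw [← ofReal_norm, Real.norm_eq_abs, hσ1, ENNReal.ofReal_one]
  have e2 : σ * Dt (T κ' W) z = T κ' (Lop σ (fun z => A z.1) W) z - ∑ k, ∑ l, A z.1 k l * T κ' (Dxx k l W) z := by
    rw [T_Lop hκ' hW]; simp only [Lop, Dxx_T hκ' hW]; ring
  calc ‖Dt (T κ (Dxx i j W)) z‖ₑ = ‖σ * Dt (T κ' W) z‖ₑ := by rw [e1, enorm_mul, hσe, one_mul]
    _ ≤ ‖T κ' (Lop σ (fun z => A z.1) W) z‖ₑ + ‖∑ k, ∑ l, A z.1 k l * T κ' (Dxx k l W) z‖ₑ := by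
      rw [e2]; exact enorm_sub_le
    _ ≤ _ := by
      refine add_le_add (T_bd hκ' hK _ z) ?_
      rw [Finset.mul_sum]
      refine (enorm_sum_le _ _).trans (Finset.sum_le_sum fun k _ => ?_)
      rw [Finset.mul_sum]
      refine (enorm_sum_le _ _).trans (Finset.sum_le_sum fun l _ => ?_)
      rw [enorm_mul]
      refine mul_le_mul' ?_ le_rfl
      rw [← ofReal_norm]
      exact ENNReal.ofReal_le_ofReal ((hS z.1).bdd hδ k l)

lemma T_sup {κ : Spc d → ℝ} (hκ : Ker κ) {σ : ℝ} (hσ : σ ^ 2 = 1) {A : ℝ → Matrix (Fin d) (Fin d) ℝ} (hA : Measurable A)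
    {δ : ℝ} (hδ : 0 < δ)
    (hS : ∀ t, inS d δ (A t)) {W : Pt d → ℝ} (hW : CinfC W) {K : ℝ} (i j : Fin d) (hK0 : ∀ y, |κ y| ≤ K)
    (hK : ∀ y, |pd j (pd i κ) y| ≤ K) {t : ℝ} (ht : t ∈ Icc (-1 : ℝ) 1) {x : Spc d} (hx : ‖x‖ ≤ 1) :
    ‖T κ (Dxx i j W) (t, x)‖ₑ ≤ ENNReal.ofReal K * ENNReal.ofReal (1 + δ⁻¹) * (nQ 1 2 (Lop σ (fun z => A z.1) W) +
      ∑ k, ∑ l, nQ 1 2 (Dxx k l W)) := by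
  have hκ' := (hκ.pd i).pd j
  have hC := (hW.Dxx i j).T hκ
  have hm : ∀ k l, Measurable (Dxx k l W) := fun k l => (hW.Dxx k l).cont.measurable
  have hLm : Measurable (Lop σ (fun z => A z.1) W) := Lop_meas hW σ (hA.comp measurable_fst)
  have hsl : ∀ {g : Pt d → ℝ}, Measurable g → Measurable fun r : ℝ => ∫⁻ y in ball x 1, ‖g (r, y)‖ₑ := by
    intro g hg
    have : Measurable fun p : ℝ × Spc d => ‖g p‖ₑ := by fun_prop
    exact this.lintegral_prod_right'
  set κ' := pd j (pd i κ)
  set F := Lop σ (fun z => A z.1) W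
  set X := nQ 1 2 F
  set Y := ∑ k, ∑ l, nQ 1 2 (Dxx k l W)
  have b1 : ∫⁻ r in Icc (-1 : ℝ) 1, ‖Dt (T κ (Dxx i j W)) (r, x)‖ₑ ≤ ENNReal.ofReal K * X +
      ENNReal.ofReal δ⁻¹ * (ENNReal.ofReal K * Y) := by
    calc _ ≤ ∫⁻ r in Icc (-1 : ℝ) 1, ((ENNReal.ofReal K * ∫⁻ y in ball x 1, ‖F (r, y)‖ₑ) +
          ENNReal.ofReal δ⁻¹ * ∑ k, ∑ l, ENNReal.ofReal K * ∫⁻ y in ball x 1, ‖Dxx k l W (r, y)‖ₑ) := by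
          refine lintegral_mono fun r => (Dt_TD hκ hσ A hδ hS hW i j hK (r, x)).trans
            (add_le_add le_rfl (mul_le_mul' le_rfl ?_))
          exact Finset.sum_le_sum fun k _ => Finset.sum_le_sum fun l _ => T_bd hκ' hK _ _
      _ = (ENNReal.ofReal K * ∫⁻ r in Icc (-1 : ℝ) 1, ∫⁻ y in ball x 1, ‖F (r, y)‖ₑ) +
          ENNReal.ofReal δ⁻¹ * ∑ k, ∑ l, ENNReal.ofReal K * ∫⁻ r in Icc (-1 : ℝ) 1, ∫⁻ y in ball x 1, ‖Dxx k l W (r, y)‖ₑ := by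
          rw [lintegral_add_left ((hsl hLm).const_mul _), lintegral_const_mul' _ _ (by simp), lintegral_const_mul' _ _ (by simp),
            lintegral_finsetSum _ fun k _ => Finset.univ.measurable_sum fun l _ => (hsl (hm k l)).const_mul _]
          congr 2
          refine Finset.sum_congr rfl fun k _ => ?_
          rw [lintegral_finsetSum _ fun l _ => (hsl (hm k l)).const_mul _]
          refine Finset.sum_congr rfl fun l _ => ?_
          rw [lintegral_const_mul' _ _ (by simp)]
      _ ≤ _ := by
          simp only [← Finset.mul_sum]
          refine add_le_add (mul_le_mul' le_rfl (slice_le hLm hx le_rfl le_rfl)) (mul_le_mul' le_rfl (mul_le_mul' le_rfl ?_))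
          exact Finset.sum_le_sum fun k _ => Finset.sum_le_sum fun l _ => slice_le (hm k l) hx le_rfl le_rfl
  have b2 : ∫⁻ r in Icc (-1 : ℝ) 1, ‖T κ (Dxx i j W) (r, x)‖ₑ ≤ ENNReal.ofReal K * Y := by
    calc _ ≤ ∫⁻ r in Icc (-1 : ℝ) 1, ENNReal.ofReal K * ∫⁻ y in ball x 1, ‖Dxx i j W (r, y)‖ₑ :=
          lintegral_mono fun r => T_bd hκ hK0 _ (r, x)
      _ ≤ _ := by
          rw [lintegral_const_mul' _ _ (by simp)]
          refine mul_le_mul' le_rfl ((slice_le (hm i j) hx le_rfl le_rfl).trans ?_)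
          refine le_trans ?_ (Finset.single_le_sum (f := fun k => ∑ l, nQ 1 2 (Dxx k l W)) (fun _ _ => zero_le)
            (Finset.mem_univ i))
          exact Finset.single_le_sum (f := fun l => nQ 1 2 (Dxx i l W)) (fun _ _ => zero_le) (Finset.mem_univ j)
  set Z := ∫⁻ r in Icc (-1 : ℝ) 1, ‖Dt (T κ (Dxx i j W)) (r, x)‖ₑ
  have b3 : ∫⁻ _ in Icc (-1 : ℝ) 1, ‖T κ (Dxx i j W) (t, x)‖ₑ ≤
      ∫⁻ r in Icc (-1 : ℝ) 1, (‖T κ (Dxx i j W) (r, x)‖ₑ + Z) := by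
    refine setLIntegral_mono' measurableSet_Icc fun r hr => ?_
    calc _ = ‖T κ (Dxx i j W) (r, x) + (T κ (Dxx i j W) (t, x) - T κ (Dxx i j W) (r, x))‖ₑ := by congr 1; ring
      _ ≤ _ := (enorm_add_le _ _).trans (add_le_add le_rfl (ftc_t hC x ht hr))
  rw [lintegral_add_right _ measurable_const, setLIntegral_const, setLIntegral_const, Real.volume_Icc] at b3
  have e2 : ENNReal.ofReal (1 - -1) = 2 := by norm_num
  rw [e2] at b3
  have b4 : ‖T κ (Dxx i j W) (t, x)‖ₑ * 2 ≤ (ENNReal.ofReal K * ENNReal.ofReal (1 + δ⁻¹) * (X + Y)) * 2 := by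
    refine b3.trans ((add_le_add b2 (mul_le_mul' b1 le_rfl)).trans ?_)
    rw [ENNReal.ofReal_add zero_le_one (by positivity), ENNReal.ofReal_one]
    set a := ENNReal.ofReal K
    set b := ENNReal.ofReal δ⁻¹
    calc _ = a * Y + 2 * (a * X) + 2 * (b * (a * Y)) := by ring
      _ ≤ a * Y + 2 * (a * X) + 2 * (b * (a * Y)) + (a * Y + 2 * (b * (a * X))) := le_self_add
      _ = _ := by ring
  exact (ENNReal.mul_le_mul_iff_left (by simp) (by simp)).1 b4

/-- kernels with four bounded derivatives -/
def KB (K : ℝ) (k : Spc d → ℝ) : Prop := ∀ i j l m y, |k y| ≤ K ∧ |pd i k y| ≤ K ∧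
      |pd i (pd j k) y| ≤ K ∧ |pd i (pd j (pd l k)) y| ≤ K ∧ |pd i (pd j (pd l (pd m k))) y| ≤ K

lemma T_osc {κ : Spc d → ℝ} (hκ : Ker κ) {σ : ℝ} (hσ : σ ^ 2 = 1) {A : ℝ → Matrix (Fin d) (Fin d) ℝ} (hA : Measurable A)
    {δ : ℝ} (hδ : 0 < δ)
    (hS : ∀ t, inS d δ (A t)) {W : Pt d → ℝ} (hW : CinfC W) {K : ℝ} (i j : Fin d) (hK : KB K κ)
    {r : ℝ} (h0 : 0 < r) (h1 : r ≤ 1) {z : Pt d} (hz : z ∈ cyl d r 0 0) :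
    ‖T κ (Dxx i j W) z - T κ (Dxx i j W) (0, 0)‖ₑ ≤ ENNReal.ofReal K * ENNReal.ofReal (1 + (d + δ⁻¹ * d ^ 2) * (1 + δ⁻¹)) *
      (nQ 1 2 (Lop σ (fun z => A z.1) W) + ENNReal.ofReal r * ∑ k, ∑ l, nQ 1 2 (Dxx k l W)) := by
  obtain ⟨t, x⟩ := z
  have hC := (hW.Dxx i j).T hκ
  have hLm : Measurable (Lop σ (fun z => A z.1) W) := Lop_meas hW σ (hA.comp measurable_fst)
  have r2 : r ^ 2 ≤ r := by nlinarith
  have ht0 : 0 < t := hz.1.1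
  have ht1 : t < r ^ 2 := by simpa using hz.1.2
  have hx : ‖x‖ < r := by simpa using hz.2
  set F := Lop σ (fun z => A z.1) W
  set X := nQ 1 2 F
  set Y := ∑ k, ∑ l, nQ 1 2 (Dxx k l W)
  set a := ENNReal.ofReal K
  set b := ENNReal.ofReal (1 + δ⁻¹)
  set c := ENNReal.ofReal δ⁻¹
  set ρ := ENNReal.ofReal r
  have hρ1 : ρ ≤ 1 := by simpa [ρ] using h1
  have p1 : ‖T κ (Dxx i j W) (t, x) - T κ (Dxx i j W) (t, 0)‖ₑ ≤ ρ * (d * (a * b * (X + Y))) := by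
    have := seg_bd hC t x x
    rw [sub_self] at this
    refine this.trans (mul_le_mul' ?_ ?_)
    · rw [← ofReal_norm]; exact ENNReal.ofReal_le_ofReal hx.le
    · calc _ ≤ ∫⁻ _ in Ioc (0 : ℝ) 1, d * (a * b * (X + Y)) := by
            refine setLIntegral_mono' measurableSet_Ioc fun θ hθ => (enorm_sum_le _ _).trans ?_
            have e : ∀ l ∈ Finset.univ, ‖|Dx l (T κ (Dxx i j W)) (t, x - θ • x)|‖ₑ ≤ a * b * (X + Y) := by
              intro l _
              rw [← Real.norm_eq_abs, enorm_norm, Dx_T hκ (hW.Dxx i j), T_ibp hκ (hW.Dxx i j)]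
              refine T_sup (hκ.pd l) hσ hA hδ hS hW i j (fun y => (hK l l l l y).2.1) (fun y => (hK j i l l y).2.2.2.1)
                ⟨by linarith, by linarith⟩ ?_
              rw [show x - θ • x = (1 - θ) • x by module, norm_smul, Real.norm_of_nonneg (by linarith [hθ.2])]
              nlinarith [norm_nonneg x, hθ.1, hθ.2]
            refine (Finset.sum_le_sum e).trans (le_of_eq ?_)
            simp
        _ = _ := by simp
  have p2 : ‖T κ (Dxx i j W) (t, 0) - T κ (Dxx i j W) (0, 0)‖ₑ ≤ a * X + ρ * (c * (d ^ 2 * (a * b * (X + Y)))) := by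
    refine (ftc_t hC 0 (a := 0) (b := r ^ 2) ⟨ht0.le, ht1.le⟩ ⟨le_rfl, by positivity⟩).trans ?_
    calc _ ≤ ∫⁻ τ in Icc (0 : ℝ) (r ^ 2), ((a * ∫⁻ y in ball (0 : Spc d) 1, ‖F (τ, y)‖ₑ) + c * (d ^ 2 * (a * b * (X + Y)))) := by
          refine setLIntegral_mono' measurableSet_Icc fun τ hτ => (Dt_TD hκ hσ A hδ hS hW i j
            (fun y => (hK j i i i y).2.2.1) (τ, 0)).trans (add_le_add le_rfl (mul_le_mul' le_rfl ?_))
          have e : ∀ k ∈ Finset.univ, ∑ l, ‖T (pd j (pd i κ)) (Dxx k l W) (τ, 0)‖ₑ ≤ d * (a * b * (X + Y)) := by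
            intro k _
            have e' : ∀ l ∈ Finset.univ, ‖T (pd j (pd i κ)) (Dxx k l W) (τ, 0)‖ₑ ≤ (a * b * (X + Y)) := by
              intro l _
              exact T_sup ((hκ.pd i).pd j) hσ hA hδ hS hW k l (fun y => (hK j i i i y).2.2.1)
                (fun y => (hK l k j i y).2.2.2.2) ⟨by linarith [hτ.1], by linarith [hτ.2]⟩ (by simp)
            refine (Finset.sum_le_sum e').trans (le_of_eq ?_)
            simp
          refine (Finset.sum_le_sum e).trans (le_of_eq ?_)
          simp; ring
      _ = (a * ∫⁻ τ in Icc (0 : ℝ) (r ^ 2), ∫⁻ y in ball (0 : Spc d) 1, ‖F (τ, y)‖ₑ) +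
          c * (d ^ 2 * (a * b * (X + Y))) * ENNReal.ofReal (r ^ 2) := by
          rw [lintegral_add_right _ measurable_const, lintegral_const_mul' _ _ (by simp [a]), setLIntegral_const, Real.volume_Icc,
            sub_zero]
      _ ≤ _ := by
          refine add_le_add (mul_le_mul' le_rfl (slice_le hLm (by simp) (by norm_num) (r2.trans h1))) ?_
          rw [mul_comm]
          exact mul_le_mul' (ENNReal.ofReal_le_ofReal r2) le_rfl
  calc _ = ‖(T κ (Dxx i j W) (t, x) - T κ (Dxx i j W) (t, 0)) + (T κ (Dxx i j W) (t, 0) - T κ (Dxx i j W) (0, 0))‖ₑ := by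
        congr 1; ring
    _ ≤ ρ * (d * (a * b * (X + Y))) + (a * X + ρ * (c * (d ^ 2 * (a * b * (X + Y))))) :=
        (enorm_add_le _ _).trans (add_le_add p1 p2)
    _ = a * X + a * ((d + c * d ^ 2) * b) * (ρ * X + ρ * Y) := by ring
    _ ≤ a * (X + ρ * Y) + a * ((d + c * d ^ 2) * b) * (1 * X + ρ * Y) := by
        refine add_le_add (mul_le_mul' le_rfl le_self_add) (mul_le_mul' le_rfl (add_le_add (mul_le_mul' hρ1 le_rfl) le_rfl))
    _ = _ := by
        have : ENNReal.ofReal (1 + (d + δ⁻¹ * d ^ 2) * (1 + δ⁻¹)) = 1 + (d + c * d ^ 2) * b := by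
          rw [ENNReal.ofReal_add zero_le_one (by positivity), ENNReal.ofReal_mul (by positivity),
            ENNReal.ofReal_add (by positivity) (by positivity), ENNReal.ofReal_mul (by positivity),
            ENNReal.ofReal_pow (by positivity), ENNReal.ofReal_one, ENNReal.ofReal_natCast]
        rw [this]; ring
end

section
variable {d : ℕ} {u w : Pt d → ℝ}

lemma tele (k : Spc d → ℝ) (n : ℕ) (g : Pt d → ℝ) (z : Pt d) :
    g z = (Rk k)^[n] g z + ∑ j ∈ Finset.range n, T k ((Rk k)^[j] g) z := by
  induction n with
  | zero => simp
  | succ n ih =>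
    rw [Finset.sum_range_succ, Function.iterate_succ_apply']
    conv_lhs => rw [ih]
    simp only [Rk]; ring

lemma nQ_one_le {s : ℝ} (hs : 1 ≤ s) (M : ℝ) : ∃ c : ℝ≥0∞, c ≠ ⊤ ∧ ∀ g : Pt d → ℝ, Measurable g →
    ∀ a ≤ M, nQ 1 a g ≤ c * nQ s M g := by
  have h := hs
  refine ⟨(volume.restrict (Qb d M)) univ ^ (1 / (ENNReal.ofReal 1).toReal - 1 / (ENNReal.ofReal s).toReal),
    ENNReal.rpow_ne_top_of_nonneg ?_ ?_, fun g hg a ha => ?_⟩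
  · rw [ENNReal.toReal_ofReal zero_le_one, ENNReal.toReal_ofReal (by linarith), sub_nonneg]
    exact one_div_le_one_div_of_le one_pos hs
  · rw [Measure.restrict_apply_univ, Qb_eq]; exact measure_ball_lt_top.ne
  · refine (nQ_mono ha g).trans ?_
    rw [mul_comm]
    exact eLpNorm_le_eLpNorm_mul_rpow_measure_univ (ENNReal.ofReal_le_ofReal hs) hg.aestronglyMeasurable

lemma avg_cyl_le {s : ℝ} (hs : 1 ≤ s) {r : ℝ} (h0 : 0 < r) (h1 : r ≤ 1) {G : Pt d → ℝ} (hG : Measurable G) :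
    (volume (cyl d r 0 0))⁻¹ * ∫⁻ z in cyl d r 0 0, ‖G z‖ₑ ≤
      (volume (cyl d 1 0 0))⁻¹ ^ (1 / s) * (ENNReal.ofReal r ^ (d + 2))⁻¹ * nQ s 1 G := by
  have hs0 : 0 < s := by linarith
  have hs1 : 1 / s ≤ 1 := by rw [div_le_one hs0]; exact hs
  have a1 := avg_pow (vol_cyl_ne 0 0 h0) (vol_cyl_fin (0 : Spc d) 0 r) (by positivity : 0 ≤ 1 / s) hs1
    (hG.enorm.pow_const s)
  simp only [← ENNReal.rpow_mul, mul_one_div_cancel hs0.ne', ENNReal.rpow_one] at a1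
  refine a1.trans ?_
  rw [nQ_eq hs0, ENNReal.mul_rpow_of_nonneg _ _ (by positivity)]
  refine mul_le_mul' ?_ (ENNReal.rpow_le_rpow (lintegral_mono_set ?_) (by positivity))
  · have := vol_cyl_mul (0 : Spc d) 0 0 0 h0 1
    rw [mul_one] at this
    rw [this, ENNReal.mul_inv (.inr (vol_cyl_fin _ _ _)) (.inr (vol_cyl_ne _ _ one_pos)),
      ENNReal.mul_rpow_of_nonneg _ _ (by positivity), mul_comm]
    refine mul_le_mul' le_rfl ?_
    conv_rhs => rw [← ENNReal.rpow_one (ENNReal.ofReal r ^ (d + 2))⁻¹]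
    refine ENNReal.rpow_le_rpow_of_exponent_le (ENNReal.one_le_inv.2 (pow_le_one' ?_ _)) hs1
    simpa using h1
  · refine prod_mono (Ioo_subset_Ioo (by norm_num) (by nlinarith)) (ball_subset_ball h1)

lemma unit_osc {δ : ℝ} (hδ : 0 < δ) {s : ℝ} (hs : 1 ≤ s) (H : HS d δ (ENNReal.ofReal s)) :
    ∃ M : ℝ, 1 ≤ M ∧ ∀ ε : ℝ, 0 < ε → ∃ r : ℝ, 0 < r ∧ r ≤ 1 ∧ ∃ N : ℝ≥0∞, N ≠ ⊤ ∧
    ∀ σ : ℝ, σ ^ 2 = 1 → ∀ A : ℝ → Matrix (Fin d) (Fin d) ℝ, Measurable A →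
    (∀ t, inS d δ (A t)) → ∀ u : Pt d → ℝ, CinfC u → ∀ i j, ∃ c : ℝ,
    (volume (cyl d r 0 0))⁻¹ * ∫⁻ z in cyl d r 0 0, ‖Dxx i j u z - c‖ₑ ≤
      ENNReal.ofReal ε * (∑ k, ∑ l, nQ s M (Dxx k l u)) + N * nQ s M (Lop σ (fun z => A z.1) u) := by
  set m := (d + 5) * (d + 2) + 1 with hm
  obtain ⟨N1, M1, hM1, hN1⟩ := many_step hδ hs H one_pos m
  set n := 2 * m
  set M := max M1 (2 + n)
  obtain ⟨K0, hK0, hmol⟩ := mol_exists d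
  obtain ⟨cV, hcV, hV⟩ := nQ_one_le (d := d) hs M
  set C := ENNReal.ofReal (1 + (d + δ⁻¹ * d ^ 2) * (1 + δ⁻¹))
  have hs0 : 0 < s := by linarith
  set v1 := (volume (cyl d 1 0 0))⁻¹ ^ (1 / s)
  have hv1 : v1 ≠ ⊤ := ENNReal.rpow_ne_top_of_nonneg (by positivity) (ENNReal.inv_ne_top.2 (vol_cyl_ne _ _ one_pos))
  set B : ℝ≥0∞ := v1 * N1 + n * (ENNReal.ofReal K0 * C * 2 ^ n * cV)
  have hB : B ≠ ⊤ := by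
    refine ENNReal.add_ne_top.2 ⟨ENNReal.mul_ne_top hv1 (by simp), ENNReal.mul_ne_top (by simp) (ENNReal.mul_ne_top
      (ENNReal.mul_ne_top (ENNReal.mul_ne_top (by simp) (by simp [C])) (by simp)) hcV)⟩
  refine ⟨M, le_max_of_le_right (by have : (0 : ℝ) ≤ n := by positivity
                                    linarith), fun ε hε => ?_⟩
  obtain ⟨h, h0, h1, hh⟩ : ∃ h : ℝ, 0 < h ∧ h ≤ 1 ∧ ENNReal.ofReal h * B ≤ ENNReal.ofReal ε := by
    refine ⟨min 1 (ε / (B.toReal + 1)), by positivity, min_le_left _ _, ?_⟩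
    rw [← ENNReal.ofReal_toReal hB, ← ENNReal.ofReal_mul (by positivity)]
    refine ENNReal.ofReal_le_ofReal ?_
    refine (mul_le_mul_of_nonneg_right (min_le_right _ _) ENNReal.toReal_nonneg).trans ?_
    rw [div_mul_eq_mul_div, div_le_iff₀ (by positivity)]
    rw [ENNReal.toReal_ofReal ENNReal.toReal_nonneg]
    exact mul_le_mul_of_nonneg_left (le_add_of_nonneg_right zero_le_one) hε.le
  obtain ⟨k, hk, hkb⟩ := hmol h h0 h1
  set r := h ^ (d + 5)
  have r0 : 0 < r := by positivity
  have r1 : r ≤ 1 := pow_le_one₀ h0.le h1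
  set η := ENNReal.ofReal h
  have hη0 : η ≠ 0 := by simpa [η] using h0
  have hηt : η ≠ ⊤ := by simp [η]
  have hρ : ENNReal.ofReal r = η ^ (d + 5) := ENNReal.ofReal_pow h0.le _
  set Kh := ENNReal.ofReal (K0 * h⁻¹ ^ (d + 4))
  have hKh : Kh = ENNReal.ofReal K0 * (η ^ (d + 4))⁻¹ := by
    simp only [Kh]
    rw [ENNReal.ofReal_mul hK0, ENNReal.ofReal_pow (by positivity), ENNReal.ofReal_inv_of_pos h0, ENNReal.inv_pow]
  refine ⟨r, r0, r1, v1 * (η ^ ((d + 5) * (d + 2)))⁻¹ * N1 + n * (Kh * C * 2 ^ n * cV), ?_, ?_⟩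
  · refine ENNReal.add_ne_top.2 ⟨ENNReal.mul_ne_top (ENNReal.mul_ne_top hv1 (by simp [hη0])) (by simp),
      ENNReal.mul_ne_top (by simp) (ENNReal.mul_ne_top
      (ENNReal.mul_ne_top (ENNReal.mul_ne_top (by simp [Kh]) (by simp [C])) (by simp)) hcV)⟩
  intro σ hσ A hA hS u hu i j
  have hK := hk.toKer
  have hm2 : ∀ k l, Measurable (Dxx k l u) := fun k l => (hu.Dxx k l).cont.measurable
  have hLm : Measurable (Lop σ (fun z => A z.1) u) := Lop_meas hu σ (hA.comp measurable_fst)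
  set X := nQ s M (Lop σ (fun z => A z.1) u)
  set Y := ∑ k, ∑ l, nQ s M (Dxx k l u)
  have hnM : ∀ q ∈ Finset.range n, (2 : ℝ) + q ≤ M := fun q hq => le_max_of_le_right (by
    have := (Finset.mem_range.1 hq).le
    have : (q : ℝ) ≤ n := by exact_mod_cast this
    linarith)
  have p1 : (volume (cyl d r 0 0))⁻¹ * ∫⁻ z in cyl d r 0 0, ‖Dxx i j ((Rk k)^[n] u) z‖ₑ ≤
      v1 * (η ^ ((d + 5) * (d + 2)))⁻¹ * (N1 * (X + η ^ m * Y)) := by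
    refine (avg_cyl_le hs r0 r1 (((hu.iter hK n).Dxx i j).cont.measurable)).trans ?_
    rw [hρ, ← pow_mul]
    refine mul_le_mul' le_rfl ?_
    refine le_trans ?_ ((hN1 h h0 h1 k hk σ hσ A hA hS u hu).trans (mul_le_mul' le_rfl (add_le_add
      (nQ_mono (le_max_left _ _) _) (mul_le_mul' le_rfl (Finset.sum_le_sum fun k _ => Finset.sum_le_sum fun l _ =>
      nQ_mono (le_max_left _ _) _)))))
    refine le_trans ?_ (Finset.single_le_sum (f := fun k' => ∑ l, nQ s 1 (Dxx k' l ((Rk k)^[n] u))) (fun _ _ => zero_le)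
            (Finset.mem_univ i))
    exact Finset.single_le_sum (f := fun l => nQ s 1 (Dxx i l ((Rk k)^[n] u))) (fun _ _ => zero_le) (Finset.mem_univ j)
  have p2 : ∀ q ∈ Finset.range n, ∀ z ∈ cyl d r 0 0, ‖T k (Dxx i j ((Rk k)^[q] u)) z - T k (Dxx i j ((Rk k)^[q] u)) (0, 0)‖ₑ ≤
      Kh * C * 2 ^ n * cV * (X + η ^ (d + 5) * Y) := by
    intro q hq z hz
    have e1 : ∀ g : Pt d → ℝ, Measurable g → nQ 1 2 ((Rk k)^[q] g) ≤ 2 ^ n * cV * nQ s M g := by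
      intro g hg
      refine (iter_nQ h1 hk le_rfl 2 q hg).trans ?_
      rw [mul_assoc]
      exact mul_le_mul' (pow_le_pow_right₀ (by norm_num) (Finset.mem_range.1 hq).le) (hV g hg _ (hnM q hq))
    refine (T_osc hK hσ hA hδ hS (hu.iter hK q) i j hkb r0 r1 hz).trans ?_
    rw [mul_assoc (_ * _) (2 ^ n) cV, mul_assoc, mul_assoc (Kh * C), ← mul_assoc]
    refine mul_le_mul' le_rfl ?_
    rw [mul_add, hρ]
    refine add_le_add ?_ ?_
    · rw [iter_Lop hK q hu]; exact e1 _ hLm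
    · rw [mul_left_comm]
      refine mul_le_mul' le_rfl ?_
      simp only [Y, Finset.mul_sum]
      refine Finset.sum_le_sum fun k' _ => Finset.sum_le_sum fun l _ => ?_
      rw [iter_Dxx hK q hu]; exact e1 _ (hm2 k' l)
  refine ⟨∑ q ∈ Finset.range n, T k (Dxx i j ((Rk k)^[q] u)) (0, 0), ?_⟩
  have p3 : ∀ z ∈ cyl d r 0 0, ‖Dxx i j u z - ∑ q ∈ Finset.range n, T k (Dxx i j ((Rk k)^[q] u)) (0, 0)‖ₑ ≤
      ‖Dxx i j ((Rk k)^[n] u) z‖ₑ + n * (Kh * C * 2 ^ n * cV * (X + η ^ (d + 5) * Y)) := by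
    intro z hz
    rw [tele k n (Dxx i j u) z, ← iter_Dxx hK n hu, add_sub_assoc, ← Finset.sum_sub_distrib]
    refine (enorm_add_le _ _).trans (add_le_add le_rfl ((enorm_sum_le _ _).trans ?_))
    calc _ ≤ ∑ q ∈ Finset.range n, Kh * C * 2 ^ n * cV * (X + η ^ (d + 5) * Y) :=
          Finset.sum_le_sum fun q hq => by rw [← iter_Dxx hK q hu]; exact p2 q hq z hz
      _ = _ := by simp
  calc _ ≤ (volume (cyl d r 0 0))⁻¹ * ∫⁻ z in cyl d r 0 0, (‖Dxx i j ((Rk k)^[n] u) z‖ₑ +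
          n * (Kh * C * 2 ^ n * cV * (X + η ^ (d + 5) * Y))) :=
        mul_le_mul' le_rfl (setLIntegral_mono' (cyl_meas _ _ _) p3)
    _ = (volume (cyl d r 0 0))⁻¹ * (∫⁻ z in cyl d r 0 0, ‖Dxx i j ((Rk k)^[n] u) z‖ₑ) +
          n * (Kh * C * 2 ^ n * cV * (X + η ^ (d + 5) * Y)) := by
        rw [lintegral_add_right _ measurable_const, setLIntegral_const, mul_add, mul_left_comm,
          ENNReal.inv_mul_cancel (vol_cyl_ne _ _ r0) (vol_cyl_fin _ _ _), mul_one]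
    _ ≤ v1 * (η ^ ((d + 5) * (d + 2)))⁻¹ * (N1 * (X + η ^ m * Y)) + n * (Kh * C * 2 ^ n * cV * (X + η ^ (d + 5) * Y)) :=
        add_le_add p1 le_rfl
    _ = (v1 * N1 * ((η ^ ((d + 5) * (d + 2)))⁻¹ * η ^ m) + n * (ENNReal.ofReal K0 * C * 2 ^ n * cV) *
          ((η ^ (d + 4))⁻¹ * η ^ (d + 5))) * Y + (v1 * (η ^ ((d + 5) * (d + 2)))⁻¹ * N1 + n * (Kh * C * 2 ^ n * cV)) * X := by
        rw [hKh]; ring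
    _ = (η * B) * Y + (v1 * (η ^ ((d + 5) * (d + 2)))⁻¹ * N1 + n * (Kh * C * 2 ^ n * cV)) * X := by
        have q1 : (η ^ ((d + 5) * (d + 2)))⁻¹ * η ^ m = η := by
          rw [hm, pow_succ, ← mul_assoc, ENNReal.inv_mul_cancel (pow_ne_zero _ hη0) (ENNReal.pow_ne_top hηt), one_mul]
        have q2 : (η ^ (d + 4))⁻¹ * η ^ (d + 5) = η := by
          rw [show d + 5 = d + 4 + 1 from rfl, pow_succ η (d + 4), ← mul_assoc, ENNReal.inv_mul_cancel (pow_ne_zero _ hη0) (ENNReal.pow_ne_top hηt), one_mul]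
        rw [q1, q2]; simp only [B]; ring
    _ ≤ _ := add_le_add (mul_le_mul' hh le_rfl) le_rfl
end

section
variable {d : ℕ} {u w : Pt d → ℝ}

/-- parabolic scaling -/
def Sc (μ t : ℝ) (x : Spc d) (z : Pt d) : Pt d := (t + μ ^ 2 * z.1, x + μ • z.2)

lemma Sc_map {μ : ℝ} (hμ : 0 < μ) (t : ℝ) (x : Spc d) :
    ∃ c : ℝ≥0∞, c ≠ 0 ∧ c ≠ ⊤ ∧ Measure.map (Sc μ t x) volume = c • volume := by
  let e : Pt d ≃ₗ[ℝ] Pt d := (LinearEquiv.smulOfNeZero ℝ ℝ (μ ^ 2) (by positivity)).prodCongr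
    (LinearEquiv.smulOfNeZero ℝ (Spc d) μ hμ.ne')
  have hdet : LinearMap.det (e : Pt d →ₗ[ℝ] Pt d) ≠ 0 := e.isUnit_det'.ne_zero
  have h := Measure.map_linearMap_addHaar_eq_smul_addHaar (volume : Measure (Pt d)) hdet
  refine ⟨ENNReal.ofReal |(LinearMap.det (e : Pt d →ₗ[ℝ] Pt d))⁻¹|, by simpa using hdet, by simp, ?_⟩
  have e1 : Sc μ t x = (fun z => (t, x) + z) ∘ (e : Pt d →ₗ[ℝ] Pt d) := by
    funext z; simp [Sc, e]
  have hme : Measurable (e : Pt d →ₗ[ℝ] Pt d) := (LinearMap.continuous_of_finiteDimensional _).measurable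
  rw [e1, ← Measure.map_map (by fun_prop) hme, h, Measure.map_smul, map_add_left_eq_self]

lemma Sc_meas (μ t : ℝ) (x : Spc d) : Measurable (Sc μ t x) := by unfold Sc; fun_prop

lemma Sc_pre {μ : ℝ} (hμ : 0 < μ) (t : ℝ) (x : Spc d) (r τ : ℝ) (y : Spc d) :
    Sc μ t x ⁻¹' (cyl d (μ * r) (t + μ ^ 2 * τ) (x + μ • y)) = cyl d r τ y := by
  ext ⟨s, z⟩
  have h2 : 0 < μ ^ 2 := by positivity
  have e2 : dist (x + μ • z) (x + μ • y) = μ * dist z y := by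
    rw [dist_add_left, dist_smul₀, Real.norm_of_nonneg hμ.le]
  simp only [Sc, cyl, mem_preimage, mem_prod, mem_Ioo, mem_ball, e2, mul_lt_mul_iff_right₀ hμ]
  rw [add_lt_add_iff_left, mul_lt_mul_iff_right₀ h2, mul_pow, add_assoc, ← mul_add, add_lt_add_iff_left, mul_lt_mul_iff_right₀ h2]

lemma Sc_av {μ : ℝ} (hμ : 0 < μ) (t : ℝ) (x : Spc d) {r : ℝ} (τ : ℝ) (y : Spc d) {f : Pt d → ℝ≥0∞}
    (hf : Measurable f) :
    (volume (cyl d r τ y))⁻¹ * ∫⁻ z in cyl d r τ y, f (Sc μ t x z) =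
    (volume (cyl d (μ * r) (t + μ ^ 2 * τ) (x + μ • y)))⁻¹ * ∫⁻ z in cyl d (μ * r) (t + μ ^ 2 * τ) (x + μ • y), f z := by
  obtain ⟨c, c0, c1, hc⟩ := Sc_map (d := d) hμ t x
  have hm := Sc_meas μ t x
  rw [← Sc_pre hμ t x r τ y]
  set C := cyl d (μ * r) (t + μ ^ 2 * τ) (x + μ • y)
  have hC : MeasurableSet C := cyl_meas _ _ _
  rw [← Measure.map_apply hm hC, ← setLIntegral_map hC hf hm, hc, Measure.restrict_smul, lintegral_smul_measure,
    Measure.smul_apply, smul_eq_mul, smul_eq_mul, ENNReal.mul_inv (.inl c0) (.inl c1), mul_mul_mul_comm,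
    ENNReal.inv_mul_cancel c0 c1, one_mul]

lemma Sc_dv (hu : CinfC u) (μ t : ℝ) (x : Spc d) (v z : Pt d) :
    dv v (fun z => u (Sc μ t x z)) z = dv (μ ^ 2 * v.1, μ • v.2) u (Sc μ t x z) := by
  have h1 : HasFDerivAt (Sc μ t x) (((μ ^ 2) • ContinuousLinearMap.fst ℝ ℝ (Spc d)).prod
      (μ • ContinuousLinearMap.snd ℝ ℝ (Spc d))) z := by
    have ha : HasFDerivAt (fun z : Pt d => t + μ ^ 2 * z.1) ((μ ^ 2) • ContinuousLinearMap.fst ℝ ℝ (Spc d)) z :=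
      ((hasFDerivAt_fst (𝕜 := ℝ) (p := z)).const_mul (μ ^ 2)).const_add t
    have hb : HasFDerivAt (fun z : Pt d => x + μ • z.2) (μ • ContinuousLinearMap.snd ℝ ℝ (Spc d)) z :=
      ((hasFDerivAt_snd (𝕜 := ℝ) (p := z)).const_smul μ).const_add x
    exact ha.prodMk hb
  have := (hu.diff (Sc μ t x z)).hasFDerivAt.comp z h1
  rw [dv, show (fun z => u (Sc μ t x z)) = u ∘ Sc μ t x from rfl, this.fderiv]
  simp [dv]

lemma CinfC.Sc (hu : CinfC u) {μ : ℝ} (hμ : 0 < μ) (t : ℝ) (x : Spc d) : CinfC (fun z => u (Sc μ t x z)) := by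
  refine ⟨hu.1.comp (by unfold _root_.Sc; fun_prop), ?_⟩
  let e : Pt d ≃ₗ[ℝ] Pt d := (LinearEquiv.smulOfNeZero ℝ ℝ (μ ^ 2) (by positivity)).prodCongr
    (LinearEquiv.smulOfNeZero ℝ (Spc d) μ hμ.ne')
  let h := e.toContinuousLinearEquiv.toHomeomorph.trans (Homeomorph.addLeft ((t, x) : Pt d))
  have : (fun z => u (_root_.Sc μ t x z)) = u ∘ h := by
    funext z; simp [_root_.Sc, h, e]
  rw [this]
  exact hu.2.comp_homeomorph h

lemma Sc_Dx (hu : CinfC u) {μ : ℝ} (hμ : 0 < μ) (t : ℝ) (x : Spc d) (i : Fin d) :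
    Dx i (fun z => u (Sc μ t x z)) = fun z => μ * Dx i u (Sc μ t x z) := by
  funext z
  rw [Dx_eq (hu.Sc hμ t x), Sc_dv hu, Dx_eq hu, dv, dv,
    show ((μ ^ 2 * ((0, EuclideanSpace.single i 1) : Pt d).1, μ • ((0, EuclideanSpace.single i 1) : Pt d).2) : Pt d) =
      μ • (0, EuclideanSpace.single i 1) by simp, map_smul, smul_eq_mul]

lemma Sc_Dt (hu : CinfC u) {μ : ℝ} (hμ : 0 < μ) (t : ℝ) (x : Spc d) :
    Dt (fun z => u (Sc μ t x z)) = fun z => μ ^ 2 * Dt u (Sc μ t x z) := by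
  funext z
  rw [Dt_eq (hu.Sc hμ t x), Sc_dv hu, Dt_eq hu, dv, dv,
    show ((μ ^ 2 * ((1, 0) : Pt d).1, μ • ((1, 0) : Pt d).2) : Pt d) = μ ^ 2 • (1, 0) by simp, map_smul, smul_eq_mul]

lemma Sc_Dxx (hu : CinfC u) {μ : ℝ} (hμ : 0 < μ) (t : ℝ) (x : Spc d) (i j : Fin d) :
    Dxx i j (fun z => u (Sc μ t x z)) = fun z => μ ^ 2 * Dxx i j u (Sc μ t x z) := by
  funext z
  have hv := (hu.Dx j).Sc hμ t x
  rw [Dxx, Sc_Dx hu hμ, Dx_eq (hv.smul μ), dv_smul hv, ← Dx_eq hv, Sc_Dx (hu.Dx j) hμ, Dxx]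
  ring

lemma Sc_Lop (hu : CinfC u) {μ : ℝ} (hμ : 0 < μ) (t : ℝ) (x : Spc d) (σ : ℝ) (A : ℝ → Matrix (Fin d) (Fin d) ℝ) (z) :
    Lop σ (fun z => A (t + μ ^ 2 * z.1)) (fun z => u (Sc μ t x z)) z = μ ^ 2 * Lop σ (fun z => A z.1) u (Sc μ t x z) := by
  simp only [Lop, Sc_Dt hu hμ, Sc_Dxx hu hμ, mul_add, Finset.mul_sum]
  congr 1
  · ring
  · refine Finset.sum_congr rfl fun i _ => Finset.sum_congr rfl fun j _ => ?_
    simp only [Sc]; ring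

/-- sum of absolute values of second derivatives -/
def hes (u : Pt d → ℝ) (z : Pt d) : ℝ≥0∞ := ∑ k, ∑ l, ENNReal.ofReal |Dxx k l u z|

lemma hes_meas (hu : CinfC u) : Measurable (hes u) := by
  unfold hes
  exact Finset.measurable_sum _ fun k _ => Finset.measurable_sum _ fun l _ =>
    (continuous_abs.comp (hu.Dxx k l).cont).measurable.ennreal_ofReal

lemma avS_mono {s : ℝ} (hs : 0 < s) (R t : ℝ) (x : Spc d) {f g : Pt d → ℝ≥0∞} (h : ∀ z, f z ≤ g z) :
    avS s R t x f ≤ avS s R t x g := by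
  unfold avS
  refine ENNReal.rpow_le_rpow (mul_le_mul' le_rfl (lintegral_mono fun z => ?_)) (by positivity)
  exact ENNReal.rpow_le_rpow (h z) hs.le

lemma avS_smul {s : ℝ} (hs : 0 < s) (R t : ℝ) (x : Spc d) (c : ℝ≥0∞) {f : Pt d → ℝ≥0∞} (hf : Measurable f) :
    avS s R t x (fun z => c * f z) = c * avS s R t x f := by
  unfold avS
  simp only [ENNReal.mul_rpow_of_nonneg _ _ hs.le]
  rw [lintegral_const_mul _ (hf.pow_const _), mul_left_comm, ENNReal.mul_rpow_of_nonneg _ _ (by positivity), ← ENNReal.rpow_mul,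
    mul_one_div_cancel hs.ne', ENNReal.rpow_one]

lemma Sc_avS {μ : ℝ} (hμ : 0 < μ) (t : ℝ) (x : Spc d) (s : ℝ) {r : ℝ} (τ : ℝ) (y : Spc d) {f : Pt d → ℝ≥0∞}
    (hf : Measurable f) : avS s r τ y (fun z => f (Sc μ t x z)) = avS s (μ * r) (t + μ ^ 2 * τ) (x + μ • y) f := by
  unfold avS
  rw [Sc_av hμ t x τ y (f := fun z => f z ^ s) (hf.pow_const _)]

lemma nQ_le_avS {s : ℝ} (hs : 1 ≤ s) {M : ℝ} (hM : 1 ≤ M) : ∃ c : ℝ≥0∞, c ≠ ⊤ ∧ ∀ g : Pt d → ℝ,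
    nQ s M g ≤ c * avS s (2 * M) (-(2 * M ^ 2)) 0 (fun z => ENNReal.ofReal |g z|) := by
  have hs0 : 0 < s := by linarith
  have h0 : volume (cyl d (2 * M) (-(2 * M ^ 2)) 0) ≠ 0 := vol_cyl_ne _ _ (by linarith)
  have h1 : volume (cyl d (2 * M) (-(2 * M ^ 2)) 0) ≠ ⊤ := vol_cyl_fin _ _ _
  refine ⟨volume (cyl d (2 * M) (-(2 * M ^ 2)) 0) ^ (1 / s), ENNReal.rpow_ne_top_of_nonneg (by positivity) h1, fun g => ?_⟩
  rw [nQ_eq hs0, avS, ← ENNReal.mul_rpow_of_nonneg _ _ (by positivity), ← mul_assoc, ENNReal.mul_inv_cancel h0 h1, one_mul]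
  refine ENNReal.rpow_le_rpow ?_ (by positivity)
  simp only [Real.enorm_eq_ofReal_abs]
  refine lintegral_mono_set (prod_mono (Ioo_subset_Ioo (by nlinarith) (by nlinarith)) (ball_subset_ball (by linarith)))

lemma osc_const {δ : ℝ} (hδ : 0 < δ) {s : ℝ} (hs : 1 ≤ s) (H : HS d δ (ENNReal.ofReal s)) {ε : ℝ} (hε : 0 < ε) :
    ∃ κ : ℝ, 2 ≤ κ ∧ ∃ N : ℝ≥0∞, N ≠ ⊤ ∧
    ∀ σ : ℝ, σ ^ 2 = 1 → ∀ A : ℝ → Matrix (Fin d) (Fin d) ℝ, Measurable A →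
    (∀ t, inS d δ (A t)) → ∀ u : Pt d → ℝ, CinfC u → ∀ i j, ∀ R : ℝ, 0 < R → ∀ t x, ∃ c : ℝ,
    (volume (cyl d R t x))⁻¹ * ∫⁻ z in cyl d R t x, ENNReal.ofReal |Dxx i j u z - c| ≤
      avS s (κ * R) (t - (κ * R) ^ 2 / 2) x
        (fun z => ENNReal.ofReal ε * hes u z + N * ENNReal.ofReal |Lop σ (fun z => A z.1) u z|) := by
  have hs0 : 0 < s := by linarith
  obtain ⟨M, hM, h⟩ := unit_osc hδ hs H
  obtain ⟨c, hc, hV⟩ := nQ_le_avS (d := d) hs hM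
  obtain ⟨r, r0, r1, N, hN, h⟩ := h (ε / (2 * (d ^ 2 + 1) * (c.toReal + 1))) (by positivity)
  refine ⟨2 * M / r, ?_, 2 * (N * c), ENNReal.mul_ne_top (by simp) (ENNReal.mul_ne_top hN hc), ?_⟩
  · rw [le_div_iff₀ r0]; nlinarith
  intro σ hσ A hA hS u hu i j R hR t x
  set μ := R / r
  have hμ : 0 < μ := by positivity
  have hμr : μ * r = R := div_mul_cancel₀ _ r0.ne'
  obtain ⟨b, hb⟩ := h σ hσ (fun τ => A (t + μ ^ 2 * τ)) (hA.comp (by fun_prop)) (fun τ => hS _) _ (hu.Sc hμ t x) i j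
  refine ⟨b / μ ^ 2, ?_⟩
  have hm2 : ∀ k l, Measurable fun z => ENNReal.ofReal |Dxx k l u z| := fun k l =>
    (continuous_abs.comp (hu.Dxx k l).cont).measurable.ennreal_ofReal
  have hLm : Measurable (Lop σ (fun z => A z.1) u) := Lop_meas hu σ (hA.comp measurable_fst)
  have hLm' : Measurable (fun z => ENNReal.ofReal |Lop σ (fun z => A z.1) u z|) :=
    (continuous_abs.measurable.comp hLm).ennreal_ofReal
  set F : Pt d → ℝ≥0∞ := fun z => ENNReal.ofReal ε * hes u z + 2 * (N * c) * ENNReal.ofReal |Lop σ (fun z => A z.1) u z|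
  have hF : Measurable F := ((hes_meas hu).const_mul _).add (hLm'.const_mul _)
  set m2 := ENNReal.ofReal (μ ^ 2)
  have m20 : m2 ≠ 0 := by simp [m2]; positivity
  have m2t : m2 ≠ ⊤ := by simp [m2]
  have eμ : ∀ y : ℝ, ENNReal.ofReal |μ ^ 2 * y| = m2 * ENNReal.ofReal |y| := fun y => by
    rw [abs_mul, abs_of_pos (by positivity), ENNReal.ofReal_mul (by positivity)]
  -- the left hand side
  have L1 : (volume (cyl d r 0 0))⁻¹ * ∫⁻ z in cyl d r 0 0, ‖Dxx i j (fun z => u (Sc μ t x z)) z - b‖ₑ =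
      m2 * ((volume (cyl d R t x))⁻¹ * ∫⁻ z in cyl d R t x, ENNReal.ofReal |Dxx i j u z - b / μ ^ 2|) := by
    have e0 : Measurable fun z => ENNReal.ofReal |Dxx i j u z - b / μ ^ 2| :=
      (continuous_abs.comp ((hu.Dxx i j).cont.sub continuous_const)).measurable.ennreal_ofReal
    have := Sc_av hμ t x (r := r) 0 0 (e0.const_mul m2)
    rw [lintegral_const_mul _ e0, mul_zero, add_zero, smul_zero, add_zero, hμr] at this
    rw [mul_left_comm, ← this]
    congr 2; funext z
    rw [Real.enorm_eq_ofReal_abs, ← eμ, Sc_Dxx hu hμ, mul_sub, mul_div_cancel₀ _ (by positivity)]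
  -- the right hand side
  have e1 : t + μ ^ 2 * -(2 * M ^ 2) = t - (2 * M / r * R) ^ 2 / 2 := by
    simp only [μ]; field_simp; ring
  have e2 : μ * (2 * M) = 2 * M / r * R := by simp only [μ]; field_simp
  set Z := avS s (2 * M / r * R) (t - (2 * M / r * R) ^ 2 / 2) x F
  have R1 : ∀ (g : Pt d → ℝ) (g' : Pt d → ℝ), (∀ z, g z = μ ^ 2 * g' (Sc μ t x z)) →
      Measurable (fun z => ENNReal.ofReal |g' z|) → nQ s M g ≤
      c * (m2 * avS s (2 * M / r * R) (t - (2 * M / r * R) ^ 2 / 2) x (fun z => ENNReal.ofReal |g' z|)) := by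
    intro g g' hg hm
    refine (hV g).trans (mul_le_mul' le_rfl ?_)
    have := Sc_avS hμ t x s (r := 2 * M) (-(2 * M ^ 2)) 0 (hm.const_mul m2)
    rw [e1, e2, smul_zero, add_zero, avS_smul hs0 _ _ _ _ hm] at this
    rw [← this]
    refine (avS_mono hs0 _ _ _ fun z => ?_)
    rw [hg, eμ]
  have R2 : ∀ k l, ENNReal.ofReal ε * nQ s M (Dxx k l (fun z => u (Sc μ t x z))) ≤ c * (m2 * Z) := by
    intro k l
    refine (mul_le_mul' le_rfl (R1 _ _ (fun z => by rw [Sc_Dxx hu hμ]) (hm2 k l))).trans ?_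
    rw [mul_left_comm, mul_left_comm _ m2, ← avS_smul hs0 _ _ _ _ (hm2 k l)]
    refine mul_le_mul' le_rfl (mul_le_mul' le_rfl (avS_mono hs0 _ _ _ fun z => le_trans (mul_le_mul' le_rfl ?_) le_self_add))
    exact (Finset.single_le_sum (f := fun l => ENNReal.ofReal |Dxx k l u z|) (fun _ _ => zero_le) (Finset.mem_univ l)).trans
      (Finset.single_le_sum (f := fun k => ∑ l, ENNReal.ofReal |Dxx k l u z|) (fun _ _ => zero_le) (Finset.mem_univ k))
  have R3 : 2 * (N * nQ s M (Lop σ (fun z => A (t + μ ^ 2 * z.1)) (fun z => u (Sc μ t x z)))) ≤ m2 * Z := by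
    refine (mul_le_mul' le_rfl (mul_le_mul' le_rfl (R1 _ _ (Sc_Lop hu hμ t x σ A) hLm'))).trans ?_
    rw [← mul_assoc N, ← mul_assoc 2, mul_left_comm, ← avS_smul hs0 _ _ _ _ hLm']
    exact mul_le_mul' le_rfl (avS_mono hs0 _ _ _ fun z => le_add_self)
  rw [L1] at hb
  rw [← ENNReal.mul_le_mul_iff_right m20 m2t]
  refine hb.trans ?_
  have hε' : ENNReal.ofReal (ε / (2 * (d ^ 2 + 1) * (c.toReal + 1))) =
      (2 * (d ^ 2 + 1) * (c + 1))⁻¹ * ENNReal.ofReal ε := by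
    rw [div_eq_inv_mul, ENNReal.ofReal_mul (by positivity), ENNReal.ofReal_inv_of_pos (by positivity)]
    congr 2
    rw [ENNReal.ofReal_mul (by positivity), ENNReal.ofReal_mul (by positivity), ENNReal.ofReal_add (by positivity) (by positivity),
      ENNReal.ofReal_add (by positivity) (by positivity), ENNReal.ofReal_toReal hc, ENNReal.ofReal_pow (by positivity)]
    simp
  have hS : ENNReal.ofReal (ε / (2 * (d ^ 2 + 1) * (c.toReal + 1))) * (∑ k, ∑ l, nQ s M (Dxx k l (fun z => u (Sc μ t x z)))) ≤
      2⁻¹ * (m2 * Z) := by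
    have es : ∀ y : Fin d → Fin d → ℝ≥0∞, ENNReal.ofReal ε * ∑ k, ∑ l, y k l = ∑ k, ∑ l, ENNReal.ofReal ε * y k l := by
      intro y; simp only [Finset.mul_sum]
    rw [hε', mul_assoc, es]
    refine (mul_le_mul' le_rfl (Finset.sum_le_sum fun k _ => Finset.sum_le_sum fun l _ => R2 k l)).trans ?_
    simp only [Finset.sum_const, Finset.card_univ, Fintype.card_fin, nsmul_eq_mul]
    have hd0 : (2 * (d ^ 2 + 1) * (c + 1) : ℝ≥0∞) ≠ ⊤ := by
      refine ENNReal.mul_ne_top (ENNReal.mul_ne_top (by simp) (ENNReal.add_ne_top.2 ⟨by simp, by simp⟩)) (ENNReal.add_ne_top.2 ⟨hc, by simp⟩)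
    rw [mul_comm, ← div_eq_mul_inv]
    refine ENNReal.div_le_of_le_mul ?_
    calc (d : ℝ≥0∞) * (d * (c * (m2 * Z))) = (d ^ 2 * c) * (m2 * Z) := by ring
      _ ≤ ((d ^ 2 + 1) * (c + 1)) * (m2 * Z) := mul_le_mul' (mul_le_mul' le_self_add le_self_add) le_rfl
      _ = (2⁻¹ * 2) * (((d ^ 2 + 1) * (c + 1)) * (m2 * Z)) := by rw [ENNReal.inv_mul_cancel (by simp) (by simp), one_mul]
      _ = _ := by ring
  have hL : N * nQ s M (Lop σ (fun z => A (t + μ ^ 2 * z.1)) (fun z => u (Sc μ t x z))) ≤ 2⁻¹ * (m2 * Z) := by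
    refine le_trans (le_of_eq ?_) (mul_le_mul' le_rfl R3)
    rw [← mul_assoc 2⁻¹, ENNReal.inv_mul_cancel (by simp) (by simp), one_mul]
  refine (add_le_add hS hL).trans (le_of_eq ?_)
  rw [← two_mul, ← mul_assoc, ENNReal.mul_inv_cancel (by simp) (by simp), one_mul]
end

section
variable {d : ℕ} {u w : Pt d → ℝ}

lemma mor_close (d : ℕ) {q p s β : ℝ} (hs : 1 ≤ s) (hsq : s < q) (hsp : s < p) (hβ : 0 < β) :
    ∃ ε : ℝ, 0 < ε ∧ ∀ κ, 2 ≤ κ → ∀ N : ℝ≥0∞, N ≠ ⊤ → ∃ N' : ℝ≥0∞, N' ≠ ⊤ ∧ ∀ u : Pt d → ℝ, CinfC u →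
    ∀ f : Pt d → ℝ≥0∞, Measurable f → (∀ i j, OSC κ s (Dxx i j u) (fun z => ENNReal.ofReal ε * hes u z + N * f z)) →
    morE q p β (hes u) ≠ ⊤ → morE q p β (hes u) ≤ N' * morE q p β f := by
  obtain ⟨C, hC, H⟩ := mor_abs d hs hsq hsp hβ
  have hq1 : 1 ≤ q := by linarith
  have hp1 : 1 ≤ p := by linarith
  have hcd : (d * (d * C) : ℝ≥0∞) ≠ ⊤ := ENNReal.mul_ne_top (by simp) (ENNReal.mul_ne_top (by simp) hC)
  refine ⟨1 / (2 * ((d * (d * C)).toReal + 1)), by positivity, fun κ hκ N hN => ⟨2 * (d * (d * C)) * N, ENNReal.mul_ne_top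
    (ENNReal.mul_ne_top (by simp) hcd) hN, fun u hu f hf ho hfin => ?_⟩⟩
  set ε : ℝ := 1 / (2 * ((d * (d * C)).toReal + 1)) with hεd
  set X := morE q p β (hes u)
  have hh := hes_meas hu
  have h1 : ∀ i j, morE q p β (fun z => ENNReal.ofReal |Dxx i j u z|) ≤ C * (ENNReal.ofReal ε * X + N * morE q p β f) := by
    intro i j
    refine (H κ hκ _ (hu.Dxx i j).cont (hu.Dxx i j).2 _ ((hh.const_mul _).add (hf.const_mul _)) (ho i j)).trans
      (mul_le_mul' le_rfl ((morE_add hq1 hp1 (hh.const_mul _) (hf.const_mul _)).trans (add_le_add ?_ ?_)))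
    · exact morE_smul (by linarith) (by linarith) _ hh
    · exact morE_smul (by linarith) (by linarith) _ hf
  have hm2 : ∀ k l, Measurable fun z => ENNReal.ofReal |Dxx k l u z| := fun k l =>
    (continuous_abs.comp (hu.Dxx k l).cont).measurable.ennreal_ofReal
  have h2 : X ≤ d * (d * C) * (ENNReal.ofReal ε * X + N * morE q p β f) := by
    calc X ≤ ∑ k, morE q p β (fun z => ∑ l, ENNReal.ofReal |Dxx k l u z|) :=
          morE_sum hq1 hp1 _ fun k => Finset.measurable_sum _ fun l _ => hm2 k l
      _ ≤ ∑ k, ∑ l, morE q p β (fun z => ENNReal.ofReal |Dxx k l u z|) :=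
          Finset.sum_le_sum fun k _ => morE_sum hq1 hp1 _ (hm2 k)
      _ ≤ ∑ k : Fin d, ∑ l : Fin d, C * (ENNReal.ofReal ε * X + N * morE q p β f) :=
          Finset.sum_le_sum fun k _ => Finset.sum_le_sum fun l _ => h1 k l
      _ = _ := by simp; ring
  have h3 : d * (d * C) * ENNReal.ofReal ε ≤ 2⁻¹ := by
    rw [← ENNReal.ofReal_toReal hcd, ← ENNReal.ofReal_mul (by positivity), show (2⁻¹ : ℝ≥0∞) = ENNReal.ofReal 2⁻¹ by
      rw [ENNReal.ofReal_inv_of_pos (by norm_num)]; simp]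
    refine ENNReal.ofReal_le_ofReal ?_
    rw [hεd, mul_one_div, div_le_iff₀ (by positivity)]
    have : 0 ≤ (d * (d * C) : ℝ≥0∞).toReal := ENNReal.toReal_nonneg
    linarith
  have h4 : X ≤ 2⁻¹ * X + d * (d * C) * N * morE q p β f := by
    refine h2.trans ?_
    rw [mul_add, ← mul_assoc _ (ENNReal.ofReal ε), ← mul_assoc _ N]
    exact add_le_add (mul_le_mul' h3 le_rfl) le_rfl
  have h5 : 2⁻¹ * X ≤ d * (d * C) * N * morE q p β f := by
    have e : X = 2⁻¹ * X + 2⁻¹ * X := by rw [← add_mul, ENNReal.inv_two_add_inv_two, one_mul]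
    nth_rewrite 1 [e] at h4
    exact (ENNReal.add_le_add_iff_left (ENNReal.mul_ne_top (by simp) hfin)).1 h4
  calc X = 2 * (2⁻¹ * X) := by rw [← mul_assoc, ENNReal.mul_inv_cancel (by simp) (by simp), one_mul]
    _ ≤ 2 * (d * (d * C) * N * morE q p β f) := mul_le_mul' le_rfl h5
    _ = _ := by ring

lemma cyl_pp {p : ℝ} (hp : 0 < p) {R : ℝ} (hR : 0 < R) (t : ℝ) (x : Spc d) {f : Pt d → ℝ≥0∞} (hf : Measurable f) :
    volume (cyl d 1 0 0) ^ (1 / p) * (ENNReal.ofReal (R ^ ((d + 2 : ℝ) / p)) * cylE p p R t x f) =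
      (∫⁻ z in cyl d R t x, f z ^ p) ^ (1 / p) := by
  have h1 := cylE_eq hp hp hR t x f
  have h2 : gam d p p R = ENNReal.ofReal R ^ (d + 2) * volume (cyl d 1 0 0) := by
    have := vol_cyl_mul (0 : Spc d) 0 0 0 hR 1
    rw [mul_one] at this
    rw [← this, vol_cyl, gam, div_self hp.ne', ENNReal.rpow_one, mul_comm]
  have h3 : gam d p p R ^ (1 / p) = volume (cyl d 1 0 0) ^ (1 / p) * ENNReal.ofReal (R ^ ((d + 2 : ℝ) / p)) := by
    rw [h2, ENNReal.mul_rpow_of_nonneg _ _ (by positivity), mul_comm, ← ENNReal.rpow_natCast, ← ENNReal.rpow_mul,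
      ENNReal.ofReal_rpow_of_pos hR]
    congr 3; push_cast; ring
  rw [← mul_assoc, ← h3, ← h1, mixn, mixI, ← lintegral_indicator (cyl_meas _ _ _), lint_pt ((hf.pow_const p).indicator (cyl_meas _ _ _))]
  simp only [div_self hp.ne', ENNReal.rpow_one]
  congr 4; funext x; congr 1; funext s
  by_cases h : (s, x) ∈ cyl d R t x <;> simp [h, hp, indicator]

/-- `(H_s)` implies `(H_p)` for `p > s`. -/
lemma hs_up {δ : ℝ} (hδ : 0 < δ) {s p : ℝ} (hs : 1 ≤ s) (hsp : s < p) (H : HS d δ (ENNReal.ofReal s)) :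
    HS d δ (ENNReal.ofReal p) := by
  have hp : 0 < p := by linarith
  set β := (d + 2 : ℝ) / p
  have hβ : 0 < β := by positivity
  obtain ⟨ε, hε, hc⟩ := mor_close d hs hsp hsp hβ
  obtain ⟨κ, hκ, N, hN, ho⟩ := osc_const hδ hs H hε
  obtain ⟨N', hN', hc⟩ := hc κ hκ N hN
  set V := volume (cyl d 1 0 0) ^ (1 / p)
  have V0 : V ≠ 0 := (ENNReal.rpow_pos (pos_iff_ne_zero.2 (vol_cyl_ne _ _ one_pos)) (vol_cyl_fin _ _ _)).ne'
  have Vt : V ≠ ⊤ := ENNReal.rpow_ne_top_of_nonneg (by positivity) (vol_cyl_fin _ _ _)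
  have eL : ∀ g : Pt d → ℝ, eLpNorm g (ENNReal.ofReal p) volume = (∫⁻ z, ENNReal.ofReal |g z| ^ p) ^ (1 / p) := by
    intro g
    rw [eLpNorm_eq_lintegral_rpow_enorm_toReal (by simpa using hp) (by simp), ENNReal.toReal_ofReal hp.le]
    simp only [Real.enorm_eq_ofReal_abs]
  have up : ∀ f : Pt d → ℝ≥0∞, Measurable f → V * morE p p β f ≤ (∫⁻ z, f z ^ p) ^ (1 / p) := by
    intro f hf
    rw [morE]
    simp only [ENNReal.mul_iSup]
    refine iSup_le fun R => iSup_le fun hR => iSup_le fun t => iSup_le fun x => ?_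
    rw [cyl_pp hp hR t x hf]
    exact ENNReal.rpow_le_rpow (setLIntegral_le_lintegral _ _) (by positivity)
  refine ⟨N'.toNNReal, fun σ hσ A hA hS u hu i j => ?_⟩
  rw [ENNReal.coe_toNNReal hN']
  have hLm : Measurable (Lop σ (fun z => A z.1) u) := Lop_meas hu σ (hA.comp measurable_fst)
  have hLm' : Measurable (fun z => ENNReal.ofReal |Lop σ (fun z => A z.1) u z|) :=
    (continuous_abs.measurable.comp hLm).ennreal_ofReal
  have hm2 : ∀ k l, Measurable fun z => ENNReal.ofReal |Dxx k l u z| := fun k l =>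
    (continuous_abs.comp (hu.Dxx k l).cont).measurable.ennreal_ofReal
  have hfin : morE p p β (hes u) ≠ ⊤ := by
    have h1 : ∀ k l, morE p p β (fun z => ENNReal.ofReal |Dxx k l u z|) ≠ ⊤ := by
      intro k l
      have := up _ (hm2 k l)
      rw [← eL] at this
      have h2 := (this.trans_lt ((hu.Dxx k l).memLp _).2).ne
      exact fun h => h2 (by rw [h, ENNReal.mul_top V0])
    refine ne_top_of_le_ne_top ?_ (morE_sum (by linarith) (by linarith) _ fun k => Finset.measurable_sum _ fun l _ => hm2 k l)
    refine ENNReal.sum_ne_top.2 fun k _ => ne_top_of_le_ne_top ?_ (morE_sum (by linarith) (by linarith) _ (hm2 k))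
    exact ENNReal.sum_ne_top.2 fun l _ => h1 k l
  have key := hc u hu _ hLm' (fun i j R hR t x => ho σ hσ A hA hS u hu i j R hR t x) hfin
  -- lower bound
  have low : eLpNorm (Dxx i j u) (ENNReal.ofReal p) volume ≤ V * morE p p β (hes u) := by
    obtain ⟨r, hr⟩ := (hu.Dxx i j).2.isCompact.isBounded.subset_ball 0
    set R := max r 1 * 2
    have hR1 : r ≤ max r 1 := le_max_left _ _
    have hR2 : 1 ≤ max r 1 := le_max_right _ _
    have hsub : tsupport (Dxx i j u) ⊆ cyl d R (-(R ^ 2 / 2)) 0 := by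
      intro z hz
      have := hr hz
      rw [← Qb_eq] at this
      refine prod_mono (Ioo_subset_Ioo ?_ ?_) (ball_subset_ball ?_) this <;> simp only [R] <;> nlinarith
    rw [eL]
    calc _ = (∫⁻ z in cyl d R (-(R ^ 2 / 2)) 0, ENNReal.ofReal |Dxx i j u z| ^ p) ^ (1 / p) := by
          rw [setLIntegral_eq_of_support_subset]
          intro z hz
          refine hsub (subset_tsupport _ fun h0 => hz ?_)
          simp [h0, hp]
      _ = V * (ENNReal.ofReal (R ^ β) * cylE p p R (-(R ^ 2 / 2)) 0 fun z => ENNReal.ofReal |Dxx i j u z|) :=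
          (cyl_pp hp (by positivity) _ _ (hm2 i j)).symm
      _ ≤ V * morE p p β (fun z => ENNReal.ofReal |Dxx i j u z|) := mul_le_mul' le_rfl
          (le_iSup_of_le R (le_iSup_of_le (by positivity) (le_iSup_of_le _ (le_iSup_of_le _ le_rfl))))
      _ ≤ _ := mul_le_mul' le_rfl (morE_mono hp hp fun z =>
          (Finset.single_le_sum (f := fun l => ENNReal.ofReal |Dxx i l u z|) (fun _ _ => zero_le) (Finset.mem_univ j)).trans
            (Finset.single_le_sum (f := fun k => ∑ l, ENNReal.ofReal |Dxx k l u z|) (fun _ _ => zero_le) (Finset.mem_univ i)))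
  refine low.trans ((mul_le_mul' le_rfl key).trans ?_)
  rw [mul_left_comm, eL]
  exact mul_le_mul' le_rfl (up _ hLm')
end

section
variable {d : ℕ} {u w : Pt d → ℝ}

lemma tay1 {F F' F'' : ℝ → ℝ} (h1 : ∀ s, HasDerivAt F (F' s) s) (h2 : ∀ s, HasDerivAt F' (F'' s) s) {K : ℝ}
    (hK : ∀ s, |F'' s| ≤ K) (h : ℝ) : |F h - F 0 - h * F' 0| ≤ K * h ^ 2 := by
  have e1 : ∀ s ∈ uIcc 0 h, |F' s - F' 0| ≤ K * |h| := by
    intro s hs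
    have := Convex.norm_image_sub_le_of_norm_hasDerivWithin_le (f := F') (s := uIcc 0 h) (C := K)
      (fun s _ => (h2 s).hasDerivWithinAt) (fun s _ => hK s) (convex_uIcc 0 h) left_mem_uIcc hs
    rw [Real.norm_eq_abs, Real.norm_eq_abs] at this
    refine this.trans (mul_le_mul_of_nonneg_left ?_ ((abs_nonneg _).trans (hK 0)))
    have := abs_sub_left_of_mem_uIcc hs
    simpa using this
  have := Convex.norm_image_sub_le_of_norm_hasDerivWithin_le (f := fun s => F s - s * F' 0) (s := uIcc 0 h) (C := K * |h|)
      (fun s _ => ((h1 s).sub ((hasDerivAt_id s).mul_const (F' 0))).hasDerivWithinAt)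
      (fun s hs => by simpa using e1 s hs) (convex_uIcc 0 h) left_mem_uIcc right_mem_uIcc
  rw [Real.norm_eq_abs, Real.norm_eq_abs] at this
  simp only [sub_zero, zero_mul, mul_assoc, abs_mul_abs_self] at this
  rw [sq, sub_right_comm]; exact this

lemma tay2 {F F' F'' F3 : ℝ → ℝ} (h1 : ∀ s, HasDerivAt F (F' s) s) (h2 : ∀ s, HasDerivAt F' (F'' s) s)
    (h3 : ∀ s, HasDerivAt F'' (F3 s) s) {K : ℝ} (hK : ∀ s, |F3 s| ≤ K) {h : ℝ} (hh : 0 ≤ h) :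
    |F h + F (-h) - 2 * F 0 - h ^ 2 * F'' 0| ≤ 2 * K * h ^ 3 := by
  have K0 : 0 ≤ K := (abs_nonneg _).trans (hK 0)
  have d1 : ∀ s, HasDerivAt (fun s => F s + F (-s) - s ^ 2 * F'' 0) (F' s - F' (-s) - 2 * s * F'' 0) s := by
    intro s
    have := ((h1 s).add ((h1 (-s)).comp s (hasDerivAt_neg s))).sub (((hasDerivAt_id s).pow 2).mul_const (F'' 0))
    refine this.congr_deriv ?_
    simp; ring
  have := Convex.norm_image_sub_le_of_norm_hasDerivWithin_le (f := fun s => F s + F (-s) - s ^ 2 * F'' 0) (s := Icc 0 h)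
      (C := 2 * K * h ^ 2) (fun s _ => (d1 s).hasDerivWithinAt) (fun s hs => ?_) (convex_Icc 0 h)
      (left_mem_Icc.2 hh) (right_mem_Icc.2 hh)
  · rw [Real.norm_eq_abs, Real.norm_eq_abs, sub_zero, abs_of_nonneg hh] at this
    have e : F h + F (-h) - 2 * F 0 - h ^ 2 * F'' 0 = F h + F (-h) - h ^ 2 * F'' 0 - (F 0 + F (-0) - 0 ^ 2 * F'' 0) := by
      rw [neg_zero]; ring
    rw [e]; refine this.trans (le_of_eq (by ring))
  · have a1 := abs_le.1 (tay1 h2 h3 hK s)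
    have a2 := abs_le.1 (tay1 h2 h3 hK (-s))
    have a3 : K * s ^ 2 ≤ K * h ^ 2 := mul_le_mul_of_nonneg_left (pow_le_pow_left₀ hs.1 hs.2 2) K0
    rw [Real.norm_eq_abs, abs_le]
    constructor <;> nlinarith

lemma CinfC.tr (hu : CinfC u) (z : Pt d) : CinfC (fun y => u (y + z)) :=
  ⟨hu.1.comp (by fun_prop), hu.2.comp_homeomorph (Homeomorph.addRight z)⟩

lemma dv_tr (v : Pt d) (u : Pt d → ℝ) (z : Pt d) : dv v (fun y => u (y + z)) = fun y => dv v u (y + z) := by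
  funext y; rw [dv, fderiv_comp_add_right, dv]

lemma Dt_tr (hu : CinfC u) (z : Pt d) : Dt (fun y => u (y + z)) = fun y => Dt u (y + z) := by
  rw [Dt_eq (hu.tr z), dv_tr, Dt_eq hu]
lemma Dxx_tr (hu : CinfC u) (i j : Fin d) (z : Pt d) : Dxx i j (fun y => u (y + z)) = fun y => Dxx i j u (y + z) := by
  rw [Dxx_eq (hu.tr z), dv_tr, dv_tr, Dxx_eq hu]

lemma line_deriv (hu : CinfC u) (v y : Pt d) (s : ℝ) : HasDerivAt (fun s : ℝ => u (y + s • v)) (dv v u (y + s • v)) s := by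
  have h1 : HasDerivAt (fun s : ℝ => y + s • v) v s := by
    simpa using ((hasDerivAt_id s).smul_const v).const_add y
  exact (hu.diff (y + s • v)).hasFDerivAt.comp_hasDerivAt s h1

open Classical in
/-- class in `L_p` -/
def tl (p : ℝ≥0∞) (f : Pt d → ℝ) : Lp ℝ p (volume : Measure (Pt d)) := if h : MemLp f p volume then h.toLp f else 0

variable {p : ℝ≥0∞}

lemma tl_eq {f : Pt d → ℝ} (h : MemLp f p volume) : tl p f = h.toLp f := by simp [tl, h]
lemma tl_add {f g : Pt d → ℝ} (h : MemLp f p volume) (k : MemLp g p volume) : tl p (fun z => f z + g z) = tl p f + tl p g := by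
  rw [tl_eq h, tl_eq k, ← MemLp.toLp_add, ← tl_eq]; rfl
lemma tl_smul {f : Pt d → ℝ} (c : ℝ) (h : MemLp f p volume) : tl p (fun z => c * f z) = c • tl p f := by
  rw [tl_eq h, ← MemLp.toLp_const_smul, ← tl_eq]; rfl
lemma tl_sub {f g : Pt d → ℝ} (h : MemLp f p volume) (k : MemLp g p volume) : tl p (fun z => f z - g z) = tl p f - tl p g := by
  rw [tl_eq h, tl_eq k, ← MemLp.toLp_sub, ← tl_eq]; rfl
lemma tl_norm {f : Pt d → ℝ} (h : MemLp f p volume) : ‖tl p f‖ = (eLpNorm f p volume).toReal := by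
  rw [tl_eq h, Lp.norm_toLp]

lemma tl_tr_norm (hu : CinfC u) (z : Pt d) : ‖tl p (fun y => u (y + z))‖ = ‖tl p u‖ := by
  rw [tl_norm ((hu.tr z).memLp p), tl_norm (hu.memLp p)]
  congr 1
  exact eLpNorm_comp_measurePreserving hu.cont.aestronglyMeasurable (measurePreserving_add_right volume z)

/-- translation is differentiable in `L_p` -/
lemma tl_deriv [Fact (1 ≤ p)] (hp : p ≠ ⊤) (hu : CinfC u) (v : Pt d) :
    HasDerivAt (fun s : ℝ => tl p (fun y => u (y + s • v))) (tl p (dv v u)) 0 := by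
  obtain ⟨K, K0, hK⟩ := ((hu.dv v).dv v).bd
  obtain ⟨r, hr⟩ := hu.2.isCompact.isBounded.subset_closedBall 0
  set S : Set (Pt d) := closedBall 0 (r + ‖v‖)
  have hS : ∀ (s : ℝ), |s| ≤ 1 → ∀ y ∉ S, u (y + s • v) = 0 := by
    intro s hs y hy
    by_contra h
    have h1 := hr (subset_tsupport u h)
    rw [mem_closedBall_zero_iff] at h1
    refine hy (mem_closedBall_zero_iff.2 ?_)
    have h2 : ‖s • v‖ ≤ ‖v‖ := by
      rw [norm_smul]; exact mul_le_of_le_one_left (norm_nonneg _) hs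
    calc ‖y‖ = ‖(y + s • v) - s • v‖ := by simp
      _ ≤ ‖y + s • v‖ + ‖s • v‖ := norm_sub_le _ _
      _ ≤ _ := add_le_add h1 h2
  have hS' : ∀ y ∉ S, dv v u y = 0 := by
    intro y hy
    have : y ∉ tsupport u := fun h => hy (closedBall_subset_closedBall (le_add_of_nonneg_right (norm_nonneg v)) (hr h))
    rw [dv, show fderiv ℝ u y = 0 from by_contra fun h => this (support_fderiv_subset ℝ h)]; rfl
  have hSm : MeasurableSet S := isClosed_closedBall.measurableSet
  have hSf : volume S ≠ ⊤ := measure_closedBall_lt_top.ne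
  set V := (volume S ^ (1 / p.toReal)).toReal
  have hVf : volume S ^ (1 / p.toReal) ≠ ⊤ := ENNReal.rpow_ne_top_of_nonneg (by positivity) hSf
  have hp0 : p ≠ 0 := fun h => by have := (Fact.out : 1 ≤ p); simp [h] at this
  have key : ∀ s : ℝ, |s| ≤ 1 → ‖tl p (fun y => u (y + s • v)) - tl p u - s • tl p (dv v u)‖ ≤ K * V * s ^ 2 := by
    intro s hs
    have m1 := (hu.tr (s • v)).memLp p
    have m2 := hu.memLp p
    have m3 := (hu.dv v).memLp p
    have m4 : MemLp (fun z => u (z + s • v) - u z) p volume := m1.sub m2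
    have m5 : MemLp (fun z => u (z + s • v) - u z - s * dv v u z) p volume := m4.sub (m3.const_mul s)
    rw [← tl_sub m1 m2, ← tl_smul s m3, ← tl_sub m4 (m3.const_mul s), tl_norm m5]
    have b : eLpNorm (fun z => u (z + s • v) - u z - s * dv v u z) p volume ≤ ENNReal.ofReal (K * s ^ 2) * volume S ^ (1 / p.toReal) := by
      have e : eLpNorm (S.indicator fun _ => K * s ^ 2) p volume = ENNReal.ofReal (K * s ^ 2) * volume S ^ (1 / p.toReal) := by
        rw [eLpNorm_indicator_const hSm hp0 hp, Real.enorm_eq_ofReal_abs, abs_of_nonneg (by positivity)]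
      rw [← e]
      refine eLpNorm_mono fun y => ?_
      by_cases hy : y ∈ S
      · rw [indicator_of_mem hy, Real.norm_eq_abs, Real.norm_eq_abs, abs_of_nonneg (by positivity : 0 ≤ K * s ^ 2)]
        have := tay1 (line_deriv hu v y) (line_deriv (hu.dv v) v y) (fun t => hK (y + t • v)) s
        simpa using this
      · have := hS 0 (by simp) y hy
        simp only [zero_smul, add_zero] at this
        rw [hS s hs y hy, this, hS' y hy]; simp
    have := ENNReal.toReal_mono (ENNReal.mul_ne_top (by simp) hVf) b
    rw [ENNReal.toReal_mul, ENNReal.toReal_ofReal (by positivity)] at this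
    refine this.trans (le_of_eq (by ring))
  rw [hasDerivAt_iff_isLittleO]
  refine Asymptotics.IsBigO.trans_isLittleO (g := fun s : ℝ => s ^ 2) (Asymptotics.IsBigO.of_bound (K * V) ?_) ?_
  · filter_upwards [Metric.closedBall_mem_nhds (0 : ℝ) one_pos] with s hs
    have := key s (by simpa using hs)
    simpa using this
  · simp only [sub_zero]
    exact Asymptotics.isLittleO_pow_id one_lt_two

end

section
variable {d : ℕ} {u w : Pt d → ℝ} {p : ℝ≥0∞}

lemma Dt_add (h : CinfC u) (k : CinfC w) (z) : Dt (fun z => u z + w z) z = Dt u z + Dt w z := by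
  rw [Dt_eq (h.add k), dv_add h k, Dt_eq h, Dt_eq k]
lemma Dt_smul (h : CinfC u) (c : ℝ) (z) : Dt (fun z => c * u z) z = c * Dt u z := by
  rw [Dt_eq (h.smul c), dv_smul h, Dt_eq h]
lemma Dxx_add (h : CinfC u) (k : CinfC w) (i j) (z) : Dxx i j (fun z => u z + w z) z = Dxx i j u z + Dxx i j w z := by
  rw [Dxx_eq (h.add k), Dxx_eq h, Dxx_eq k, funext (dv_add h k _), dv_add (h.dv _) (k.dv _)]
lemma Dxx_smul (h : CinfC u) (c : ℝ) (i j) (z) : Dxx i j (fun z => c * u z) z = c * Dxx i j u z := by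
  rw [Dxx_eq (h.smul c), Dxx_eq h, funext (dv_smul h c _), dv_smul (h.dv _)]
lemma Lop_add (h : CinfC u) (k : CinfC w) (σ : ℝ) (a) (z) : Lop σ a (fun z => u z + w z) z = Lop σ a u z + Lop σ a w z := by
  simp only [Lop, Dt_add h k, Dxx_add h k, mul_add, Finset.sum_add_distrib]; ring
lemma Lop_smul (h : CinfC u) (c : ℝ) (σ : ℝ) (a) (z) : Lop σ a (fun z => c * u z) z = c * Lop σ a u z := by
  simp only [Lop, Dt_smul h, Dxx_smul h, mul_add, Finset.mul_sum]
  congr 1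
  · ring
  · exact Finset.sum_congr rfl fun i _ => Finset.sum_congr rfl fun j _ => by ring

lemma lap_sup [Fact (1 ≤ p)] (hp : p ≠ ⊤) {σ lam : ℝ} (hσ : σ ^ 2 = 1) (hl : 0 < lam)
    (Λ : StrongDual ℝ (Lp ℝ p (volume : Measure (Pt d))))
    (hΛ : ∀ ψ, CinfC ψ → Λ (tl p (fun z => Lop σ (fun _ => 1) ψ z - lam * ψ z)) = 0) {g : Pt d → ℝ} (hg : CinfC g) :
    Λ (tl p g) ≤ 0 := by
  set Φ : (Pt d → ℝ) → Pt d → ℝ := fun w z => Λ (tl p (fun y => w (y + z)))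
  have hd : ∀ w, CinfC w → ∀ v z s, HasDerivAt (fun s : ℝ => Φ w (z + s • v)) (Φ (dv v w) (z + s • v)) s := by
    intro w hw v z s
    have h1 := tl_deriv hp (hw.tr (z + s • v)) v
    rw [dv_tr, ← sub_self s] at h1
    have h2 := Λ.hasFDerivAt.comp_hasDerivAt s (h1.comp_sub_const s s)
    refine h2.congr_of_eventuallyEq (.of_forall fun t => ?_)
    simp only [Φ, Function.comp]
    congr 2; funext y; congr 1; rw [sub_smul]; abel
  have hb : ∀ w, CinfC w → ∀ z, |Φ w z| ≤ ‖Λ‖ * ‖tl p w‖ := by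
    intro w hw z
    have := Λ.le_opNorm (tl p (fun y => w (y + z)))
    rwa [tl_tr_norm hw] at this
  have hadd : ∀ f g, CinfC f → CinfC g → ∀ z, Φ (fun y => f y + g y) z = Φ f z + Φ g z := by
    intro f g hf hg z
    simp only [Φ]; rw [tl_add ((hf.tr z).memLp p) ((hg.tr z).memLp p), map_add]
  have hsm : ∀ (c : ℝ) f, CinfC f → ∀ z, Φ (fun y => c * f y) z = c * Φ f z := by
    intro c f hf z
    simp only [Φ]; rw [tl_smul c ((hf.tr z).memLp p), map_smul, smul_eq_mul]
  have hsum : ∀ (S : Finset (Fin d)) (f : Fin d → Pt d → ℝ), (∀ i, CinfC (f i)) → ∀ z,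
      Φ (fun y => ∑ i ∈ S, f i y) z = ∑ i ∈ S, Φ (f i) z := by
    intro S f hf z
    classical
    induction S using Finset.induction_on with
    | empty =>
      have := hsm 0 _ CinfC.zero z
      simpa using this
    | insert i S hi ih =>
      simp only [Finset.sum_insert hi]
      rw [hadd _ _ (hf i) (CinfC.sum S hf), ih]
  let e : Fin d → Pt d := fun i => (0, EuclideanSpace.single i 1)
  have heq : ∀ z, lam * Φ g z = Φ (dv (σ • (1, 0)) g) z + ∑ i, Φ (dv (e i) (dv (e i) g)) z := by
    intro z
    have h := hΛ _ (hg.tr z)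
    have e1 : (fun y => Lop σ (fun _ => 1) (fun y => g (y + z)) y - lam * g (y + z)) =
        fun y => (fun y => (dv (σ • (1, 0)) g y + ∑ i, dv (e i) (dv (e i) g) y) + (-lam) * g y) (y + z) := by
      funext y
      have : ∀ i j : Fin d, (1 : Matrix (Fin d) (Fin d) ℝ) i j * Dxx i j g (y + z) = if i = j then Dxx i j g (y + z) else 0 := by
        intro i j; rcases eq_or_ne i j with hij | hij <;> simp [Matrix.one_apply, hij]
      simp only [Lop, Dt_tr hg, Dxx_tr hg, this]
      simp only [Finset.sum_ite_eq, Finset.mem_univ, if_true, Dxx_eq hg, Dt_eq hg]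
      simp only [dv, map_smul, smul_eq_mul, e]; ring
    rw [e1] at h
    replace h : Φ (fun y => (dv (σ • (1, 0)) g y + ∑ i, dv (e i) (dv (e i) g) y) + (-lam) * g y) z = 0 := h
    have c1 := hg.dv (σ • (1, 0))
    have c2 := CinfC.sum Finset.univ fun i => (hg.dv (e i)).dv (e i)
    rw [hadd _ _ (c1.add c2) (hg.smul _), hadd _ _ c1 c2, hsum _ _ (fun i => (hg.dv (e i)).dv (e i)), hsm _ _ hg] at h
    linarith
  set v0 : Pt d := σ • (1, 0)
  set K : ℝ := ‖Λ‖ * ‖tl p (dv v0 (dv v0 g))‖ + ∑ i, ‖Λ‖ * ‖tl p (dv (e i) (dv (e i) (dv (e i) g)))‖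
  have K0 : ‖Λ‖ * ‖tl p (dv v0 (dv v0 g))‖ ≤ K := le_add_of_nonneg_right (Finset.sum_nonneg fun i _ => by positivity)
  have K1 : ∀ i, ‖Λ‖ * ‖tl p (dv (e i) (dv (e i) (dv (e i) g)))‖ ≤ K := fun i =>
    (Finset.single_le_sum (f := fun i => ‖Λ‖ * ‖tl p (dv (e i) (dv (e i) (dv (e i) g)))‖) (fun i _ => by positivity)
      (Finset.mem_univ i)).trans (le_add_of_nonneg_left (by positivity))
  have Kp : 0 ≤ K := le_trans (by positivity) K0
  have hbdd : BddAbove (range (Φ g)) := ⟨_, by rintro _ ⟨z, rfl⟩; exact (abs_le.1 (hb g hg z)).2⟩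
  set m := sSup (range (Φ g))
  have hm : ∀ z, Φ g z ≤ m := fun z => le_csSup hbdd ⟨z, rfl⟩
  have hmain : ∀ h : ℝ, 0 < h → h ≤ 1 → lam * m ≤ (lam + (1 + K) + d * (2 + 2 * K)) * h := by
    intro h h0 h1
    obtain ⟨_, ⟨z, rfl⟩, hz⟩ := exists_lt_of_lt_csSup (range_nonempty (Φ g)) (show m - h ^ 3 < m by
      have : 0 < h ^ 3 := by positivity
      linarith)
    have hh3 : h ^ 3 ≤ h := by nlinarith [pow_pos h0 2, pow_le_one₀ h0.le h1 (n := 2)]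
    have a1 : Φ (dv v0 g) z ≤ (1 + K) * h := by
      have := (abs_le.1 (tay1 (hd g hg v0 z) (hd _ (hg.dv v0) v0 z)
        (fun s => (hb _ ((hg.dv v0).dv v0) (z + s • v0)).trans K0) h)).1
      simp only [zero_smul, add_zero] at this
      have h2 := hm (z + h • v0)
      have : h * Φ (dv v0 g) z ≤ h * ((1 + K) * h) := by nlinarith
      exact le_of_mul_le_mul_left this h0
    have a2 : ∀ i, Φ (dv (e i) (dv (e i) g)) z ≤ (2 + 2 * K) * h := by
      intro i
      have := (abs_le.1 (tay2 (hd g hg (e i) z) (hd _ (hg.dv (e i)) (e i) z) (hd _ ((hg.dv (e i)).dv (e i)) (e i) z)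
        (fun s => (hb _ (((hg.dv (e i)).dv (e i)).dv (e i)) (z + s • e i)).trans (K1 i)) h0.le)).1
      simp only [zero_smul, add_zero] at this
      have h2 := hm (z + h • e i)
      have h3 := hm (z + (-h) • e i)
      have : h ^ 2 * Φ (dv (e i) (dv (e i) g)) z ≤ h ^ 2 * ((2 + 2 * K) * h) := by nlinarith
      exact le_of_mul_le_mul_left this (by positivity)
    have a3 : ∑ i, Φ (dv (e i) (dv (e i) g)) z ≤ d * ((2 + 2 * K) * h) := by
      refine (Finset.sum_le_sum fun i _ => a2 i).trans (by simp)
    have := heq z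
    nlinarith
  have hm0 : m ≤ 0 := by
    by_contra hc
    push Not at hc
    set C := lam + (1 + K) + d * (2 + 2 * K)
    have hC : 0 < C := by positivity
    have := hmain (min 1 (lam * m / (2 * C))) (by positivity) (min_le_left _ _)
    have h2 : C * min 1 (lam * m / (2 * C)) ≤ C * (lam * m / (2 * C)) := mul_le_mul_of_nonneg_left (min_le_right _ _) hC.le
    have h3 : C * (lam * m / (2 * C)) = lam * m / 2 := by field_simp
    have : 0 < lam * m := by positivity
    linarith
  have := (hm 0).trans hm0
  simpa [Φ] using this

lemma lap_ann [Fact (1 ≤ p)] (hp : p ≠ ⊤) {σ lam : ℝ} (hσ : σ ^ 2 = 1) (hl : 0 < lam)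
    (Λ : StrongDual ℝ (Lp ℝ p (volume : Measure (Pt d))))
    (hΛ : ∀ ψ, CinfC ψ → Λ (tl p (fun z => Lop σ (fun _ => 1) ψ z - lam * ψ z)) = 0) : Λ = 0 := by
  have h0 : ∀ g, CinfC g → Λ (tl p g) = 0 := by
    intro g hg
    refine le_antisymm (lap_sup hp hσ hl Λ hΛ hg) ?_
    have := lap_sup hp hσ hl Λ hΛ (hg.smul (-1))
    rw [tl_smul _ (hg.memLp p), map_smul] at this
    simpa using this
  have hD := MeasureTheory.Lp.dense_hasCompactSupport_contDiff (F := ℝ) (μ := (volume : Measure (Pt d))) hp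
  ext f
  have : Set.EqOn Λ (0 : StrongDual ℝ (Lp ℝ p (volume : Measure (Pt d)))) univ := by
    rw [← hD.closure_eq]
    refine Set.EqOn.closure ?_ Λ.continuous (ContinuousLinearMap.continuous _)
    rintro f ⟨g, hfg, hg1, hg2⟩
    have hg : CinfC g := ⟨hg2, hg1⟩
    have : f = tl p g := by
      rw [tl_eq (hg.memLp p)]
      exact Lp.ext (hfg.trans (hg.memLp p).coeFn_toLp.symm)
    rw [this, h0 g hg]; rfl
  exact this (mem_univ f)
end

section
variable {d : ℕ} {u w : Pt d → ℝ} {p : ℝ≥0∞}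

/-- `L - λ` -/
def Hl (σ lam : ℝ) (A : ℝ → Matrix (Fin d) (Fin d) ℝ) (ψ : Pt d → ℝ) (z : Pt d) : ℝ := Lop σ (fun z => A z.1) ψ z - lam * ψ z

lemma Hl_memLp {δ : ℝ} (hδ : 0 < δ) (h : CinfC u) {A : ℝ → Matrix (Fin d) (Fin d) ℝ}
    (hA : Measurable A) (hS : ∀ t, inS d δ (A t)) (σ lam : ℝ) (p : ℝ≥0∞) : MemLp (Hl σ lam A u) p volume :=
  (Lop_memLp hδ h (hA.comp measurable_fst) (fun z => hS z.1) σ p).sub ((h.memLp p).const_mul lam)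

lemma CinfC.pow (h : CinfC u) (n : ℕ) : CinfC (fun z => u z ^ (n + 1)) := by
  induction n with
  | zero => simpa using h
  | succ n ih =>
    have := ih.mul h
    simpa only [← pow_succ] using this

lemma dv_pow (h : CinfC u) (n : ℕ) (v z) : dv v (fun z => u z ^ n) z = n * u z ^ (n - 1) * dv v u z := by
  have := ((h.diff z).hasFDerivAt.pow n).fderiv
  simp only [dv]; rw [this]; simp

lemma bern {n : ℕ} {x y : ℝ} : 2 * n * (x * y ^ (2 * n - 1)) ≤ x ^ (2 * n) + (2 * n - 1) * y ^ (2 * n) := by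
  rcases Nat.eq_zero_or_pos n with rfl | hn
  · simp
  have hp : ∀ x : ℝ, x ^ (2 * n) = |x| ^ (2 * n) := fun x => by rw [pow_mul, pow_mul, sq_abs]
  have h1 : x * y ^ (2 * n - 1) ≤ |x| * |y| ^ (2 * n - 1) := by
    rw [← abs_pow, ← abs_mul]; exact le_abs_self _
  rw [hp x, hp y]
  have key : ∀ a b : ℝ, 0 ≤ a → 0 ≤ b → 2 * n * (a * b ^ (2 * n - 1)) ≤ a ^ (2 * n) + (2 * n - 1) * b ^ (2 * n) := by
    intro a b ha hb
    rcases hb.eq_or_lt with rfl | hb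
    · rw [zero_pow (by omega), zero_pow (by omega)]; simp; positivity
    have := one_add_mul_sub_le_pow (a := a / b) (by have : 0 ≤ a / b := by positivity
                                                    linarith) (2 * n)
    rw [div_pow, le_div_iff₀ (by positivity)] at this
    have e : b ^ (2 * n) = b ^ (2 * n - 1) * b := by rw [← pow_succ]; congr 1; omega
    have e2 : (1 + ((2 * n : ℕ) : ℝ) * (a / b - 1)) * b ^ (2 * n) = b ^ (2 * n) + 2 * n * (a * b ^ (2 * n - 1)) - 2 * n * b ^ (2 * n) := by
      rw [e]; push_cast; field_simp; ring
    linarith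
  have := key |x| |y| (abs_nonneg _) (abs_nonneg _)
  have h2 : (0 : ℝ) ≤ 2 * n := by positivity
  nlinarith [mul_le_mul_of_nonneg_left h1 h2]

lemma pw_abs (n : ℕ) (x : ℝ) : |x| ^ ((2 * n : ℕ) : ℝ) = x ^ (2 * n) := by
  rw [Real.rpow_natCast, pow_mul, sq_abs, ← pow_mul]

lemma int_pow {n : ℕ} (hn : 0 < n) {g : Pt d → ℝ} (hg : MemLp g (2 * n : ℕ) volume) : Integrable (fun z => g z ^ (2 * n)) := by
  have h2 := hg.integrable_norm_rpow (by simp; omega) (ENNReal.natCast_ne_top _)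
  simpa only [ENNReal.toReal_natCast, Real.norm_eq_abs, pw_abs] using h2

lemma tl_le {n : ℕ} (hn : 0 < n) {f g : Pt d → ℝ} (hf : MemLp f (2 * n : ℕ) volume) (hg : MemLp g (2 * n : ℕ) volume)
    (h : ∫ z, f z ^ (2 * n) ≤ ∫ z, g z ^ (2 * n)) : ‖tl (2 * n : ℕ) f‖ ≤ ‖tl (2 * n : ℕ) g‖ := by
  have e : ∀ g : Pt d → ℝ, MemLp g (2 * n : ℕ) volume → ‖tl (2 * n : ℕ) g‖ = (∫ z, g z ^ (2 * n)) ^ ((2 * n : ℕ) : ℝ)⁻¹ := by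
    intro g hg
    rw [tl_norm hg, MemLp.eLpNorm_eq_integral_rpow_norm (by simp; omega) (ENNReal.natCast_ne_top _) hg, ENNReal.toReal_ofReal (by positivity)]
    simp only [ENNReal.toReal_natCast, Real.norm_eq_abs, pw_abs]
  rw [e _ hf, e _ hg]
  refine Real.rpow_le_rpow (integral_nonneg fun z => ?_) h (by positivity)
  change 0 ≤ f z ^ (2 * n)
  rw [pow_mul]; positivity

/-- resolvent bound -/
lemma res_bd {δ : ℝ} (hδ : 0 < δ) {n : ℕ} (hn : 0 < n) {σ lam : ℝ} (hl : 0 < lam) {A : ℝ → Matrix (Fin d) (Fin d) ℝ}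
    (hA : Measurable A) (hS : ∀ t, inS d δ (A t)) (h : CinfC u) :
    lam * ‖tl (2 * n : ℕ) u‖ ≤ ‖tl (2 * n : ℕ) (Hl σ lam A u)‖ := by
  have : Fact (1 ≤ ((2 * n : ℕ) : ℝ≥0∞)) := ⟨by exact_mod_cast (by omega : 1 ≤ 2 * n)⟩
  have hHm := Hl_memLp hδ h hA hS σ lam (2 * n : ℕ)
  have hum := h.memLp (2 * n : ℕ)
  have h2n : 2 * n = (2 * n - 1) + 1 := by omega
  have c1 : CinfC (fun z => u z ^ (2 * n)) := by rw [h2n]; exact h.pow _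
  have c2 : CinfC (fun z => u z ^ (2 * n - 1)) := by
    have : 2 * n - 1 = (2 * n - 2) + 1 := by omega
    rw [this]; exact h.pow _
  have z1 := (Zint_Dt c1).smul (σ / (2 * n))
  have z2 := Zint.sum Finset.univ fun i => Zint.sum Finset.univ fun j => Zint_Dx ((h.Dx j).mul c2) i
    (b := fun t => A t i j) (meas_entry hA i j) (fun t => (hS t).bdd hδ i j)
  have hn' : (0 : ℝ) < n := by exact_mod_cast hn
  have hpt : ∀ z, lam * (2 * n * u z ^ (2 * n)) - 2 * n * ((σ / (2 * n)) * Dt (fun z => u z ^ (2 * n)) z +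
      ∑ i, ∑ j, A z.1 i j * Dx i (fun z => Dx j u z * u z ^ (2 * n - 1)) z) ≤
      lam * ((lam⁻¹ * Hl σ lam A u z) ^ (2 * n) + (2 * n - 1) * u z ^ (2 * n)) := by
    intro z
    have e1 : Dt (fun z => u z ^ (2 * n)) z = (2 * n) * (Dt u z * u z ^ (2 * n - 1)) := by
      rw [Dt_eq c1, dv_pow h, Dt_eq h]; push_cast; ring
    have e2 : ∀ i j, Dx i (fun z => Dx j u z * u z ^ (2 * n - 1)) z = Dxx i j u z * u z ^ (2 * n - 1) +
        (2 * n - 1 : ℕ) * u z ^ (2 * n - 2) * (Dx i u z * Dx j u z) := by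
      intro i j
      rw [Dx_mul (h.Dx j) c2, Dx_eq c2, dv_pow h, ← Dx_eq h, Nat.sub_sub]; simp only [Dxx]; ring
    have e3 : ∑ i, ∑ j, A z.1 i j * Dx i (fun z => Dx j u z * u z ^ (2 * n - 1)) z =
        (∑ i, ∑ j, A z.1 i j * Dxx i j u z) * u z ^ (2 * n - 1) +
        (2 * n - 1 : ℕ) * u z ^ (2 * n - 2) * ∑ i, ∑ j, A z.1 i j * Dx i u z * Dx j u z := by
      simp only [e2, Finset.sum_mul, Finset.mul_sum, ← Finset.sum_add_distrib]
      exact Finset.sum_congr rfl fun i _ => Finset.sum_congr rfl fun j _ => by ring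
    have pos : 0 ≤ (2 * n - 1 : ℕ) * u z ^ (2 * n - 2) * ∑ i, ∑ j, A z.1 i j * Dx i u z * Dx j u z := by
      have a1 : 0 ≤ u z ^ (2 * n - 2) := by
        rw [show 2 * n - 2 = 2 * (n - 1) by omega, pow_mul]; positivity
      have a2 := ((hS z.1).2 (fun i => Dx i u z)).1
      have a3 : 0 ≤ δ * ∑ i, Dx i u z ^ 2 := by positivity
      exact mul_nonneg (mul_nonneg (by positivity) a1) (a3.trans a2)
    rw [e1, e3]
    set Q := (2 * n - 1 : ℕ) * u z ^ (2 * n - 2) * ∑ i, ∑ j, A z.1 i j * Dx i u z * Dx j u z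
    have hb := bern (n := n) (x := -(lam⁻¹ * Hl σ lam A u z)) (y := u z)
    rw [Even.neg_pow (even_two_mul n)] at hb
    have hb2 := mul_le_mul_of_nonneg_left hb hl.le
    refine le_trans ?_ hb2
    have e4 : u z ^ (2 * n) = u z * u z ^ (2 * n - 1) := by rw [← pow_succ']; congr 1
    have e5 : lam * (2 * n * (-(lam⁻¹ * Hl σ lam A u z) * u z ^ (2 * n - 1))) = - (2 * n * (Hl σ lam A u z * u z ^ (2 * n - 1))) := by
      field_simp
    have e6 : 2 * (n : ℝ) * (σ / (2 * n) * (2 * n * (Dt u z * u z ^ (2 * n - 1)))) = 2 * n * (σ * (Dt u z * u z ^ (2 * n - 1))) := by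
      field_simp
    rw [e5, mul_add (2 * (n : ℝ)), e6, e4, Hl, Lop]
    have : 0 ≤ 2 * n * Q := by positivity
    nlinarith
  have i1 := int_pow hn hum
  have i2 := int_pow hn (hHm.const_mul lam⁻¹)
  have zz := (z1.add z2).smul (2 * n)
  have hi := integral_mono (((i1.const_mul (2 * n)).const_mul lam).sub zz.1) ((i2.add (i1.const_mul (2 * n - 1))).const_mul lam) hpt
  have l1 : ∫ z, (lam * (2 * n * u z ^ (2 * n)) - 2 * n * ((σ / (2 * n)) * Dt (fun z => u z ^ (2 * n)) z +
      ∑ i, ∑ j, A z.1 i j * Dx i (fun z => Dx j u z * u z ^ (2 * n - 1)) z)) = lam * (2 * n * ∫ z, u z ^ (2 * n)) := by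
    rw [integral_sub ((i1.const_mul (2 * n)).const_mul lam) zz.1, zz.2, integral_const_mul, integral_const_mul, sub_zero]
  have l2 : ∫ z, lam * ((lam⁻¹ * Hl σ lam A u z) ^ (2 * n) + (2 * n - 1) * u z ^ (2 * n)) =
      lam * (∫ z, (lam⁻¹ * Hl σ lam A u z) ^ (2 * n)) + lam * ((2 * n - 1) * ∫ z, u z ^ (2 * n)) := by
    rw [integral_const_mul, integral_add i2 (i1.const_mul (2 * n - 1)), integral_const_mul, mul_add]
  have hi' := (l1.symm.le.trans hi).trans l2.le
  have : ∫ z, u z ^ (2 * n) ≤ ∫ z, (lam⁻¹ * Hl σ lam A u z) ^ (2 * n) := by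
    refine le_of_mul_le_mul_left ?_ hl
    linarith
  have := tl_le hn hum (hHm.const_mul lam⁻¹) this
  rw [tl_smul _ hHm, norm_smul, Real.norm_of_nonneg (by positivity)] at this
  rwa [inv_mul_eq_div, le_div_iff₀ hl, mul_comm] at this

lemma hes_bd {δ : ℝ} (hδ : 0 < δ) {n : ℕ} (hn : 0 < n) {N : ℝ≥0} {σ lam : ℝ} (hl : 0 < lam) {A : ℝ → Matrix (Fin d) (Fin d) ℝ}
    (hA : Measurable A) (hS : ∀ t, inS d δ (A t)) (h : CinfC u) (i j : Fin d)
    (H : eLpNorm (Dxx i j u) (2 * n : ℕ) volume ≤ N * eLpNorm (Lop σ (fun z => A z.1) u) (2 * n : ℕ) volume) :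
    ‖tl (2 * n : ℕ) (Dxx i j u)‖ ≤ 2 * N * ‖tl (2 * n : ℕ) (Hl σ lam A u)‖ := by
  have : Fact (1 ≤ ((2 * n : ℕ) : ℝ≥0∞)) := ⟨by exact_mod_cast (by omega : 1 ≤ 2 * n)⟩
  have hHm := Hl_memLp hδ h hA hS σ lam (2 * n : ℕ)
  have hL : MemLp (Lop σ (fun z => A z.1) u) (2 * n : ℕ) volume := Lop_memLp hδ h (hA.comp measurable_fst) (fun z => hS z.1) σ (2 * n : ℕ)
  have h1 : ‖tl (2 * n : ℕ) (Dxx i j u)‖ ≤ N * ‖tl (2 * n : ℕ) (Lop σ (fun z => A z.1) u)‖ := by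
    rw [tl_norm ((h.Dxx i j).memLp _), tl_norm hL]
    have := ENNReal.toReal_mono (ENNReal.mul_ne_top ENNReal.coe_ne_top hL.2.ne) H
    rwa [ENNReal.toReal_mul] at this
  have e : tl (2 * n : ℕ) (Lop σ (fun z => A z.1) u) = tl (2 * n : ℕ) (Hl σ lam A u) + lam • tl (2 * n : ℕ) u := by
    rw [← tl_smul _ (h.memLp _), ← tl_add hHm ((h.memLp _).const_mul lam)]
    congr 1; funext z; simp [Hl]
  have h2 := res_bd (σ := σ) hδ hn hl hA hS h
  have h3 := norm_add_le (tl (2 * n : ℕ) (Hl σ lam A u)) (lam • tl (2 * n : ℕ) u)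
  rw [← e, norm_smul, Real.norm_of_nonneg hl.le] at h3
  have := N.2
  nlinarith [mul_le_mul_of_nonneg_left (h3.trans (add_le_add le_rfl h2)) N.2]
end

section
variable {d : ℕ} {u w : Pt d → ℝ}

lemma inS_one {δ : ℝ} (hδ : 0 < δ) (hδ1 : δ ≤ 1) : inS d δ 1 := by
  have e : ∀ ξ : Fin d → ℝ, ∑ i, ∑ j, (1 : Matrix (Fin d) (Fin d) ℝ) i j * ξ i * ξ j = ∑ i, ξ i ^ 2 := by
    intro ξ
    refine Finset.sum_congr rfl fun i _ => ?_
    simp [Matrix.one_apply, sq]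
  refine ⟨Matrix.isSymm_one, fun ξ => ?_⟩
  rw [e]
  have h0 : 0 ≤ ∑ i, ξ i ^ 2 := by positivity
  exact ⟨mul_le_of_le_one_left h0 hδ1, le_mul_of_one_le_left h0 ((one_le_inv₀ hδ).2 hδ1)⟩

lemma inS_conv {δ c : ℝ} {a b : Matrix (Fin d) (Fin d) ℝ} (ha : inS d δ a) (hb : inS d δ b) (h0 : 0 ≤ c) (h1 : c ≤ 1) :
    inS d δ ((1 - c) • a + c • b) := by
  refine ⟨(ha.1.smul _).add (hb.1.smul _), fun ξ => ?_⟩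
  have e : ∑ i, ∑ j, ((1 - c) • a + c • b) i j * ξ i * ξ j =
      (1 - c) * (∑ i, ∑ j, a i j * ξ i * ξ j) + c * ∑ i, ∑ j, b i j * ξ i * ξ j := by
    simp only [Finset.mul_sum, ← Finset.sum_add_distrib]
    refine Finset.sum_congr rfl fun i _ => Finset.sum_congr rfl fun j _ => ?_
    simp; ring
  rw [e]
  have h2 : 0 ≤ 1 - c := by linarith
  constructor
  · nlinarith [mul_le_mul_of_nonneg_left (ha.2 ξ).1 h2, mul_le_mul_of_nonneg_left (hb.2 ξ).1 h0]
  · nlinarith [mul_le_mul_of_nonneg_left (ha.2 ξ).2 h2, mul_le_mul_of_nonneg_left (hb.2 ξ).2 h0]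

lemma Hl_add (h : CinfC u) (k : CinfC w) (σ lam : ℝ) (A) : Hl σ lam A (fun z => u z + w z) = fun z => Hl σ lam A u z + Hl σ lam A w z := by
  funext z; simp only [Hl, Lop_add h k]; ring
lemma Hl_smul (h : CinfC u) (c σ lam : ℝ) (A) : Hl σ lam A (fun z => c * u z) = fun z => c * Hl σ lam A u z := by
  funext z; simp only [Hl, Lop_smul h]; ring

/-- density of the range -/
def Den (p : ℝ≥0∞) (σ lam : ℝ) (A : ℝ → Matrix (Fin d) (Fin d) ℝ) : Prop :=
  ∀ g : Lp ℝ p (volume : Measure (Pt d)), ∀ ε : ℝ, 0 < ε → ∃ ψ, CinfC ψ ∧ ‖g - tl p (Hl σ lam A ψ)‖ < ε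

lemma rg_ex {δ : ℝ} (hδ : 0 < δ) (p : ℝ≥0∞) [Fact (1 ≤ p)] (σ lam : ℝ) {A : ℝ → Matrix (Fin d) (Fin d) ℝ}
    (hA : Measurable A) (hS : ∀ t, inS d δ (A t)) : ∃ F : Submodule ℝ (Lp ℝ p (volume : Measure (Pt d))),
    (∀ x, x ∈ F ↔ ∃ ψ, CinfC ψ ∧ tl p (Hl σ lam A ψ) = x) ∧ (¬ Den p σ lam A → ∃ x, x ∉ F.topologicalClosure) := by
  let F : Submodule ℝ (Lp ℝ p (volume : Measure (Pt d))) :=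
    { carrier := {x | ∃ ψ, CinfC ψ ∧ tl p (Hl σ lam A ψ) = x}
      add_mem' := by
        rintro _ _ ⟨f, hf, rfl⟩ ⟨g, hg, rfl⟩
        exact ⟨_, hf.add hg, by rw [Hl_add hf hg, tl_add (Hl_memLp hδ hf hA hS _ _ _) (Hl_memLp hδ hg hA hS _ _ _)]⟩
      zero_mem' := ⟨_, CinfC.zero.smul 0, by
        rw [Hl_smul CinfC.zero, tl_smul _ (Hl_memLp hδ CinfC.zero hA hS _ _ _), zero_smul]⟩
      smul_mem' := by
        rintro c _ ⟨f, hf, rfl⟩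
        exact ⟨_, hf.smul c, by rw [Hl_smul hf, tl_smul _ (Hl_memLp hδ hf hA hS _ _ _)]⟩ }
  refine ⟨F, fun x => Iff.rfl, fun h => ?_⟩
  by_contra hc
  push Not at hc
  refine h fun g ε hε => ?_
  obtain ⟨_, ⟨ψ, hψ, rfl⟩, hy⟩ := Metric.mem_closure_iff.1 (hc g) ε hε
  exact ⟨ψ, hψ, by rwa [dist_eq_norm] at hy⟩

lemma den_one {δ : ℝ} (hδ : 0 < δ) (hδ1 : δ ≤ 1) {p : ℝ≥0∞} [Fact (1 ≤ p)] (hp : p ≠ ⊤) {σ lam : ℝ} (hσ : σ ^ 2 = 1) (hl : 0 < lam) :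
    Den (d := d) p σ lam (fun _ => 1) := by
  obtain ⟨F, hF, hD⟩ := rg_ex (d := d) hδ p σ lam (A := fun _ => 1) measurable_const (fun _ => inS_one hδ hδ1)
  by_contra hc
  obtain ⟨x, hx⟩ := hD hc
  obtain ⟨f, c, h1, h2⟩ := geometric_hahn_banach_point_closed F.topologicalClosure.convex F.isClosed_topologicalClosure hx
  have h3 : ∀ b ∈ F, f b = 0 := by
    intro b hb
    by_contra h0
    have := h2 _ (F.le_topologicalClosure (F.smul_mem (c / f b) hb))
    rw [map_smul, smul_eq_mul, div_mul_cancel₀ _ h0] at this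
    exact this.false
  have h4 := h2 0 (zero_mem _)
  have := lap_ann hp hσ hl f fun ψ hψ => h3 _ ((hF _).2 ⟨ψ, hψ, rfl⟩)
  rw [this] at h1 h4
  simp at h1 h4; linarith

lemma den_step {δ : ℝ} (hδ : 0 < δ) {p : ℝ≥0∞} [Fact (1 ≤ p)] {σ lam : ℝ} {A B : ℝ → Matrix (Fin d) (Fin d) ℝ}
    (hA : Measurable A) (hS : ∀ t, inS d δ (A t)) (hB : Measurable B) (hT : ∀ t, inS d δ (B t)) {η M : ℝ} (hη : 0 ≤ η)
    (hM : ∀ ψ : Pt d → ℝ, CinfC ψ → ∀ i j, ‖tl p (Dxx i j ψ)‖ ≤ M * ‖tl p (Hl σ lam A ψ)‖)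
    (hAB : ∀ t i j, |A t i j - B t i j| ≤ η) (hs : d * (d * (η * M)) ≤ 1 / 2) (D : Den p σ lam A) : Den p σ lam B := by
  obtain ⟨F, hF, hD⟩ := rg_ex (d := d) hδ p σ lam hB hT
  by_contra hc
  obtain ⟨x, hx, hy⟩ := riesz_lemma F.isClosed_topologicalClosure (hD hc) (r := 3 / 4) (by norm_num)
  have hx0 : 0 < ‖x‖ := by
    rw [norm_pos_iff]; rintro rfl; exact hx (zero_mem _)
  obtain ⟨ψ, hψ, hψx⟩ := D x (‖x‖ / 8) (by positivity)
  have h1 := hy _ (F.le_topologicalClosure ((hF _).2 ⟨ψ, hψ, rfl⟩))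
  have mA := Hl_memLp hδ hψ hA hS σ lam p
  have mB := Hl_memLp hδ hψ hB hT σ lam p
  set X := ‖tl p (Hl σ lam A ψ)‖
  have mD : ∀ i j, MemLp (fun z : Pt d => (A z.1 i j - B z.1 i j) * Dxx i j ψ z) p volume := by
    intro i j
    refine MemLp.of_le_mul (c := η) ((hψ.Dxx i j).memLp p) ?_ (.of_forall fun z => ?_)
    · exact ((((meas_entry hA i j).sub (meas_entry hB i j)).comp measurable_fst).mul (hψ.Dxx i j).cont.measurable).aestronglyMeasurable
    · rw [norm_mul]; exact mul_le_mul_of_nonneg_right (hAB _ _ _) (norm_nonneg _)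
  have h2 : ‖tl p (Hl σ lam A ψ) - tl p (Hl σ lam B ψ)‖ ≤ d * (d * (η * M)) * X := by
    have e : (fun z => Hl σ lam A ψ z - Hl σ lam B ψ z) = fun z => ∑ i, ∑ j, (A z.1 i j - B z.1 i j) * Dxx i j ψ z := by
      funext z
      simp only [Hl, Lop, sub_mul, Finset.sum_sub_distrib]; ring
    rw [← tl_sub mA mB, tl_norm (show MemLp (fun z => Hl σ lam A ψ z - Hl σ lam B ψ z) p volume from mA.sub mB), e]
    have e1 : ∀ i j, eLpNorm (fun z : Pt d => (A z.1 i j - B z.1 i j) * Dxx i j ψ z) p volume ≤ ENNReal.ofReal (η * M * X) := by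
      intro i j
      have a1 := eLpNorm_le_mul_eLpNorm_of_ae_le_mul (μ := volume) (f := fun z : Pt d => (A z.1 i j - B z.1 i j) * Dxx i j ψ z)
        (g := Dxx i j ψ) (c := η) (.of_forall fun z => by
          rw [norm_mul]; exact mul_le_mul_of_nonneg_right (hAB _ _ _) (norm_nonneg _)) p
      refine a1.trans ?_
      have a2 := hM ψ hψ i j
      rw [tl_norm ((hψ.Dxx i j).memLp p)] at a2
      rw [mul_assoc, ENNReal.ofReal_mul hη]
      refine mul_le_mul' le_rfl ?_
      rw [← ENNReal.ofReal_toReal ((hψ.Dxx i j).memLp p).2.ne]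
      exact ENNReal.ofReal_le_ofReal a2
    have e2 : eLpNorm (fun z : Pt d => ∑ i, ∑ j, (A z.1 i j - B z.1 i j) * Dxx i j ψ z) p volume ≤
        ∑ i : Fin d, ∑ j : Fin d, ENNReal.ofReal (η * M * X) := by
      have s1 : ∀ i, eLpNorm (fun z : Pt d => ∑ j, (A z.1 i j - B z.1 i j) * Dxx i j ψ z) p volume ≤ ∑ j : Fin d, ENNReal.ofReal (η * M * X) := by
        intro i
        have := eLpNorm_sum_le (s := Finset.univ) (fun j _ => (mD i j).1) (Fact.out : 1 ≤ p)
        simp only [Finset.sum_fn] at this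
        exact this.trans (Finset.sum_le_sum fun j _ => e1 i j)
      have := eLpNorm_sum_le (s := Finset.univ) (fun i _ => (memLp_finsetSum Finset.univ fun j _ => mD i j).1) (Fact.out : 1 ≤ p)
      simp only [Finset.sum_fn] at this
      exact this.trans (Finset.sum_le_sum fun i _ => s1 i)
    rcases Nat.eq_zero_or_pos d with h0 | h0
    · subst h0; simp
    have hX : 0 ≤ η * M * X := by
      have := (norm_nonneg _).trans (hM ψ hψ ⟨0, h0⟩ ⟨0, h0⟩)
      rw [mul_assoc]; positivity
    refine ENNReal.toReal_le_of_le_ofReal (by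
      have : d * (d * (η * M)) * X = d * d * (η * M * X) := by ring
      rw [this]; positivity) (e2.trans (le_of_eq ?_))
    simp only [Finset.sum_const, Finset.card_univ, Fintype.card_fin, nsmul_eq_mul]
    rw [← ENNReal.ofReal_natCast, ← ENNReal.ofReal_mul (by positivity), ← ENNReal.ofReal_mul (by positivity)]
    congr 1; ring
  have hX : X ≤ ‖x‖ + ‖x‖ / 8 := by
    have : X ≤ ‖x‖ + ‖x - tl p (Hl σ lam A ψ)‖ := norm_le_norm_add_norm_sub _ _
    linarith
  have h3 : ‖x - tl p (Hl σ lam B ψ)‖ ≤ ‖x - tl p (Hl σ lam A ψ)‖ + ‖tl p (Hl σ lam A ψ) - tl p (Hl σ lam B ψ)‖ :=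
    norm_sub_le_norm_sub_add_norm_sub _ _ _
  have h4 : d * (d * (η * M)) * X ≤ 1 / 2 * X := mul_le_mul_of_nonneg_right hs (norm_nonneg _)
  linarith

lemma den_all {δ : ℝ} (hδ : 0 < δ) (hδ1 : δ ≤ 1) {n : ℕ} (hn : 0 < n) [Fact (1 ≤ ((2 * n : ℕ) : ℝ≥0∞))] (H : HS d δ (2 * n : ℕ)) {σ lam : ℝ} (hσ : σ ^ 2 = 1)
    (hl : 0 < lam) {A : ℝ → Matrix (Fin d) (Fin d) ℝ} (hA : Measurable A) (hS : ∀ t, inS d δ (A t)) : Den (2 * n : ℕ) σ lam A := by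
  obtain ⟨N, hN⟩ := H
  obtain ⟨m, hm⟩ := exists_nat_gt (d * (d * ((1 + δ⁻¹) * (2 * N))) * 2 : ℝ)
  have hm0 : (0 : ℝ) < m := lt_of_le_of_lt (by positivity) hm
  let B : ℕ → ℝ → Matrix (Fin d) (Fin d) ℝ := fun k t => (1 - (k : ℝ) / m) • 1 + ((k : ℝ) / m) • A t
  have hBm : ∀ k, Measurable (B k) := by
    intro k
    refine measurable_pi_lambda _ fun i => measurable_pi_lambda _ fun j => ?_
    have := meas_entry hA i j
    change Measurable fun t => (1 - (k : ℝ) / m) * (1 : Matrix (Fin d) (Fin d) ℝ) i j + (k : ℝ) / m * A t i j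
    fun_prop
  have hBS : ∀ k ≤ m, ∀ t, inS d δ (B k t) := fun k hk t =>
    inS_conv (inS_one hδ hδ1) (hS t) (by positivity) (div_le_one_of_le₀ (by exact_mod_cast hk) hm0.le)
  have main : ∀ k ≤ m, Den (2 * n : ℕ) σ lam (B k) := by
    intro k
    induction k with
    | zero =>
      intro _
      have : B 0 = fun _ => 1 := by funext t; simp [B]
      rw [this]; exact den_one hδ hδ1 (ENNReal.natCast_ne_top _) hσ hl
    | succ k ih =>
      intro hk
      have hk' : k ≤ m := by omega
      refine den_step (η := (1 + δ⁻¹) / m) (M := 2 * N) hδ (hBm k) (hBS k hk') (hBm _) (hBS _ hk) (by positivity)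
        (fun ψ hψ i j => hes_bd hδ hn hl (hBm k) (hBS k hk') hψ i j (hN σ hσ _ (hBm k) (hBS k hk') ψ hψ i j)) ?_ ?_ (ih hk')
      · intro t i j
        have e : B k t i j - B (k + 1) t i j = ((1 : Matrix (Fin d) (Fin d) ℝ) i j - A t i j) / m := by
          simp only [B, Matrix.add_apply, Matrix.smul_apply, smul_eq_mul]; push_cast; field_simp; ring
        rw [e, abs_div, abs_of_pos hm0]
        refine div_le_div_of_nonneg_right ((abs_sub _ _).trans (add_le_add ?_ ((hS t).bdd hδ i j))) hm0.le
        rw [Matrix.one_apply]; split_ifs <;> simp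
      · have : (d * (d * ((1 + δ⁻¹) / m * (2 * N))) : ℝ) = (d * (d * ((1 + δ⁻¹) * (2 * N)))) / m := by field_simp
        rw [this, div_le_iff₀ hm0]; linarith
  have := main m le_rfl
  have e : B m = A := by funext t; simp [B, div_self hm0.ne']
  rwa [e] at this
end

section
variable {d : ℕ} {u w : Pt d → ℝ}

lemma zibp (h : CinfC u) (k : CinfC w) {b : ℝ → ℝ} (hb : Measurable b) {B : ℝ} (hB : ∀ t, |b t| ≤ B) (i j) :
    Zint (fun z : Pt d => b z.1 * (Dxx i j u z * w z - u z * Dxx i j w z)) := by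
  have h1 := (Zint_Dx ((h.Dx j).mul k) i hb hB).add ((Zint_Dx (h.mul (k.Dx i)) j hb hB).smul (-1))
  convert h1 using 2 with z
  rw [Dx_mul (h.Dx j) k, Dx_mul h (k.Dx i), Dx_comm k j i]
  simp only [Dxx]; ring

lemma Dxx_comm (h : CinfC u) (i j k l) : Dxx i j (Dxx k l u) = Dxx k l (Dxx i j u) := by
  have key : ∀ a b c e : Pt d, dv a (dv b (dv c (dv e u))) = dv c (dv e (dv a (dv b u))) := fun a b c e => by
    rw [dv_comm (h.dv e) b c, dv_comm h b e, dv_comm ((h.dv b).dv e) a c, dv_comm (h.dv b) a e]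
  rw [Dxx_eq (h.Dxx k l), Dxx_eq (h.Dxx i j), Dxx_eq h, Dxx_eq h, key]

lemma dual_id {δ : ℝ} (hδ : 0 < δ) (h : CinfC u) (k : CinfC w) {A : ℝ → Matrix (Fin d) (Fin d) ℝ} (hA : Measurable A)
    (hS : ∀ t, inS d δ (A t)) (σ lam : ℝ) (i j) :
    Zint fun z => Dxx i j u z * Hl (-σ) lam A w z - Hl σ lam A u z * Dxx i j w z := by
  have z1 := ((zibp h k.Dt (b := fun _ => 1) measurable_const (B := 1) (by simp) i j).add (Zint_Dt (h.mul (k.Dxx i j)))).smul (-σ)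
  have z2 := (zibp h k (b := fun _ => 1) measurable_const (B := 1) (by simp) i j).smul (-lam)
  have z3 := Zint.sum Finset.univ fun m => Zint.sum Finset.univ fun l =>
    (zibp h (k.Dxx m l) (meas_entry hA m l) (fun t => (hS t).bdd hδ m l) i j).add
    ((zibp h (k.Dxx i j) (meas_entry hA m l) (fun t => (hS t).bdd hδ m l) m l).smul (-1))
  convert (z1.add z2).add z3 using 2 with z
  have e : Dt (Dxx i j w) = Dxx i j (Dt w) := by
    simp only [Dxx]; rw [Dt_Dx (k.Dx j), Dt_Dx k]
  have e2 : ∀ m l, A z.1 m l * (Dxx i j u z * Dxx m l w z - u z * Dxx i j (Dxx m l w) z) +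
      -1 * (A z.1 m l * (Dxx m l u z * Dxx i j w z - u z * Dxx m l (Dxx i j w) z)) =
      Dxx i j u z * (A z.1 m l * Dxx m l w z) - (A z.1 m l * Dxx m l u z) * Dxx i j w z := by
    intro m l; rw [Dxx_comm k i j]; ring
  rw [Dt_mul h (k.Dxx i j), e]
  simp only [e2, Finset.sum_sub_distrib, ← Finset.mul_sum, ← Finset.sum_mul, Hl, Lop]
  ring

lemma hold {s p : ℝ≥0∞} [ENNReal.HolderTriple s p 1] {f g : Pt d → ℝ} (hf : MemLp f s volume) (hg : MemLp g p volume) :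
    |∫ z, f z * g z| ≤ (eLpNorm f s volume).toReal * (eLpNorm g p volume).toReal := by
  have h := eLpNorm_smul_le_mul_eLpNorm (p := s) (q := p) (r := 1) hg.1 hf.1
  rw [← ENNReal.toReal_mul]
  have h2 : ‖∫ z, f z * g z‖ₑ ≤ eLpNorm f s volume * eLpNorm g p volume := by
    refine (enorm_integral_le_lintegral_enorm _).trans ?_
    rw [eLpNorm_one_eq_lintegral_enorm] at h
    exact h
  have := ENNReal.toReal_mono (ENNReal.mul_ne_top hf.2.ne hg.2.ne) h2
  simpa using this

lemma hs_dual {δ : ℝ} (hδ : 0 < δ) (hδ1 : δ ≤ 1) {n : ℕ} (hn : 0 < n) (H : HS d δ (2 * n : ℕ)) :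
    HS d δ (ENNReal.ofReal ((2 * n : ℕ) / ((2 * n : ℕ) - 1))) := by
  have H' := H
  obtain ⟨N, hN⟩ := H'
  set P : ℝ := ((2 * n : ℕ) : ℝ) with hP
  have hP2 : 2 ≤ P := by rw [hP]; exact_mod_cast (by omega : 2 ≤ 2 * n)
  set s : ℝ := P / (P - 1) with hs
  have hs1 : 1 < s := by rw [hs, one_lt_div (by linarith)]; linarith
  have hsP : s⁻¹ = 1 - P⁻¹ := by rw [hs]; field_simp
  have hP1 : P - 1 ≠ 0 := by linarith
  have hsPP : (s - 1) * P = s := by rw [hs]; field_simp; ring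
  have F1 : Fact (1 ≤ ((2 * n : ℕ) : ℝ≥0∞)) := ⟨by exact_mod_cast (by omega : 1 ≤ 2 * n)⟩
  have F2 : ENNReal.HolderTriple (ENNReal.ofReal s) ((2 * n : ℕ) : ℝ≥0∞) 1 := ⟨by
    rw [← ENNReal.ofReal_natCast, ← hP, ← ENNReal.ofReal_inv_of_pos (by linarith), ← ENNReal.ofReal_inv_of_pos (by linarith),
      ← ENNReal.ofReal_add (by positivity) (by positivity), hsP]; simp⟩
  have F3 : Fact (1 ≤ ENNReal.ofReal s) := ⟨by simpa using hs1.le⟩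
  have hsr : (ENNReal.ofReal s).toReal = s := ENNReal.toReal_ofReal (by linarith)
  refine ⟨2 * N, fun σ hσ A hA hS u hu i j => ?_⟩
  set G := Dxx i j u
  have hG : CinfC G := hu.Dxx i j
  set g : Pt d → ℝ := fun z => G z * |G z| ^ (s - 2) with hg
  have hGm := hG.cont.measurable
  have hgm : Measurable g := by fun_prop
  have eg : ∀ z, |g z| = |G z| ^ (s - 1) := by
    intro z
    rcases eq_or_ne (G z) 0 with h0 | h0
    · simp [hg, h0, Real.zero_rpow (by linarith : s - 1 ≠ 0)]
    · have : 0 < |G z| := abs_pos.2 h0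
      rw [hg, abs_mul, abs_of_nonneg (a := |G z| ^ (s - 2)) (by positivity), show s - 1 = 1 + (s - 2) by ring, Real.rpow_add this, Real.rpow_one]
  have eg2 : ∀ z, G z * g z = |G z| ^ s := by
    intro z
    have : G z * g z = |G z| * |g z| := by
      rw [hg]; simp only [abs_mul, abs_of_nonneg (show 0 ≤ |G z| ^ (s - 2) by positivity)]
      rw [← mul_assoc, ← mul_assoc, abs_mul_abs_self]
    rw [this, eg]
    rcases eq_or_ne (G z) 0 with h0 | h0
    · simp [h0, Real.zero_rpow (by linarith : s ≠ 0)]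
    · have : 0 < |G z| := abs_pos.2 h0
      rw [show s = 1 + (s - 1) by ring, Real.rpow_add this, Real.rpow_one]; simp
  have eg3 : ∀ z, |g z| ^ P = |G z| ^ s := by
    intro z; rw [eg, ← Real.rpow_mul (abs_nonneg _), hsPP]
  have mG := hG.memLp (ENNReal.ofReal s)
  have iG : Integrable (fun z => |G z| ^ s) := by
    have := mG.integrable_norm_rpow (by simp; linarith) ENNReal.ofReal_ne_top
    simpa only [hsr, Real.norm_eq_abs] using this
  have mg : MemLp g (2 * n : ℕ) volume := by
    rw [← integrable_norm_rpow_iff hgm.aestronglyMeasurable (by simp; omega) (ENNReal.natCast_ne_top _)]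
    simp only [ENNReal.toReal_natCast, Real.norm_eq_abs, ← hP, eg3]; exact iG
  set I := ∫ z, |G z| ^ s with hI
  have I0 : 0 ≤ I := integral_nonneg fun z => by positivity
  have nG : eLpNorm G (ENNReal.ofReal s) volume = ENNReal.ofReal (I ^ s⁻¹) := by
    rw [MemLp.eLpNorm_eq_integral_rpow_norm (by simp; linarith) ENNReal.ofReal_ne_top mG, hsr]
    simp only [Real.norm_eq_abs, hI]
  have ng : ‖tl (2 * n : ℕ) g‖ = I ^ P⁻¹ := by
    rw [tl_norm mg, MemLp.eLpNorm_eq_integral_rpow_norm (by simp; omega) (ENNReal.natCast_ne_top _) mg, ENNReal.toReal_ofReal (by positivity)]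
    simp only [ENNReal.toReal_natCast, Real.norm_eq_abs, ← hP, eg3, hI]
  have mf : MemLp (Lop σ (fun z => A z.1) u) (ENNReal.ofReal s) volume :=
    Lop_memLp hδ hu (hA.comp measurable_fst) (fun z => hS z.1) σ _
  set F := ‖tl (ENNReal.ofReal s) (Lop σ (fun z => A z.1) u)‖ with hF
  set U := ‖tl (ENNReal.ofReal s) u‖
  have main : ∀ ε : ℝ, 0 < ε → I ≤ I ^ s⁻¹ * ε + (F + ε * U) * (2 * N * (I ^ P⁻¹ + ε)) := by
    intro ε hε
    obtain ⟨ψ, hψ, hd⟩ := den_all hδ hδ1 hn H (σ := -σ) (lam := ε) (by rw [neg_sq, hσ]) hε hA hS (tl (2 * n : ℕ) g) ε hε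
    have mh := Hl_memLp hδ hψ hA hS (-σ) ε (2 * n : ℕ)
    have mu := Hl_memLp hδ hu hA hS σ ε (ENNReal.ofReal s)
    have mgh : MemLp (fun z => g z - Hl (-σ) ε A ψ z) (2 * n : ℕ) volume := mg.sub mh
    have hz := dual_id hδ hu hψ hA hS σ ε i j
    have a1 := hold mG mgh
    have a2 := hold mu ((hψ.Dxx i j).memLp (2 * n : ℕ))
    have j1 : Integrable (fun z => G z * (g z - Hl (-σ) ε A ψ z)) := MemLp.integrable_mul mG mgh
    have j2 : Integrable (fun z => Hl σ ε A u z * Dxx i j ψ z) := MemLp.integrable_mul mu ((hψ.Dxx i j).memLp (2 * n : ℕ))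
    have e : I = (∫ z, G z * (g z - Hl (-σ) ε A ψ z)) + ∫ z, Hl σ ε A u z * Dxx i j ψ z := by
      have : (fun z => |G z| ^ s) = fun z => (G z * (g z - Hl (-σ) ε A ψ z) + Hl σ ε A u z * Dxx i j ψ z) +
          (Dxx i j u z * Hl (-σ) ε A ψ z - Hl σ ε A u z * Dxx i j ψ z) := by
        funext z; rw [← eg2]; ring
      have j3 : Integrable (fun z => G z * (g z - Hl (-σ) ε A ψ z) + Hl σ ε A u z * Dxx i j ψ z) := j1.add j2
      rw [hI, this, integral_add j3 hz.1, hz.2, add_zero, integral_add j1 j2]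
    rw [nG, ENNReal.toReal_ofReal (by positivity), ← tl_norm mgh, tl_sub mg mh] at a1
    rw [← tl_norm mu, ← tl_norm ((hψ.Dxx i j).memLp (2 * n : ℕ))] at a2
    have a3 : ‖tl (ENNReal.ofReal s) (Hl σ ε A u)‖ ≤ F + ε * U := by
      have : tl (ENNReal.ofReal s) (Hl σ ε A u) = tl (ENNReal.ofReal s) (Lop σ (fun z => A z.1) u) - ε • tl (ENNReal.ofReal s) u := by
        rw [← tl_smul _ (hu.memLp _), ← tl_sub mf ((hu.memLp _).const_mul ε)]; rfl
      rw [this]; refine (norm_sub_le _ _).trans ?_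
      rw [norm_smul, Real.norm_of_nonneg hε.le]
    have a4 := hes_bd hδ hn hε hA hS hψ i j (hN (-σ) (by rw [neg_sq, hσ]) A hA hS ψ hψ i j)
    have a5 : ‖tl (2 * n : ℕ) (Hl (-σ) ε A ψ)‖ ≤ I ^ P⁻¹ + ε := by
      have := norm_le_norm_add_norm_sub (tl (2 * n : ℕ) g) (tl (2 * n : ℕ) (Hl (-σ) ε A ψ))
      rw [ng] at this; linarith
    refine e.le.trans (add_le_add ((le_abs_self _).trans (a1.trans (mul_le_mul_of_nonneg_left hd.le (Real.rpow_nonneg I0 _)))) ?_)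
    refine (le_abs_self _).trans (a2.trans (mul_le_mul a3 (a4.trans ?_) (norm_nonneg _) (by positivity)))
    exact mul_le_mul_of_nonneg_left a5 (by positivity)
  have lim : I ≤ F * (2 * N * I ^ P⁻¹) := by
    have hc : Continuous fun ε : ℝ => I ^ s⁻¹ * ε + (F + ε * U) * (2 * N * (I ^ P⁻¹ + ε)) := by fun_prop
    have ht := (hc.tendsto 0).mono_left (nhdsWithin_le_nhds (s := Ioi 0))
    have := ge_of_tendsto ht (eventually_mem_nhdsWithin.mono fun ε hε => main ε hε)
    simpa using this
  have fin : I ^ s⁻¹ ≤ 2 * N * F := by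
    rcases I0.eq_or_lt with h0 | h0
    · rw [← h0, Real.zero_rpow (by positivity)]; positivity
    · rw [hsP, Real.rpow_sub h0, Real.rpow_one, div_le_iff₀ (by positivity)]; linarith
  rw [nG]
  refine (ENNReal.ofReal_le_ofReal fin).trans (le_of_eq ?_)
  rw [hF, tl_norm mf, ENNReal.ofReal_mul (by positivity), ENNReal.ofReal_toReal mf.2.ne, ENNReal.ofReal_mul (by positivity)]
  simp
end

section
variable {d : ℕ} {u : Pt d → ℝ}

lemma hs_all {δ : ℝ} (hδ : 0 < δ) (hδ1 : δ ≤ 1) {s : ℝ} (hs : 1 < s) : HS d δ (ENNReal.ofReal s) := by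
  obtain ⟨n, hn⟩ := exists_nat_gt (max 2 (s / (s - 1)))
  have h2 : (2 : ℝ) < n := (le_max_left _ _).trans_lt hn
  have h3 : s / (s - 1) < n := (le_max_right _ _).trans_lt hn
  have hn0 : 0 < n := by exact_mod_cast (by linarith : (0 : ℝ) < n)
  have H2 : HS d δ (ENNReal.ofReal 2) := by simpa using hs_two d δ hδ
  have HP : HS d δ (2 * n : ℕ) := by
    have := hs_up (p := ((2 * n : ℕ) : ℝ)) hδ (by norm_num) (by push_cast; linarith) H2
    rwa [ENNReal.ofReal_natCast] at this
  refine hs_up hδ ?_ ?_ (hs_dual hδ hδ1 hn0 HP)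
  · push_cast; rw [one_le_div (by linarith)]; linarith
  · rw [div_lt_iff₀ (by linarith)] at h3
    push_cast; rw [div_lt_iff₀ (by linarith)]; nlinarith

lemma abs_le_mnorm (m : Fin d → Fin d → ℝ) (i j) : |m i j| ≤ mnorm m := by
  refine Real.abs_le_sqrt ?_
  refine (Finset.single_le_sum (f := fun j => m i j ^ 2) (fun _ _ => sq_nonneg _) (Finset.mem_univ j)).trans ?_
  exact Finset.single_le_sum (f := fun i => ∑ j, m i j ^ 2) (fun _ _ => Finset.sum_nonneg fun _ _ => sq_nonneg _) (Finset.mem_univ i)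

lemma mnorm_le_sum (m : Fin d → Fin d → ℝ) : mnorm m ≤ ∑ i, ∑ j, |m i j| := by
  refine Real.sqrt_le_iff.2 ⟨by positivity, ?_⟩
  have := Finset.sum_sq_le_sq_sum_of_nonneg (s := (Finset.univ : Finset (Fin d × Fin d))) (f := fun x => |m x.1 x.2|) (fun _ _ => abs_nonneg _)
  simpa only [Fintype.sum_prod_type, sq_abs] using this

lemma aT_int {δ : ℝ} (hδ : 0 < δ) {a : Pt d → Matrix (Fin d) (Fin d) ℝ} (ha : Measurable a) (hS : ∀ z, inS d δ (a z))
    (R : ℝ) (x : Spc d) (t : ℝ) (i j) : IntegrableOn (fun y => a (t, y) i j) (ball x R) := by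
  refine Measure.integrableOn_of_bounded (M := δ⁻¹) measure_ball_lt_top.ne ?_ (.of_forall fun y => (hS (t, y)).bdd hδ i j)
  exact ((meas_entry ha i j).comp measurable_prodMk_left).aestronglyMeasurable

lemma aT_meas {a : Pt d → Matrix (Fin d) (Fin d) ℝ} (ha : Measurable a) (R : ℝ) (x : Spc d) :
    Measurable fun t => (aTilde a R x t : Matrix (Fin d) (Fin d) ℝ) := by
  refine measurable_pi_lambda _ fun i => measurable_pi_lambda _ fun j => ?_
  change Measurable fun t => ⨍ y in ball x R, a (t, y) i j
  simp only [average_eq, smul_eq_mul]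
  have := (StronglyMeasurable.integral_prod_right' (ν := volume.restrict (ball x R)) (meas_entry ha i j).stronglyMeasurable).measurable
  exact this.const_mul _

lemma aT_inS {δ : ℝ} (hδ : 0 < δ) {a : Pt d → Matrix (Fin d) (Fin d) ℝ} (ha : Measurable a) (hS : ∀ z, inS d δ (a z))
    {R : ℝ} (hR : 0 < R) (x : Spc d) (t : ℝ) : inS d δ (aTilde a R x t) := by
  have hi := aT_int hδ ha hS R x t
  have hv0 := vol_ball_ne x hR
  have hvt : volume (ball x R) ≠ ⊤ := measure_ball_lt_top.ne
  refine ⟨?_, fun ξ => ?_⟩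
  · ext i j
    change ⨍ y in ball x R, a (t, y) j i = ⨍ y in ball x R, a (t, y) i j
    congr 1; ext y; exact (hS (t, y)).1.apply i j
  have hr : 0 < volume.real (ball x R) := ENNReal.toReal_pos hv0 hvt
  have i1 : ∀ i, IntegrableOn (fun y => ∑ j, a (t, y) i j * ξ i * ξ j) (ball x R) := fun i =>
    integrable_finsetSum _ fun j _ => ((hi i j).mul_const _).mul_const _
  have i2 : IntegrableOn (fun y => ∑ i, ∑ j, a (t, y) i j * ξ i * ξ j) (ball x R) := integrable_finsetSum _ fun i _ => i1 i
  have e : ∑ i, ∑ j, aTilde a R x t i j * ξ i * ξ j = (volume.real (ball x R))⁻¹ * ∫ y in ball x R, ∑ i, ∑ j, a (t, y) i j * ξ i * ξ j := by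
    rw [integral_finsetSum _ fun i _ => i1 i, Finset.mul_sum]
    refine Finset.sum_congr rfl fun i _ => ?_
    rw [integral_finsetSum _ fun j _ => ((hi i j).mul_const _).mul_const _, Finset.mul_sum]
    refine Finset.sum_congr rfl fun j _ => ?_
    rw [integral_mul_const, integral_mul_const, aTilde, setAverage_eq, smul_eq_mul]; ring
  rw [e]
  have c : ∀ c : ℝ, c = (volume.real (ball x R))⁻¹ * ∫ _ in ball x R, c := fun c => by
    rw [setIntegral_const, smul_eq_mul, inv_mul_cancel_left₀ hr.ne']
  constructor
  · rw [c (δ * _)]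
    exact mul_le_mul_of_nonneg_left (integral_mono (integrableOn_const hvt) i2 fun y => ((hS (t, y)).2 ξ).1) (by positivity)
  · rw [c (δ⁻¹ * _)]
    exact mul_le_mul_of_nonneg_left (integral_mono i2 (integrableOn_const hvt) fun y => ((hS (t, y)).2 ξ).2) (by positivity)

lemma avS_holder {s0 s r : ℝ} (hs0 : 0 < s0) (hs : 0 < s) (hr : 0 < r) (h : s0 / r + s0 / s = 1) {R : ℝ} (hR : 0 < R) (t : ℝ) (x : Spc d)
    {W Y : Pt d → ℝ≥0∞} (hW : Measurable W) (hY : Measurable Y) :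
    avS s0 R t x (fun z => W z * Y z) ≤ avS r R t x W * avS s R t x Y := by
  have h1 := ENNReal.lintegral_mul_norm_pow_le (μ := volume.restrict (cyl d R t x)) (hW.pow_const r).aemeasurable
    (hY.pow_const s).aemeasurable (p := s0 / r) (q := s0 / s) (by positivity) (by positivity) h
  simp only [← ENNReal.rpow_mul, mul_div_cancel₀ s0 hr.ne', mul_div_cancel₀ s0 hs.ne'] at h1
  set V := (volume (cyl d R t x))⁻¹
  have hV0 : V ≠ 0 := ENNReal.inv_ne_zero.2 (vol_cyl_fin x t R)
  have hVt : V ≠ ⊤ := ENNReal.inv_ne_top.2 (vol_cyl_ne x t hR)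
  have hV : V = V ^ (s0 / r) * V ^ (s0 / s) := by rw [← ENNReal.rpow_add _ _ hV0 hVt, h, ENNReal.rpow_one]
  have h2 : V * ∫⁻ z in cyl d R t x, (W z * Y z) ^ s0 ≤ (V * ∫⁻ z in cyl d R t x, W z ^ r) ^ (s0 / r) *
      (V * ∫⁻ z in cyl d R t x, Y z ^ s) ^ (s0 / s) := by
    simp only [ENNReal.mul_rpow_of_nonneg _ _ hs0.le]
    rw [ENNReal.mul_rpow_of_nonneg _ _ (by positivity : 0 ≤ s0 / r), ENNReal.mul_rpow_of_nonneg _ _ (by positivity : 0 ≤ s0 / s),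
      mul_mul_mul_comm, ← hV]
    exact mul_le_mul' le_rfl h1
  refine (ENNReal.rpow_le_rpow h2 (by positivity)).trans (le_of_eq ?_)
  rw [ENNReal.mul_rpow_of_nonneg _ _ (by positivity), ← ENNReal.rpow_mul, ← ENNReal.rpow_mul]
  simp only [avS]; congr 2 <;> field_simp

lemma vmo_osc {δ : ℝ} (hδ : 0 < δ) {s0 s : ℝ} (hs0 : 1 ≤ s0) (hss : s0 < s) (H : HS d δ (ENNReal.ofReal s0)) {ε : ℝ} (hε : 0 < ε) :
    ∃ κ : ℝ, 2 ≤ κ ∧ ∃ N : ℝ≥0∞, N ≠ ⊤ ∧ ∃ α : ℝ, 0 < α ∧ ∀ a : Pt d → Matrix (Fin d) (Fin d) ℝ, Measurable a →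
    (∀ z, inS d δ (a z)) → aSharp a ≤ ENNReal.ofReal α → ∀ u : Pt d → ℝ, CinfC u → ∀ i j,
    OSC κ s (Dxx i j u) (fun z => ENNReal.ofReal ε * hes u z + N * ENNReal.ofReal |Lop 1 a u z|) := by
  obtain ⟨κ, hκ, N, hN, hosc⟩ := osc_const hδ hs0 H (ε := ε / 4) (by positivity)
  set e4 : ℝ≥0∞ := ENNReal.ofReal (ε / 4)
  have he0 : e4 ≠ 0 := by simp [e4, hε]
  have het : e4 ≠ ⊤ := ENNReal.ofReal_ne_top
  set K : ℝ≥0∞ := N / e4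
  have hK : K ≠ ⊤ := ENNReal.div_ne_top hN he0
  set r : ℝ := s0 * s / (s - s0) with hr
  have hss' : 0 < s - s0 := by linarith
  have hs : 0 < s := by linarith
  have hr1 : 1 ≤ r := by rw [hr, one_le_div hss']; nlinarith
  have hrs : s0 / r + s0 / s = 1 := by rw [hr]; field_simp; ring
  set M : ℝ≥0∞ := ENNReal.ofReal (∑ _i : Fin d, ∑ _j : Fin d, (δ⁻¹ + δ⁻¹))
  set D : ℝ≥0∞ := K ^ r * M ^ (r - 1)
  have hD : D ≠ ⊤ := ENNReal.mul_ne_top (ENNReal.rpow_ne_top_of_nonneg (by linarith) hK) (ENNReal.rpow_ne_top_of_nonneg (by linarith) ENNReal.ofReal_ne_top)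
  refine ⟨κ, hκ, 4 * N, ENNReal.mul_ne_top (by simp) hN, (D.toReal + 1)⁻¹, by positivity, fun a ha hS hsh u hu i j R hR t x => ?_⟩
  set ρ := κ * R
  have hρ : 0 < ρ := by positivity
  set A : ℝ → Matrix (Fin d) (Fin d) ℝ := fun t => aTilde a ρ x t
  have hA : Measurable A := aT_meas ha ρ x
  have hAS : ∀ t, inS d δ (A t) := aT_inS hδ ha hS hρ x
  obtain ⟨c, hc⟩ := hosc 1 (by norm_num) A hA hAS u hu i j R hR t x
  refine ⟨c, hc.trans ?_⟩
  set T := t - ρ ^ 2 / 2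
  set m : Pt d → ℝ≥0∞ := fun z => ENNReal.ofReal (mnorm fun i j => a z i j - A z.1 i j)
  have hmm : Measurable m := by
    have h1 := fun i j => meas_entry ha i j
    have h2 : ∀ i j, Measurable fun z : Pt d => A z.1 i j := fun i j => (meas_entry (A := fun z : Pt d => A z.1) (hA.comp measurable_fst) i j)
    simp only [m, mnorm]
    refine (Real.continuous_sqrt.measurable.comp ?_).ennreal_ofReal
    exact Finset.measurable_sum _ fun i _ => Finset.measurable_sum _ fun j _ => ((h1 i j).sub (h2 i j)).pow_const 2
  have hmM : ∀ z, m z ≤ M := fun z => ENNReal.ofReal_le_ofReal ((mnorm_le_sum _).trans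
    (Finset.sum_le_sum fun i _ => Finset.sum_le_sum fun j _ => (abs_sub _ _).trans (add_le_add ((hS z).bdd hδ i j) ((hAS z.1).bdd hδ i j))))
  set Y : Pt d → ℝ≥0∞ := fun z => e4 * hes u z + N * ENNReal.ofReal |Lop 1 a u z|
  have hYm : Measurable Y := ((hes_meas hu).const_mul _).add ((Lop_meas hu 1 ha).abs.ennreal_ofReal.const_mul _)
  set W : Pt d → ℝ≥0∞ := fun z => 1 + K * m z
  have hWm : Measurable W := (hmm.const_mul _).const_add _
  have hpt : ∀ z, e4 * hes u z + N * ENNReal.ofReal |Lop 1 (fun z => A z.1) u z| ≤ W z * Y z := by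
    intro z
    have e1 : |Lop 1 (fun z => A z.1) u z| ≤ |Lop 1 a u z| + (mnorm fun i j => a z i j - A z.1 i j) * ∑ k, ∑ l, |Dxx k l u z| := by
      have : Lop 1 (fun z => A z.1) u z = Lop 1 a u z - ∑ k, ∑ l, (a z k l - A z.1 k l) * Dxx k l u z := by
        simp only [Lop, sub_mul, Finset.sum_sub_distrib]; ring
      rw [this]
      refine (abs_sub _ _).trans (add_le_add le_rfl ?_)
      refine (Finset.abs_sum_le_sum_abs _ _).trans ?_
      rw [Finset.mul_sum]
      refine Finset.sum_le_sum fun k _ => (Finset.abs_sum_le_sum_abs _ _).trans ?_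
      rw [Finset.mul_sum]
      refine Finset.sum_le_sum fun l _ => ?_
      rw [abs_mul]
      exact mul_le_mul_of_nonneg_right (abs_le_mnorm (fun i j => a z i j - A z.1 i j) k l) (abs_nonneg _)
    have e2 : ENNReal.ofReal |Lop 1 (fun z => A z.1) u z| ≤ ENNReal.ofReal |Lop 1 a u z| + m z * hes u z := by
      refine (ENNReal.ofReal_le_ofReal e1).trans (ENNReal.ofReal_add_le.trans (add_le_add le_rfl ?_))
      refine (ENNReal.ofReal_mul (show 0 ≤ mnorm fun i j => a z i j - A z.1 i j from Real.sqrt_nonneg _)).le.trans ?_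
      refine mul_le_mul' le_rfl (le_of_eq ?_)
      rw [hes, ENNReal.ofReal_sum_of_nonneg fun _ _ => by positivity]
      exact Finset.sum_congr rfl fun k _ => ENNReal.ofReal_sum_of_nonneg fun _ _ => abs_nonneg _
    have e3 : N = K * e4 := (ENNReal.div_mul_cancel he0 het).symm
    calc _ ≤ e4 * hes u z + N * (ENNReal.ofReal |Lop 1 a u z| + m z * hes u z) := add_le_add le_rfl (mul_le_mul' le_rfl e2)
      _ = Y z + K * m z * (e4 * hes u z) := by
        simp only [Y]; rw [mul_add, add_assoc]; congr 2; rw [e3]; ring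
      _ ≤ Y z + K * m z * Y z := add_le_add le_rfl (mul_le_mul' le_rfl le_self_add)
      _ = W z * Y z := by simp only [W]; rw [add_mul, one_mul]
  have hav : (volume (cyl d ρ T x))⁻¹ * ∫⁻ z in cyl d ρ T x, m z ≤ ENNReal.ofReal (D.toReal + 1)⁻¹ := by
    have h0 : aSharpCyl a ρ T x ≤ aSharp a := le_iSup_of_le ρ (le_iSup_of_le hρ (le_iSup_of_le T (le_iSup_of_le x le_rfl)))
    exact h0.trans hsh
  have hDa : D * ENNReal.ofReal (D.toReal + 1)⁻¹ ≤ 1 := by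
    rw [← ENNReal.ofReal_toReal hD, ← ENNReal.ofReal_mul (by positivity), ENNReal.toReal_ofReal (by positivity), ENNReal.ofReal_le_one,
      mul_inv_le_iff₀ (by positivity)]; linarith
  have hW : avS r ρ T x W ≤ 4 := by
    have w1 : ∀ z, W z ^ r ≤ 2 ^ (r - 1) * (1 + D * m z) := by
      intro z
      refine (ENNReal.rpow_add_le_mul_rpow_add_rpow _ _ hr1).trans (mul_le_mul' le_rfl ?_)
      rw [ENNReal.one_rpow, ENNReal.mul_rpow_of_nonneg _ _ (by linarith)]
      refine add_le_add le_rfl ?_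
      have : m z ^ r ≤ M ^ (r - 1) * m z := by
        calc m z ^ r = m z ^ ((r - 1) + 1) := by ring_nf
          _ = m z ^ (r - 1) * m z := by rw [ENNReal.rpow_add_of_nonneg _ _ (by linarith) zero_le_one, ENNReal.rpow_one]
          _ ≤ _ := mul_le_mul' (ENNReal.rpow_le_rpow (hmM z) (by linarith)) le_rfl
      rw [mul_assoc]
      exact mul_le_mul' le_rfl this
    have w2 : (volume (cyl d ρ T x))⁻¹ * ∫⁻ z in cyl d ρ T x, W z ^ r ≤ 2 ^ (r - 1) * 2 := by
      refine (mul_le_mul' le_rfl (lintegral_mono w1)).trans ?_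
      rw [lintegral_const_mul _ ((hmm.const_mul _).const_add _), mul_left_comm]
      refine mul_le_mul' le_rfl ?_
      rw [lintegral_add_left measurable_const, lintegral_const_mul _ hmm, mul_add, setLIntegral_const, one_mul,
        ENNReal.inv_mul_cancel (vol_cyl_ne x T hρ) (vol_cyl_fin x T ρ), mul_left_comm]
      exact (add_le_add le_rfl ((mul_le_mul' le_rfl hav).trans hDa)).trans one_add_one_eq_two.le
    refine (ENNReal.rpow_le_rpow w2 (by positivity)).trans ?_
    have : (2 : ℝ≥0∞) ^ (r - 1) * 2 = 2 ^ r := by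
      nth_rw 2 [← ENNReal.rpow_one 2]
      rw [← ENNReal.rpow_add _ _ (by simp) (by simp)]; ring_nf
    rw [this, ← ENNReal.rpow_mul, mul_one_div_cancel (by linarith), ENNReal.rpow_one]; norm_num
  calc _ ≤ avS s0 ρ T x (fun z => W z * Y z) := avS_mono (by linarith) _ _ _ hpt
    _ ≤ avS r ρ T x W * avS s ρ T x Y := avS_holder (by linarith) hs (by linarith) hrs hρ T x hWm hYm
    _ ≤ 4 * avS s ρ T x Y := mul_le_mul' hW le_rfl
    _ = avS s ρ T x (fun z => 4 * Y z) := (avS_smul hs _ _ _ _ hYm).symm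
    _ = _ := by
      congr 1; funext z; simp only [Y, e4]
      rw [mul_add, ← mul_assoc, ← mul_assoc]; congr 2
      rw [show (4 : ℝ≥0∞) = ENNReal.ofReal 4 by simp, ← ENNReal.ofReal_mul (by norm_num)]; congr 1; ring
end

section
variable {d : ℕ} {u : Pt d → ℝ}

lemma gam_pow {q p : ℝ} (hq : 0 < q) (hp : 0 < p) {ρ : ℝ} (hρ : 0 < ρ) :
    gam d q p ρ ^ (1 / p) = ENNReal.ofReal (ρ ^ (d / p + 2 / q)) * gam d q p 1 ^ (1 / p) := by
  have h := gam_mul (d := d) (q := q) (p := p) (by positivity) hρ 1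
  rw [mul_one] at h
  rw [h, ENNReal.mul_rpow_of_nonneg _ _ (by positivity)]
  congr 1
  rw [← ENNReal.ofReal_pow hρ.le, ENNReal.ofReal_rpow_of_pos (by positivity), ← ENNReal.ofReal_mul (by positivity),
    ENNReal.ofReal_rpow_of_pos (by positivity)]
  congr 1
  rw [← Real.rpow_natCast ρ d, ← Real.rpow_natCast ρ 2, ← Real.rpow_mul hρ.le, ← Real.rpow_add hρ, ← Real.rpow_mul hρ.le]
  congr 1; push_cast; field_simp

lemma g1_ne {q p : ℝ} (hq : 0 < q) (hp : 0 < p) : gam d q p 1 ^ (1 / p) ≠ 0 :=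
  (ENNReal.rpow_pos (pos_iff_ne_zero.2 (gam_ne q p one_pos)) (gam_fin (by positivity))).ne'

lemma g1_fin {q p : ℝ} (hq : 0 < q) (hp : 0 < p) : gam d q p 1 ^ (1 / p) ≠ ⊤ :=
  ENNReal.rpow_ne_top_of_nonneg (by positivity) (gam_fin (by positivity))

lemma morE_fin {q p β : ℝ} (hq : 0 < q) (hp : 0 < p) (hβ : 0 ≤ β) (hβ0 : β ≤ d / p + 2 / q) {w : Pt d → ℝ} (hw : CinfC w) :
    morE q p β (fun z => ENNReal.ofReal |w z|) ≠ ⊤ := by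
  obtain ⟨B, hB⟩ := hw.1.continuous.bounded_above_of_compact_support hw.2
  obtain ⟨R, hR⟩ := hw.2.isBounded.subset_ball (0 : Pt d)
  set F : Pt d → ℝ≥0∞ := fun z => ENNReal.ofReal |w z|
  have hF : ∀ z, F z ≤ ENNReal.ofReal B := fun z => ENNReal.ofReal_le_ofReal (hB z)
  have hS : ∃ ρ > 0, ∃ t, ∀ z, F z ≤ (cyl d ρ t 0).indicator F z := by
    refine ⟨2 * |R| + 2, by positivity, -|R| - 1, fun z => ?_⟩
    by_cases hz : z ∈ tsupport w
    · have h1 := hR hz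
      rw [mem_ball_zero_iff, Prod.norm_def, max_lt_iff, Real.norm_eq_abs, abs_lt] at h1
      have h2 := le_abs_self R
      have h3 := abs_nonneg R
      rw [indicator_of_mem]
      refine ⟨⟨by linarith [h1.1.1], ?_⟩, ?_⟩
      · nlinarith [h1.1.2]
      · rw [mem_ball_zero_iff]; linarith [h1.2]
    · have : F z = 0 := by simp [F, image_eq_zero_of_notMem_tsupport hz]
      rw [this]; exact zero_le
  obtain ⟨ρ0, hρ0, t0, hS⟩ := hS
  set G := gam d q p 1 ^ (1 / p)
  have hM : mixn q p F ≠ ⊤ := by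
    refine ne_top_of_le_ne_top ?_ ((mixn_mono hq.le hp.le hS).trans (cylE_eq hq hp hρ0 t0 0 F).le)
    refine ENNReal.mul_ne_top (ENNReal.rpow_ne_top_of_nonneg (by positivity) (gam_fin (by positivity))) ?_
    refine ne_top_of_le_ne_top ENNReal.ofReal_ne_top ((cylE_mono hq hp ρ0 t0 0 fun z _ => hF z).trans (cylE_const hq hp hρ0 t0 0 _).le)
  refine ne_top_of_le_ne_top (b := ENNReal.ofReal B + mixn q p F / G)
    (ENNReal.add_ne_top.2 ⟨ENNReal.ofReal_ne_top, ENNReal.div_ne_top hM (g1_ne hq hp)⟩) ?_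
  refine iSup_le fun ρ => iSup_le fun hρ => iSup_le fun t => iSup_le fun x => ?_
  rcases le_total ρ 1 with h1 | h1
  · refine le_trans ?_ le_self_add
    refine (mul_le_mul' (ENNReal.ofReal_le_one.2 (Real.rpow_le_one hρ.le h1 hβ))
      ((cylE_mono hq hp ρ t x fun z _ => hF z).trans (cylE_const hq hp hρ t x _).le)).trans (one_mul _).le
  · refine le_trans ?_ le_add_self
    rw [ENNReal.le_div_iff_mul_le (.inl (g1_ne hq hp)) (.inl (g1_fin hq hp))]
    calc _ ≤ ENNReal.ofReal (ρ ^ (d / p + 2 / q)) * cylE q p ρ t x F * G :=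
          mul_le_mul' (mul_le_mul' (ENNReal.ofReal_le_ofReal (Real.rpow_le_rpow_of_exponent_le h1 hβ0)) le_rfl) le_rfl
      _ = mixn q p ((cyl d ρ t x).indicator F) := by rw [cylE_eq hq hp hρ, gam_pow hq hp hρ]; ring
      _ ≤ _ := mixn_mono hq.le hp.le fun z => indicator_le_self _ _ z

lemma hes_fin {q p β : ℝ} (hq : 1 ≤ q) (hp : 1 ≤ p) (hβ : 0 ≤ β) (hβ0 : β ≤ d / p + 2 / q) (hu : CinfC u) :
    morE q p β (hes u) ≠ ⊤ := by
  have hm : ∀ k l, Measurable fun z => ENNReal.ofReal |Dxx k l u z| := fun k l =>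
    (continuous_abs.comp (hu.Dxx k l).cont).measurable.ennreal_ofReal
  have h1 : morE q p β (hes u) ≤ ∑ k, ∑ l, morE q p β (fun z => ENNReal.ofReal |Dxx k l u z|) :=
    (morE_sum hq hp Finset.univ fun k => Finset.measurable_sum _ fun l _ => hm k l).trans
      (Finset.sum_le_sum fun k _ => morE_sum hq hp Finset.univ fun l => hm k l)
  refine ne_top_of_le_ne_top ?_ h1
  exact ENNReal.sum_ne_top.2 fun k _ => ENNReal.sum_ne_top.2 fun l _ => morE_fin (by linarith) (by linarith) hβ hβ0 (hu.Dxx k l)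

lemma morE_zero {q p β β' : ℝ} {F : Pt d → ℝ≥0∞} (h : morE q p β F = 0) : morE q p β' F = 0 := by
  refine le_antisymm (iSup_le fun ρ => iSup_le fun hρ => iSup_le fun t => iSup_le fun x => ?_) zero_le
  have := cylE_le_mor q p β hρ t x F
  rw [h, mul_zero] at this
  exact (mul_le_mul' le_rfl this).trans (mul_zero _).le

lemma morE_top {q p β : ℝ} (hq : 0 < q) (hp : 0 < p) (hβ : d / p + 2 / q < β) {F : Pt d → ℝ≥0∞} {β' : ℝ} (h : morE q p β' F ≠ 0) :
    morE q p β F = ⊤ := by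
  have : ∃ R > 0, ∃ t x, cylE q p R t x F ≠ 0 := by
    by_contra hc
    push Not at hc
    refine h (le_antisymm (iSup_le fun ρ => iSup_le fun hρ => iSup_le fun t => iSup_le fun x => ?_) zero_le)
    rw [hc ρ hρ t x, mul_zero]
  obtain ⟨R, hR, t, x, hne⟩ := this
  by_contra hX
  set G := gam d q p 1 ^ (1 / p)
  set c := mixn q p ((cyl d R t x).indicator F) with hc
  have hc0 : c ≠ 0 := by
    rw [hc, cylE_eq hq hp hR]
    exact mul_ne_zero (ENNReal.rpow_pos (pos_iff_ne_zero.2 (gam_ne q p hR)) (gam_fin (by positivity))).ne' hne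
  have hXt : G * morE q p β F / c ≠ ⊤ := ENNReal.div_ne_top (ENNReal.mul_ne_top (g1_fin hq hp) hX) hc0
  have key : ∀ ρ, R ≤ ρ → ρ ^ (β - (d / p + 2 / q)) ≤ (G * morE q p β F / c).toReal := by
    intro ρ hρR
    have hρ : 0 < ρ := hR.trans_le hρR
    rw [← ENNReal.ofReal_le_iff_le_toReal hXt, ENNReal.le_div_iff_mul_le (.inl hc0) (.inr (ENNReal.mul_ne_top (g1_fin hq hp) hX))]
    have hsub : cyl d R t x ⊆ cyl d ρ t x := by
      rintro z ⟨hz1, hz2⟩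
      exact ⟨⟨hz1.1, hz1.2.trans_le (add_le_add le_rfl (pow_le_pow_left₀ hR.le hρR 2))⟩, ball_subset_ball hρR hz2⟩
    have h0 : ENNReal.ofReal (ρ ^ β) * cylE q p ρ t x F ≤ morE q p β F :=
      le_iSup_of_le ρ (le_iSup_of_le hρ (le_iSup_of_le t (le_iSup_of_le x le_rfl)))
    calc _ ≤ ENNReal.ofReal (ρ ^ (β - (d / p + 2 / q))) * mixn q p ((cyl d ρ t x).indicator F) :=
          mul_le_mul' le_rfl (mixn_mono hq.le hp.le fun z => indicator_le_indicator_of_subset hsub (fun _ => zero_le) z)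
      _ = G * (ENNReal.ofReal (ρ ^ β) * cylE q p ρ t x F) := by
        rw [cylE_eq hq hp hρ, gam_pow hq hp hρ, ← mul_assoc, ← mul_assoc, ← ENNReal.ofReal_mul (by positivity), ← Real.rpow_add hρ,
          sub_add_cancel]; ring
      _ ≤ _ := mul_le_mul' le_rfl h0
  obtain ⟨ρ, h1, h2⟩ := (((tendsto_rpow_atTop (sub_pos.2 hβ)).eventually_gt_atTop (G * morE q p β F / c).toReal).and
    (Filter.eventually_ge_atTop R)).exists
  exact absurd (key ρ h2) (not_le.2 h1)

lemma core {δ : ℝ} (hδ : 0 < δ) (hδ1 : δ ≤ 1) {p q β : ℝ} (hp : 1 < p) (hq : 1 < q) (hβ : 0 < β) (hβ0 : β ≤ d / p + 2 / q) :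
    ∃ α : ℝ, 0 < α ∧ ∃ N : ℝ≥0∞, N ≠ ⊤ ∧ ∀ a : Pt d → Matrix (Fin d) (Fin d) ℝ, Measurable a →
    (∀ z, inS d δ (a z)) → aSharp a ≤ ENNReal.ofReal α → ∀ u : Pt d → ℝ, CinfC u →
    morreyQP q p β (Dt u) + morreyQP q p β (fun z => mnorm fun i j => Dxx i j u z) ≤
      N * morE q p β (fun z => ENNReal.ofReal |Lop 1 a u z|) := by
  obtain ⟨s, hs1, hs2⟩ := exists_between (lt_min hp hq)
  obtain ⟨s0, hs3, hs4⟩ := exists_between hs1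
  obtain ⟨ε, hε, H⟩ := mor_close d hs1.le (hs2.trans_le (min_le_right _ _)) (hs2.trans_le (min_le_left _ _)) hβ
  obtain ⟨κ, hκ, N, hN, α, hα, hosc⟩ := vmo_osc (d := d) hδ hs3.le hs4 (hs_all hδ hδ1 hs3) hε
  obtain ⟨N', hN', H'⟩ := H κ hκ N hN
  set D := ENNReal.ofReal δ⁻¹
  refine ⟨α, hα, 1 + D * N' + N', by simp [ENNReal.add_ne_top, ENNReal.mul_ne_top, D, hN'], fun a ha hS hsh u hu => ?_⟩
  set f : Pt d → ℝ≥0∞ := fun z => ENNReal.ofReal |Lop 1 a u z|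
  have hf : Measurable f := (Lop_meas hu 1 ha).abs.ennreal_ofReal
  have hh := H' u hu f hf (hosc a ha hS hsh u hu) (hes_fin hq.le hp.le hβ.le hβ0 hu)
  have hes_eq : ∀ z, hes u z = ENNReal.ofReal (∑ k, ∑ l, |Dxx k l u z|) := fun z => by
    rw [hes, ENNReal.ofReal_sum_of_nonneg fun _ _ => by positivity]
    exact Finset.sum_congr rfl fun k _ => (ENNReal.ofReal_sum_of_nonneg fun _ _ => abs_nonneg _).symm
  have hp0 : 0 < p := by linarith
  have hq0 : 0 < q := by linarith
  have h1 : morreyQP q p β (Dt u) ≤ morE q p β f + D * (N' * morE q p β f) := by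
    rw [morE_eq]
    refine (morE_mono hq0 hp0 (g := fun z => f z + D * hes u z) fun z => ?_).trans
      ((morE_add hq.le hp.le hf ((hes_meas hu).const_mul D)).trans
        (add_le_add le_rfl ((morE_smul hq0 hp0 D (hes_meas hu)).trans (mul_le_mul' le_rfl hh))))
    have e : |Dt u z| ≤ |Lop 1 a u z| + δ⁻¹ * ∑ k, ∑ l, |Dxx k l u z| := by
      have : Dt u z = Lop 1 a u z - ∑ k, ∑ l, a z k l * Dxx k l u z := by simp only [Lop]; ring
      rw [this]
      refine (abs_sub _ _).trans (add_le_add le_rfl ?_)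
      refine (Finset.abs_sum_le_sum_abs _ _).trans ?_
      rw [Finset.mul_sum]
      refine Finset.sum_le_sum fun k _ => (Finset.abs_sum_le_sum_abs _ _).trans ?_
      rw [Finset.mul_sum]
      refine Finset.sum_le_sum fun l _ => ?_
      rw [abs_mul]
      exact mul_le_mul_of_nonneg_right ((hS z).bdd hδ k l) (abs_nonneg _)
    refine (ENNReal.ofReal_le_ofReal e).trans (ENNReal.ofReal_add_le.trans (add_le_add le_rfl ?_))
    rw [ENNReal.ofReal_mul (by positivity), hes_eq]
  have h2 : morreyQP q p β (fun z => mnorm fun i j => Dxx i j u z) ≤ N' * morE q p β f := by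
    rw [morE_eq]
    refine (morE_mono hq0 hp0 fun z => ?_).trans hh
    rw [hes_eq, abs_of_nonneg (show 0 ≤ mnorm fun i j => Dxx i j u z from Real.sqrt_nonneg _)]
    exact ENNReal.ofReal_le_ofReal (mnorm_le_sum _)
  refine (add_le_add h1 h2).trans (le_of_eq ?_)
  ring
end

theorem stmt17 (d : ℕ) (hd : 1 ≤ d) (δ : ℝ) (hδ0 : 0 < δ) (hδ1 : δ ≤ 1)
    (p q β : ℝ) (hp : 1 < p) (hq : 1 < q) (hβ : 1 < β) :
    ∃ aHat N : ℝ, 0 < aHat ∧ 0 < N ∧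
      ∀ a : Pt d → Matrix (Fin d) (Fin d) ℝ, Measurable a → (∀ z, inS d δ (a z)) →
        aSharp a ≤ ENNReal.ofReal aHat →
      ∀ u : Pt d → ℝ, CinfC u →
        morreyQP q p β (Dt u) + morreyQP q p β (fun z => mnorm fun i j => Dxx i j u z) ≤
          ENNReal.ofReal N *
            morreyQP q p β (fun z => Dt u z + ∑ i, ∑ j, a z i j * Dxx i j u z) := by
  have hp0 : 0 < p := by linarith
  have hq0 : 0 < q := by linarith
  obtain ⟨α, hα, N, hN, H⟩ := core (d := d) (β := min β (d / p + 2 / q)) hδ0 hδ1 hp hq (lt_min (by linarith) (by positivity)) (min_le_right _ _)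
  refine ⟨α, N.toReal + 1, hα, by positivity, fun a ha hS hsh u hu => ?_⟩
  have h := H a ha hS hsh u hu
  have e : (fun z => Dt u z + ∑ i, ∑ j, a z i j * Dxx i j u z) = Lop 1 a u := by funext z; simp [Lop]
  rw [e, morE_eq q p β (Lop 1 a u)]
  rcases le_or_gt β (d / p + 2 / q) with hc | hc
  · rw [min_eq_left hc] at h
    refine h.trans (mul_le_mul' ?_ le_rfl)
    rw [← ENNReal.ofReal_toReal hN, ENNReal.toReal_ofReal ENNReal.toReal_nonneg]
    exact ENNReal.ofReal_le_ofReal (by linarith)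
  · rw [min_eq_right hc.le] at h
    by_cases h0 : morE q p (d / p + 2 / q) (fun z => ENNReal.ofReal |Lop 1 a u z|) = 0
    · rw [h0, mul_zero, nonpos_iff_eq_zero, add_eq_zero, morE_eq, morE_eq] at h
      have h1 : morreyQP q p β (Dt u) = 0 := by
        rw [morE_eq]; exact morE_zero h.1
      have h2 : morreyQP q p β (fun z => mnorm fun i j => Dxx i j u z) = 0 := by
        rw [morE_eq]; exact morE_zero h.2
      rw [h1, h2, add_zero]; exact zero_le
    · rw [morE_top hq0 hp0 hc h0, ENNReal.mul_top (by simp; positivity)]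
      exact le_top
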